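/- Let A : ℝⁿ → ℝ be a smooth ℤⁿ-periodic function with ∫_{[0,1]ⁿ} A dx = 0. Then there exists a smooth ℤⁿ-periodic function φ : ℝⁿ → ℝ such that u(x) = ½|x|² + φ(x) is convex with positive definite Hessian and satisfies Abreu's equation Σ_{i,j} ∂²u^{ij}/∂x_i∂x_j = A on ℝⁿ. -/

import Mathlib

open MeasureTheory Matrix

/-- Partial derivative in the `i`-th coordinate direction. -/
noncomputable def pd {n : ℕ} (i : Fin n) (f : (Fin n → ℝ) → ℝ) (x : Fin n → ℝ) : ℝ :=
  fderiv ℝ f x (Pi.single i 1)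

/-- Hessian matrix `(u_{ij})` of `u` at `x`. -/
noncomputable def hess {n : ℕ} (u : (Fin n → ℝ) → ℝ) (x : Fin n → ℝ) :
    Matrix (Fin n) (Fin n) ℝ :=
  Matrix.of fun i j => pd i (pd j u) x

/-- `f : ℝⁿ → ℝ` is ℤⁿ-periodic. -/
def ZPer {n : ℕ} (f : (Fin n → ℝ) → ℝ) : Prop :=
  ∀ (x : Fin n → ℝ) (k : Fin n → ℤ), f (x + fun i => (k i : ℝ)) = f x

/-- Abreu's operator `∑_{i,j} ∂²u^{ij}/∂x_i∂x_j`, where `(u^{ij})` is the inverse Hessian. -/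
noncomputable def abreuOp {n : ℕ} (u : (Fin n → ℝ) → ℝ) (x : Fin n → ℝ) : ℝ :=
  ∑ i, ∑ j, pd i (pd j (fun z => (hess u z)⁻¹ i j)) x

namespace Abreu
open Set Filter Topology
open scoped ContDiff

/-- A function on `ℝⁿ` with values in any type which is invariant under integer translations. -/
def Per {α : Type*} {n : ℕ} (f : (Fin n → ℝ) → α) : Prop :=
  ∀ (x : Fin n → ℝ) (k : Fin n → ℤ), f (x + fun i => (k i : ℝ)) = f x

section Torus
variable {𝕜 : Type} [RCLike 𝕜] {n : ℕ}

lemma integral_fderiv_eq_zero {f : (Fin n → ℝ) → 𝕜} (hf : ContDiff ℝ 1 f) (hp : Per f)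
    (i : Fin n) : ∫ x in Icc (0 : Fin n → ℝ) 1, fderiv ℝ f x (Pi.single i 1) = 0 := by
  cases n with
  | zero => exact i.elim0
  | succ m =>
    have hd := hf.differentiable one_ne_zero
    have hc : Continuous fun x => fderiv ℝ f x (Pi.single i 1) :=
      (hf.continuous_fderiv one_ne_zero).clm_apply continuous_const
    have h := integral_divergence_of_hasFDerivAt_off_countable' (E := 𝕜) (0 : Fin (m+1) → ℝ) 1
      (by intro j; simp) (fun j => if j = i then f else 0)
      (fun j => if j = i then fderiv ℝ f else 0) ∅ countable_empty
      (by intro j; split_ifs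
          · exact hf.continuous.continuousOn
          · exact continuousOn_const)
      (by intro x _ j; split_ifs
          · exact (hd x).hasFDerivAt
          · exact hasFDerivAt_const _ _)
      (by
        refine Continuous.integrableOn_Icc ?_
        refine continuous_finsetSum _ fun j _ => ?_
        by_cases h : j = i
        · subst h; simpa using hc
        · simpa [h] using continuous_const)
    have e : ∀ x : Fin (m+1) → ℝ, ∑ j, (if j = i then fderiv ℝ f else 0) x (Pi.single j 1)
        = fderiv ℝ f x (Pi.single i 1) := by
      intro x
      rw [Finset.sum_eq_single i] <;> simp +contextual
    simp only [e] at h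
    rw [h]
    refine Finset.sum_eq_zero fun j _ => ?_
    by_cases hji : j = i
    · subst hji
      rw [sub_eq_zero]
      refine integral_congr_ae (Eventually.of_forall fun x => ?_)
      simp only [if_true, Pi.one_apply, Pi.zero_apply]
      rw [← hp (j.insertNth (0:ℝ) x) (Pi.single j 1)]
      congr 1
      ext l
      rcases Fin.eq_self_or_eq_succAbove j l with rfl | ⟨l, rfl⟩
      · simp
      · simp [Fin.succAbove_ne]
    · simp [hji]

variable (𝕜 n) in
/-- The subalgebra of smooth periodic functions. -/
def TT : Subalgebra 𝕜 ((Fin n → ℝ) → 𝕜) where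
  carrier := {f | ContDiff ℝ ∞ f ∧ Per f}
  mul_mem' := fun ha hb => ⟨ha.1.mul hb.1, fun x k => by simp [ha.2 x k, hb.2 x k]⟩
  add_mem' := fun ha hb => ⟨ha.1.add hb.1, fun x k => by simp [ha.2 x k, hb.2 x k]⟩
  algebraMap_mem' := fun r => ⟨contDiff_const, fun x k => rfl⟩

variable (𝕜 n) in
/-- The algebra of smooth periodic functions. -/
def T : Type := ↥(TT 𝕜 n)

instance : CommRing (T 𝕜 n) := inferInstanceAs (CommRing (TT 𝕜 n))
noncomputable instance : Algebra 𝕜 (T 𝕜 n) := inferInstanceAs (Algebra 𝕜 (TT 𝕜 n))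

/-- Evaluation at a point. -/
noncomputable def ev (x : Fin n → ℝ) : T 𝕜 n →ₐ[𝕜] 𝕜 :=
  ((Pi.evalAlgHom 𝕜 (fun _ => 𝕜) x).comp (TT 𝕜 n).val : TT 𝕜 n →ₐ[𝕜] 𝕜)

lemma T.ext {f g : T 𝕜 n} (h : ∀ x, ev x f = ev x g) : f = g := Subtype.ext (funext h)

lemma ev_smooth (f : T 𝕜 n) : ContDiff ℝ ∞ (fun x => ev x f) := f.2.1
lemma ev_per (f : T 𝕜 n) : Per (fun x => ev x f) := f.2.2
lemma ev_cont (f : T 𝕜 n) : Continuous (fun x => ev x f) := (ev_smooth f).continuous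
lemma ev_diff (f : T 𝕜 n) (x) : DifferentiableAt ℝ (fun x => ev x f) x :=
  ((ev_smooth f).differentiable (by simp)) x

lemma ev_smul (x) (c : 𝕜) (f : T 𝕜 n) : ev x (c • f) = c * ev x f := by simp

/-- Build an element of the algebra. -/
def mkT (f : (Fin n → ℝ) → 𝕜) (h1 : ContDiff ℝ ∞ f) (h2 : Per f) : T 𝕜 n := ⟨f, h1, h2⟩
@[simp] lemma ev_mkT (f : (Fin n → ℝ) → 𝕜) (h1 h2 x) : ev x (mkT f h1 h2) = f x := rfl

lemma Per.fderiv {f : (Fin n → ℝ) → 𝕜} (h : Per f) (v) : Per (fun x => fderiv ℝ f x v) := by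
  intro x k
  dsimp only
  rw [← fderiv_comp_add_right]
  congr 2
  ext1 y; exact h y k

lemma fderiv_smooth {f : (Fin n → ℝ) → 𝕜} (h : ContDiff ℝ ∞ f) (v) :
    ContDiff ℝ ∞ (fun x => fderiv ℝ f x v) :=
  (h.fderiv_right (by simp)).clm_apply contDiff_const

variable (𝕜) in
/-- Partial derivatives as derivations of the algebra of smooth periodic functions. -/
noncomputable def dk (i : Fin n) : Derivation 𝕜 (T 𝕜 n) (T 𝕜 n) :=
  Derivation.mk'
    { toFun := fun f => mkT (fun x => fderiv ℝ (fun y => ev y f) x (Pi.single i 1))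
        (fderiv_smooth (ev_smooth f) _) ((ev_per f).fderiv _)
      map_add' := fun f g => T.ext fun x => by
        simp only [ev_mkT, map_add]
        rw [fderiv_fun_add (ev_diff f x) (ev_diff g x)]; rfl
      map_smul' := fun c f => T.ext fun x => by
        simp only [ev_mkT, ev_smul, RingHom.id_apply]
        rw [fderiv_const_mul (ev_diff f x)]; rfl }
    (fun f g => T.ext fun x => by
      simp only [LinearMap.coe_mk, AddHom.coe_mk, ev_mkT, map_mul, map_add, smul_eq_mul]
      rw [fderiv_fun_mul (ev_diff f x) (ev_diff g x)]; simp)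

lemma ev_dk (i : Fin n) (f : T 𝕜 n) (x) :
    ev x (dk 𝕜 i f) = fderiv ℝ (fun y => ev y f) x (Pi.single i 1) := rfl

lemma hasFDerivAt_ev (f : T 𝕜 n) (x) :
    HasFDerivAt (fun y => ev y f) (fderiv ℝ (fun y => ev y f) x) x := (ev_diff f x).hasFDerivAt

lemma fderiv_ev (f : T 𝕜 n) (x v) :
    fderiv ℝ (fun y => ev y f) x v = ∑ i, (v i : 𝕜) * ev x (dk 𝕜 i f) := by
  conv_lhs => rw [pi_eq_sum_univ' v]
  simp [map_sum, ev_dk, RCLike.real_smul_eq_coe_mul]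

lemma hasDerivAt_ev (f : T 𝕜 n) (x v : Fin n → ℝ) (t : ℝ) :
    HasDerivAt (fun t : ℝ => ev (x + t • v) f) (∑ i, (v i : 𝕜) * ev (x + t • v) (dk 𝕜 i f)) t := by
  rw [← fderiv_ev]
  have h : HasDerivAt (fun t : ℝ => x + t • v) v t := by
    simpa using ((hasDerivAt_id t).smul_const v).const_add x
  exact (hasFDerivAt_ev f (x + t • v)).comp_hasDerivAt t h

lemma dk_comm (i j : Fin n) (f : T 𝕜 n) : dk 𝕜 i (dk 𝕜 j f) = dk 𝕜 j (dk 𝕜 i f) := by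
  refine T.ext fun x => ?_
  have hs : IsSymmSndFDerivAt ℝ (fun y => ev y f) x :=
    (ev_smooth f).contDiffAt.isSymmSndFDerivAt
      (by simp only [minSmoothness_of_isRCLikeNormedField]; exact ENat.LEInfty.out)
  have e : ∀ i j : Fin n, ev x (dk 𝕜 i (dk 𝕜 j f))
      = fderiv ℝ (fderiv ℝ (fun y => ev y f)) x (Pi.single i 1) (Pi.single j 1) := by
    intro i j
    rw [ev_dk]
    simp only [ev_dk]
    rw [fderiv_clm_apply]
    · simp
    · exact ((ev_smooth f).fderiv_right (m := ∞) (by simp)).differentiable (by simp) x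
    · exact differentiableAt_const _
  rw [e, e, hs]

lemma dk_mul (i : Fin n) (f g : T 𝕜 n) : dk 𝕜 i (f * g) = dk 𝕜 i f * g + f * dk 𝕜 i g := by
  rw [Derivation.leibniz, smul_eq_mul, smul_eq_mul]; ring

@[simp] lemma ev_algebraMap (x) (c : 𝕜) : ev x (algebraMap 𝕜 (T 𝕜 n) c) = c := rfl

/-- The integral over the unit cube. -/
noncomputable def I : T 𝕜 n →ₗ[𝕜] 𝕜 where
  toFun f := ∫ x in Icc (0 : Fin n → ℝ) 1, ev x f
  map_add' f g := by
    simp only [map_add]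
    exact integral_add (ev_cont f).integrableOn_Icc (ev_cont g).integrableOn_Icc
  map_smul' c f := by
    simp only [ev_smul, RingHom.id_apply, smul_eq_mul]
    exact integral_const_mul _ _

lemma I_def (f : T 𝕜 n) : I f = ∫ x in Icc (0 : Fin n → ℝ) 1, ev x f := rfl

lemma I_dk (i : Fin n) (f : T 𝕜 n) : I (dk 𝕜 i f) = 0 :=
  integral_fderiv_eq_zero ((ev_smooth f).of_le (by exact_mod_cast le_top)) (ev_per f) i

lemma I_parts' (i : Fin n) (f g : T 𝕜 n) : I (f * dk 𝕜 i g) = - I (dk 𝕜 i f * g) := by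
  have := I_dk i (f * g)
  rw [dk_mul, map_add] at this
  exact eq_neg_of_add_eq_zero_right this

lemma volume_cube : volume.real (Icc (0 : Fin n → ℝ) 1) = 1 := by
  simp [Measure.real, Real.volume_Icc_pi]

lemma I_const (c : 𝕜) : I (algebraMap 𝕜 (T 𝕜 n) c) = c := by
  simp [I_def, volume_cube]

lemma I_one : I (1 : T 𝕜 n) = 1 := by simpa using I_const (n := n) (1 : 𝕜)

/-- Every point can be moved into the unit cube. -/
lemma exists_cube (x : Fin n → ℝ) :
    ∃ y ∈ Icc (0 : Fin n → ℝ) 1, ∃ k : Fin n → ℤ, x = y + fun i => (k i : ℝ) :=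
  ⟨fun i => Int.fract (x i), ⟨fun i => Int.fract_nonneg _, fun i => (Int.fract_lt_one _).le⟩,
    fun i => ⌊x i⌋, by ext i; simp [Int.fract_add_floor]⟩

lemma Per.exists_max {f : (Fin n → ℝ) → ℝ} (hc : Continuous f) (hp : Per f) :
    ∃ x, ∀ y, f y ≤ f x := by
  obtain ⟨x, -, hx⟩ := (isCompact_Icc : IsCompact (Icc (0 : Fin n → ℝ) 1)).exists_isMaxOn
    ⟨0, by simp⟩ hc.continuousOn
  refine ⟨x, fun y => ?_⟩
  obtain ⟨z, hz, k, rfl⟩ := exists_cube y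
  rw [hp]; exact hx hz

lemma norm_I_le {f : T 𝕜 n} {c : ℝ} (h : ∀ x, ‖ev x f‖ ≤ c) : ‖I f‖ ≤ c := by
  have := norm_setIntegral_le_of_norm_le_const (μ := volume) (s := Icc (0 : Fin n → ℝ) 1)
    (f := fun x => ev x f) (C := c) isCompact_Icc.measure_lt_top (fun x _ => h x)
  rwa [volume_cube, mul_one] at this

lemma exists_bound (f : T 𝕜 n) : ∃ C, ∀ x, ‖ev x f‖ ≤ C := by
  obtain ⟨x, hx⟩ := Per.exists_max (f := fun x => ‖ev x f‖) (ev_cont f).norm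
    (fun x k => by exact congrArg _ (ev_per f x k))
  exact ⟨_, hx⟩

/-- Inverse of a nowhere vanishing function. -/
noncomputable def invT (f : T 𝕜 n) (h : ∀ x, ev x f ≠ 0) : T 𝕜 n :=
  mkT (fun x => (ev x f)⁻¹) ((ev_smooth f).inv h) (fun x k => by exact congrArg _ (ev_per f x k))

@[simp] lemma ev_invT (f : T 𝕜 n) (h x) : ev x (invT f h) = (ev x f)⁻¹ := rfl

lemma mul_invT (f : T 𝕜 n) (h) : f * invT f h = 1 :=
  T.ext fun x => by simp [mul_inv_cancel₀ (h x)]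

lemma isUnit_of_ne {f : T 𝕜 n} (h : ∀ x, ev x f ≠ 0) : IsUnit f :=
  IsUnit.of_mul_eq_one _ (mul_invT f h)

end Torus

section RealTorus
variable {n : ℕ}

/-- Partial derivatives of real functions. -/
noncomputable abbrev dx (i : Fin n) : Derivation ℝ (T ℝ n) (T ℝ n) := dk ℝ i

lemma ev_dx (i : Fin n) (f : T ℝ n) (x) :
    ev x (dx i f) = fderiv ℝ (fun y => ev y f) x (Pi.single i 1) := rfl
lemma dx_comm (i j : Fin n) (f : T ℝ n) : dx i (dx j f) = dx j (dx i f) := dk_comm i j f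
lemma dx_mul (i : Fin n) (f g : T ℝ n) : dx i (f * g) = dx i f * g + f * dx i g := dk_mul i f g
lemma I_dx (i : Fin n) (f : T ℝ n) : I (dx i f) = 0 := I_dk i f
lemma I_parts (i : Fin n) (f g : T ℝ n) : I (f * dx i g) = - I (dx i f * g) := I_parts' i f g

lemma I_mono {f g : T ℝ n} (h : ∀ x, ev x f ≤ ev x g) : I f ≤ I g :=
  setIntegral_mono (ev_cont f).integrableOn_Icc (ev_cont g).integrableOn_Icc h

lemma I_nonneg {f : T ℝ n} (h : ∀ x, 0 ≤ ev x f) : 0 ≤ I f := by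
  simpa using I_mono (f := 0) (g := f) (by simpa using h)

lemma I_eq_zero {f : T ℝ n} (h : ∀ x, 0 ≤ ev x f) (h0 : I f = 0) : f = 0 := by
  refine T.ext fun x => ?_
  by_contra hx
  have hx' : 0 < ev x f := lt_of_le_of_ne (h x) (fun e => hx (by simp [← e]))
  obtain ⟨y, hy, k, rfl⟩ := exists_cube x
  replace hx' : 0 < ev y f := hx'.trans_eq (ev_per f y k)
  have hae := (setIntegral_eq_zero_iff_of_nonneg_ae (Eventually.of_forall h)
    (ev_cont f).integrableOn_Icc).1 h0
  have hU : IsOpen {z | 0 < ev z f} := isOpen_lt continuous_const (ev_cont f)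
  have hcl : y ∈ closure (interior (Icc (0 : Fin n → ℝ) 1)) := by
    have hc : Convex ℝ (Icc (0 : Fin n → ℝ) 1) := convex_Icc _ _
    rw [hc.closure_interior_eq_closure_of_nonempty_interior]
    · exact subset_closure hy
    · refine ⟨fun _ => 1/2, ?_⟩
      rw [← Set.pi_univ_Icc, interior_pi_set Set.finite_univ]
      intro i _
      simp [interior_Icc]; norm_num
  obtain ⟨z, hz1, hz2⟩ := mem_closure_iff.1 hcl _ hU hx'
  have hpos : 0 < volume ({z | 0 < ev z f} ∩ interior (Icc (0 : Fin n → ℝ) 1)) :=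
    (hU.inter isOpen_interior).measure_pos volume ⟨z, hz1, hz2⟩
  have h3 := (ae_restrict_iff' measurableSet_Icc).1 hae
  have h4 : volume ({z | 0 < ev z f} ∩ interior (Icc (0 : Fin n → ℝ) 1)) = 0 := by
    refine measure_mono_null ?_ h3
    rintro w ⟨hw1, hw2⟩ hw3
    exact hw1.ne' (hw3 (interior_subset hw2))
  exact hpos.ne' h4

/-- Exponential. -/
noncomputable def expT (f : T ℝ n) : T ℝ n :=
  mkT (fun x => Real.exp (ev x f)) (ev_smooth f).exp (fun x k => congrArg _ (ev_per f x k))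
@[simp] lemma ev_expT (f : T ℝ n) (x) : ev x (expT f) = Real.exp (ev x f) := rfl

lemma dx_expT (i) (f : T ℝ n) : dx i (expT f) = expT f * dx i f :=
  T.ext fun x => by
    simp only [ev_dx, ev_expT, map_mul]
    rw [fderiv_exp (ev_diff f x)]; rfl

/-- Logarithm of a positive function. -/
noncomputable def logT (f : T ℝ n) (h : ∀ x, 0 < ev x f) : T ℝ n :=
  mkT (fun x => Real.log (ev x f)) ((ev_smooth f).log fun x => (h x).ne')
    (fun x k => congrArg _ (ev_per f x k))
@[simp] lemma ev_logT (f : T ℝ n) (h x) : ev x (logT f h) = Real.log (ev x f) := rfl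

lemma dx_logT (i) (f : T ℝ n) (h) : f * dx i (logT f h) = dx i f :=
  T.ext fun x => by
    simp only [ev_dx, ev_logT, map_mul]
    rw [fderiv.log (ev_diff f x) (h x).ne']
    simp [mul_inv_cancel_left₀ (h x).ne']

lemma exists_max (f : T ℝ n) : ∃ x, ∀ y, ev y f ≤ ev x f := Per.exists_max (ev_cont f) (ev_per f)

lemma dx_eq_zero_of_max {f : T ℝ n} {x} (h : ∀ y, ev y f ≤ ev x f) (i) : ev x (dx i f) = 0 := by
  rw [ev_dx, IsLocalMax.fderiv_eq_zero (Eventually.of_forall h)]; rfl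

lemma hess_nonpos_of_max {f : T ℝ n} {x} (h : ∀ y, ev y f ≤ ev x f) (v : Fin n → ℝ) :
    ∑ i, ∑ j, v i * v j * ev x (dx i (dx j f)) ≤ 0 := by
  by_contra! hc
  set g : ℝ → ℝ := fun t => ev (x + t • v) f
  have hd : deriv g = fun t => ev (x + t • v) (∑ j, v j • dx j f) := by
    funext t; rw [(hasDerivAt_ev f x v t).deriv]; simp
  have h2 : deriv (deriv g) 0 = ∑ i, ∑ j, v i * v j * ev x (dx i (dx j f)) := by
    rw [hd, (hasDerivAt_ev _ x v 0).deriv]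
    simp [Finset.mul_sum, mul_assoc]
  have h1 : deriv g 0 = 0 := by
    rw [hd]; simp [dx_eq_zero_of_max h]
  have hg : ContinuousAt g 0 := (hasDerivAt_ev f x v 0).continuousAt
  have hmin : IsLocalMin g 0 := isLocalMin_of_deriv_deriv_pos (by rw [h2]; exact hc) h1 hg
  -- a local minimum that is a global maximum is locally constant
  have hconst : g =ᶠ[𝓝 0] fun _ => g 0 := by
    filter_upwards [hmin] with t ht
    exact le_antisymm (by simpa [g] using h (x + t • v)) ht
  have hd0 : deriv g =ᶠ[𝓝 0] fun _ => 0 := by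
    have := hconst.deriv
    simpa using this
  have : deriv (deriv g) 0 = 0 := by rw [hd0.deriv_eq]; simp
  linarith

end RealTorus

end Abreu

namespace Abreu
open Set Filter Topology
open scoped ContDiff

section Jacobi
variable {R : Type*} [CommRing R] {K : Type*} [CommRing K] [Algebra K R]
  {m : Type*}

lemma map_derivation_mul [Fintype m] (d : Derivation K R R) (M N : Matrix m m R) :
    (M * N).map d = M.map d * N + M * N.map d := by
  ext i j
  simp only [map_apply, mul_apply, map_sum, Derivation.leibniz, smul_eq_mul, Matrix.add_apply,
    ← Finset.sum_add_distrib]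
  exact Finset.sum_congr rfl fun k _ => by ring

lemma map_derivation_one [DecidableEq m] (d : Derivation K R R) : (1 : Matrix m m R).map d = 0 := by
  ext i j
  by_cases h : i = j <;> simp [h, one_apply]

/-- The ring homomorphism into the dual numbers given by a derivation. -/
def dualHom (d : Derivation K R R) : R →+* TrivSqZeroExt R R where
  toFun r := TrivSqZeroExt.inl r + TrivSqZeroExt.inr (d r)
  map_one' := by ext <;> simp
  map_zero' := by ext <;> simp
  map_add' a b := by ext <;> simp
  map_mul' a b := by ext <;> simp [Derivation.leibniz, mul_comm]

/-- Jacobi's formula for a derivation applied to a determinant. -/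
lemma derivation_det [Fintype m] [DecidableEq m] (d : Derivation K R R) (M N : Matrix m m R) (h : M * N = 1) :
    d M.det = M.det * (N * M.map d).trace := by
  have e : M.map (dualHom d) = M.map (TrivSqZeroExt.inlHom R R) *
      (1 + (TrivSqZeroExt.inr 1 : TrivSqZeroExt R R) •
        (N * M.map d).map (TrivSqZeroExt.inlHom R R)) := by
    rw [mul_add, mul_one, mul_smul_comm, ← Matrix.map_mul, ← mul_assoc, h, one_mul]
    ext i j <;> simp [dualHom]
  have h1 := congrArg TrivSqZeroExt.snd (congrArg Matrix.det e)
  rw [det_mul, det_one_add_smul] at h1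
  rw [← RingHom.mapMatrix_apply, ← RingHom.map_det, ← RingHom.mapMatrix_apply,
    ← RingHom.map_det] at h1
  have h2 : (TrivSqZeroExt.inr 1 : TrivSqZeroExt R R) ^ 2 = 0 := by
    rw [pow_two, TrivSqZeroExt.inr_mul_inr]
  rw [h2, mul_zero, add_zero] at h1
  have h3 : ((N * M.map d).map (TrivSqZeroExt.inlHom R R)).trace
      = TrivSqZeroExt.inl (N * M.map d).trace := by
    exact (map_sum (TrivSqZeroExt.inlHom R R) _ _).symm
  rw [h3] at h1
  simpa [dualHom] using h1

end Jacobi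

variable {n : ℕ}

/-- The matrix `1 + D²φ`. -/
noncomputable def hM (φ : T ℝ n) : Matrix (Fin n) (Fin n) (T ℝ n) :=
  Matrix.of fun i j => (1 : Matrix (Fin n) (Fin n) (T ℝ n)) i j + dx i (dx j φ)

/-- A smooth periodic `φ` such that `1 + D²φ` is positive definite. -/
structure Pot (n : ℕ) where
  φ : T ℝ n
  pos : ∀ x, ((hM φ).map (ev x)).PosDef

namespace Pot
variable (s : Pot n)

/-- The Hessian. -/
noncomputable def H : Matrix (Fin n) (Fin n) (T ℝ n) := hM s.φ
/-- The inverse Hessian. -/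
noncomputable def G : Matrix (Fin n) (Fin n) (T ℝ n) := (hM s.φ)⁻¹

lemma H_apply (i j) : s.H i j = (1 : Matrix (Fin n) (Fin n) (T ℝ n)) i j + dx i (dx j s.φ) := rfl

lemma ev_det (x) (M : Matrix (Fin n) (Fin n) (T ℝ n)) : ev x M.det = (M.map (ev x)).det :=
  AlgHom.map_det _ _

lemma detH_pos (x) : 0 < ev x s.H.det := by
  rw [ev_det]; exact (s.pos x).det_pos

lemma isUnit_detH : IsUnit s.H.det := isUnit_of_ne fun x => (s.detH_pos x).ne'

lemma HG : s.H * s.G = 1 := mul_nonsing_inv _ s.isUnit_detH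
lemma GH : s.G * s.H = 1 := nonsing_inv_mul _ s.isUnit_detH

lemma Hsymm (i j) : s.H i j = s.H j i := by
  rw [H_apply, H_apply, dx_comm, one_apply, one_apply]; simp [eq_comm]
lemma Ht : s.Hᵀ = s.H := by ext1 i j; exact s.Hsymm j i
lemma Gt : s.Gᵀ = s.G := by
  have h : s.Gᵀ * s.H = 1 := by
    rw [← s.Ht, ← transpose_mul, s.HG, transpose_one]
  calc s.Gᵀ = s.Gᵀ * (s.H * s.G) := by rw [s.HG, mul_one]
    _ = s.G := by rw [← mul_assoc, h, one_mul]
lemma Gsymm (i j) : s.G i j = s.G j i := by conv_lhs => rw [← s.Gt, transpose_apply]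

lemma HG_sum (i j) : ∑ k, s.H i k * s.G k j = if i = j then 1 else 0 := by
  rw [← mul_apply, s.HG, one_apply]
lemma GH_sum (i j) : ∑ k, s.G i k * s.H k j = if i = j then 1 else 0 := by
  rw [← mul_apply, s.GH, one_apply]

lemma dG (d : Derivation ℝ (T ℝ n) (T ℝ n)) : s.G.map d = -(s.G * s.H.map d * s.G) := by
  have h := map_derivation_mul d s.H s.G
  rw [s.HG, map_derivation_one] at h
  have h2 := congrArg (s.G * ·) h
  simp only [mul_zero, mul_add, ← mul_assoc, s.GH, one_mul] at h2
  exact (neg_eq_of_add_eq_zero_right h2.symm).symm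

lemma dH (d : Derivation ℝ (T ℝ n) (T ℝ n)) : s.H.map d = -(s.H * s.G.map d * s.H) := by
  rw [dG]
  simp only [Matrix.mul_neg, Matrix.neg_mul, neg_neg, ← mul_assoc, s.HG, one_mul]
  rw [mul_assoc, s.GH, mul_one]

lemma dxH_symm (a b c) : dx a (s.H b c) = dx b (s.H a c) := by
  have h : ∀ a b c, dx a (s.H b c) = dx a (dx b (dx c s.φ)) := by
    intro a b c
    rw [H_apply, map_add, one_apply]
    split_ifs <;> simp
  rw [h, h, dx_comm a b]

lemma _root_.Abreu.comb_apply (c : Fin n → T ℝ n) (f : T ℝ n) :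
    (∑ a, c a • dx a : Derivation ℝ (T ℝ n) (T ℝ n)) f = ∑ a, c a * dx a f := by
  have h := congrFun (map_sum (Derivation.coeFnAddMonoidHom (R := ℝ) (A := T ℝ n) (M := T ℝ n))
    (fun a => c a • dx a) Finset.univ) f
  rw [Finset.sum_apply] at h
  exact h

/-- Derivative in the dual coordinates. -/
noncomputable def D (k : Fin n) : Derivation ℝ (T ℝ n) (T ℝ n) := ∑ a, (s.G k a : T ℝ n) • dx a

lemma D_apply (k) (f : T ℝ n) : s.D k f = ∑ a, s.G k a * dx a f := by
  exact comb_apply (fun a => s.G k a) f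

lemma D_mul (k) (f g : T ℝ n) : s.D k (f * g) = s.D k f * g + f * s.D k g := by
  rw [Derivation.leibniz, smul_eq_mul, smul_eq_mul]; ring

lemma dx_eq (a) (f : T ℝ n) : dx a f = ∑ k, s.H a k * s.D k f := by
  simp only [D_apply, Finset.mul_sum]
  rw [Finset.sum_comm]
  simp only [← mul_assoc, ← Finset.sum_mul, s.HG_sum]
  simp

/-- Third derivatives of the dual potential. -/
noncomputable def C (k : Fin n) : Matrix (Fin n) (Fin n) (T ℝ n) := s.G.map (s.D k)

lemma C_apply (k l m) : s.C k l m = s.D k (s.G l m) := rfl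
lemma C_symm (k l m) : s.C k l m = s.C k m l := by rw [C_apply, C_apply, s.Gsymm]

lemma dxG (a l m) : dx a (s.G l m) = -∑ b, ∑ c, s.G l b * s.G m c * dx a (s.H b c) := by
  have h : dx a (s.G l m) = -((s.G * s.H.map (dx a) * s.G) l m) :=
    congrFun (congrFun (s.dG (dx a)) l) m
  rw [h]
  simp only [mul_apply, map_apply, Finset.sum_mul]
  rw [Finset.sum_comm]
  congr 1
  refine Finset.sum_congr rfl fun b _ => Finset.sum_congr rfl fun c _ => ?_
  rw [s.Gsymm c m]; ring

lemma C_eq (k l m) : s.C k l m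
    = -∑ a, ∑ b, ∑ c, s.G k a * s.G l b * s.G m c * dx a (s.H b c) := by
  rw [C_apply, D_apply, ← Finset.sum_neg_distrib]
  refine Finset.sum_congr rfl fun a _ => ?_
  rw [dxG, mul_neg, Finset.mul_sum]
  congr 1
  refine Finset.sum_congr rfl fun b _ => ?_
  rw [Finset.mul_sum]
  exact Finset.sum_congr rfl fun c _ => by ring

lemma C_swap (k l m) : s.C k l m = s.C l k m := by
  rw [C_eq, C_eq, Finset.sum_comm]
  congr 1
  refine Finset.sum_congr rfl fun a _ => Finset.sum_congr rfl fun b _ =>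
    Finset.sum_congr rfl fun c _ => ?_
  rw [s.dxH_symm b a]; ring

lemma Ct (k) : (s.C k)ᵀ = s.C k := by ext1 i j; exact s.C_symm k j i

lemma D_comm (k l) (f : T ℝ n) : s.D k (s.D l f) = s.D l (s.D k f) := by
  have e : ∀ k l, s.D k (s.D l f) = ∑ b, s.C k l b * dx b f
      + ∑ a, ∑ b, s.G k a * s.G l b * dx a (dx b f) := by
    intro k l
    rw [D_apply s l, map_sum]
    simp only [D_mul, Finset.sum_add_distrib]
    congr 1
    simp only [D_apply, Finset.mul_sum]
    rw [Finset.sum_comm]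
    exact Finset.sum_congr rfl fun a _ => Finset.sum_congr rfl fun b _ => by ring
  rw [e, e]
  congr 1
  · exact Finset.sum_congr rfl fun b _ => by rw [s.C_swap]
  · rw [Finset.sum_comm]
    exact Finset.sum_congr rfl fun b _ => Finset.sum_congr rfl fun a _ => by
      rw [dx_comm]; ring

/-- `log det G`. -/
noncomputable def F : T ℝ n := -logT s.H.det s.detH_pos

lemma dF (d : Derivation ℝ (T ℝ n) (T ℝ n)) (hd : ∃ c : Fin n → T ℝ n, d = ∑ a, c a • dx a) :
    d s.F = (s.H * s.G.map d).trace := by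
  have key : ∀ a, dx a s.F = (s.H * s.G.map (dx a)).trace := by
    intro a
    have h1 := dx_logT a _ s.detH_pos
    rw [derivation_det (dx a) s.H s.G s.HG] at h1
    have h2 := s.isUnit_detH.mul_left_cancel h1
    rw [F, map_neg, h2, dG, Matrix.mul_neg, trace_neg, ← mul_assoc, ← mul_assoc, s.HG, one_mul,
      trace_mul_comm]
  obtain ⟨c, rfl⟩ := hd
  simp only [comb_apply, key, trace, diag_apply, mul_apply, map_apply, Finset.mul_sum]
  rw [Finset.sum_comm]
  refine Finset.sum_congr rfl fun i _ => ?_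
  rw [Finset.sum_comm]
  exact Finset.sum_congr rfl fun j _ => Finset.sum_congr rfl fun k _ => by ring

lemma DF (k) : s.D k s.F = ∑ i, ∑ j, s.H i j * s.C k i j := by
  rw [s.dF (s.D k) ⟨fun a => s.G k a, rfl⟩]
  simp only [trace, diag_apply, mul_apply, map_apply]
  exact Finset.sum_congr rfl fun i _ => Finset.sum_congr rfl fun j _ => by
    rw [s.Gsymm j i, C_apply]

lemma div_G (k) : ∑ a, dx a (s.G k a) = s.D k s.F := by
  rw [DF]
  refine Finset.sum_congr rfl fun a _ => ?_
  rw [s.dx_eq]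
  refine Finset.sum_congr rfl fun l _ => ?_
  rw [← C_apply, s.C_swap, s.C_symm]

/-- The second order operator `∑ ∂_k (G_{kl} ∂_l f)`. -/
noncomputable def Δ (f : T ℝ n) : T ℝ n := ∑ k, dx k (s.D k f)

/-- The associated carré du champ. -/
noncomputable def Γ (f g : T ℝ n) : T ℝ n := ∑ k, ∑ l, s.H k l * s.D k f * s.D l g

lemma Γ_eq (f g : T ℝ n) : s.Γ f g = ∑ k, dx k f * s.D k g := by
  simp only [Γ, s.dx_eq _ f, Finset.sum_mul]
  rw [Finset.sum_comm]
  exact Finset.sum_congr rfl fun k _ => Finset.sum_congr rfl fun l _ => by rw [s.Hsymm]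

lemma Γ_eqG (f g : T ℝ n) : s.Γ f g = ∑ k, ∑ l, s.G k l * dx k f * dx l g := by
  rw [Γ_eq]
  simp only [D_apply, Finset.mul_sum]
  exact Finset.sum_congr rfl fun k _ => Finset.sum_congr rfl fun l _ => by ring

lemma Γ_comm (f g : T ℝ n) : s.Γ f g = s.Γ g f := by
  rw [Γ, Γ, Finset.sum_comm]
  exact Finset.sum_congr rfl fun k _ => Finset.sum_congr rfl fun l _ => by
    rw [s.Hsymm]; ring

lemma Δ_eq (f : T ℝ n) : s.Δ f = ∑ k, ∑ l, s.H k l * s.D k (s.D l f) := by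
  simp only [Δ, s.dx_eq]
  exact Finset.sum_congr rfl fun k _ => Finset.sum_congr rfl fun l _ => by rw [s.D_comm]

lemma Δ_eqG (f : T ℝ n) : s.Δ f = ∑ k, ∑ l, s.G k l * dx k (dx l f) + ∑ l, s.D l s.F * dx l f := by
  simp only [Δ, D_apply s _ f, map_sum, dx_mul, Finset.sum_add_distrib, ← s.div_G,
    Finset.sum_mul]
  rw [add_comm]
  congr 1
  rw [Finset.sum_comm]
  exact Finset.sum_congr rfl fun k _ => Finset.sum_congr rfl fun l _ => by rw [s.Gsymm]

/-- The left side of Abreu's equation. -/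
noncomputable def A : T ℝ n := ∑ a, ∑ b, dx a (dx b (s.G a b))

lemma ΔF : s.Δ s.F = s.A := by
  simp only [Δ, ← s.div_G, map_sum, A]

lemma Δ_sub (f g : T ℝ n) : s.Δ (f - g) = s.Δ f - s.Δ g := by
  simp [Δ, Finset.sum_sub_distrib]
lemma Δ_smul (c : ℝ) (f : T ℝ n) : s.Δ (c • f) = c • s.Δ f := by
  simp [Δ, Finset.smul_sum]
lemma Δ_sum {ι : Type*} (t : Finset ι) (f : ι → T ℝ n) :
    s.Δ (∑ i ∈ t, f i) = ∑ i ∈ t, s.Δ (f i) := by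
  simp only [Δ, map_sum]; exact Finset.sum_comm

lemma Γ_add_left (f g h : T ℝ n) : s.Γ (f + g) h = s.Γ f h + s.Γ g h := by
  simp [Γ_eq, add_mul, Finset.sum_add_distrib]
lemma Γ_smul_left (c : ℝ) (f h : T ℝ n) : s.Γ (c • f) h = c • s.Γ f h := by
  simp [Γ_eq, Finset.smul_sum]
lemma Γ_mul_left (f g h : T ℝ n) : s.Γ (f * g) h = f * s.Γ g h + g * s.Γ f h := by
  simp only [Γ_eq, dx_mul, Finset.mul_sum, ← Finset.sum_add_distrib]
  exact Finset.sum_congr rfl fun k _ => by ring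
lemma Γ_pow_left (f h : T ℝ n) (p : ℕ) : s.Γ (f ^ (p + 1)) h = (p + 1 : ℝ) • (f ^ p * s.Γ f h) := by
  simp only [Γ_eq, Derivation.leibniz_pow, Finset.mul_sum, Finset.smul_sum, Nat.add_sub_cancel,
    smul_eq_mul]
  refine Finset.sum_congr rfl fun k _ => ?_
  rw [← Nat.cast_smul_eq_nsmul ℝ]
  push_cast
  simp only [smul_mul_assoc]
  rw [mul_assoc]
lemma Γ_expT_left (f h : T ℝ n) : s.Γ (expT f) h = expT f * s.Γ f h := by
  simp only [Γ_eq, dx_expT, Finset.mul_sum, mul_assoc]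

lemma Δ_mul (f g : T ℝ n) : s.Δ (f * g) = f * s.Δ g + g * s.Δ f + (2 : ℝ) • s.Γ f g := by
  rw [two_smul]
  nth_rewrite 2 [s.Γ_comm]
  simp only [Δ, Γ_eq, D_mul, map_add, dx_mul, Finset.mul_sum, ← Finset.sum_add_distrib]
  exact Finset.sum_congr rfl fun k _ => by ring

lemma D_expT (k) (f : T ℝ n) : s.D k (expT f) = expT f * s.D k f := by
  simp only [D_apply, dx_expT, Finset.mul_sum]
  exact Finset.sum_congr rfl fun k _ => by ring

lemma Δ_expT (f : T ℝ n) : s.Δ (expT f) = expT f * (s.Δ f + s.Γ f f) := by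
  simp only [Δ, D_expT, Γ_eq, dx_mul, dx_expT, mul_add, Finset.mul_sum, ← Finset.sum_add_distrib]
  exact Finset.sum_congr rfl fun k _ => by ring

lemma I_Δ (f g : T ℝ n) : I (f * s.Δ g) = - I (s.Γ f g) := by
  simp only [Δ, Finset.mul_sum, map_sum, I_parts, Γ_eq, Finset.sum_neg_distrib]

lemma I_D (k) (f g : T ℝ n) : I (f * s.D k g) = - I (g * s.D k f) - I (f * g * s.D k s.F) := by
  have : ∀ a, I (f * (s.G k a * dx a g)) = -I (g * (s.G k a * dx a f)) - I (f * g * dx a (s.G k a)) := by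
    intro a
    rw [← mul_assoc, I_parts, dx_mul, add_mul, map_add, neg_add, sub_eq_add_neg]
    congr 3 <;> ring
  rw [D_apply, D_apply, ← s.div_G]
  simp only [Finset.mul_sum, map_sum, this, Finset.sum_sub_distrib, Finset.sum_neg_distrib]

/-- Second derivatives of `G` in the dual coordinates. -/
noncomputable def Z (i j : Fin n) : Matrix (Fin n) (Fin n) (T ℝ n) := (s.C j).map (s.D i)

lemma Z_apply (i j k l) : s.Z i j k l = s.D i (s.C j k l) := rfl
lemma Z_symm (i j k l) : s.Z i j k l = s.Z i j l k := by rw [Z_apply, Z_apply, s.C_symm]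
lemma Z_swap₂ (i j k l) : s.Z i j k l = s.Z i k j l := by rw [Z_apply, Z_apply, s.C_swap]
lemma Z_swap (i j k l) : s.Z i j k l = s.Z j i k l := by
  simp only [Z_apply, C_apply]; rw [D_comm]

/-- The Hessian of a function in the dual coordinates. -/
noncomputable def hD (f : T ℝ n) : Matrix (Fin n) (Fin n) (T ℝ n) :=
  Matrix.of fun i j => s.D i (s.D j f)
lemma hD_apply (f : T ℝ n) (i j) : s.hD f i j = s.D i (s.D j f) := rfl
lemma hDt (f : T ℝ n) : (s.hD f)ᵀ = s.hD f := by ext1 i j; exact s.D_comm j i f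

/-- The quadratic quantity `tr(H C_k H C_l)`. -/
noncomputable def Q : Matrix (Fin n) (Fin n) (T ℝ n) :=
  Matrix.of fun k l => (s.H * s.C k * s.H * s.C l).trace
lemma Q_apply (k l) : s.Q k l = (s.H * s.C k * s.H * s.C l).trace := rfl

lemma dH_D (k) : s.H.map (s.D k) = -(s.H * s.C k * s.H) := s.dH _

lemma hD_F (k l) : s.hD s.F k l = s.Δ (s.G k l) - s.Q k l := by
  have h : ∀ l, s.D l s.F = (s.H * s.C l).trace := fun l => s.dF _ ⟨fun a => s.G l a, rfl⟩
  have e : s.D k (s.H * s.C l).trace = ((s.H * s.C l).map (s.D k)).trace :=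
    map_sum (s.D k) _ _
  rw [hD_apply, h, e, map_derivation_mul, dH_D, trace_add, add_comm, Matrix.neg_mul, trace_neg,
    ← sub_eq_add_neg, Q_apply]
  congr 1
  rw [Δ_eq]
  simp only [trace, diag_apply, mul_apply]
  refine Finset.sum_congr rfl fun i _ => Finset.sum_congr rfl fun j _ => ?_
  change s.H i j * s.Z k l j i = s.H i j * s.Z i j k l
  have e : s.Z k l j i = s.Z i j k l := by
    rw [s.Z_symm k l j i, s.Z_swap₂ k l i j, s.Z_swap k i l j, s.Z_swap₂ i k l j,
      s.Z_symm i l k j, s.Z_swap₂ i l j k, s.Z_symm i j l k]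
  rw [e]

lemma Δ_G : s.G.map s.Δ = s.hD s.F + s.Q := by
  ext1 k l; rw [Matrix.add_apply, hD_F, map_apply]; ring

lemma mul₃_apply (X Y W : Matrix (Fin n) (Fin n) (T ℝ n)) (i l) :
    (X * Y * W) i l = ∑ j, ∑ k, X i j * Y j k * W k l := by
  simp only [mul_apply, Finset.sum_mul]
  exact Finset.sum_comm

lemma trace_mul_sum (X Y : Matrix (Fin n) (Fin n) (T ℝ n)) :
    (X * Y).trace = ∑ a, ∑ b, X a b * Y b a := by
  simp only [trace, diag_apply, mul_apply]

lemma Q_eq : s.Q = ∑ a, ∑ b, s.H a b • (s.C a * s.H * s.C b) := by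
  ext1 k l
  simp only [Q_apply, Matrix.sum_apply, Matrix.smul_apply, smul_eq_mul]
  have e : (s.H * s.C k * s.H * s.C l).trace = (s.H * (s.C k * s.H * s.C l)).trace := by
    simp only [mul_assoc]
  rw [e, trace_mul_sum, Finset.sum_comm]
  refine Finset.sum_congr rfl fun a _ => Finset.sum_congr rfl fun b _ => ?_
  rw [s.Hsymm, mul₃_apply, mul₃_apply]
  congr 1
  refine Finset.sum_congr rfl fun c _ => Finset.sum_congr rfl fun d _ => ?_
  simp only [s.C_swap, s.C_symm]

lemma ΔG_Z : s.G.map s.Δ = ∑ k, ∑ l, s.H k l • s.Z k l := by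
  ext1 i j
  simp only [map_apply, Δ_eq, Matrix.sum_apply, Matrix.smul_apply, smul_eq_mul]
  rfl

lemma ΔH : s.H.map s.Δ = s.H * (s.Q - s.hD s.F) * s.H := by
  have h : ∀ k l, (s.H.map (s.D l)).map (s.D k)
      = s.H * (s.C k * s.H * s.C l) * s.H + s.H * (s.C l * s.H * s.C k) * s.H
        - s.H * s.Z k l * s.H := by
    intro k l
    have e : (-(s.H * s.C l * s.H)).map (s.D k) = -((s.H * s.C l * s.H).map (s.D k)) := by
      ext1 i j; exact map_neg (s.D k) _
    rw [dH_D, e, map_derivation_mul, map_derivation_mul, dH_D]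
    change -((-(s.H * s.C k * s.H) * s.C l + s.H * s.Z k l) * s.H
      + s.H * s.C l * -(s.H * s.C k * s.H)) = _
    noncomm_ring
  have h1 : s.H.map s.Δ = ∑ k, ∑ l, s.H k l • (s.H.map (s.D l)).map (s.D k) := by
    ext1 i j
    simp only [map_apply, Δ_eq, Matrix.sum_apply, Matrix.smul_apply, smul_eq_mul]
  have h2 : ∀ X : Fin n → Fin n → Matrix (Fin n) (Fin n) (T ℝ n),
      ∑ k, ∑ l, s.H k l • (s.H * X k l * s.H) = s.H * (∑ k, ∑ l, s.H k l • X k l) * s.H := by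
    intro X
    simp only [Finset.mul_sum, Finset.sum_mul, mul_smul_comm, smul_mul_assoc]
  have h3 : ∑ k, ∑ l, s.H k l • (s.C l * s.H * s.C k) = s.Q := by
    rw [Q_eq, Finset.sum_comm]
    exact Finset.sum_congr rfl fun k _ => Finset.sum_congr rfl fun l _ => by rw [s.Hsymm]
  rw [h1]
  simp only [h, smul_sub, smul_add, Finset.sum_sub_distrib, Finset.sum_add_distrib, h2, h3,
    ← s.Q_eq, ← s.ΔG_Z, s.Δ_G]
  noncomm_ring

end Pot

end Abreu

namespace Abreu
open Set Filter Topology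
open scoped ContDiff

variable {n : ℕ}

/-- A symmetric bilinear form with values in smooth periodic functions which is pointwise
positive semidefinite. -/
structure IsPSD {V : Type*} [AddCommGroup V] [Module ℝ V] (b : V →ₗ[ℝ] V →ₗ[ℝ] T ℝ n) : Prop where
  symm : ∀ X Y, b X Y = b Y X
  nonneg : ∀ x X, 0 ≤ ev x (b X X)

namespace IsPSD
variable {V : Type*} [AddCommGroup V] [Module ℝ V] {b : V →ₗ[ℝ] V →ₗ[ℝ] T ℝ n}

lemma add_self (h : IsPSD b) (X Y) : b (X + Y) (X + Y) = b X X + 2 * b X Y + b Y Y := by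
  simp only [map_add, LinearMap.add_apply, h.symm Y X]; ring

lemma sub_self (h : IsPSD b) (X Y) : b (X - Y) (X - Y) = b X X - 2 * b X Y + b Y Y := by
  simp only [map_sub, LinearMap.sub_apply, h.symm Y X]; ring

lemma two_mul_le (h : IsPSD b) (x X Y) : 2 * ev x (b X Y) ≤ ev x (b X X) + ev x (b Y Y) := by
  have := h.nonneg x (X - Y)
  rw [h.sub_self] at this
  simp only [map_add, map_sub, map_mul, map_ofNat] at this
  linarith

lemma neg_two_mul_le (h : IsPSD b) (x X Y) :
    -(2 * ev x (b X Y)) ≤ ev x (b X X) + ev x (b Y Y) := by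
  have := h.nonneg x (X + Y)
  rw [h.add_self] at this
  simp only [map_add, map_mul, map_ofNat] at this
  linarith

lemma cs (h : IsPSD b) (x X Y) : ev x (b X Y) ^ 2 ≤ ev x (b X X) * ev x (b Y Y) := by
  have key : ∀ t : ℝ, 0 ≤ ev x (b Y Y) * (t * t) + (2 * ev x (b X Y)) * t + ev x (b X X) := by
    intro t
    have := h.nonneg x (X + t • Y)
    rw [h.add_self] at this
    simp only [map_add, map_mul, map_ofNat, map_smul, LinearMap.smul_apply, smul_eq_mul] at this
    linarith
  have := discrim_le_zero key
  rw [discrim] at this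
  nlinarith

end IsPSD

/-- Multiplication as a bilinear form. -/
noncomputable def mulB : T ℝ n →ₗ[ℝ] T ℝ n →ₗ[ℝ] T ℝ n := LinearMap.mul ℝ (T ℝ n)
lemma mulB_apply (f g : T ℝ n) : mulB f g = f * g := rfl
lemma mulB_psd : IsPSD (mulB : T ℝ n →ₗ[ℝ] T ℝ n →ₗ[ℝ] T ℝ n) where
  symm f g := mul_comm _ _
  nonneg x f := by rw [mulB_apply, map_mul]; exact mul_self_nonneg _

lemma exists_frame {M : Matrix (Fin n) (Fin n) ℝ} (h : M.PosSemidef) :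
    ∃ (m : ℕ) (B : Fin m → Fin n → ℝ), ∀ i j, M i j = ∑ a, B a i * B a j := by
  obtain ⟨m, A, hA⟩ := Matrix.posSemidef_iff_eq_sum_vecMulVec.mp h
  refine ⟨m, A, fun i j => ?_⟩
  rw [hA, Matrix.sum_apply]
  simp [vecMulVec_apply]

namespace Pot
variable (s : Pot n)

lemma posH (x) : (s.H.map (ev x)).PosDef := s.pos x

lemma ev_inv (x) : s.G.map (ev x) = (s.H.map (ev x))⁻¹ := by
  symm
  apply inv_eq_right_inv
  have := congrArg (fun M => M.map (ev x)) s.HG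
  simpa [Matrix.map_mul] using this

lemma posG (x) : (s.G.map (ev x)).PosDef := by
  rw [ev_inv]; exact (s.posH x).inv

lemma frameH (x) : ∃ (m : ℕ) (B : Fin m → Fin n → ℝ), ∀ i j, ev x (s.H i j) = ∑ a, B a i * B a j :=
  exists_frame (s.posH x).posSemidef
lemma frameG (x) : ∃ (m : ℕ) (B : Fin m → Fin n → ℝ), ∀ i j, ev x (s.G i j) = ∑ a, B a i * B a j :=
  exists_frame (s.posG x).posSemidef

section Lift
variable {V : Type*} [AddCommGroup V] [Module ℝ V] (b : V →ₗ[ℝ] V →ₗ[ℝ] T ℝ n)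

/-- Contract one more index of two tensors with the Hessian. -/
noncomputable def lift : (Fin n → V) →ₗ[ℝ] (Fin n → V) →ₗ[ℝ] T ℝ n :=
  LinearMap.mk₂ ℝ (fun X Y => ∑ i, ∑ k, s.H i k * b (X i) (Y k))
    (fun X X' Y => by simp [mul_add, Finset.sum_add_distrib])
    (fun c X Y => by simp [Finset.smul_sum])
    (fun X Y Y' => by simp [mul_add, Finset.sum_add_distrib])
    (fun c X Y => by simp [Finset.smul_sum])

lemma lift_apply (X Y : Fin n → V) : s.lift b X Y = ∑ i, ∑ k, s.H i k * b (X i) (Y k) := rfl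

variable {b} in
lemma lift_psd (h : IsPSD b) : IsPSD (s.lift b) where
  symm X Y := by
    rw [lift_apply, lift_apply, Finset.sum_comm]
    exact Finset.sum_congr rfl fun i _ => Finset.sum_congr rfl fun k _ => by
      rw [s.Hsymm, h.symm]
  nonneg x X := by
    obtain ⟨m, B, hB⟩ := s.frameH x
    have e : ev x (s.lift b X X)
        = ∑ a, ev x (b (∑ i, B a i • X i) (∑ k, B a k • X k)) := by
      simp only [lift_apply, map_sum, map_mul, hB, Finset.sum_mul, LinearMap.sum_apply, map_smul,
        LinearMap.smul_apply, smul_eq_mul]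
      simp_rw [Finset.sum_comm (s := Finset.univ (α := Fin n)) (t := Finset.univ (α := Fin m))]
      simp only [Finset.mul_sum]
      exact Finset.sum_congr rfl fun a _ => Finset.sum_congr rfl fun i _ =>
        Finset.sum_congr rfl fun k _ => by rw [h.symm]; ring
    rw [e]
    exact Finset.sum_nonneg fun a _ => h.nonneg x _

end Lift

/-- Inner product of vectors. -/
noncomputable def ip1 : (Fin n → T ℝ n) →ₗ[ℝ] (Fin n → T ℝ n) →ₗ[ℝ] T ℝ n := s.lift mulB
lemma ip1_psd : IsPSD s.ip1 := s.lift_psd mulB_psd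
lemma ip1_apply (u v) : s.ip1 u v = ∑ i, ∑ k, s.H i k * (u i * v k) := rfl

/-- Inner product of matrices. -/
noncomputable def ip : Matrix (Fin n) (Fin n) (T ℝ n) →ₗ[ℝ] Matrix (Fin n) (Fin n) (T ℝ n) →ₗ[ℝ]
    T ℝ n :=
  LinearMap.mk₂ ℝ (fun X Y => (s.H * X * s.H * Yᵀ).trace)
    (fun X X' Y => by simp [mul_add, add_mul]) (fun c X Y => by simp)
    (fun X Y Y' => by simp [mul_add]) (fun c X Y => by simp)

lemma ip_apply (X Y) : s.ip X Y = (s.H * X * s.H * Yᵀ).trace := rfl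

lemma ip_eq (X Y) : s.ip X Y = s.lift s.ip1 (fun i j => X i j) (fun i j => Y i j) := by
  rw [ip_apply, lift_apply, trace_mul_sum]
  have h : ∀ a b, (s.H * X * s.H) a b * Yᵀ b a
      = ∑ j, ∑ k, s.H j a * (s.H k b * (X j k * Y a b)) := by
    intro a b
    rw [mul₃_apply, transpose_apply]
    simp only [Finset.sum_mul]
    exact Finset.sum_congr rfl fun j _ => Finset.sum_congr rfl fun k _ => by
      rw [s.Hsymm a j]; ring
  simp only [h, ip1_apply, Finset.mul_sum]
  rw [Finset.sum_congr rfl fun a _ => Finset.sum_comm, Finset.sum_comm]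
  exact Finset.sum_congr rfl fun a _ => Finset.sum_congr rfl fun j _ => Finset.sum_comm

lemma ip_psd : IsPSD s.ip where
  symm X Y := by rw [ip_eq, ip_eq, (s.lift_psd s.ip1_psd).symm]
  nonneg x X := by rw [ip_eq]; exact (s.lift_psd s.ip1_psd).nonneg x _

/-- Inner product of three-tensors. -/
noncomputable def ip3 : (Fin n → Matrix (Fin n) (Fin n) (T ℝ n)) →ₗ[ℝ]
    (Fin n → Matrix (Fin n) (Fin n) (T ℝ n)) →ₗ[ℝ] T ℝ n := s.lift s.ip
lemma ip3_psd : IsPSD s.ip3 := s.lift_psd s.ip_psd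
lemma ip3_apply (X Y) : s.ip3 X Y = ∑ i, ∑ k, s.H i k * s.ip (X i) (Y k) := rfl

/-- Inner product of four-tensors. -/
noncomputable def ip4 : (Fin n → Fin n → Matrix (Fin n) (Fin n) (T ℝ n)) →ₗ[ℝ]
    (Fin n → Fin n → Matrix (Fin n) (Fin n) (T ℝ n)) →ₗ[ℝ] T ℝ n := s.lift s.ip3
lemma ip4_psd : IsPSD s.ip4 := s.lift_psd s.ip3_psd
lemma ip4_apply (X Y) : s.ip4 X Y
    = ∑ i, ∑ k, s.H i k * ∑ j, ∑ l, s.H j l * s.ip (X i j) (Y k l) := rfl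

end Pot

end Abreu

namespace Abreu
open Set Filter Topology
open scoped ContDiff

variable {n : ℕ}
namespace Pot
variable (s : Pot n)

lemma ip_sum (X Y) : s.ip X Y = ∑ i, ∑ k, ∑ j, ∑ l, s.H i k * (s.H j l * (X i j * Y k l)) := by
  rw [ip_eq]
  simp only [lift_apply, ip1_apply, Finset.mul_sum]

lemma ip_smul_left (a : T ℝ n) (X Y) : s.ip (a • X) Y = a * s.ip X Y := by
  simp [ip_apply]
lemma ip_smul_right (a : T ℝ n) (X Y) : s.ip X (a • Y) = a * s.ip X Y := by
  simp [ip_apply]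
lemma ip_comm (X Y) : s.ip X Y = s.ip Y X := s.ip_psd.symm X Y

lemma Q_ip (k l) : s.Q k l = s.ip (s.C k) (s.C l) := by rw [ip_apply, Ct, Q_apply]

/-- The quadratic form of `X` on the differentials of `f` and `g`. -/
noncomputable def quad (X : Matrix (Fin n) (Fin n) (T ℝ n)) (f g : T ℝ n) : T ℝ n :=
  ∑ k, ∑ l, X k l * (dx k f * dx l g)

/-- The tensor product of two gradients. -/
noncomputable def gr2 (f g : T ℝ n) : Matrix (Fin n) (Fin n) (T ℝ n) :=
  Matrix.of fun i j => s.D i f * s.D j g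
lemma gr2_apply (f g : T ℝ n) (i j) : s.gr2 f g i j = s.D i f * s.D j g := rfl

lemma ip_gr2 (X) (f g : T ℝ n) : s.ip X (s.gr2 f g) = quad X f g := by
  rw [ip_sum]
  refine Finset.sum_congr rfl fun i _ => ?_
  rw [Finset.sum_comm]
  refine Finset.sum_congr rfl fun j _ => ?_
  rw [s.dx_eq i f, s.dx_eq j g, Finset.sum_mul_sum, Finset.mul_sum]
  refine Finset.sum_congr rfl fun k _ => ?_
  rw [Finset.mul_sum]
  exact Finset.sum_congr rfl fun l _ => by rw [gr2_apply]; ring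

lemma quad_gr2 (f g u v : T ℝ n) : quad (s.gr2 f g) u v = s.Γ f u * s.Γ g v := by
  simp only [quad, gr2_apply, s.Γ_comm _ u, s.Γ_comm _ v, Γ_eq, Finset.sum_mul_sum]
  exact Finset.sum_congr rfl fun k _ => Finset.sum_congr rfl fun l _ => by ring

/-- The first order correction of the Hessian. -/
noncomputable def K (f : T ℝ n) : Matrix (Fin n) (Fin n) (T ℝ n) := ∑ d, dx d f • s.C d

lemma K_apply (f : T ℝ n) (i j) : s.K f i j = ∑ d, dx d f * s.C d i j := by
  simp [K, Matrix.sum_apply]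

/-- The Hessian in the original coordinates, with raised indices. -/
noncomputable def B (f : T ℝ n) : Matrix (Fin n) (Fin n) (T ℝ n) := s.hD f - s.K f

lemma quad_Q (f g : T ℝ n) : quad s.Q f g = s.ip (s.K f) (s.K g) := by
  simp only [quad, K, map_sum, LinearMap.sum_apply, ip_smul_left, ip_smul_right, Q_ip]
  rw [Finset.sum_comm]
  exact Finset.sum_congr rfl fun k _ => Finset.sum_congr rfl fun l _ => by ring

lemma ip_K (f : T ℝ n) (X) : s.ip (s.K f) X = ∑ d, dx d f * s.ip (s.C d) X := by
  simp only [K, map_sum, LinearMap.sum_apply, ip_smul_left]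

lemma dH_apply (k i j) : s.D k (s.H i j) = -∑ a, ∑ b, s.H i a * s.C k a b * s.H b j := by
  rw [← mul₃_apply]
  exact congrFun (congrFun (s.dH_D k) i) j

lemma Δ_D (l) (g : T ℝ n) : s.Δ (s.D l g) = s.D l (s.Δ g) + s.ip (s.C l) (s.hD g) := by
  have e : ∀ i j, s.D l (s.H i j * s.D i (s.D j g))
      = -((∑ a, ∑ b, s.H i a * s.C l a b * s.H b j) * s.hD g i j) + s.H i j * s.D i (s.D j (s.D l g)) := by
    intro i j
    rw [D_mul, dH_apply, s.D_comm l i, s.D_comm l j, neg_mul, hD_apply]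
  rw [s.Δ_eq g, map_sum]
  simp only [map_sum, e, Finset.sum_add_distrib, Finset.sum_neg_distrib]
  rw [← Δ_eq]
  have e2 : ∑ i, ∑ j, (∑ a, ∑ b, s.H i a * s.C l a b * s.H b j) * s.hD g i j
      = s.ip (s.C l) (s.hD g) := by
    rw [s.ip_comm, ip_sum]
    simp only [Finset.sum_mul]
    refine Finset.sum_congr rfl fun i _ => ?_
    rw [Finset.sum_comm]
    refine Finset.sum_congr rfl fun a _ => ?_
    refine Finset.sum_congr rfl fun j _ => Finset.sum_congr rfl fun b _ => ?_
    rw [s.Hsymm b j]; ring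
  rw [e2]; ring

lemma sum_Γ_H (f g : T ℝ n) : ∑ k, ∑ l, s.Γ (s.H k l) (s.D k f) * s.D l g
    = - s.ip (s.hD f) (s.K g) := by
  have e : ∀ p k, ∑ l, s.D p (s.H k l) * s.D l g = -∑ a, s.H k a * s.K g p a := by
    intro p k
    simp only [dH_apply, neg_mul, Finset.sum_neg_distrib, Finset.sum_mul]
    rw [Finset.sum_comm]
    congr 1
    refine Finset.sum_congr rfl fun a _ => ?_
    rw [Finset.sum_comm, K_apply, Finset.mul_sum]
    refine Finset.sum_congr rfl fun b _ => ?_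
    rw [dx_eq, Finset.sum_mul, Finset.mul_sum]
    refine Finset.sum_congr rfl fun l _ => ?_
    rw [s.C_symm, s.C_swap]; ring
  have e2 : ∀ k, ∑ l, s.Γ (s.H k l) (s.D k f) * s.D l g
      = -∑ p, ∑ q, ∑ a, s.H q p * (s.H k a * (s.hD f q k * s.K g p a)) := by
    intro k
    simp only [Γ, Finset.sum_mul]
    rw [Finset.sum_comm, ← Finset.sum_neg_distrib]
    refine Finset.sum_congr rfl fun p _ => ?_
    rw [Finset.sum_comm, ← Finset.sum_neg_distrib]
    refine Finset.sum_congr rfl fun q _ => ?_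
    have : ∀ l, s.H p q * s.D p (s.H k l) * s.D q (s.D k f) * s.D l g
        = (s.H p q * s.D q (s.D k f)) * (s.D p (s.H k l) * s.D l g) := fun l => by ring
    simp only [this, ← Finset.mul_sum, e]
    rw [mul_neg, Finset.mul_sum, Finset.mul_sum]
    congr 1
    exact Finset.sum_congr rfl fun a _ => by rw [hD_apply, s.Hsymm p q]; ring
  simp only [e2, Finset.sum_neg_distrib]
  rw [ip_sum]
  congr 1
  rw [Finset.sum_comm, Finset.sum_congr rfl fun a _ => Finset.sum_comm, Finset.sum_comm]

lemma sum_H_Γ (f g : T ℝ n) : ∑ k, ∑ l, s.H k l * s.Γ (s.D k f) (s.D l g)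
    = s.ip (s.hD f) (s.hD g) := by
  simp only [ip_sum, Γ, Finset.mul_sum]
  refine Finset.sum_congr rfl fun i _ => Finset.sum_congr rfl fun k _ =>
    Finset.sum_congr rfl fun j _ => Finset.sum_congr rfl fun l _ => ?_
  rw [hD_apply, hD_apply, s.D_comm i, s.D_comm k]; ring

lemma sum_ΔH (f g : T ℝ n) : ∑ k, ∑ l, s.Δ (s.H k l) * (s.D k f * s.D l g)
    = quad s.Q f g - quad (s.hD s.F) f g := by
  have e : ∀ k l, s.Δ (s.H k l) = (s.H * (s.Q - s.hD s.F) * s.H) k l := fun k l =>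
    congrFun (congrFun s.ΔH k) l
  have e2 : quad s.Q f g - quad (s.hD s.F) f g = quad (s.Q - s.hD s.F) f g := by
    simp only [quad, Matrix.sub_apply, sub_mul, Finset.sum_sub_distrib]
  rw [e2, ← ip_gr2, ip_sum]
  simp only [e, mul₃_apply, Finset.sum_mul]
  rw [Finset.sum_congr rfl fun a _ => Finset.sum_comm]
  rw [Finset.sum_comm]
  refine Finset.sum_congr rfl fun i _ => Finset.sum_congr rfl fun k _ => ?_
  rw [Finset.sum_comm]
  refine Finset.sum_congr rfl fun j _ => Finset.sum_congr rfl fun l _ => ?_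
  rw [gr2_apply, s.Hsymm k i]; ring

lemma bochner (f g : T ℝ n) : s.Δ (s.Γ f g) = s.Γ f (s.Δ g) + s.Γ g (s.Δ f)
    - quad (s.hD s.F) f g + s.ip (s.hD f) (s.hD g) + s.ip (s.B f) (s.B g) := by
  have e : ∀ k l, s.Δ (s.H k l * s.D k f * s.D l g) = s.Δ (s.H k l) * (s.D k f * s.D l g)
      + (s.H k l * s.D l g * s.Δ (s.D k f) + s.H k l * s.D k f * s.Δ (s.D l g))
      + (2 : ℝ) • (s.Γ (s.H k l) (s.D k f) * s.D l g + s.Γ (s.H k l) (s.D l g) * s.D k f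
        + s.H k l * s.Γ (s.D k f) (s.D l g)) := by
    intro k l
    simp only [Δ_mul, Γ_mul_left, two_smul]; ring
  have h1 : ∀ f g : T ℝ n, ∑ k, ∑ l, s.H k l * s.D l g * s.Δ (s.D k f)
      = s.Γ g (s.Δ f) + s.ip (s.K g) (s.hD f) := by
    intro f g
    simp only [← Finset.sum_mul, ← dx_eq, Δ_D, mul_add, Finset.sum_add_distrib, Γ_eq, ip_K]
  have h2 : ∀ f g : T ℝ n, ∑ k, ∑ l, s.H k l * s.D k f * s.Δ (s.D l g)
      = s.Γ f (s.Δ g) + s.ip (s.K f) (s.hD g) := by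
    intro f g
    rw [← h1, Finset.sum_comm]
    exact Finset.sum_congr rfl fun k _ => Finset.sum_congr rfl fun l _ => by rw [s.Hsymm]
  have h3 : ∑ k, ∑ l, s.Γ (s.H k l) (s.D l g) * s.D k f = - s.ip (s.hD g) (s.K f) := by
    rw [← sum_Γ_H, Finset.sum_comm]
    exact Finset.sum_congr rfl fun k _ => Finset.sum_congr rfl fun l _ => by rw [s.Hsymm]
  rw [Γ]
  simp only [Δ_sum, e, Finset.sum_add_distrib, h1, h2, h3, sum_Γ_H, sum_H_Γ,
    sum_ΔH, quad_Q, B, map_sub, LinearMap.sub_apply, two_smul]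
  rw [s.ip_comm (s.K g), s.ip_comm (s.hD g), s.ip_comm (s.hD f) (s.K g)]
  ring

end Pot

end Abreu

namespace Abreu
open Set Filter Topology
open scoped ContDiff

variable {n : ℕ}
namespace Pot
variable (s : Pot n)

lemma D_Γ (m) (f g : T ℝ n) : s.D m (s.Γ f g)
    = ∑ k, s.B f m k * dx k g + ∑ k, s.hD g m k * dx k f := by
  have e : ∑ k, s.D m (dx k f) * s.D k g = ∑ k, s.B f m k * dx k g := by
    have e1 : ∀ k, s.D m (dx k f) = ∑ l, s.H k l * s.B f m l := by
      intro k
      have e2 : ∑ l, s.D m (s.H k l) * s.D l f = -∑ l, s.H k l * s.K f m l := by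
        simp only [dH_apply, neg_mul, Finset.sum_neg_distrib, Finset.sum_mul]
        rw [Finset.sum_comm]
        congr 1
        refine Finset.sum_congr rfl fun a _ => ?_
        rw [Finset.sum_comm, K_apply, Finset.mul_sum]
        refine Finset.sum_congr rfl fun b _ => ?_
        rw [dx_eq, Finset.sum_mul, Finset.mul_sum]
        refine Finset.sum_congr rfl fun l _ => ?_
        rw [s.C_symm, s.C_swap]; ring
      rw [s.dx_eq k f, map_sum]
      simp only [D_mul, Finset.sum_add_distrib, e2, B, Matrix.sub_apply, mul_sub,
        Finset.sum_sub_distrib, hD_apply]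
      ring
    simp only [e1, s.dx_eq _ g, Finset.sum_mul, Finset.mul_sum]
    rw [Finset.sum_comm]
    exact Finset.sum_congr rfl fun k _ => Finset.sum_congr rfl fun l _ => by
      rw [s.Hsymm]; ring
  rw [Γ_eq, map_sum]
  simp only [D_mul, Finset.sum_add_distrib, e]
  congr 1
  exact Finset.sum_congr rfl fun k _ => by rw [hD_apply]; ring

lemma Γ_Γ (h f g : T ℝ n) : s.Γ h (s.Γ f g) = quad (s.B f) h g + quad (s.hD g) h f := by
  simp only [Γ_eq s h, D_Γ, mul_add, Finset.sum_add_distrib, Finset.mul_sum, quad]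
  congr 1 <;> exact Finset.sum_congr rfl fun k _ => Finset.sum_congr rfl fun l _ => by ring

/-- The cubic energy density. -/
noncomputable def S : T ℝ n := s.ip3 s.C s.C

lemma S_eq : s.S = ∑ k, ∑ l, s.H k l * s.Q k l := by
  simp only [S, ip3_apply, Q_ip]

lemma Qt : s.Qᵀ = s.Q := by
  ext1 k l; rw [transpose_apply, Q_ip, Q_ip, ip_comm]

lemma sum_mul_eq_trace (X Y : Matrix (Fin n) (Fin n) (T ℝ n)) :
    ∑ i, ∑ j, X i j * Y i j = (X * Yᵀ).trace := by
  rw [trace_mul_sum]; rfl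

lemma sum_ip (X Y : Fin n → Fin n → Matrix (Fin n) (Fin n) (T ℝ n)) :
    ∑ i, ∑ j, s.ip (Matrix.of fun k l => X k l i j)
      (Matrix.of fun k l => (s.H * Y k l * s.H) i j) = s.ip4 X Y := by
  have e : ∀ k a l b, ∑ i, ∑ j, X k l i j * (s.H * Y a b * s.H) i j = s.ip (X k l) (Y a b) := by
    intro k a l b
    rw [sum_mul_eq_trace, ip_apply, transpose_mul, transpose_mul, Ht]
    rw [← mul_assoc, ← mul_assoc, trace_mul_comm]
    simp only [mul_assoc]
  simp only [ip_sum, Matrix.of_apply, ip4_apply, ← e, Finset.mul_sum]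
  have e2 : ∀ g : Fin n → Fin n → Fin n → Fin n → Fin n → Fin n → T ℝ n,
      ∑ i, ∑ j, ∑ k, ∑ a, ∑ l, ∑ b, g i j k a l b = ∑ k, ∑ a, ∑ l, ∑ b, ∑ i, ∑ j, g i j k a l b := by
    intro g
    have := Finset.sum_comm (s := Finset.univ) (t := Finset.univ) (f := fun (p : Fin n × Fin n)
      (q : Fin n × Fin n × Fin n × Fin n) => g p.1 p.2 q.1 q.2.1 q.2.2.1 q.2.2.2)
    simpa only [Fintype.sum_prod_type] using this
  rw [e2]

/-- First quadratic four-tensor. -/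
noncomputable def E1 (k l : Fin n) : Matrix (Fin n) (Fin n) (T ℝ n) :=
  ∑ d, ∑ e, (s.C d k l * s.H d e) • s.C e
/-- Second quadratic four-tensor. -/
noncomputable def E2 (k l : Fin n) : Matrix (Fin n) (Fin n) (T ℝ n) := s.C k * s.H * s.C l
/-- Third quadratic four-tensor. -/
noncomputable def E3 (k l : Fin n) : Matrix (Fin n) (Fin n) (T ℝ n) := s.C l * s.H * s.C k

lemma hD_H (k l i j) : s.hD (s.H i j) k l = -(s.H * (s.Z k l - s.E2 k l - s.E3 k l) * s.H) i j := by
  have e : (-(s.H * s.C l * s.H)).map (s.D k) = -((s.H * s.C l * s.H).map (s.D k)) := by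
    ext1 i j; exact map_neg (s.D k) _
  have h : (s.H.map (s.D l)).map (s.D k) = -(s.H * (s.Z k l - s.E2 k l - s.E3 k l) * s.H) := by
    rw [dH_D, e, map_derivation_mul, map_derivation_mul, dH_D]
    change -((-(s.H * s.C k * s.H) * s.C l + s.H * s.Z k l) * s.H
      + s.H * s.C l * -(s.H * s.C k * s.H)) = _
    rw [E2, E3]
    noncomm_ring
  exact congrFun (congrFun h i) j

lemma K_G (k l i j) : s.K (s.G i j) k l = s.E1 k l i j := by
  rw [K_apply]
  simp only [E1, Matrix.sum_apply, Matrix.smul_apply, smul_eq_mul]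
  refine Finset.sum_congr rfl fun d _ => ?_
  rw [s.dx_eq, Finset.sum_mul]
  exact Finset.sum_congr rfl fun e _ => by rw [C_apply s e]; ring

lemma K_H (k l i j) : s.K (s.H i j) k l = -(s.H * s.E1 k l * s.H) i j := by
  have h : ∀ e, s.D e (s.H i j) = -((s.H * s.C e * s.H) i j) := fun e =>
    congrFun (congrFun (s.dH_D e) i) j
  rw [K_apply]
  simp only [E1, Finset.mul_sum, Finset.sum_mul, Matrix.sum_apply,
    mul_smul_comm, smul_mul_assoc, Matrix.smul_apply, smul_eq_mul, ← Finset.sum_neg_distrib]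
  refine Finset.sum_congr rfl fun d _ => ?_
  rw [s.dx_eq, Finset.sum_mul]
  exact Finset.sum_congr rfl fun e _ => by rw [h]; ring

lemma sum_Γ_map (N M : Matrix (Fin n) (Fin n) (T ℝ n)) :
    ∑ i, ∑ j, s.Γ (N i j) (M i j) =
      ∑ k, ∑ l, s.H k l * (N.map (s.D k) * (M.map (s.D l))ᵀ).trace := by
  simp only [← sum_mul_eq_trace, Γ, Finset.mul_sum]
  have e2 : ∀ g : Fin n → Fin n → Fin n → Fin n → T ℝ n,
      ∑ i, ∑ j, ∑ k, ∑ l, g i j k l = ∑ k, ∑ l, ∑ i, ∑ j, g i j k l := by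
    intro g
    have := Finset.sum_comm (s := Finset.univ) (t := Finset.univ) (f := fun (p q : Fin n × Fin n) =>
      g p.1 p.2 q.1 q.2)
    simpa only [Fintype.sum_prod_type] using this
  rw [e2]
  refine Finset.sum_congr rfl fun k _ => Finset.sum_congr rfl fun l _ =>
    Finset.sum_congr rfl fun i _ => Finset.sum_congr rfl fun j _ => ?_
  rw [map_apply, map_apply]; ring

lemma sum_Γ_G (M : Matrix (Fin n) (Fin n) (T ℝ n)) :
    ∑ i, ∑ j, s.Γ (s.G i j) (M i j) = ∑ k, ∑ l, s.H k l * (s.C k * (M.map (s.D l))ᵀ).trace :=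
  s.sum_Γ_map s.G M

lemma sum_Γ_HM (M : Matrix (Fin n) (Fin n) (T ℝ n)) :
    ∑ i, ∑ j, s.Γ (s.H i j) (M i j) = - s.ip3 s.C (fun l => M.map (s.D l)) := by
  rw [sum_Γ_map, ip3_apply]
  simp only [dH_D, Matrix.neg_mul, trace_neg, mul_neg, Finset.sum_neg_distrib, ip_apply]

lemma sum_quad (X : Matrix (Fin n) (Fin n) (T ℝ n)) :
    ∑ i, ∑ j, quad X (s.G i j) (s.H i j) = - s.ip X s.Q := by
  have h : ∑ i, ∑ j, s.gr2 (s.G i j) (s.H i j) = -s.Q := by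
    ext1 k l
    have h : ∀ i j, s.D l (s.H i j) = -((s.H * s.C l * s.H) i j) := fun i j =>
      congrFun (congrFun (s.dH_D l) i) j
    simp only [Matrix.sum_apply, gr2_apply, h, ← C_apply, mul_neg, Finset.sum_neg_distrib,
      sum_mul_eq_trace, Matrix.neg_apply, Q_apply, transpose_mul, Ht, Ct]
    rw [← mul_assoc, ← mul_assoc, trace_mul_comm]
    simp only [mul_assoc]
  rw [← map_neg, ← h, map_sum]
  refine Finset.sum_congr rfl fun i _ => ?_
  rw [map_sum]
  exact Finset.sum_congr rfl fun j _ => (ip_gr2 ..).symm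

lemma S_eq_sum_Γ : s.S = -∑ i, ∑ j, s.Γ (s.G i j) (s.H i j) := by
  have h : ∑ i, ∑ j, s.Γ (s.H i j) (s.G i j) = -s.S := sum_Γ_HM s s.G
  simp only [s.Γ_comm (s.G _ _), h, neg_neg]

lemma sum_Γ_G_H (X : Matrix (Fin n) (Fin n) (T ℝ n)) (hX : Xᵀ = X) :
    ∑ i, ∑ j, s.Γ (s.G i j) ((s.H * X * s.H) i j) =
      s.ip3 s.C (fun l => X.map (s.D l)) - 2 * s.ip s.Q X := by
  rw [sum_Γ_G]
  have e : ∀ k l, (s.C k * ((s.H * X * s.H).map (s.D l))ᵀ).trace =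
      s.ip (s.C k) (X.map (s.D l)) - (s.C k * s.H * s.C l * s.H * X * s.H).trace
        - (s.C k * s.H * X * s.H * s.C l * s.H).trace := by
    intro k l
    have hXt : (X.map (s.D l))ᵀ = X.map (s.D l) := by
      ext1 a b
      exact congrArg (s.D l) (congrFun (congrFun hX a) b)
    rw [map_derivation_mul, map_derivation_mul, dH_D, ip_apply]
    simp only [transpose_add, transpose_mul, transpose_neg, Ht, Ct, hX, hXt]
    rw [mul_assoc s.H (s.C k), mul_assoc s.H, trace_mul_comm s.H]
    simp only [mul_add, trace_add, Matrix.mul_neg, Matrix.neg_mul, trace_neg, mul_assoc]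
    ring
  have e1 : ∑ k, ∑ l, s.H k l * (s.C k * s.H * s.C l * s.H * X * s.H).trace = s.ip s.Q X := by
    have e : s.ip s.Q X = (s.Q * (s.H * X * s.H)).trace := by
      rw [ip_apply, hX, mul_assoc, mul_assoc, trace_mul_comm]; simp only [mul_assoc]
    rw [e, Q_eq]
    simp only [Finset.sum_mul, trace_sum, smul_mul_assoc, trace_smul, smul_eq_mul, mul_assoc]
  have e2 : ∑ k, ∑ l, s.H k l * (s.C k * s.H * X * s.H * s.C l * s.H).trace = s.ip s.Q X := by
    rw [← e1, Finset.sum_comm]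
    refine Finset.sum_congr rfl fun k _ => Finset.sum_congr rfl fun l _ => ?_
    rw [s.Hsymm, mul_assoc _ (s.C k), trace_mul_comm]
    simp only [mul_assoc]
  simp only [e, mul_sub, Finset.sum_sub_distrib, e1, e2, ip3_apply]
  ring

lemma sum_ip_hD (X Y : Fin n → Fin n → Matrix (Fin n) (Fin n) (T ℝ n))
    (f g : Fin n → Fin n → Matrix (Fin n) (Fin n) (T ℝ n)) (hf : ∀ i j k l, f i j k l = X k l i j)
    (hg : ∀ i j k l, g i j k l = -(s.H * Y k l * s.H) i j) :
    ∑ i, ∑ j, s.ip (f i j) (g i j) = -s.ip4 X Y := by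
  have e1 : ∀ i j, f i j = Matrix.of fun k l => X k l i j := fun i j => by ext1 k l; exact hf i j k l
  have e2 : ∀ i j, g i j = -Matrix.of fun k l => (s.H * Y k l * s.H) i j :=
    fun i j => by ext1 k l; exact hg i j k l
  simp only [e1, e2, map_neg, Finset.sum_neg_distrib, sum_ip]

lemma ip3_map_D (X Y : Matrix (Fin n) (Fin n) (T ℝ n)) :
    (s.ip3 s.C fun l => (X + Y).map (s.D l)) =
      (s.ip3 s.C fun l => X.map (s.D l)) + s.ip3 s.C fun l => Y.map (s.D l) := by
  rw [← map_add]
  congr 1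
  ext l i j
  simp

lemma ip3_map_D_sub (X Y : Matrix (Fin n) (Fin n) (T ℝ n)) :
    (s.ip3 s.C fun l => (X - Y).map (s.D l)) =
      (s.ip3 s.C fun l => X.map (s.D l)) - s.ip3 s.C fun l => Y.map (s.D l) := by
  rw [← map_sub]
  congr 1
  ext l i j
  simp

lemma ΔS : s.Δ s.S = s.ip4 s.Z (s.Z - s.E2 - s.E3) + s.ip4 (s.Z - s.E1) (s.Z - s.E2 - s.E3 - s.E1)
    + 2 * s.ip s.Q s.Q + 2 * s.ip3 s.C (fun l => (s.hD s.F).map (s.D l))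
    - 3 * s.ip (s.hD s.F) s.Q := by
  have t1 : ∑ i, ∑ j, s.Γ (s.G i j) (s.Δ (s.H i j)) =
      s.ip3 s.C (fun l => (s.Q - s.hD s.F).map (s.D l)) - 2 * s.ip s.Q (s.Q - s.hD s.F) := by
    rw [← sum_Γ_G_H _ _ (by rw [transpose_sub, Qt, hDt]), ← ΔH]; rfl
  have t2 : ∑ i, ∑ j, s.Γ (s.H i j) (s.Δ (s.G i j)) =
      -s.ip3 s.C (fun l => (s.hD s.F + s.Q).map (s.D l)) := by
    rw [← sum_Γ_HM, ← Δ_G]; rfl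
  have t4 : ∑ i, ∑ j, s.ip (s.hD (s.G i j)) (s.hD (s.H i j)) = -s.ip4 s.Z (s.Z - s.E2 - s.E3) := by
    refine s.sum_ip_hD _ _ _ _ (fun i j k l => ?_) fun i j k l => ?_
    · rw [hD_apply, Z_apply, C_apply]
    · rw [hD_H]; rfl
  have t5 : ∑ i, ∑ j, s.ip (s.B (s.G i j)) (s.B (s.H i j))
      = -s.ip4 (s.Z - s.E1) (s.Z - s.E2 - s.E3 - s.E1) := by
    refine s.sum_ip_hD _ _ _ _ (fun i j k l => ?_) fun i j k l => ?_
    · rw [B, Matrix.sub_apply, K_G, hD_apply]; rfl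
    · rw [B, Matrix.sub_apply, K_H, hD_H]
      change _ = -(s.H * (s.Z k l - s.E2 k l - s.E3 k l - s.E1 k l) * s.H) i j
      have e : s.H * (s.Z k l - s.E2 k l - s.E3 k l - s.E1 k l) * s.H =
          s.H * (s.Z k l - s.E2 k l - s.E3 k l) * s.H - s.H * s.E1 k l * s.H := by noncomm_ring
      rw [e, Matrix.sub_apply]
      ring
  have t3 := s.sum_quad (s.hD s.F)
  rw [S_eq_sum_Γ, ← neg_one_smul ℝ, Δ_smul]
  simp only [Δ_sum, bochner, Finset.sum_add_distrib, Finset.sum_sub_distrib, t1, t2, t3, t4, t5,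
    ip3_map_D, ip3_map_D_sub, map_sub (s.ip s.Q), s.ip_comm s.Q (s.hD s.F), neg_one_smul]
  ring

end Pot

end Abreu

namespace Abreu
open Set Filter Topology
open scoped ContDiff

variable {n : ℕ}
namespace Pot
variable (s : Pot n)

lemma sum_comm₄ {M : Type*} [AddCommMonoid M] (g : Fin n → Fin n → Fin n → Fin n → M) :
    ∑ i, ∑ j, ∑ k, ∑ l, g i j k l = ∑ k, ∑ l, ∑ i, ∑ j, g i j k l := by
  have := Finset.sum_comm (s := Finset.univ) (t := Finset.univ) (f := fun (p q : Fin n × Fin n) =>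
    g p.1 p.2 q.1 q.2)
  simpa only [Fintype.sum_prod_type] using this

lemma ip4_E1 : s.ip4 s.E1 s.E1 = s.ip s.Q s.Q := by
  have hR : ∀ d d', s.ip (∑ e, s.H d e • s.C e) (∑ e, s.H d' e • s.C e) =
      (s.H * s.Q * s.H) d d' := by
    intro d d'
    simp only [map_sum, LinearMap.sum_apply, ip_smul_left, ip_smul_right, ← Q_ip, mul₃_apply]
    rw [Finset.sum_comm]
    exact Finset.sum_congr rfl fun e _ => Finset.sum_congr rfl fun e' _ => by rw [s.Hsymm d']; ring
  have hE : ∀ i j, s.E1 i j = ∑ d, s.C d i j • ∑ e, s.H d e • s.C e := by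
    intro i j
    simp only [E1, Finset.smul_sum, smul_smul]
  have e : ∀ i j k l, s.ip (s.E1 i j) (s.E1 k l) =
      ∑ d, ∑ d', s.C d i j * s.C d' k l * (s.H * s.Q * s.H) d d' := by
    intro i j k l
    simp only [hE]
    simp only [map_sum (s.ip _) (fun d => s.C d k l • _), map_sum s.ip (fun d => s.C d i j • _),
      LinearMap.sum_apply, ip_smul_left, ip_smul_right, hR]
    exact Finset.sum_congr rfl fun e _ => Finset.sum_congr rfl fun e' _ => by ring
  have e2 : s.ip s.Q s.Q = ∑ d, ∑ d', (s.H * s.Q * s.H) d d' * s.Q d d' := by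
    rw [sum_mul_eq_trace, ip_apply]
  rw [e2, ip4_apply]
  simp only [e, Q_ip, ip_sum s (s.C _), Finset.mul_sum]
  have e3 : ∀ g : Fin n → Fin n → Fin n → Fin n → Fin n → Fin n → T ℝ n,
      ∑ i, ∑ j, ∑ k, ∑ a, ∑ l, ∑ b, g i j k a l b = ∑ l, ∑ b, ∑ i, ∑ j, ∑ k, ∑ a, g i j k a l b := by
    intro g
    have := Finset.sum_comm (s := Finset.univ) (t := Finset.univ) (f := fun
      (q : Fin n × Fin n × Fin n × Fin n) (p : Fin n × Fin n) => g q.1 q.2.1 q.2.2.1 q.2.2.2 p.1 p.2)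
    simpa only [Fintype.sum_prod_type] using this
  rw [e3]
  refine Finset.sum_congr rfl fun d _ => Finset.sum_congr rfl fun d' _ => Finset.sum_congr rfl fun i _ =>
    Finset.sum_congr rfl fun k _ => Finset.sum_congr rfl fun j _ => Finset.sum_congr rfl fun l _ => ?_
  ring

lemma sum_trace_E (X : Matrix (Fin n) (Fin n) (T ℝ n)) :
    ∑ i, ∑ k, s.H i k * (s.H * s.C i * s.H * X * s.H * s.C k).trace = (s.Q * s.H * X * s.H).trace := by
  rw [Q_eq, Finset.sum_comm]
  simp only [Finset.sum_mul, trace_sum, smul_mul_assoc, trace_smul, smul_eq_mul, mul_assoc]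
  refine Finset.sum_congr rfl fun k _ => Finset.sum_congr rfl fun l _ => ?_
  rw [s.Hsymm]
  congr 1
  rw [← mul_assoc s.H, ← mul_assoc (s.H * _), ← mul_assoc (s.H * _ * _), ← mul_assoc (s.H * _ * _ * _),
    trace_mul_comm]
  simp only [mul_assoc]

lemma ip4_E2 : s.ip4 s.E2 s.E2 = s.ip s.Q s.Q := by
  have e : ∀ i k, ∑ j, ∑ l, s.H j l * s.ip (s.E2 i j) (s.E2 k l)
      = (s.H * s.C i * s.H * s.Q * s.H * s.C k).trace := by
    intro i k
    simp only [Q_eq, Finset.sum_mul, Finset.mul_sum, trace_sum, smul_mul_assoc, mul_smul_comm,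
      trace_smul, smul_eq_mul, ip_apply, E2, transpose_mul, Ht, Ct, mul_assoc]
  rw [ip4_apply]
  simp only [e]
  rw [sum_trace_E, ip_apply, Qt, mul_assoc s.H, mul_assoc s.H, trace_mul_comm]

lemma ip4_E3 : s.ip4 s.E3 s.E3 = s.ip s.Q s.Q := by
  rw [← ip4_E2, ip4_apply, ip4_apply]
  simp only [Finset.mul_sum]
  rw [sum_comm₄]
  refine Finset.sum_congr rfl fun i _ => Finset.sum_congr rfl fun k _ =>
    Finset.sum_congr rfl fun j _ => Finset.sum_congr rfl fun l _ => ?_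
  rw [mul_left_comm]; rfl

lemma bracket (x) : ev x (s.ip s.Q s.Q) ≤ 2 * ev x (s.ip4 s.Z (s.Z - s.E2 - s.E3) +
    s.ip4 (s.Z - s.E1) (s.Z - s.E2 - s.E3 - s.E1) + 2 * s.ip s.Q s.Q) := by
  have h1 := s.ip4_psd.nonneg x (2 • s.Z - (s.E1 + s.E2 + s.E3))
  have h2 := s.ip4_psd.two_mul_le x s.E2 s.E3
  have e1 := s.ip4_psd.symm s.E1 s.E2
  have e2 := s.ip4_psd.symm s.E1 s.E3
  have e3 := s.ip4_psd.symm s.E2 s.E3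
  have e4 := s.ip4_psd.symm s.E1 s.Z
  have e5 := s.ip4_psd.symm s.E2 s.Z
  have e6 := s.ip4_psd.symm s.E3 s.Z
  simp only [map_sub, map_add, LinearMap.sub_apply, LinearMap.add_apply, two_smul, ip4_E1, ip4_E2,
    ip4_E3, e1, e2, e3, e4, e5, e6, map_mul, map_ofNat] at h1 h2 ⊢
  linarith

end Pot

end Abreu

namespace Abreu
open Set Filter Topology
open scoped ContDiff

variable {n : ℕ}

section RealMatrix
variable {M : Matrix (Fin n) (Fin n) ℝ}

lemma diag_le_trace (h : M.PosSemidef) (i) : M i i ≤ M.trace :=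
  Finset.single_le_sum (f := fun i => M i i) (fun _ _ => h.diag_nonneg) (Finset.mem_univ i)

lemma abs_le_trace (h : M.PosSemidef) (i j) : |M i j| ≤ M.trace := by
  obtain ⟨m, B, hB⟩ := exists_frame h
  have h1 : |M i j| ≤ (M i i + M j j) / 2 := by
    simp only [hB, ← Finset.sum_add_distrib, Finset.sum_div]
    refine (Finset.abs_sum_le_sum_abs _ _).trans (Finset.sum_le_sum fun a _ => ?_)
    rw [abs_le]; constructor <;> nlinarith [sq_nonneg (B a i - B a j), sq_nonneg (B a i + B a j)]
  linarith [diag_le_trace h i, diag_le_trace h j]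

lemma quad_eq_frame {m : ℕ} {B : Fin m → Fin n → ℝ} (hB : ∀ i j, M i j = ∑ a, B a i * B a j)
    (v : Fin n → ℝ) : ∑ i, ∑ j, M i j * v i * v j = ∑ a, (∑ i, B a i * v i) ^ 2 := by
  simp only [hB, sq, Finset.sum_mul, Finset.mul_sum]
  rw [Finset.sum_congr rfl fun i _ => Finset.sum_comm, Finset.sum_comm]
  exact Finset.sum_congr rfl fun a _ => Finset.sum_congr rfl fun i _ =>
    Finset.sum_congr rfl fun j _ => by ring

lemma quad_le (h : M.PosSemidef) (v : Fin n → ℝ) :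
    ∑ i, ∑ j, M i j * v i * v j ≤ M.trace * ∑ i, v i ^ 2 := by
  obtain ⟨m, B, hB⟩ := exists_frame h
  have e : M.trace = ∑ a, ∑ i, B a i ^ 2 := by
    simp only [trace, diag_apply, hB, sq]; exact Finset.sum_comm
  rw [quad_eq_frame hB, e, Finset.sum_mul]
  exact Finset.sum_le_sum fun a _ => Finset.sum_mul_sq_le_sq_mul_sq _ _ _

lemma sum_sq_le (h : M.PosSemidef) (v : Fin n → ℝ) :
    ∑ k, (∑ a, M k a * v a) ^ 2 ≤ M.trace * ∑ i, ∑ j, M i j * v i * v j := by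
  obtain ⟨m, B, hB⟩ := exists_frame h
  have e : M.trace = ∑ i, ∑ a, B a i ^ 2 := by
    simp only [trace, diag_apply, hB, sq]
  rw [quad_eq_frame hB, e, Finset.sum_mul]
  refine Finset.sum_le_sum fun k _ => ?_
  have e2 : ∑ a, M k a * v a = ∑ b, B b k * ∑ i, B b i * v i := by
    simp only [hB, Finset.sum_mul, Finset.mul_sum]
    rw [Finset.sum_comm]
    exact Finset.sum_congr rfl fun a _ => Finset.sum_congr rfl fun i _ => by ring
  rw [e2]
  exact Finset.sum_mul_sq_le_sq_mul_sq _ _ _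

lemma det_le_trace (h : M.PosSemidef) : M.det ≤ n.factorial * M.trace ^ n := by
  have := Matrix.det_le (A := M) (abv := AbsoluteValue.abs) (x := M.trace) (fun i j => abs_le_trace h i j)
  simp only [Fintype.card_fin, nsmul_eq_mul] at this
  exact (le_abs_self _).trans this

lemma trace_inv_le (h : M.PosDef) :
    (M⁻¹).trace ≤ n * (n.factorial * (1 + M.trace) ^ n) * (M.det)⁻¹ := by
  have ht : 0 ≤ M.trace := h.posSemidef.trace_nonneg
  have h1 : ∀ i, (M⁻¹) i i ≤ (n.factorial * (1 + M.trace) ^ n) * (M.det)⁻¹ := by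
    intro i
    rw [inv_def, Matrix.smul_apply, Ring.inverse_eq_inv', smul_eq_mul, mul_comm]
    refine mul_le_mul_of_nonneg_right ?_ (inv_nonneg.mpr h.det_pos.le)
    rw [adjugate_apply]
    have := Matrix.det_le (A := M.updateRow i (Pi.single i 1)) (abv := AbsoluteValue.abs)
      (x := 1 + M.trace) (fun a b => ?_)
    · simp only [Fintype.card_fin, nsmul_eq_mul] at this
      exact (le_abs_self _).trans this
    · rw [updateRow_apply]
      simp only [AbsoluteValue.abs_apply]
      split_ifs
      · by_cases hb : b = i
        · simp [hb, ht]
        · simp [hb]; linarith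
      · linarith [abs_le_trace h.posSemidef a b]
  calc (M⁻¹).trace ≤ ∑ _i : Fin n, (n.factorial * (1 + M.trace) ^ n) * (M.det)⁻¹ :=
        Finset.sum_le_sum fun i _ => h1 i
    _ = _ := by simp; ring

end RealMatrix

/-- Uniform boundedness of a family. -/
def Bdd {σ : Type*} (f : σ → T ℝ n) : Prop := ∃ C : ℝ, ∀ s x, |ev x (f s)| ≤ C

namespace Pot
variable (s : Pot n)

/-- Trace of the inverse Hessian. -/
noncomputable def P : T ℝ n := s.G.trace
/-- Trace of the Hessian. -/
noncomputable def Tr : T ℝ n := s.H.trace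

lemma ev_P (x) : ev x s.P = (s.G.map (ev x)).trace := by simp [P, trace]
lemma ev_Tr (x) : ev x s.Tr = (s.H.map (ev x)).trace := by simp [Tr, trace]
lemma P_nonneg (x) : 0 ≤ ev x s.P := by rw [ev_P]; exact (s.posG x).posSemidef.trace_nonneg
lemma Tr_nonneg (x) : 0 ≤ ev x s.Tr := by rw [ev_Tr]; exact (s.posH x).posSemidef.trace_nonneg
lemma abs_H_le (x i j) : |ev x (s.H i j)| ≤ ev x s.Tr := by
  rw [ev_Tr]; exact abs_le_trace (s.posH x).posSemidef i j
lemma abs_G_le (x i j) : |ev x (s.G i j)| ≤ ev x s.P := by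
  rw [ev_P]; exact abs_le_trace (s.posG x).posSemidef i j

lemma exp_F (x) : Real.exp (ev x s.F) = ((s.H.map (ev x)).det)⁻¹ := by
  rw [F, map_neg, ev_logT, Real.exp_neg, Real.exp_log (s.detH_pos x), ev_det]
lemma exp_neg_F (x) : Real.exp (-ev x s.F) = (s.H.map (ev x)).det := by
  rw [Real.exp_neg, exp_F, inv_inv]
lemma det_G (x) : (s.G.map (ev x)).det = Real.exp (ev x s.F) := by
  rw [ev_inv, det_nonsing_inv, Ring.inverse_eq_inv', exp_F]

lemma P_le (x) : ev x s.P ≤ n * (n.factorial * (1 + ev x s.Tr) ^ n) * Real.exp (ev x s.F) := by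
  rw [ev_P, ev_inv, exp_F, ev_Tr]; exact trace_inv_le (s.posH x)
lemma Tr_le (x) : ev x s.Tr ≤ n * (n.factorial * (1 + ev x s.P) ^ n) * Real.exp (-ev x s.F) := by
  have := trace_inv_le (s.posG x)
  rw [det_G, ev_inv, Matrix.nonsing_inv_nonsing_inv _ (s.posH x).det_pos.ne'.isUnit, ← Real.exp_neg,
    ← ev_inv, ← ev_P, ← ev_Tr] at this
  exact this

lemma exp_neg_F_le (x) : Real.exp (-ev x s.F) ≤ n.factorial * ev x s.Tr ^ n := by
  rw [exp_neg_F, ev_Tr]; exact det_le_trace (s.posH x).posSemidef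
lemma exp_F_le (x) : Real.exp (ev x s.F) ≤ n.factorial * ev x s.P ^ n := by
  rw [← det_G, ev_P]; exact det_le_trace (s.posG x).posSemidef

lemma ev_Γ (x f g) : ev x (s.Γ f g) = ∑ k, ∑ l, ev x (s.G k l) * ev x (dx k f) * ev x (dx l g) := by
  simp only [Γ_eqG, map_sum, map_mul]

lemma Γ_le (x f) : ev x (s.Γ f f) ≤ ev x s.P * ∑ k, ev x (dx k f) ^ 2 := by
  rw [ev_Γ, ev_P]
  exact quad_le (s.posG x).posSemidef fun k => ev x (dx k f)

lemma sum_D_sq_le (x f) : ∑ k, ev x (s.D k f) ^ 2 ≤ ev x s.P * ev x (s.Γ f f) := by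
  rw [ev_Γ, ev_P]
  simp only [D_apply, map_sum, map_mul]
  exact sum_sq_le (s.posG x).posSemidef fun k => ev x (dx k f)

lemma Γ_psd : IsPSD (LinearMap.mk₂ ℝ s.Γ s.Γ_add_left s.Γ_smul_left
    (fun a b c => by rw [s.Γ_comm, s.Γ_add_left, s.Γ_comm b, s.Γ_comm c])
    (fun a b c => by rw [s.Γ_comm, s.Γ_smul_left, s.Γ_comm c])) where
  symm f g := s.Γ_comm f g
  nonneg x f := by
    obtain ⟨m, B, hB⟩ := s.frameG x
    change 0 ≤ ev x (s.Γ f f)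
    rw [ev_Γ]
    have := quad_eq_frame (M := s.G.map (ev x)) hB (fun k => ev x (dx k f))
    simp only [map_apply] at this
    rw [this]
    positivity

lemma Γ_nonneg (x f) : 0 ≤ ev x (s.Γ f f) := s.Γ_psd.nonneg x f
lemma Γ_cs (x f g) : ev x (s.Γ f g) ^ 2 ≤ ev x (s.Γ f f) * ev x (s.Γ g g) := s.Γ_psd.cs x f g

lemma Δ_nonpos_of_max {f : T ℝ n} {x} (h : ∀ y, ev y f ≤ ev x f) : ev x (s.Δ f) ≤ 0 := by
  obtain ⟨m, B, hB⟩ := s.frameG x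
  rw [Δ_eqG]
  simp only [map_add, map_sum, map_mul, dx_eq_zero_of_max h, mul_zero, Finset.sum_const_zero, add_zero,
    hB, Finset.sum_mul]
  rw [Finset.sum_congr rfl fun i _ => Finset.sum_comm, Finset.sum_comm]
  exact Finset.sum_nonpos fun a _ => hess_nonpos_of_max h (B a)

/-- The Legendre-type companion potential. -/
noncomputable def Θ : T ℝ n := s.φ + (1 / 2 : ℝ) • ∑ i, dx i s.φ ^ 2

lemma H_eq (i j) : s.H i j = (if i = j then 1 else 0) + dx i (dx j s.φ) := s.H_apply i j

lemma D_dx_φ (k i) : s.D k (dx i s.φ) = (if k = i then 1 else 0) - s.G k i := by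
  have : ∀ a, dx a (dx i s.φ) = s.H a i - if a = i then 1 else 0 := fun a => by rw [H_eq]; ring
  simp only [D_apply, this, mul_sub, Finset.sum_sub_distrib, GH_sum]
  simp

lemma D_Θ (k) : s.D k s.Θ = dx k s.φ := by
  have h : s.D k (∑ i, dx i s.φ ^ 2) = (2 : ℝ) • (dx k s.φ - s.D k s.φ) := by
    simp only [map_sum, sq, s.D_mul, D_dx_φ, two_smul, mul_sub, sub_mul, Finset.sum_add_distrib,
      Finset.sum_sub_distrib]
    simp [D_apply, mul_comm]
  rw [Θ, map_add, Derivation.map_smul, h, smul_smul]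
  norm_num

lemma Δ_Θ : s.Δ s.Θ = s.Tr - (n : T ℝ n) := by
  simp only [Δ, D_Θ, Tr, trace, diag_apply, H_eq]
  simp [Finset.sum_add_distrib]

lemma Δ_φ : s.Δ s.φ = (n : T ℝ n) - s.P + s.Γ s.φ s.F := by
  have : ∀ k l, dx k (dx l s.φ) = s.H l k - if k = l then 1 else 0 := fun k l => by
    rw [s.Hsymm, H_eq]; ring
  rw [Δ_eqG, Γ_eq]
  simp only [this, mul_sub, Finset.sum_sub_distrib, GH_sum, P, trace]
  simp [mul_comm]

end Pot

end Abreu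

namespace Abreu
open Set Filter Topology
open scoped ContDiff

variable {n : ℕ}

lemma hasDerivAt_ev_single (f : T ℝ n) (x : Fin n → ℝ) (i : Fin n) (t : ℝ) :
    HasDerivAt (fun t : ℝ => ev (x + t • Pi.single i (1 : ℝ)) f)
      (ev (x + t • Pi.single i (1 : ℝ)) (dx i f)) t := by
  refine (hasDerivAt_ev f x (Pi.single i 1) t).congr_deriv ?_
  rw [Finset.sum_eq_single i]
  · simp
  · intro b _ hb; simp [hb]
  · simp

lemma ev_add_single (f : T ℝ n) (x : Fin n → ℝ) (i : Fin n) :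
    ev (x + (1 : ℝ) • Pi.single i (1 : ℝ)) f = ev x f := by
  convert ev_per f x (Pi.single i 1) using 4
  ext j
  by_cases h : j = i
  · subst h; simp
  · simp [h]

/-- A periodic function with gradient bounded by one oscillates by at most `n`. -/
lemma abs_sub_le_of_grad {f : T ℝ n} (h : ∀ x i, |ev x (dx i f)| ≤ 1) (x y : Fin n → ℝ) :
    |ev y f - ev x f| ≤ n := by
  obtain ⟨v, hv, k, hk⟩ := exists_cube (y - x)
  have e : ev y f = ev (x + v) f := by
    have := ev_per f (x + v) k
    rwa [add_assoc, ← hk, add_sub_cancel] at this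
  rw [e]
  have hb : ∀ t ∈ Ico (0 : ℝ) 1, ‖∑ i, (v i : ℝ) * ev (x + t • v) (dk ℝ i f)‖ ≤ n := by
    intro t _
    refine (norm_sum_le _ _).trans ?_
    calc _ ≤ ∑ _i : Fin n, (1 : ℝ) := Finset.sum_le_sum fun i _ => ?_
      _ = n := by simp
    rw [norm_mul, Real.norm_eq_abs, Real.norm_eq_abs, abs_of_nonneg (hv.1 i)]
    exact mul_le_one₀ (hv.2 i) (abs_nonneg _) (h _ i)
  have := norm_image_sub_le_of_norm_deriv_le_segment_01'
    (f := fun t : ℝ => ev (x + t • v) f)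
    (f' := fun t => ∑ i, (v i : ℝ) * ev (x + t • v) (dk ℝ i f)) (C := n)
    (fun t _ => (hasDerivAt_ev f x v t).hasDerivWithinAt) hb
  simpa using this

lemma abs_le_of_mean {f : T ℝ n} {c : ℝ} (h : ∀ x y, |ev y f - ev x f| ≤ c) (h0 : I f = 0) (x) :
    |ev x f| ≤ c := by
  have := norm_I_le (f := f - algebraMap ℝ _ (ev x f)) (c := c) (fun y => by
    rw [map_sub, ev_algebraMap]; exact h x y)
  rwa [map_sub, I_const, h0, zero_sub, norm_neg] at this

lemma abs_deriv_le_of_monotone {g g' g'' : ℝ → ℝ} (hd : ∀ t, HasDerivAt g (g' t) t)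
    (hd2 : ∀ t, HasDerivAt g' (g'' t) t) (hp : ∀ t, 0 ≤ g'' t + 1) (h0 : g 0 = g 1)
    (h1 : g' 0 = g' 1) : |g' 0| ≤ 1 := by
  have hm : Monotone fun t : ℝ => g' t + t :=
    monotone_of_hasDerivAt_nonneg (fun t => (hd2 t).add (hasDerivAt_id' t)) hp
  obtain ⟨c, hc, hc0⟩ := exists_hasDerivAt_eq_zero one_pos
    (fun t _ => (hd t).continuousAt.continuousWithinAt) h0 fun t _ => hd t
  have h2 := hm hc.1.le
  have h3 := hm hc.2.le
  simp only [hc0] at h2 h3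
  rw [abs_le]; constructor <;> linarith [hc.1, hc.2]

namespace Pot
variable (s : Pot n)

lemma _root_.Abreu.abs_dx_le (f f' : T ℝ n) (i : Fin n) (hf : dx i f = f')
    (hp : ∀ x, 0 ≤ ev x (dx i f') + 1) (x) : |ev x f'| ≤ 1 := by
  have h1 := fun t => hasDerivAt_ev_single f x i t
  have h2 := fun t => hasDerivAt_ev_single f' x i t
  rw [hf] at h1
  have h := abs_deriv_le_of_monotone h1 h2 (fun t => hp _)
    (by rw [ev_add_single, zero_smul, add_zero]) (by rw [ev_add_single, zero_smul, add_zero])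
  rwa [zero_smul, add_zero] at h

lemma abs_grad_le (x) (i : Fin n) : |ev x (dx i s.φ)| ≤ 1 := by
  refine abs_dx_le _ _ i rfl (fun x => ?_) x
  have := (s.posH x).diag_pos (i := i)
  rw [map_apply, H_eq, if_pos rfl, map_add, map_one] at this
  rw [add_comm]; exact this.le

lemma sum_grad_sq_le (x) : ∑ i, ev x (dx i s.φ) ^ 2 ≤ n := by
  calc _ ≤ ∑ _i : Fin n, (1 : ℝ) :=
        Finset.sum_le_sum fun i _ => by rw [sq_le_one_iff_abs_le_one]; exact s.abs_grad_le x i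
    _ = n := by simp

end Pot

/-- Solutions of the continuity path for the right-hand side `A0`. -/
structure Sol (A0 : T ℝ n) extends Pot n where
  t : ℝ
  t0 : 0 ≤ t
  t1 : t ≤ 1
  mean : I φ = 0
  eqn : toPot.A = t • A0

variable {A0 : T ℝ n}

namespace Sol

lemma abs_φ_le (s : Sol A0) (x) : |ev x s.φ| ≤ n :=
  abs_le_of_mean (abs_sub_le_of_grad s.abs_grad_le) s.mean x

lemma abs_Θ_le (s : Sol A0) (x) : |ev x s.Θ| ≤ 2 * n := by
  have h1 := s.abs_φ_le x
  have h2 := s.sum_grad_sq_le x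
  have h3 : 0 ≤ ∑ i, ev x (dx i s.φ) ^ 2 := by positivity
  have e : ev x s.Θ = ev x s.φ + 1 / 2 * ∑ i, ev x (dx i s.φ) ^ 2 := by
    simp only [Pot.Θ, map_add, ev_smul, map_sum, map_pow]
  rw [abs_le] at *
  rw [e]
  constructor <;> linarith [(Nat.cast_nonneg n : (0 : ℝ) ≤ n)]

lemma bdd_dx_A (A0 : T ℝ n) (d : T ℝ n →ₗ[ℝ] T ℝ n) : Bdd fun s : Sol A0 => d s.A := by
  obtain ⟨C, hC⟩ := exists_bound (d A0)
  refine ⟨C, fun s x => ?_⟩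
  dsimp only
  rw [s.eqn, map_smul, ev_smul, abs_mul, abs_of_nonneg s.t0]
  exact (mul_le_of_le_one_left (abs_nonneg _) s.t1).trans (hC x)

lemma bdd_A (A0 : T ℝ n) : Bdd fun s : Sol A0 => s.A := bdd_dx_A A0 LinearMap.id

lemma F_lower (A0 : T ℝ n) : ∃ C : ℝ, ∀ (s : Sol A0) x, -C ≤ ev x s.F := by
  obtain ⟨K, hK⟩ := bdd_A A0
  refine ⟨Real.log (n.factorial * (n + K) ^ n) + 4 * n, fun s x => ?_⟩
  obtain ⟨y, hy⟩ := exists_max (s.Θ - s.F)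
  have h1 := s.Δ_nonpos_of_max hy
  rw [s.Δ_sub, s.Δ_Θ, s.ΔF] at h1
  simp only [map_sub, map_natCast] at h1
  have hT : ev y s.Tr ≤ n + K := by linarith [(abs_le.mp (hK s y)).2]
  have h2 := s.exp_neg_F_le y
  have h3 : Real.exp (-ev y s.F) ≤ n.factorial * (n + K) ^ n :=
    h2.trans (by gcongr; exact s.Tr_nonneg y)
  rw [← Real.le_log_iff_exp_le ((Real.exp_pos _).trans_le h3)] at h3
  have h4 := hy x
  simp only [map_sub] at h4
  linarith [(abs_le.mp (s.abs_Θ_le x)).1, (abs_le.mp (s.abs_Θ_le y)).2]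

lemma F_upper [NeZero n] (A0 : T ℝ n) : ∃ C : ℝ, ∀ (s : Sol A0) x, ev x s.F ≤ C := by
  obtain ⟨K, hK⟩ := bdd_A A0
  have hn : (0 : ℝ) < n := by exact_mod_cast Nat.pos_of_ne_zero (NeZero.ne n)
  refine ⟨Real.log (n.factorial * (2 * n + 4 * n * K) ^ n) + 1, fun s x => ?_⟩
  obtain ⟨y, hy⟩ := exists_max (s.F - (1 / (2 * n) : ℝ) • s.φ)
  have h1 := s.Δ_nonpos_of_max hy
  rw [s.Δ_sub, s.Δ_smul, s.ΔF, s.Δ_φ] at h1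
  have hd := dx_eq_zero_of_max hy
  have hg : ev y (s.Γ s.φ s.F) = 1 / (2 * n) * ev y (s.Γ s.φ s.φ) := by
    simp only [s.Γ_comm s.φ s.F, s.Γ_eq, map_sum, map_mul, Finset.mul_sum]
    refine Finset.sum_congr rfl fun k _ => ?_
    have := hd k
    rw [map_sub, Derivation.map_smul, map_sub, ev_smul] at this
    rw [sub_eq_zero.mp this]; ring
  have hg2 : ev y (s.Γ s.φ s.φ) ≤ ev y s.P * n :=
    (s.Γ_le y s.φ).trans (mul_le_mul_of_nonneg_left (s.sum_grad_sq_le y) (s.P_nonneg y))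
  have hA := (abs_le.mp (hK s y)).1
  rw [map_sub, ev_smul, map_add, map_sub, map_natCast, hg] at h1
  have hP : ev y s.P ≤ 2 * n + 4 * n * K := by
    set P := ev y s.P
    set g := ev y (s.Γ s.φ s.φ)
    set a := ev y s.A
    have e : a - 1 / (2 * n) * (n - P + 1 / (2 * n) * g)
      = (4 * n * a - 2 * n + 2 * P - g / n) / (4 * n) := by field_simp; ring
    rw [e, div_le_iff₀ (by positivity)] at h1
    have : g / n ≤ P := by rw [div_le_iff₀ hn]; exact hg2
    nlinarith
  have h2 := s.exp_F_le y
  have h3 : Real.exp (ev y s.F) ≤ n.factorial * (2 * n + 4 * n * K) ^ n :=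
    h2.trans (by gcongr; exact s.P_nonneg y)
  rw [← Real.le_log_iff_exp_le ((Real.exp_pos _).trans_le h3)] at h3
  have h4 := hy x
  simp only [map_sub, ev_smul] at h4
  have h5 : 1 / (2 * n) * (ev x s.φ - ev y s.φ) ≤ 1 := by
    rw [one_div, inv_mul_le_iff₀ (by positivity)]
    linarith [(abs_le.mp (s.abs_φ_le x)).2, (abs_le.mp (s.abs_φ_le y)).1]
  linarith

lemma bdd_F [NeZero n] (A0 : T ℝ n) : Bdd fun s : Sol A0 => s.F := by
  obtain ⟨C, hC⟩ := F_lower A0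
  obtain ⟨C', hC'⟩ := F_upper A0
  exact ⟨max C C', fun s x => abs_le.mpr ⟨by linarith [hC s x, le_max_left C C'],
    (hC' s x).trans (le_max_right _ _)⟩⟩

end Sol

end Abreu

namespace Abreu
open Set Filter Topology
open scoped ContDiff

variable {n : ℕ}

lemma I_add_le {f g : T ℝ n} {a b : ℝ} (hf : I f ≤ a) (hg : I g ≤ b) : I (f + g) ≤ a + b := by
  rw [map_add]; exact add_le_add hf hg

section LQ
variable {σ : Type*} {f g : σ → T ℝ n}

/-- All moments are bounded uniformly in the family. -/
def LQ (f : σ → T ℝ n) : Prop := ∀ p : ℕ, ∃ C : ℝ, ∀ s, I (f s ^ (2 * p)) ≤ C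

lemma LQ.of_abs_le (hg : LQ g) (h : ∀ s x, |ev x (f s)| ≤ |ev x (g s)|) : LQ f := fun p =>
  (hg p).imp fun _ hC s => (I_mono fun x => by
    rw [map_pow, map_pow, ← (even_two_mul p).pow_abs, ← (even_two_mul p).pow_abs (ev x (g s))]
    exact pow_le_pow_left₀ (abs_nonneg _) (h s x) _).trans (hC s)

lemma LQ.const (c : T ℝ n) : LQ fun _ : σ => c := fun p => ⟨I (c ^ (2 * p)), fun _ => le_rfl⟩

lemma LQ.add (hf : LQ f) (hg : LQ g) : LQ fun s => f s + g s := fun p => by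
  obtain ⟨A, hA⟩ := hf p
  obtain ⟨B, hB⟩ := hg p
  refine ⟨2 ^ (2 * p - 1) * (A + B), fun s => (I_mono (g := (2 ^ (2 * p - 1) : ℝ) •
    (f s ^ (2 * p) + g s ^ (2 * p))) fun x => ?_).trans ?_⟩
  · rw [map_pow, map_add, ev_smul, map_add, map_pow, map_pow]
    exact (even_two_mul p).add_pow_le
  · rw [map_smul, smul_eq_mul]
    exact mul_le_mul_of_nonneg_left (I_add_le (hA s) (hB s)) (by positivity)

lemma LQ.mul (hf : LQ f) (hg : LQ g) : LQ fun s => f s * g s := fun p => by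
  obtain ⟨A, hA⟩ := hf (2 * p)
  obtain ⟨B, hB⟩ := hg (2 * p)
  refine ⟨A + B, fun s => (I_mono fun x => ?_).trans (I_add_le (hA s) (hB s))⟩
  simp only [map_pow, map_mul, map_add, mul_pow]
  rw [show 2 * (2 * p) = 2 * p * 2 by ring, pow_mul _ (2 * p), pow_mul _ (2 * p)]
  nlinarith [sq_nonneg (ev x (f s) ^ (2 * p) - ev x (g s) ^ (2 * p)), sq_nonneg (ev x (f s) ^ (2 * p)),
    sq_nonneg (ev x (g s) ^ (2 * p))]

lemma LQ.smul (hf : LQ f) (c : ℝ) : LQ fun s => c • f s := by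
  simpa only [Algebra.smul_def] using (LQ.const (σ := σ) (algebraMap ℝ (T ℝ n) c)).mul hf
lemma LQ.pow (hf : LQ f) (k : ℕ) : LQ fun s => f s ^ k := by
  induction k with
  | zero => simpa using LQ.const (σ := σ) (1 : T ℝ n)
  | succ k ih => simpa only [pow_succ] using ih.mul hf
lemma LQ.sum {ι : Type*} (t : Finset ι) {f : ι → σ → T ℝ n} (h : ∀ i, LQ (f i)) :
    LQ fun s => ∑ i ∈ t, f i s := by
  classical
  induction t using Finset.induction_on with
  | empty => simpa using LQ.const (σ := σ) (0 : T ℝ n)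
  | insert a t ha ih => simpa only [Finset.sum_insert ha] using (h a).add ih

lemma LQ.moment (hf : LQ f) (p : ℕ) : ∃ C : ℝ, ∀ s, |I (f s ^ p)| ≤ C := by
  obtain ⟨A, hA⟩ := hf p
  refine ⟨1 + A, fun s => ?_⟩
  have h1 : ∀ x, 0 ≤ ev x (1 + f s ^ (2 * p) - f s ^ p) := fun x => by
    simp only [map_sub, map_add, map_pow, map_one]
    rw [mul_comm, pow_mul]
    nlinarith [sq_nonneg (ev x (f s) ^ p - 1), sq_nonneg (ev x (f s) ^ p)]
  have h2 : ∀ x, 0 ≤ ev x (1 + f s ^ (2 * p) + f s ^ p) := fun x => by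
    simp only [map_add, map_pow, map_one]
    rw [mul_comm, pow_mul]
    nlinarith [sq_nonneg (ev x (f s) ^ p + 1), sq_nonneg (ev x (f s) ^ p)]
  have h3 := I_nonneg h1
  have h4 := I_nonneg h2
  simp only [map_add, map_sub, I_one] at h3 h4
  rw [abs_le]
  constructor <;> linarith [hA s]

end LQ

namespace Pot
variable (s : Pot n)

lemma Q_trace_add_nonneg (h : T ℝ n) (x) :
    0 ≤ ev x (s.Q.trace + (2 : ℝ) • s.Γ h s.P + s.P * s.Γ h h) := by
  let U : Fin n → Matrix (Fin n) (Fin n) (T ℝ n) := fun k => Matrix.of fun i j =>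
    if j = k then s.D i h else 0
  have h1 : ∀ k, s.ip (s.C k) (s.C k) = s.Q k k := fun k => by
    rw [s.ip_apply, s.Ct, s.Q_apply]
  have hU : ∀ k (M : Matrix (Fin n) (Fin n) (T ℝ n)), (M * (U k)ᵀ).trace = ∑ i, M i k * s.D i h :=
    fun k M => by
      rw [← sum_mul_eq_trace]
      refine Finset.sum_congr rfl fun i _ => ?_
      simp [U]
  have h2 : ∀ k (M : Matrix (Fin n) (Fin n) (T ℝ n)), s.ip M (U k * s.G)
      = ∑ i, (s.H * M) i k * s.D i h := fun k M => by
    rw [s.ip_apply, transpose_mul, s.Gt, Matrix.mul_assoc, ← Matrix.mul_assoc s.H s.G, s.HG,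
      Matrix.one_mul, hU]
  have h3 : ∑ k, s.ip (s.C k) (U k * s.G) = s.Γ h s.P := by
    simp only [h2, mul_apply, Γ, P, trace, diag_apply, map_sum, Finset.mul_sum, Finset.sum_mul]
    rw [Finset.sum_comm]
    refine Finset.sum_congr rfl fun i _ => ?_
    rw [Finset.sum_comm]
    refine Finset.sum_congr rfl fun j _ => Finset.sum_congr rfl fun k _ => ?_
    rw [s.C_swap k j k, s.C_apply]; ring
  have h4 : ∑ k, s.ip (U k * s.G) (U k * s.G) = s.P * s.Γ h h := by
    have e : ∀ k i j, (U k * s.G) i j = s.D i h * s.G k j := fun k i j => by simp [U, mul_apply]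
    have e2 : ∀ k i, (s.H * (U k * s.G)) i k = ∑ j, s.H i j * (s.D j h * s.G k k) := fun k i => by
      rw [mul_apply]; simp only [e]
    simp only [h2, e2, Γ, P, trace, diag_apply, Finset.mul_sum, Finset.sum_mul]
    rw [Finset.sum_congr rfl fun k _ => Finset.sum_comm]
    rw [Finset.sum_comm, Finset.sum_congr rfl fun i _ => Finset.sum_comm]
    rw [Finset.sum_comm]
    refine Finset.sum_congr rfl fun i _ => Finset.sum_congr rfl fun j _ => Finset.sum_congr rfl fun k _ => ?_
    ring
  have e : s.Q.trace + (2 : ℝ) • s.Γ h s.P + s.P * s.Γ h h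
      = ∑ k, s.ip (s.C k + U k * s.G) (s.C k + U k * s.G) := by
    simp only [s.ip_psd.add_self, Finset.sum_add_distrib, h4, ← Finset.mul_sum, h3, h1, trace, diag_apply,
      Algebra.smul_def, show algebraMap ℝ (T ℝ n) 2 = 2 from map_ofNat _ 2]
  rw [e, map_sum]
  exact Finset.sum_nonneg fun k _ => s.ip_psd.nonneg x _

lemma Δ_P : s.Δ s.P = ∑ k, s.D k (s.D k s.F) + s.Q.trace := by
  have := congrArg trace s.Δ_G
  rw [trace_add] at this
  simp only [trace, diag_apply, map_apply, hD_apply] at this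
  rw [P, trace, s.Δ_sum]
  exact this

lemma Δ_expT_mul_P (h : T ℝ n) (x) :
    ev x (expT h * (∑ k, s.D k (s.D k s.F) + s.P * s.Δ h)) ≤ ev x (s.Δ (expT h * s.P)) := by
  have h1 := mul_nonneg (Real.exp_pos (ev x h)).le (s.Q_trace_add_nonneg h x)
  rw [← ev_expT, ← map_mul] at h1
  have e : s.Δ (expT h * s.P) - expT h * (∑ k, s.D k (s.D k s.F) + s.P * s.Δ h)
      = expT h * (s.Q.trace + (2 : ℝ) • s.Γ h s.P + s.P * s.Γ h h) := by
    rw [s.Δ_mul, s.Δ_expT, s.Γ_expT_left, Δ_P]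
    simp only [Algebra.smul_def]
    ring
  rwa [← sub_nonneg, ← map_sub, e]

end Pot

end Abreu

namespace Abreu
open Set Filter Topology
open scoped ContDiff

variable {n : ℕ}

lemma I_smul (c : ℝ) (f : T ℝ n) : I (c • f) = c * I f := by rw [map_smul, smul_eq_mul]

lemma pow_eq_mul_dx (d : Derivation ℝ (T ℝ n) (T ℝ n)) (f : T ℝ n) (m : ℕ) :
    d (f ^ (m + 1)) = (m + 1 : ℝ) • (f ^ m * d f) := by
  rw [Derivation.leibniz_pow, ← Nat.cast_smul_eq_nsmul ℝ]
  push_cast; rfl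

namespace Pot
variable (s : Pot n)

lemma I_pow_mul_Δ (v : T ℝ n) (m : ℕ) :
    I (v ^ (m + 1) * s.Δ v) = -(m + 1) * I (v ^ m * s.Γ v v) := by
  rw [I_Δ, Γ_pow_left, map_smul, smul_eq_mul, neg_mul]

/-- Pointwise estimate behind the moment bound for the trace of the inverse Hessian. -/
lemma moment_aux {ι : Type*} [Fintype ι] (X Y Z : ι → ℝ) {v e p g N α : ℝ} {m : ℕ} (hv : v = e * p)
    (he : 0 ≤ e) (hp : 0 ≤ p) (hg : 0 ≤ g) (hY : ∑ k, Y k ^ 2 ≤ p * g) (hZ : ∑ k, Z k ^ 2 ≤ N)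
    (hα : α = (m + 1) / 4 + 2) :
    -(α ^ 2 * N / 4) * (v ^ (m + 1) * e) ≤ (m + 1) * (v ^ m * g)
      + ∑ k, (-(X k * ((m + 1) * (v ^ m * Y k) * e + v ^ (m + 1) * (e * (-α * X k + α * Z k))))
        - v ^ (m + 1) * e * X k * X k) := by
  have hv0 : 0 ≤ v := by rw [hv]; positivity
  have hX0 : 0 ≤ ∑ k, X k ^ 2 := by positivity
  have hcs := Finset.sum_mul_sq_le_sq_mul_sq Finset.univ X Y
  have h1 : e * ∑ k, X k * Y k ≤ g + e * v / 4 * ∑ k, X k ^ 2 := by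
    refine (abs_le_of_sq_le_sq' ?_ (by positivity)).2
    rw [hv]
    nlinarith [mul_le_mul_of_nonneg_left (hcs.trans (mul_le_mul_of_nonneg_left hY hX0)) (sq_nonneg e),
      sq_nonneg (g - e * (e * p) / 4 * ∑ k, X k ^ 2)]
  have h2 : α * ∑ k, X k * Z k ≤ ∑ k, X k ^ 2 + α ^ 2 / 4 * N := by
    have : ∑ k, (X k - α / 2 * Z k) ^ 2 = ∑ k, X k ^ 2 - α * ∑ k, X k * Z k + α ^ 2 / 4 * ∑ k, Z k ^ 2 := by
      simp only [Finset.mul_sum, ← Finset.sum_add_distrib, ← Finset.sum_sub_distrib]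
      exact Finset.sum_congr rfl fun k _ => by ring
    have h0 : 0 ≤ ∑ k, (X k - α / 2 * Z k) ^ 2 := by positivity
    nlinarith [mul_le_mul_of_nonneg_left hZ (by positivity : 0 ≤ α ^ 2 / 4)]
  have e1 : ∑ k, (-(X k * ((m + 1) * (v ^ m * Y k) * e + v ^ (m + 1) * (e * (-α * X k + α * Z k))))
        - v ^ (m + 1) * e * X k * X k) = -((m + 1) * v ^ m * (e * ∑ k, X k * Y k))
        + v ^ (m + 1) * e * ((α - 1) * ∑ k, X k ^ 2 - α * ∑ k, X k * Z k) := by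
    simp only [Finset.mul_sum, ← Finset.sum_sub_distrib, ← Finset.sum_neg_distrib,
      ← Finset.sum_add_distrib]
    exact Finset.sum_congr rfl fun k _ => by ring
  rw [e1]
  have h3 := mul_le_mul_of_nonneg_left h1 (by positivity : 0 ≤ (m + 1) * v ^ m)
  have h4 := mul_le_mul_of_nonneg_left h2 (by positivity : 0 ≤ v ^ (m + 1) * e)
  have e2 : (m + 1) * v ^ m * (e * v / 4 * ∑ k, X k ^ 2) = v ^ (m + 1) * e * ((m + 1) / 4 * ∑ k, X k ^ 2) := by
    ring
  have e3 : v ^ (m + 1) * e * ((α - 1) * ∑ k, X k ^ 2) =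
    v ^ (m + 1) * e * ((m + 1) / 4 * ∑ k, X k ^ 2) + v ^ (m + 1) * e * ∑ k, X k ^ 2 := by rw [hα]; ring
  nlinarith

lemma moment_ineq {m : ℕ} {α : ℝ} (hα : α = (m + 1) / 4 + 2) (v e h : T ℝ n)
    (hh : h = (-α) • (s.F - s.Θ)) (he : e = expT h) (hv : v = e * s.P) :
    α * I (v ^ (m + 2) * (s.Tr - (n : T ℝ n) - s.A)) ≤ α ^ 2 * n / 4 * I (v ^ (m + 1) * e) := by
  have hΔh : s.Δ h = α • (s.Tr - (n : T ℝ n) - s.A) := by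
    rw [hh, Δ_smul, Δ_sub, ΔF, Δ_Θ, neg_smul, ← smul_neg]; congr 1; ring
  have hDh : ∀ k, s.D k h = (-α) • s.D k s.F + α • dx k s.φ := fun k => by
    rw [hh, Derivation.map_smul, map_sub, D_Θ, smul_sub, neg_smul, neg_smul, sub_neg_eq_add]
  have hDe : ∀ k, s.D k e = e * s.D k h := fun k => by rw [he, D_expT]
  have he0 : ∀ x, 0 ≤ ev x e := fun x => by rw [he, ev_expT]; positivity
  have hv0 : ∀ x, 0 ≤ ev x v := fun x => by
    rw [hv, map_mul]; exact mul_nonneg (he0 x) (s.P_nonneg x)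
  have h1 : I (v ^ (m + 1) * (e * (∑ k, s.D k (s.D k s.F) + s.P * s.Δ h)))
      ≤ -(m + 1) * I (v ^ m * s.Γ v v) := by
    rw [← I_pow_mul_Δ]
    refine I_mono fun x => ?_
    rw [map_mul, map_mul _ _ (s.Δ v), hv, he]
    refine mul_le_mul_of_nonneg_left (s.Δ_expT_mul_P h x) ?_
    rw [← he, ← hv, map_pow]
    exact pow_nonneg (hv0 x) _
  have h2 : I (v ^ (m + 1) * (e * (∑ k, s.D k (s.D k s.F) + s.P * s.Δ h)))
      = I (∑ k, (-(s.D k s.F * s.D k (v ^ (m + 1) * e)) - v ^ (m + 1) * e * s.D k s.F * s.D k s.F))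
        + α * I (v ^ (m + 2) * (s.Tr - (n : T ℝ n) - s.A)) := by
    have e1 : v ^ (m + 1) * (e * (∑ k, s.D k (s.D k s.F) + s.P * s.Δ h))
        = ∑ k, v ^ (m + 1) * e * s.D k (s.D k s.F)
          + α • (v ^ (m + 2) * (s.Tr - (n : T ℝ n) - s.A)) := by
      have e2 : v ^ (m + 2) = v ^ (m + 1) * (e * s.P) := (pow_succ v (m + 1)).trans (by rw [← hv])
      rw [hΔh, ← Finset.mul_sum, e2, ← mul_smul_comm]
      ring
    rw [e1, map_add, map_smul, smul_eq_mul, map_sum, map_sum]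
    congr 1
    refine Finset.sum_congr rfl fun k _ => ?_
    rw [I_D, map_sub, map_neg]
  have h3 : I ((-(α ^ 2 * n / 4)) • (v ^ (m + 1) * e)) ≤ I ((m + 1 : ℝ) • (v ^ m * s.Γ v v)
      + ∑ k, (-(s.D k s.F * s.D k (v ^ (m + 1) * e)) - v ^ (m + 1) * e * s.D k s.F * s.D k s.F)) := by
    refine I_mono fun x => ?_
    have := moment_aux (fun k => ev x (s.D k s.F)) (fun k => ev x (s.D k v)) (fun k => ev x (dx k s.φ))
      (v := ev x v) (e := ev x e) (p := ev x s.P) (g := ev x (s.Γ v v)) (by rw [hv, map_mul]) (he0 x)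
      (s.P_nonneg x) (s.Γ_nonneg x v) (s.sum_D_sq_le x v) (s.sum_grad_sq_le x) hα
    simp only [D_mul, pow_eq_mul_dx, hDe, hDh, map_add, map_sum, map_sub, map_neg, map_mul, ev_smul, map_pow]
    exact this
  simp only [map_add, map_smul, smul_eq_mul] at h3
  linarith

end Pot

variable {A0 : T ℝ n}

namespace Sol

lemma exists_P_ge [NeZero n] (A0 : T ℝ n) : ∃ c : ℝ, 0 < c ∧ ∀ (s : Sol A0) x, c ≤ ev x s.P := by
  obtain ⟨C, hC⟩ := bdd_F A0
  refine ⟨min 1 (Real.exp (-C) / n.factorial), by positivity, fun s x => ?_⟩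
  rcases le_or_gt 1 (ev x s.P) with h | h
  · exact (min_le_left _ _).trans h
  · refine (min_le_right _ _).trans ?_
    rw [div_le_iff₀ (by positivity), mul_comm]
    calc Real.exp (-C) ≤ Real.exp (ev x s.F) := Real.exp_le_exp.mpr (abs_le.mp (hC s x)).1
      _ ≤ _ := s.exp_F_le x
      _ ≤ n.factorial * ev x s.P := by
        gcongr
        exact pow_le_of_le_one (s.P_nonneg x) h.le (NeZero.ne n)

lemma moment_P [NeZero n] (A0 : T ℝ n) (m : ℕ) : ∃ C : ℝ, ∀ s : Sol A0, I (s.P ^ (m + 2)) ≤ C := by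
  obtain ⟨CF, hF⟩ := bdd_F A0
  obtain ⟨K, hK⟩ := bdd_A A0
  obtain ⟨c, hc, hP⟩ := exists_P_ge A0
  have hn : (0 : ℝ) < n := by exact_mod_cast Nat.pos_of_ne_zero (NeZero.ne n)
  obtain ⟨α, hα⟩ : ∃ α : ℝ, α = (m + 1) / 4 + 2 := ⟨_, rfl⟩
  have hα0 : 0 < α := by rw [hα]; positivity
  set B := CF + 2 * n with hB
  obtain ⟨C1, hC1⟩ : ∃ C1 : ℝ, C1 = n + |K| + α * n / (4 * c) := ⟨_, rfl⟩
  have hC10 : 0 < C1 := by rw [hC1]; positivity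
  set V := Real.exp (α * B) * (n * (n.factorial * (1 + 2 * C1) ^ n) * Real.exp CF) with hV
  refine ⟨(Real.exp (-(α * B)) ^ (m + 2))⁻¹ * (2 * V ^ (m + 2)), fun s => ?_⟩
  obtain ⟨h, hh⟩ : ∃ h, h = (-α) • (s.F - s.Θ) := ⟨_, rfl⟩
  obtain ⟨e, he⟩ : ∃ e, e = expT h := ⟨_, rfl⟩
  obtain ⟨v, hv⟩ : ∃ v, v = e * s.P := ⟨_, rfl⟩
  have key := s.moment_ineq hα v e h hh he hv
  have hb : ∀ x, |ev x h| ≤ α * B := fun x => by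
    rw [hh, ev_smul, abs_mul, abs_neg, abs_of_pos hα0, map_sub]
    refine mul_le_mul_of_nonneg_left ((abs_sub _ _).trans ?_) hα0.le
    exact add_le_add (hF s x) (s.abs_Θ_le x)
  have he0 : ∀ x, Real.exp (-(α * B)) ≤ ev x e := fun x => by
    rw [he, ev_expT]; exact Real.exp_le_exp.mpr (abs_le.mp (hb x)).1
  have he1 : ∀ x, ev x e ≤ Real.exp (α * B) := fun x => by
    rw [he, ev_expT]; exact Real.exp_le_exp.mpr (abs_le.mp (hb x)).2
  have hep : ∀ x, 0 < ev x e := fun x => (Real.exp_pos _).trans_le (he0 x)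
  have hv0 : ∀ x, 0 ≤ ev x v := fun x => by
    rw [hv, map_mul]; exact mul_nonneg (hep x).le (s.P_nonneg x)
  have h1 : I (v ^ (m + 1) * e) ≤ c⁻¹ * I (v ^ (m + 2)) := by
    rw [← I_smul]
    refine I_mono fun x => ?_
    rw [ev_smul, pow_succ v (m + 1), map_mul, map_mul, mul_left_comm]
    refine mul_le_mul_of_nonneg_left ?_ (by rw [map_pow]; exact pow_nonneg (hv0 x) _)
    rw [le_inv_mul_iff₀ hc, hv, map_mul, mul_comm]
    exact mul_le_mul_of_nonneg_left (hP s x) (hep x).le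
  have h2 : I (v ^ (m + 2) * s.Tr) ≤ C1 * I (v ^ (m + 2)) := by
    have h3 : I (v ^ (m + 2) * s.Tr - (n + |K|) • v ^ (m + 2))
        ≤ I (v ^ (m + 2) * (s.Tr - (n : T ℝ n) - s.A)) := by
      refine I_mono fun x => ?_
      simp only [map_sub, map_mul, ev_smul, map_natCast]
      have h4 : 0 ≤ ev x (v ^ (m + 2)) := by rw [map_pow]; exact pow_nonneg (hv0 x) _
      nlinarith [(abs_le.mp ((hK s x).trans (le_abs_self K))).2]
    have h4 : α * I (v ^ (m + 2) * (s.Tr - (n : T ℝ n) - s.A))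
        ≤ α * (α * n / (4 * c) * I (v ^ (m + 2))) :=
      key.trans ((mul_le_mul_of_nonneg_left h1 (by positivity)).trans_eq (by field_simp))
    have h5 := le_of_mul_le_mul_left h4 hα0
    rw [map_sub, map_smul, smul_eq_mul] at h3
    rw [hC1]
    linarith
  have h3 : I (v ^ (m + 2)) ≤ I ((2 * C1)⁻¹ • (v ^ (m + 2) * s.Tr) + algebraMap ℝ _ (V ^ (m + 2))) := by
    refine I_mono fun x => ?_
    rw [map_add, ev_smul, map_mul, ev_algebraMap, map_pow]
    have hvx := pow_nonneg (hv0 x) (m + 2)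
    have hV0 : 0 ≤ V := by positivity
    rcases le_or_gt (2 * C1) (ev x s.Tr) with hT | hT
    · have : ev x v ^ (m + 2) ≤ (2 * C1)⁻¹ * (ev x v ^ (m + 2) * ev x s.Tr) := by
        rw [le_inv_mul_iff₀ (by positivity), mul_comm]
        exact mul_le_mul_of_nonneg_left hT hvx
      exact this.trans (le_add_of_nonneg_right (by positivity))
    · refine le_add_of_nonneg_of_le (by have := s.Tr_nonneg x; positivity) (pow_le_pow_left₀ (hv0 x) ?_ _)
      rw [hv, map_mul, hV]
      have hT0 := s.Tr_nonneg x
      have := s.P_nonneg x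
      gcongr
      · exact he1 x
      · refine (s.P_le x).trans ?_
        have := (abs_le.mp (hF s x)).2
        gcongr
  have h4 : I (s.P ^ (m + 2)) ≤ I (((Real.exp (-(α * B))) ^ (m + 2))⁻¹ • v ^ (m + 2)) := by
    refine I_mono fun x => ?_
    rw [ev_smul, le_inv_mul_iff₀ (by positivity), map_pow, map_pow, ← mul_pow, hv, map_mul]
    have := s.P_nonneg x
    gcongr
    exact he0 x
  rw [map_smul, smul_eq_mul] at h4
  refine h4.trans (mul_le_mul_of_nonneg_left ?_ (by positivity))
  rw [map_add, map_smul, I_const, smul_eq_mul] at h3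
  have h5 : (2 * C1)⁻¹ * I (v ^ (m + 2) * s.Tr) ≤ 1 / 2 * I (v ^ (m + 2)) := by
    rw [inv_mul_le_iff₀ (by positivity)]; linarith
  linarith

lemma lq_P [NeZero n] (A0 : T ℝ n) : LQ fun s : Sol A0 => s.P := fun p => by
  rcases p with _ | p
  · exact ⟨1, fun s => by simp [I_one]⟩
  · exact moment_P A0 (2 * p)

lemma lq_Tr [NeZero n] (A0 : T ℝ n) : LQ fun s : Sol A0 => s.Tr := by
  obtain ⟨C, hC⟩ := bdd_F A0
  refine (((LQ.const 1).add (lq_P A0)).pow n |>.smul (n * n.factorial * Real.exp C)).of_abs_le fun s x => ?_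
  have h1 := s.P_nonneg x
  have h2 := (abs_le.mp (hC s x)).1
  rw [abs_of_nonneg (s.Tr_nonneg x), ev_smul, map_pow, map_add, map_one, abs_of_nonneg (by positivity)]
  refine (s.Tr_le x).trans ?_
  calc _ ≤ n * (n.factorial * (1 + ev x s.P) ^ n) * Real.exp C := by gcongr; linarith
    _ = _ := by ring

lemma lq_H [NeZero n] (A0 : T ℝ n) (i j) : LQ fun s : Sol A0 => s.H i j :=
  (lq_Tr A0).of_abs_le fun s x => (s.abs_H_le x i j).trans (le_abs_self _)

end Sol

end Abreu

namespace Abreu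
open Set Filter Topology
open scoped ContDiff

variable {n : ℕ}

lemma abs_two_mul_le {a p q : ℝ} (h : a ^ 2 ≤ p * q) (hp : 0 ≤ p) (hq : 0 ≤ q) (t : ℝ) :
    |2 * t * a| ≤ t ^ 2 * p + q := by
  refine abs_le_of_sq_le_sq ?_ (by positivity)
  nlinarith [mul_le_mul_of_nonneg_left h (sq_nonneg t), sq_nonneg (t ^ 2 * p - q)]

lemma pow_mul_le_add {w r : ℝ} (hw : 0 ≤ w) (hr : 0 ≤ r) (k : ℕ) :
    w ^ k * r ≤ w ^ (k + 1) / 4 + (4 * r) ^ (k + 1) := by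
  rcases le_total (4 * r) w with h | h
  · have : w ^ k * (4 * r) ≤ w ^ k * w := by gcongr
    rw [pow_succ]
    have h2 : 0 ≤ (4 * r) ^ (k + 1) := by positivity
    linarith
  · have : w ^ k * (4 * r) ≤ (4 * r) ^ k * (4 * r) := by gcongr
    rw [pow_succ (4 * r)]
    have h2 : 0 ≤ w ^ (k + 1) := by positivity
    have h3 : 0 ≤ w ^ k * r := by positivity
    linarith

namespace Pot
variable (s : Pot n)

noncomputable def V : T ℝ n := s.Γ s.F s.F
noncomputable def W : T ℝ n := expT ((1 / 2 : ℝ) • s.F) * s.V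
noncomputable def J : T ℝ n := s.ip (s.hD s.F) (s.hD s.F)

lemma V_nonneg (x) : 0 ≤ ev x s.V := s.Γ_nonneg x _
lemma J_nonneg (x) : 0 ≤ ev x s.J := s.ip_psd.nonneg x _
lemma ev_W (x) : ev x s.W = Real.exp (ev x s.F / 2) * ev x s.V := by
  rw [W, map_mul, ev_expT, ev_smul, one_div, inv_mul_eq_div]
lemma W_nonneg (x) : 0 ≤ ev x s.W := by rw [ev_W]; exact mul_nonneg (Real.exp_pos _).le (s.V_nonneg x)

lemma le_Δ_W (x) : Real.exp (ev x s.F / 2) * (ev x s.J + 2 * ev x (s.Γ s.F s.A)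
    + ev x s.A * ev x s.V / 2) ≤ ev x (s.Δ s.W) := by
  have e : (4 : ℝ) • s.Δ s.W = expT ((1 / 2 : ℝ) • s.F) * ((4 : ℝ) • (s.J + (2 : ℝ) • s.Γ s.F s.A)
      + (2 : ℝ) • (s.A * s.V) + s.ip ((2 : ℝ) • s.B s.F + s.gr2 s.F s.F) ((2 : ℝ) • s.B s.F + s.gr2 s.F s.F)) := by
    have hb : s.Δ s.V = s.Γ s.F s.A + s.Γ s.F s.A - quad (s.hD s.F) s.F s.F + s.J
        + s.ip (s.B s.F) (s.B s.F) := by rw [V, s.bochner, s.ΔF, J]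
    have hc : s.Γ s.F s.V = quad (s.B s.F) s.F s.F + quad (s.hD s.F) s.F s.F := s.Γ_Γ _ _ _
    have hd : s.Γ ((1 / 2 : ℝ) • s.F) ((1 / 2 : ℝ) • s.F) = (1 / 4 : ℝ) • s.V := by
      rw [Γ_smul_left, s.Γ_comm, Γ_smul_left, smul_smul, V]; norm_num
    have he : s.ip ((2 : ℝ) • s.B s.F + s.gr2 s.F s.F) ((2 : ℝ) • s.B s.F + s.gr2 s.F s.F)
        = (4 : ℝ) • s.ip (s.B s.F) (s.B s.F) + (4 : ℝ) • quad (s.B s.F) s.F s.F + s.V * s.V := by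
      rw [s.ip_psd.add_self]
      simp only [map_smul, LinearMap.smul_apply, ip_gr2, quad_gr2, smul_smul]
      rw [V]
      simp only [Algebra.smul_def, map_ofNat, show algebraMap ℝ (T ℝ n) (2 * 2) = 4 by
        rw [show (2 * 2 : ℝ) = 4 by norm_num]; exact map_ofNat _ 4]
      ring
    rw [W, s.Δ_mul, Δ_expT, s.Γ_expT_left, hb, hd, Δ_smul, s.ΔF, Γ_smul_left, hc, he]
    simp only [Algebra.smul_def, show algebraMap ℝ (T ℝ n) 2 = 2 from map_ofNat _ 2,
        show algebraMap ℝ (T ℝ n) 4 = 4 from map_ofNat _ 4]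
    have h4 : (4 : T ℝ n) * algebraMap ℝ (T ℝ n) (1 / 4) = 1 := by
      rw [← show algebraMap ℝ (T ℝ n) 4 = 4 from map_ofNat _ 4, ← map_mul]; norm_num
    have h2 : (2 : T ℝ n) * algebraMap ℝ (T ℝ n) (1 / 2) = 1 := by
      rw [← show algebraMap ℝ (T ℝ n) 2 = 2 from map_ofNat _ 2, ← map_mul]; norm_num
    linear_combination expT (algebraMap ℝ (T ℝ n) (1 / 2) * s.F) * (s.V * s.V) * h4
      + expT (algebraMap ℝ (T ℝ n) (1 / 2) * s.F) * (2 * s.V * s.A + 4 * (quad (s.B s.F) s.F s.F + quad (s.hD s.F) s.F s.F)) * h2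
  have h1 := s.ip_psd.nonneg x ((2 : ℝ) • s.B s.F + s.gr2 s.F s.F)
  have h2 := congrArg (ev x) e
  have h3 := (Real.exp_pos (ev x s.F / 2)).le
  rw [ev_smul, map_mul, ev_expT, ev_smul, one_div, inv_mul_eq_div] at h2
  simp only [map_add (ev x), ev_smul, map_mul] at h2
  nlinarith [mul_nonneg h3 h1]

end Pot

namespace Sol

lemma exists_W_bound [NeZero n] (A0 : T ℝ n) : ∃ b : ℝ, 0 < b ∧ ∀ (s : Sol A0) x,
    ev x s.V ≤ b * ev x s.W ∧ ev x s.W ≤ b * ev x s.V := by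
  obtain ⟨C, hC⟩ := bdd_F A0
  refine ⟨Real.exp (C / 2), Real.exp_pos _, fun s x => ?_⟩
  have h := abs_le.mp (hC s x)
  have hV := s.V_nonneg x
  rw [s.ev_W]
  constructor
  · rw [← mul_assoc, ← Real.exp_add]
    exact le_mul_of_one_le_left hV (Real.one_le_exp (by linarith))
  · gcongr; linarith

lemma exists_J_le [NeZero n] (A0 : T ℝ n) : ∃ K L : ℝ, 0 < K ∧ 0 ≤ L ∧ ∀ (s : Sol A0) x,
    ev x s.J ≤ K * ev x (s.Δ s.W) + L * (ev x s.V + ev x s.P) := by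
  obtain ⟨C, hC⟩ := bdd_F A0
  obtain ⟨a, ha⟩ := bdd_A A0
  choose d hd using fun i => bdd_dx_A A0 (dx i).toLinearMap
  refine ⟨Real.exp (C / 2), Real.exp C * (1 + |a| + ∑ i, d i ^ 2), Real.exp_pos _, by positivity,
    fun s x => ?_⟩
  have hV := s.V_nonneg x
  have hP := s.P_nonneg x
  have h := abs_le.mp (hC s x)
  have h1 := s.le_Δ_W x
  have h2 : -(2 * ev x (s.Γ s.F s.A)) ≤ ev x s.V + ev x (s.Γ s.A s.A) := s.Γ_psd.neg_two_mul_le x s.F s.A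
  have h3 : ev x (s.Γ s.A s.A) ≤ ev x s.P * ∑ i, d i ^ 2 := (s.Γ_le x s.A).trans (by
    gcongr ev x s.P * ∑ i, ?_ with i
    exact sq_le_sq.mpr ((hd i s x).trans (le_abs_self _)))
  have h4 : -(|a| * ev x s.V) ≤ ev x s.A * ev x s.V := by
    rw [← neg_mul]; gcongr
    exact (neg_le_neg (le_abs_self a)).trans (abs_le.mp (ha s x)).1
  have h5 : ev x s.J ≤ ev x s.J + 2 * ev x (s.Γ s.F s.A) + ev x s.A * ev x s.V / 2
      + (1 + |a| + ∑ i, d i ^ 2) * (ev x s.V + ev x s.P) := by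
    have : 0 ≤ (∑ i, d i ^ 2) * ev x s.V := by positivity
    have : 0 ≤ (1 + |a|) * ev x s.P := by positivity
    have : 0 ≤ |a| * ev x s.V := by positivity
    linarith
  have h6 : 0 ≤ (1 + |a| + ∑ i, d i ^ 2) * (ev x s.V + ev x s.P) := by positivity
  have e1 : Real.exp (C / 2) * Real.exp (ev x s.F / 2) ≤ Real.exp C := by
    rw [← Real.exp_add]; exact Real.exp_le_exp.mpr (by linarith)
  have e2 : 1 ≤ Real.exp (C / 2) * Real.exp (ev x s.F / 2) := by
    rw [← Real.exp_add]; exact Real.one_le_exp (by linarith)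
  calc ev x s.J ≤ Real.exp (C / 2) * Real.exp (ev x s.F / 2) * ev x s.J :=
        le_mul_of_one_le_left (s.J_nonneg x) e2
    _ ≤ Real.exp (C / 2) * Real.exp (ev x s.F / 2) * (ev x s.J + 2 * ev x (s.Γ s.F s.A)
      + ev x s.A * ev x s.V / 2 + (1 + |a| + ∑ i, d i ^ 2) * (ev x s.V + ev x s.P)) := by gcongr
    _ = Real.exp (C / 2) * (Real.exp (ev x s.F / 2) * (ev x s.J + 2 * ev x (s.Γ s.F s.A)
      + ev x s.A * ev x s.V / 2)) + (Real.exp (C / 2) * Real.exp (ev x s.F / 2)) *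
      ((1 + |a| + ∑ i, d i ^ 2) * (ev x s.V + ev x s.P)) := by ring
    _ ≤ _ := by
      rw [mul_assoc (Real.exp C)]
      gcongr

/-- Energy estimate for powers of the weighted squared gradient. -/
lemma energy_W [NeZero n] {A0 : T ℝ n} (s : Sol A0) {K L : ℝ}
    (h : ∀ x, ev x s.J ≤ K * ev x (s.Δ s.W) + L * (ev x s.V + ev x s.P)) (m : ℕ) :
    I (s.W ^ (m + 1) * s.J) + K * ((m + 1) * I (s.W ^ m * s.Γ s.W s.W))
      ≤ L * I (s.W ^ (m + 1) * (s.V + s.P)) := by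
  have h1 : I (s.W ^ (m + 1) * s.J) ≤ I (K • (s.W ^ (m + 1) * s.Δ s.W)
      + L • (s.W ^ (m + 1) * (s.V + s.P))) := I_mono fun x => by
    simp only [map_add, ev_smul, map_mul, map_pow]
    have := mul_le_mul_of_nonneg_left (h x) (pow_nonneg (s.W_nonneg x) (m + 1))
    linarith
  rw [map_add, I_smul, I_smul, s.I_pow_mul_Δ] at h1
  linarith

lemma I_W_mul_V [NeZero n] {A0 : T ℝ n} (s : Sol A0) {C a : ℝ} (hC : ∀ x, |ev x s.F| ≤ C)
    (ha : ∀ x, |ev x s.A| ≤ a) (m : ℕ) :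
    I (s.W ^ (m + 2) * s.V) ≤ 2 * C * a * I (s.W ^ (m + 2))
      + ((m + 2) * C) ^ 2 * I (s.W ^ m * s.Γ s.W s.W) := by
  have h1 := s.I_Δ (s.W ^ (m + 2) * s.F) s.F
  rw [s.Γ_mul_left, s.Γ_pow_left, s.ΔF] at h1
  have h2 : I (s.W ^ (m + 2) * s.V) ≤ I ((C * a) • s.W ^ (m + 2) + ((1 / 2 : ℝ) • (s.W ^ (m + 2) * s.V)
      + (((m + 2) * C) ^ 2 / 2) • (s.W ^ m * s.Γ s.W s.W))
      + (s.W ^ (m + 2) * s.F * s.A + (s.W ^ (m + 2) * s.Γ s.F s.F +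
        s.F * (((m + 1 : ℕ) + 1 : ℝ) • (s.W ^ (m + 1) * s.Γ s.W s.F))))) := I_mono fun x => by
    have hW := s.W_nonneg x
    have hV := s.V_nonneg x
    have hG := s.Γ_nonneg x s.W
    have hC0 : 0 ≤ C := (abs_nonneg _).trans (hC x)
    have e1 : -(C * a) ≤ ev x s.F * ev x s.A := (abs_le.mp (abs_mul (ev x s.F) (ev x s.A) ▸
      mul_le_mul (hC x) (ha x) (abs_nonneg _) hC0)).1
    have e2 := abs_two_mul_le (p := ev x s.V) (q := ((m + 2) * C) ^ 2 * ev x (s.Γ s.W s.W))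
      (t := ev x s.W) (a := (m + 2) * ev x s.F * ev x (s.Γ s.W s.F)) ?_ hV (by positivity)
    · have e3 := (abs_le.mp e2).1
      have e4 := mul_le_mul_of_nonneg_left e3 (pow_nonneg hW m)
      have e5 := mul_le_mul_of_nonneg_left e1 (pow_nonneg hW (m + 2))
      have e6 : ev x (s.Γ s.F s.F) = ev x s.V := rfl
      simp only [map_add, ev_smul, map_mul, map_pow, e6]
      push_cast
      ring_nf at e4 e5 ⊢
      linarith
    · have := s.Γ_cs x s.W s.F
      have h3 : ev x s.F ^ 2 ≤ C ^ 2 := sq_le_sq.mpr ((hC x).trans (le_abs_self _))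
      calc _ = (m + 2) ^ 2 * (ev x s.F ^ 2 * ev x (s.Γ s.W s.F) ^ 2) := by ring
        _ ≤ (m + 2) ^ 2 * (C ^ 2 * (ev x (s.Γ s.W s.W) * ev x s.V)) := by
            gcongr; exact this
        _ = _ := by ring
  simp only [map_add I, I_smul] at h2 h1
  linarith

lemma lq_W [NeZero n] (A0 : T ℝ n) : LQ fun s : Sol A0 => s.W := by
  obtain ⟨C, hC⟩ := bdd_F A0
  obtain ⟨a, ha⟩ := bdd_A A0
  obtain ⟨K, L, hK, hL, hJ⟩ := exists_J_le A0
  obtain ⟨b, hb, hW⟩ := exists_W_bound A0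
  have key : ∀ m : ℕ, ∃ B : ℝ, ∀ s : Sol A0, I (s.W ^ (m + 3)) ≤ B := fun m => by
    obtain ⟨E, hE⟩ := (lq_P A0).moment (m + 2)
    set c3 := ((m + 2) * C) ^ 2 * (L / K) with hc3
    set D := b * (|2 * C * a| + c3 * b + c3) with hD
    have hc0 : 0 ≤ c3 := by positivity
    have hD0 : 0 ≤ D := by positivity
    refine ⟨2 * ((4 * (D + 1 / 4)) ^ (m + 3) + (4 * D) ^ (m + 2) * E), fun s => ?_⟩
    have h1 := s.I_W_mul_V (hC s) (ha s) m
    have h2 := s.energy_W (hJ s) m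
    have h3 : 0 ≤ I (s.W ^ (m + 1) * s.J) := I_nonneg fun x => by
      rw [map_mul, map_pow]; exact mul_nonneg (pow_nonneg (s.W_nonneg x) _) (s.J_nonneg x)
    have h4 : 0 ≤ I (s.W ^ m * s.Γ s.W s.W) := I_nonneg fun x => by
      rw [map_mul, map_pow]; exact mul_nonneg (pow_nonneg (s.W_nonneg x) _) (s.Γ_nonneg x _)
    have h5 : I (s.W ^ (m + 3)) ≤ I (b • (s.W ^ (m + 2) * s.V)) := I_mono fun x => by
      rw [ev_smul, map_mul, map_pow, map_pow, pow_succ _ (m + 2), mul_left_comm]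
      exact mul_le_mul_of_nonneg_left (hW s x).2 (pow_nonneg (s.W_nonneg x) _)
    have h6 : I (s.W ^ (m + 1) * (s.V + s.P)) ≤ I (b • s.W ^ (m + 2) + s.W ^ (m + 1) * s.P) :=
      I_mono fun x => by
        simp only [map_add, ev_smul, map_mul, map_pow]
        have := mul_le_mul_of_nonneg_left (hW s x).1 (pow_nonneg (s.W_nonneg x) (m + 1))
        rw [mul_add, pow_succ _ (m + 1)]; linarith
    have h7 : I (D • (s.W ^ (m + 1) * s.P)) ≤ I ((1 / 4 : ℝ) • s.W ^ (m + 2)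
        + ((4 * D) ^ (m + 2)) • s.P ^ (m + 2)) := I_mono fun x => by
      simp only [map_add, ev_smul, map_mul, map_pow]
      have := pow_mul_le_add (s.W_nonneg x) (mul_nonneg hD0 (s.P_nonneg x)) (m + 1)
      rw [show 4 * (D * ev x s.P) = 4 * D * ev x s.P by ring, mul_pow (4 * D)] at this
      linarith
    have h8 : I ((D + 1 / 4) • s.W ^ (m + 2)) ≤ I ((1 / 4 : ℝ) • s.W ^ (m + 3)
        + algebraMap ℝ _ ((4 * (D + 1 / 4)) ^ (m + 3))) := I_mono fun x => by
      simp only [map_add, ev_smul, map_pow (ev x), ev_algebraMap]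
      have := pow_mul_le_add (s.W_nonneg x) (by positivity : 0 ≤ D + 1 / 4) (m + 2)
      linarith
    have h9 : 0 ≤ I (s.W ^ (m + 2)) := I_nonneg fun x => by
      rw [map_pow]; exact pow_nonneg (s.W_nonneg x) _
    have h10 : 0 ≤ I (s.W ^ (m + 1) * s.P) := I_nonneg fun x => by
      rw [map_mul, map_pow]; exact mul_nonneg (pow_nonneg (s.W_nonneg x) _) (s.P_nonneg x)
    simp only [map_add I, I_smul, I_const] at h5 h6 h7 h8
    have h11 : I (s.W ^ m * s.Γ s.W s.W) ≤ L / K * (b * I (s.W ^ (m + 2)) + I (s.W ^ (m + 1) * s.P)) := by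
      rw [div_mul_eq_mul_div, le_div_iff₀ hK]
      have : 0 ≤ K * (m * I (s.W ^ m * s.Γ s.W s.W)) := by positivity
      have := mul_le_mul_of_nonneg_left h6 hL
      linarith
    have h12 : I (s.W ^ (m + 3)) ≤ D * I (s.W ^ (m + 2)) + D * I (s.W ^ (m + 1) * s.P) := by
      have e1 : 2 * C * a * I (s.W ^ (m + 2)) ≤ |2 * C * a| * I (s.W ^ (m + 2)) := by
        gcongr; exact le_abs_self _
      have e2 := mul_le_mul_of_nonneg_left h11 (sq_nonneg (((m : ℝ) + 2) * C))
      rw [← mul_assoc, ← hc3] at e2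
      have e3 := mul_le_mul_of_nonneg_left (h1.trans (add_le_add e1 e2)) hb.le
      have e4 : 0 ≤ b * c3 * I (s.W ^ (m + 2)) := by positivity
      have e5 : 0 ≤ b * (|2 * C * a| + c3 * b) * I (s.W ^ (m + 1) * s.P) := by positivity
      rw [hD]
      linarith
    have h13 := mul_le_mul_of_nonneg_left (abs_le.mp (hE s)).2 (by positivity : 0 ≤ (4 * D) ^ (m + 2))
    have h14 : 0 ≤ (4 * (D + 1 / 4)) ^ (m + 3) := by positivity
    have h15 : 0 ≤ I (s.P ^ (m + 2)) := I_nonneg fun x => by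
      rw [map_pow]; exact pow_nonneg (s.P_nonneg x) _
    have h16 : 0 ≤ (4 * D) ^ (m + 2) * I (s.P ^ (m + 2)) := by positivity
    linarith
  rintro (_ | _ | p)
  · exact ⟨1, fun s => by simp [I_one]⟩
  · obtain ⟨B, hB⟩ := key 0
    refine ⟨1 / 4 * B + 4 ^ 3, fun s => ?_⟩
    have h : I (s.W ^ 2) ≤ I ((1 / 4 : ℝ) • s.W ^ 3 + algebraMap ℝ _ (4 ^ 3)) := I_mono fun x => by
      simp only [map_add, ev_smul, map_pow (ev x), ev_algebraMap]
      have := pow_mul_le_add (s.W_nonneg x) zero_le_one 2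
      norm_num at this ⊢
      linarith
    rw [map_add, I_smul, I_const] at h
    have := hB s
    norm_num at this h ⊢
    linarith
  · exact key (2 * p + 1)

lemma lq_V [NeZero n] (A0 : T ℝ n) : LQ fun s : Sol A0 => s.V := by
  obtain ⟨b, hb, hW⟩ := exists_W_bound A0
  refine ((lq_W A0).smul b).of_abs_le fun s x => ?_
  rw [ev_smul, abs_of_nonneg (s.V_nonneg x), abs_of_nonneg (mul_nonneg hb.le (s.W_nonneg x))]
  exact (hW s x).1

/-- Weighted `L²` bounds for the second derivatives of `log det`. -/
lemma I_V_pow_mul_J [NeZero n] (A0 : T ℝ n) (p : ℕ) : ∃ C : ℝ, ∀ s : Sol A0, I (s.V ^ p * s.J) ≤ C := by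
  obtain ⟨K, L, hK, hL, hJ⟩ := exists_J_le A0
  obtain ⟨b, hb, hW⟩ := exists_W_bound A0
  obtain ⟨B, hB⟩ := (((lq_W A0).pow p).mul ((lq_V A0).add (lq_P A0))).moment 1
  simp only [pow_one] at hB
  refine ⟨b ^ p * (L * B), fun s => ?_⟩
  have h1 : I (s.V ^ p * s.J) ≤ I (b ^ p • (s.W ^ p * s.J)) := I_mono fun x => by
    rw [ev_smul, map_mul, map_mul, map_pow, map_pow, ← mul_assoc, ← mul_pow]
    exact mul_le_mul_of_nonneg_right (pow_le_pow_left₀ (s.V_nonneg x) (hW s x).1 _) (s.J_nonneg x)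
  rw [I_smul] at h1
  refine h1.trans (mul_le_mul_of_nonneg_left (le_trans ?_ (mul_le_mul_of_nonneg_left
    (abs_le.mp (hB s)).2 hL)) (by positivity))
  rcases p with _ | m
  · have : I (1 * s.J) ≤ I (K • (1 * s.Δ s.W) + L • (s.V + s.P)) := I_mono fun x => by
      simp only [map_add, ev_smul, one_mul]
      have := hJ s x
      linarith
    rw [map_add, I_smul, I_smul, s.I_Δ, s.Γ_comm, s.Γ_eq] at this
    simpa using this
  · have h := s.energy_W (hJ s) m
    have h4 : 0 ≤ I (s.W ^ m * s.Γ s.W s.W) := I_nonneg fun x => by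
      rw [map_mul, map_pow]; exact mul_nonneg (pow_nonneg (s.W_nonneg x) _) (s.Γ_nonneg x _)
    have : 0 ≤ K * ((m + 1) * I (s.W ^ m * s.Γ s.W s.W)) := by positivity
    linarith

end Sol

end Abreu

namespace Abreu
open Set Filter Topology
open scoped ContDiff

variable {n : ℕ}

namespace Pot
variable (s : Pot n)

lemma I_mul_Γ (f u v : T ℝ n) : I (f * s.Γ u v) = - I (f * v * s.Δ u) - I (v * s.Γ f u) := by
  have h := s.I_Δ (f * v) u
  rw [s.Γ_mul_left, map_add] at h
  rw [h, s.Γ_comm u v]; ring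

lemma I_mul_ip3_map (f : T ℝ n) (X : Matrix (Fin n) (Fin n) (T ℝ n)) :
    I (f * s.ip3 s.C fun l => X.map (s.D l))
      = I (f * (s.ip s.Q X - s.ip (s.hD s.F) X)) - I (s.ip (s.K f) X) := by
  have h1 : ∑ i, ∑ j, s.Γ (s.H i j) (X i j) = -(s.ip3 s.C fun l => X.map (s.D l)) := sum_Γ_HM s X
  have h2 : ∑ i, ∑ j, X i j * s.Δ (s.H i j) = s.ip s.Q X - s.ip (s.hD s.F) X := by
    rw [← LinearMap.sub_apply, ← map_sub, s.ip_apply, ← s.ΔH, ← sum_mul_eq_trace]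
    simp only [map_apply, mul_comm]
  have h3 : ∑ i, ∑ j, X i j * s.Γ f (s.H i j) = - s.ip (s.K f) X := by
    rw [ip_K]
    simp only [ip_apply, Γ_eq, Finset.mul_sum, ← Finset.sum_neg_distrib]
    rw [Finset.sum_congr rfl fun i _ => Finset.sum_comm, Finset.sum_comm]
    refine Finset.sum_congr rfl fun k _ => ?_
    rw [← mul_neg, ← trace_neg, ← Matrix.neg_mul, ← s.dH_D, ← sum_mul_eq_trace]
    simp only [Finset.mul_sum, map_apply]
    exact Finset.sum_congr rfl fun i _ => Finset.sum_congr rfl fun j _ => by ring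
  rw [← neg_neg (s.ip3 _ _), ← h1, mul_neg, ← h2, map_neg]
  simp only [Finset.mul_sum, map_sum]
  rw [Finset.sum_congr rfl fun i _ => Finset.sum_congr rfl fun j _ => s.I_mul_Γ f (s.H i j) (X i j)]
  simp only [Finset.sum_sub_distrib, Finset.sum_neg_distrib]
  have h4 := congrArg I h3
  simp only [map_sum, map_neg] at h4
  rw [h4]
  simp only [mul_assoc]
  ring

lemma K_pow (f : T ℝ n) (m : ℕ) : s.K (f ^ (m + 1)) = ((m + 1 : ℝ) • f ^ m) • s.K f := by
  simp only [K, Finset.smul_sum, pow_eq_mul_dx, smul_smul, smul_mul_assoc]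

lemma ip_K_sq_le (x) (f : T ℝ n) (Y) :
    ev x (s.ip (s.K f) Y) ^ 2 ≤ ev x s.S * ev x (s.Γ f f) * ev x (s.ip Y Y) := by
  have h := s.ip3_psd.cs x s.C fun l => s.D l f • Y
  have e1 : (s.ip3 s.C fun l => s.D l f • Y) = s.ip (s.K f) Y := by
    rw [ip_K, ip3_apply]
    simp only [ip_smul_right]
    refine Finset.sum_congr rfl fun i _ => ?_
    rw [s.dx_eq, Finset.sum_mul]
    exact Finset.sum_congr rfl fun k _ => by ring
  have e2 : (s.ip3 (fun l => s.D l f • Y) fun l => s.D l f • Y) = s.Γ f f * s.ip Y Y := by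
    rw [ip3_apply, Γ, Finset.sum_mul]
    simp only [ip_smul_right, ip_smul_left, Finset.sum_mul]
    exact Finset.sum_congr rfl fun i _ => Finset.sum_congr rfl fun k _ => by ring
  rw [e1, e2, map_mul] at h
  rw [mul_assoc]; exact h

lemma S_nonneg (x) : 0 ≤ ev x s.S := s.ip3_psd.nonneg x _

lemma ip_K_K_le (x) (f : T ℝ n) : ev x (s.ip (s.K f) (s.K f)) ≤ ev x s.S * ev x (s.Γ f f) := by
  have h := s.ip_K_sq_le x f (s.K f)
  have h1 := s.ip_psd.nonneg x (s.K f)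
  rcases h1.eq_or_lt with h0 | h0
  · rw [← h0]; exact mul_nonneg (s.S_nonneg x) (s.Γ_nonneg x f)
  · rw [sq] at h; exact le_of_mul_le_mul_right h h0

lemma S_sq_le (x) : ev x s.S ^ 2 ≤ n * ev x (s.ip s.Q s.Q) := by
  have h := s.ip_psd.cs x s.G s.Q
  have e1 : s.ip s.G s.Q = s.S := by
    rw [ip_apply, s.HG, Matrix.one_mul, ← sum_mul_eq_trace, S_eq]
  have e2 : s.ip s.G s.G = (n : T ℝ n) := by
    rw [ip_apply, s.HG, Matrix.one_mul, s.Gt, s.HG, trace_one, Fintype.card_fin]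
  rwa [e1, e2, map_natCast] at h

/-- Energy estimate for powers of `S`. -/
lemma energy_S (m : ℕ) :
    (m + 1) / 2 * I (s.S ^ m * s.Γ s.S s.S) + 1 / 4 * I (s.S ^ (m + 1) * s.ip s.Q s.Q)
      ≤ (2 * m + 5) * I (s.S ^ (m + 1) * s.J) := by
  set D4 := s.ip4 s.Z (s.Z - s.E2 - s.E3) + s.ip4 (s.Z - s.E1) (s.Z - s.E2 - s.E3 - s.E1)
    + 2 * s.ip s.Q s.Q with hD4
  have h1 := s.I_pow_mul_Δ s.S m
  rw [ΔS, ← hD4] at h1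
  have h2 := s.I_mul_ip3_map (s.S ^ (m + 1)) (s.hD s.F)
  rw [K_pow, ip_smul_left] at h2
  have e : s.S ^ (m + 1) * (D4 + 2 * s.ip3 s.C (fun l => (s.hD s.F).map (s.D l))
      - 3 * s.ip (s.hD s.F) s.Q) = s.S ^ (m + 1) * D4
      + (2 : ℝ) • (s.S ^ (m + 1) * s.ip3 s.C (fun l => (s.hD s.F).map (s.D l)))
      - (3 : ℝ) • (s.S ^ (m + 1) * s.ip (s.hD s.F) s.Q) := by
    simp only [Algebra.smul_def, map_ofNat]; ring
  rw [e, map_sub, map_add, I_smul, I_smul, h2, mul_sub, mul_sub, map_sub, smul_mul_assoc, I_smul,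
    s.ip_comm s.Q] at h1
  have h3 : I (s.S ^ (m + 1) * s.ip (s.hD s.F) s.Q) ≤ I ((1 / 4 : ℝ) • (s.S ^ (m + 1) * s.ip s.Q s.Q)
      + s.S ^ (m + 1) * s.J) := I_mono fun x => by
    simp only [map_add, ev_smul, map_mul, map_pow]
    have := s.ip_psd.two_mul_le x ((2 : ℝ) • s.hD s.F) s.Q
    simp only [map_smul, LinearMap.smul_apply, smul_eq_mul] at this
    have h4 : ev x (s.ip (s.hD s.F) s.Q) ≤ 1 / 4 * ev x (s.ip s.Q s.Q) + ev x s.J := by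
      rw [J]; linarith
    have := mul_le_mul_of_nonneg_left h4 (pow_nonneg (s.S_nonneg x) (m + 1))
    linarith
  have h4 : I (s.S ^ m * s.ip (s.K s.S) (s.hD s.F)) ≤ I ((1 / 4 : ℝ) • (s.S ^ m * s.Γ s.S s.S)
      + s.S ^ (m + 1) * s.J) := I_mono fun x => by
    simp only [map_add, ev_smul, map_mul, map_pow]
    have h := s.ip_K_sq_le x s.S (s.hD s.F)
    have h5 := s.Γ_nonneg x s.S
    have h6 := s.J_nonneg x
    have h7 := s.S_nonneg x
    have h8 := (abs_le.mp (abs_two_mul_le (t := 1) (a := 2 * ev x (s.ip (s.K s.S) (s.hD s.F)))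
      (q := 4 * (ev x s.S * ev x s.J)) (p := ev x (s.Γ s.S s.S)) (by
        rw [← J] at h
        linarith) h5 (by positivity))).2
    have := mul_le_mul_of_nonneg_left h8 (pow_nonneg h7 m)
    rw [pow_succ]
    linarith
  have h5 : I (s.S ^ (m + 1) * s.ip s.Q s.Q) ≤ I ((2 : ℝ) • (s.S ^ (m + 1) * D4)) := I_mono fun x => by
    simp only [ev_smul, map_mul, map_pow]
    have := mul_le_mul_of_nonneg_left (s.bracket x) (pow_nonneg (s.S_nonneg x) (m + 1))
    rw [← hD4] at this
    linarith
  simp only [map_add I, I_smul] at h3 h4 h5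
  rw [← J] at h1
  have h6 := mul_le_mul_of_nonneg_left h4 (by positivity : (0 : ℝ) ≤ 2 * (m + 1))
  linarith

lemma Γ_V_le (x) : ev x (s.Γ s.V s.V) ≤ ev x s.V * (8 * ev x s.J + 2 * (ev x s.S * ev x s.V)) := by
  have h := s.ip_psd.cs x (s.B s.F + s.hD s.F) (s.gr2 s.V s.F)
  have e1 : s.ip (s.B s.F + s.hD s.F) (s.gr2 s.V s.F) = s.Γ s.V s.V := by
    rw [map_add, LinearMap.add_apply, ip_gr2, ip_gr2, ← s.Γ_Γ, V]
  have e2 : s.ip (s.gr2 s.V s.F) (s.gr2 s.V s.F) = s.Γ s.V s.V * s.V := by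
    rw [ip_gr2, quad_gr2]; rfl
  have e3 : ev x (s.ip (s.B s.F + s.hD s.F) (s.B s.F + s.hD s.F))
      ≤ 8 * ev x s.J + 2 * (ev x s.S * ev x s.V) := by
    have h1 := s.ip_K_K_le x s.F
    have h2 := s.ip_psd.neg_two_mul_le x ((2 : ℝ) • s.hD s.F) (s.K s.F)
    have h3 : s.B s.F + s.hD s.F = (2 : ℝ) • s.hD s.F - s.K s.F := by rw [B, two_smul]; abel
    rw [h3, s.ip_psd.sub_self]
    simp only [map_add, map_sub, map_mul, map_smul, LinearMap.smul_apply, smul_eq_mul, map_ofNat] at h2 ⊢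
    rw [← J] at h2 ⊢
    rw [← V] at h1
    linarith
  rw [e1, e2, map_mul] at h
  have h1 := s.Γ_nonneg x s.V
  have hV := s.V_nonneg x
  rcases h1.eq_or_lt with h0 | h0
  · rw [← h0]
    exact mul_nonneg hV ((s.ip_psd.nonneg x _).trans e3)
  · refine le_trans (le_of_mul_le_mul_right ?_ h0) (mul_le_mul_of_nonneg_left e3 hV)
    rw [sq] at h; linarith

lemma Γ_W_le (x) : ev x (s.Γ s.W s.W) ≤ Real.exp (ev x s.F) *
    (ev x s.V * (16 * ev x s.J + 4 * (ev x s.S * ev x s.V)) + ev x s.V ^ 3) := by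
  have hd : ∀ f, s.Γ s.W f = expT ((1 / 2 : ℝ) • s.F) * (s.Γ s.V f + (1 / 2 : ℝ) • (s.V * s.Γ s.F f)) := fun f => by
    rw [W, s.Γ_mul_left, s.Γ_expT_left, Γ_smul_left]
    simp only [Algebra.smul_def]; ring
  have h : ev x (s.Γ s.W s.W) = Real.exp (ev x s.F) * (ev x (s.Γ s.V s.V) + ev x s.V * ev x (s.Γ s.F s.V)
      + 1 / 4 * ev x s.V ^ 3) := by
    have hF : ev x (s.Γ s.F s.F) = ev x s.V := rfl
    rw [hd, s.Γ_comm s.V, s.Γ_comm s.F, hd, hd]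
    simp only [map_mul, map_add, ev_smul, ev_expT, s.Γ_comm s.V s.F, hF]
    rw [show Real.exp (ev x s.F) = Real.exp (1 / 2 * ev x s.F) * Real.exp (1 / 2 * ev x s.F) by
      rw [← Real.exp_add]; congr 1; ring]
    ring
  rw [h]
  have h1 := s.Γ_V_le x
  have hV := s.V_nonneg x
  have h4 := (abs_le.mp (abs_two_mul_le (s.Γ_cs x s.F s.V) (s.Γ_nonneg x _) (s.Γ_nonneg x _) (ev x s.V))).2
  rw [← V] at h4
  refine mul_le_mul_of_nonneg_left ?_ (Real.exp_pos _).le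
  have h5 : 0 ≤ ev x s.V ^ 3 := by positivity
  have h6 := mul_nonneg hV (s.J_nonneg x)
  have h7 := mul_nonneg hV (mul_nonneg (s.S_nonneg x) hV)
  have h8 : ev x s.V ^ 2 * ev x s.V = ev x s.V ^ 3 := by ring
  rw [h8] at h4
  have h9 : ev x s.V * (8 * ev x s.J + 2 * (ev x s.S * ev x s.V)) =
      8 * (ev x s.V * ev x s.J) + 2 * (ev x s.V * (ev x s.S * ev x s.V)) := by ring
  have h10 : ev x s.V * (16 * ev x s.J + 4 * (ev x s.S * ev x s.V)) =
      16 * (ev x s.V * ev x s.J) + 4 * (ev x s.V * (ev x s.S * ev x s.V)) := by ring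
  rw [h9] at h1
  rw [h10]
  linarith

end Pot

section
variable {σ : Type*} {f w : σ → T ℝ n}

lemma exists_I_pow_mul_le (hw : ∀ s x, 0 ≤ ev x (w s)) (hf : LQ f) (hf0 : ∀ s x, 0 ≤ ev x (f s))
    (k : ℕ) {η : ℝ} (hη : 0 < η) :
    ∃ C : ℝ, ∀ s, I (w s ^ k * f s) ≤ η * I (w s ^ (k + 1)) + C := by
  obtain ⟨B, hB⟩ := hf.moment (k + 1)
  refine ⟨4 * η * (1 / η) ^ (k + 1) * B, fun s => ?_⟩
  have h : I (w s ^ k * f s) ≤ I (η • w s ^ (k + 1) + (4 * η * (1 / η) ^ (k + 1)) • f s ^ (k + 1)) :=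
    I_mono fun x => by
      have := pow_mul_le_add (hw s x) (div_nonneg (hf0 s x) (by positivity : 0 ≤ 4 * η)) k
      simp only [map_add, ev_smul, map_mul, map_pow]
      have h1 := mul_le_mul_of_nonneg_left this (by positivity : 0 ≤ 4 * η)
      have e1 : 4 * (ev x (f s) / (4 * η)) = 1 / η * ev x (f s) := by field_simp
      have e2 : 4 * η * (ev x (w s) ^ k * (ev x (f s) / (4 * η))) = ev x (w s) ^ k * ev x (f s) := by
        field_simp
      rw [e1, e2, mul_pow] at h1
      linarith
  rw [map_add, I_smul, I_smul] at h
  have := mul_le_mul_of_nonneg_left (abs_le.mp (hB s)).2 (by positivity : 0 ≤ 4 * η * (1 / η) ^ (k + 1))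
  linarith

lemma LQ.of_pow_add_three (hw : ∀ s x, 0 ≤ ev x (w s))
    (h : ∀ m : ℕ, ∃ B : ℝ, ∀ s, I (w s ^ (m + 3)) ≤ B) : LQ w := by
  rintro (_ | _ | p)
  · exact ⟨1, fun s => by simp [I_one]⟩
  · obtain ⟨C, hC⟩ := exists_I_pow_mul_le hw (LQ.const 1) (fun s x => by simp) 2 one_pos
    obtain ⟨B, hB⟩ := h 0
    refine ⟨B + C, fun s => ?_⟩
    have := hC s
    have := hB s
    simp only [mul_one, one_mul] at *
    linarith
  · exact h (2 * p + 1)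

lemma LQ.of_sq_le (hw : LQ w) (h : ∀ s x, ev x (f s) ^ 2 ≤ ev x (w s)) : LQ f := fun p => by
  obtain ⟨B, hB⟩ := hw.moment p
  refine ⟨B, fun s => (I_mono fun x => ?_).trans (abs_le.mp (hB s)).2⟩
  rw [map_pow, map_pow, pow_mul]
  exact pow_le_pow_left₀ (sq_nonneg _) (h s x) _

end

namespace Sol

lemma exists_Γ_S_W_le [NeZero n] (A0 : T ℝ n) {ε : ℝ} (hε : 0 < ε) : ∃ R : ℝ, 0 < R ∧ ∀ (s : Sol A0) x,
    -ev x (s.Γ s.S s.W) ≤ ε * ev x (s.Γ s.S s.S)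
      + R * (ev x s.V * ev x s.J + ev x s.S * ev x s.V ^ 2 + ev x s.V ^ 3) := by
  obtain ⟨C, hC⟩ := bdd_F A0
  refine ⟨16 * Real.exp C / ε, by positivity, fun s x => ?_⟩
  have h1 := (abs_le.mp (abs_two_mul_le (s.Γ_cs x s.S s.W) (s.Γ_nonneg x _) (s.Γ_nonneg x _) ε)).1
  have h2 := s.Γ_W_le x
  have hV := s.V_nonneg x
  have hJ := s.J_nonneg x
  have hS := s.S_nonneg x
  have h3 := s.Γ_nonneg x s.S
  have h4 : ev x (s.Γ s.W s.W) ≤ 16 * Real.exp C *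
      (ev x s.V * ev x s.J + ev x s.S * ev x s.V ^ 2 + ev x s.V ^ 3) := by
    refine h2.trans ?_
    have h5 := (abs_le.mp (hC s x)).2
    have h6 : 0 ≤ ev x s.S * ev x s.V ^ 2 := by positivity
    have h7 : 0 ≤ ev x s.V ^ 3 := by positivity
    have h8 : ev x s.V * (16 * ev x s.J + 4 * (ev x s.S * ev x s.V)) + ev x s.V ^ 3
        ≤ 16 * (ev x s.V * ev x s.J + ev x s.S * ev x s.V ^ 2 + ev x s.V ^ 3) := by
      have : ev x s.V * (16 * ev x s.J + 4 * (ev x s.S * ev x s.V))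
        = 16 * (ev x s.V * ev x s.J) + 4 * (ev x s.S * ev x s.V ^ 2) := by ring
      rw [this]
      linarith
    rw [show 16 * Real.exp C * (ev x s.V * ev x s.J + ev x s.S * ev x s.V ^ 2 + ev x s.V ^ 3) =
      Real.exp C * (16 * (ev x s.V * ev x s.J + ev x s.S * ev x s.V ^ 2 + ev x s.V ^ 3)) by ring]
    exact mul_le_mul (Real.exp_le_exp.mpr h5) h8 (by positivity) (by positivity)
  have h5 : -(ev x (s.Γ s.S s.W)) * (2 * ε) ≤ (ε * ev x (s.Γ s.S s.S)
      + 16 * Real.exp C / ε * (ev x s.V * ev x s.J + ev x s.S * ev x s.V ^ 2 + ev x s.V ^ 3)) * ε := by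
    have e : 16 * Real.exp C / ε * (ev x s.V * ev x s.J + ev x s.S * ev x s.V ^ 2 + ev x s.V ^ 3) * ε
      = 16 * Real.exp C * (ev x s.V * ev x s.J + ev x s.S * ev x s.V ^ 2 + ev x s.V ^ 3) := by
      field_simp
    rw [add_mul, e]
    linarith
  have h6 : 0 ≤ (ε * ev x (s.Γ s.S s.S)
      + 16 * Real.exp C / ε * (ev x s.V * ev x s.J + ev x s.S * ev x s.V ^ 2 + ev x s.V ^ 3)) := by positivity
  refine le_of_mul_le_mul_right ?_ (by positivity : 0 < 2 * ε)
  linarith [mul_nonneg h6 hε.le]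

lemma moment_S [NeZero n] (A0 : T ℝ n) (m : ℕ) : ∃ B : ℝ, ∀ s : Sol A0, I (s.S ^ (m + 3)) ≤ B := by
  obtain ⟨K, L, hK, hL, hJ⟩ := exists_J_le A0
  have hn : (0 : ℝ) < n := by exact_mod_cast Nat.pos_of_ne_zero (NeZero.ne n)
  obtain ⟨R, hR, hΓ⟩ := exists_Γ_S_W_le A0 (by positivity : 0 < 1 / (4 * K * (2 * m + 5)))
  set N := K * (m + 1) * R with hN
  have hN0 : 0 < N := by positivity
  have hV0 : ∀ (s : Sol A0) x, 0 ≤ ev x (s.V ^ 2) := fun s x => by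
    rw [map_pow]; exact pow_nonneg (s.V_nonneg x) _
  have hV3 : ∀ (s : Sol A0) x, 0 ≤ ev x (s.V ^ 3) := fun s x => by
    rw [map_pow]; exact pow_nonneg (s.V_nonneg x) _
  have hVP : ∀ (s : Sol A0) x, 0 ≤ ev x (s.V + s.P) := fun s x => by
    rw [map_add]; exact add_nonneg (s.V_nonneg x) (s.P_nonneg x)
  have hS : ∀ (s : Sol A0) x, 0 ≤ ev x s.S := fun s => s.S_nonneg
  obtain ⟨B1, h1⟩ := I_V_pow_mul_J A0 (m + 1)
  obtain ⟨B2, h2⟩ := exists_I_pow_mul_le hS ((lq_V A0).pow 2) hV0 (m + 1) one_pos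
  obtain ⟨B3, h3⟩ := exists_I_pow_mul_le hS ((lq_V A0).pow 3) hV3 m one_pos
  obtain ⟨B4, h4⟩ := exists_I_pow_mul_le hS (LQ.const 1) (fun s x => by simp) (m + 1) one_pos
  obtain ⟨B5, h5⟩ := exists_I_pow_mul_le hS ((lq_V A0).add (lq_P A0)) hVP (m + 1) one_pos
  set M := (4 / 3) * (2 * m + 5) * (2 * N + L) with hM
  have hM0 : 0 < M := by positivity
  obtain ⟨B6, h6⟩ := exists_I_pow_mul_le hS (LQ.const 1) (fun s x => by simp) (m + 2)
    (by positivity : 0 < 1 / (8 * n * M))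
  refine ⟨8 * n * ((4 / 3) * (2 * m + 5) * ((4 * N) ^ (m + 1) * B1 + N * (B2 + B3 + B4) + L * B5) + M * B6),
    fun s => ?_⟩
  have e1 : I (s.S ^ (m + 1) * s.J) ≤ K * -((m + 1) * I (s.S ^ m * s.Γ s.S s.W))
      + L * I (s.S ^ (m + 1) * (s.V + s.P)) := by
    have : I (s.S ^ (m + 1) * s.J) ≤ I (K • (s.S ^ (m + 1) * s.Δ s.W)
      + L • (s.S ^ (m + 1) * (s.V + s.P))) := I_mono fun x => by
        have := mul_le_mul_of_nonneg_left (hJ s x) (pow_nonneg (s.S_nonneg x) (m + 1))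
        simp only [map_add, ev_smul, map_mul, map_pow]
        linarith
    rwa [map_add, I_smul, I_smul, s.I_Δ, s.Γ_pow_left, I_smul] at this
  have e2 : I ((-(K * (m + 1))) • (s.S ^ m * s.Γ s.S s.W)) ≤
      I (((m + 1) / (4 * (2 * m + 5)) : ℝ) • (s.S ^ m * s.Γ s.S s.S)
      + (1 / 4 : ℝ) • (s.S ^ (m + 1) * s.J) + (4 * N) ^ (m + 1) • (s.V ^ (m + 1) * s.J)
      + N • (s.S ^ (m + 1) * s.V ^ 2 + s.S ^ m * s.V ^ 3)) := I_mono fun x => by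
    have hV := s.V_nonneg x
    have hJ := s.J_nonneg x
    have hS := s.S_nonneg x
    have f1 := mul_le_mul_of_nonneg_left (hΓ s x) (by positivity : 0 ≤ K * (m + 1) * ev x s.S ^ m)
    have f2 := mul_le_mul_of_nonneg_right (pow_mul_le_add hS (mul_nonneg hN0.le hV) m) hJ
    rw [show 4 * (N * ev x s.V) = 4 * N * ev x s.V by ring, mul_pow (4 * N)] at f2
    have e3 : K * (m + 1) * ev x s.S ^ m * (1 / (4 * K * (2 * m + 5)) * ev x (s.Γ s.S s.S) +
        R * (ev x s.V * ev x s.J + ev x s.S * ev x s.V ^ 2 + ev x s.V ^ 3))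
        = (m + 1) / (4 * (2 * m + 5)) * (ev x s.S ^ m * ev x (s.Γ s.S s.S)) + ev x s.S ^ m * (N * ev x s.V) * ev x s.J
        + N * (ev x s.S ^ (m + 1) * ev x s.V ^ 2 + ev x s.S ^ m * ev x s.V ^ 3) := by
      rw [hN]; field_simp; ring
    rw [e3] at f1
    simp only [map_add, ev_smul, map_mul, map_pow]
    linarith
  have e4 := s.energy_S m
  have e5 : I (s.S ^ (m + 3)) ≤ I ((n : ℝ) • (s.S ^ (m + 1) * s.ip s.Q s.Q)) := I_mono fun x => by
    have := mul_le_mul_of_nonneg_left (s.S_sq_le x) (pow_nonneg (s.S_nonneg x) (m + 1))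
    simp only [ev_smul, map_mul, map_pow]
    rw [pow_add _ (m + 1) 2]
    linarith
  simp only [map_add I, I_smul] at e2 e5
  have q1 := mul_le_mul_of_nonneg_left (h1 s) (by positivity : 0 ≤ (4 * N) ^ (m + 1))
  have q2 := h2 s
  have q3 := h3 s
  have q4 := h4 s
  have q5 := h5 s
  have q6 := h6 s
  simp only [mul_one, one_mul] at q2 q3 q4 q5 q6
  have g0 : 0 ≤ I (s.S ^ m * s.Γ s.S s.S) := I_nonneg fun x => by
    rw [map_mul, map_pow]; exact mul_nonneg (pow_nonneg (s.S_nonneg x) _) (s.Γ_nonneg x _)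
  have u1 : 3 / 4 * I (s.S ^ (m + 1) * s.J) ≤ (m + 1) / (4 * (2 * m + 5)) * I (s.S ^ m * s.Γ s.S s.S)
      + (2 * N + L) * I (s.S ^ (m + 2)) + ((4 * N) ^ (m + 1) * B1 + N * (B2 + B3 + B4) + L * B5) := by
    have q9 : I (s.S ^ (m + 1) * s.V ^ 2) + I (s.S ^ m * s.V ^ 3)
        ≤ 2 * I (s.S ^ (m + 2)) + (B2 + B3 + B4) := by
      have a2 : I (s.S ^ (m + 1) * s.V ^ 2) ≤ I (s.S ^ (m + 2)) + B2 := q2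
      have a4 : I (s.S ^ (m + 1)) ≤ I (s.S ^ (m + 2)) + B4 := q4
      linarith
    have q7 := mul_le_mul_of_nonneg_left q9 hN0.le
    have q8 : L * I (s.S ^ (m + 1) * (s.V + s.P)) ≤ L * (I (s.S ^ (m + 2)) + B5) :=
      mul_le_mul_of_nonneg_left q5 hL
    have e9 : K * -((m + 1) * I (s.S ^ m * s.Γ s.S s.W)) = -(K * (m + 1)) * I (s.S ^ m * s.Γ s.S s.W) := by ring
    rw [e9] at e1
    linarith
  have u2 := mul_le_mul_of_nonneg_left u1 (by positivity : (0 : ℝ) ≤ (4 / 3) * (2 * m + 5))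
  have e6 : (4 / 3) * (2 * m + 5) * ((m + 1) / (4 * (2 * m + 5)) * I (s.S ^ m * s.Γ s.S s.S))
    = (m + 1) / 3 * I (s.S ^ m * s.Γ s.S s.S) := by field_simp
  have u3 := mul_le_mul_of_nonneg_left q6 hM0.le
  have e7 : M * (1 / (8 * n * M) * I (s.S ^ (m + 3))) = 1 / (8 * n) * I (s.S ^ (m + 3)) := by field_simp
  have u4 : 1 / (4 * n) * I (s.S ^ (m + 3)) ≤ 1 / 4 * I (s.S ^ (m + 1) * s.ip s.Q s.Q) := by
    rw [div_mul_eq_mul_div, one_mul, div_le_iff₀ (by positivity)]; linarith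
  have g1 : 0 ≤ (m + 1) / 6 * I (s.S ^ m * s.Γ s.S s.S) := by positivity
  have u5 : 1 / (8 * n) * I (s.S ^ (m + 3)) ≤ (4 / 3) * (2 * m + 5) *
      ((4 * N) ^ (m + 1) * B1 + N * (B2 + B3 + B4) + L * B5) + M * B6 := by
    have e8 : 1 / (4 * n) * I (s.S ^ (m + 3)) = 1 / (8 * n) * I (s.S ^ (m + 3)) + 1 / (8 * n) * I (s.S ^ (m + 3)) := by
      field_simp; ring
    rw [mul_add M, e7] at u3
    rw [mul_add ((4 / 3) * (2 * (m : ℝ) + 5)), mul_add ((4 / 3) * (2 * (m : ℝ) + 5)), e6, ← mul_assoc _ (2 * N + L), ← hM] at u2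
    have e10 : (4 / 3) * (2 * (m : ℝ) + 5) * (3 / 4 * I (s.S ^ (m + 1) * s.J)) =
      (2 * m + 5) * I (s.S ^ (m + 1) * s.J) := by ring
    rw [e10] at u2
    linarith
  rwa [div_mul_eq_mul_div, one_mul, div_le_iff₀ (by positivity), mul_comm _ (8 * (n : ℝ))] at u5

lemma lq_S [NeZero n] (A0 : T ℝ n) : LQ fun s : Sol A0 => s.S :=
  LQ.of_pow_add_three (fun s => s.S_nonneg) (moment_S A0)

lemma lq_dx_H [NeZero n] (A0 : T ℝ n) (a i j) : LQ fun s : Sol A0 => dx a (s.H i j) := by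
  refine ((lq_S A0).mul ((lq_Tr A0).pow 3)).of_sq_le fun s x => ?_
  have h := s.ip3_psd.cs x s.C fun k => if k = a then Matrix.single i j 1 else 0
  have e1 : (s.ip3 s.C fun k => if k = a then Matrix.single i j 1 else 0) = - dx a (s.H i j) := by
    rw [s.ip3_apply, s.dx_eq, Finset.sum_comm]
    rw [Finset.sum_eq_single a (fun k _ hk => Finset.sum_eq_zero fun i _ => by simp [hk]) (by simp)]
    rw [← Finset.sum_neg_distrib]
    refine Finset.sum_congr rfl fun k _ => ?_
    rw [if_pos rfl, s.ip_apply]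
    have h := congrFun (congrFun (s.dH_D k) i) j
    rw [Matrix.map_apply, Matrix.neg_apply] at h
    rw [h, mul_neg, neg_neg, s.Hsymm k a]
    congr 1
    simp [Matrix.mul_apply, Matrix.trace, Matrix.single_apply, Finset.sum_mul, ite_and]
  have e2 : (s.ip3 (fun k => if k = a then Matrix.single i j 1 else 0)
      fun k => if k = a then Matrix.single i j 1 else 0) = s.H a a * (s.H i i * s.H j j) := by
    rw [s.ip3_apply]
    rw [Finset.sum_eq_single a (fun k _ hk => Finset.sum_eq_zero fun i _ => by simp [hk]) (by simp),
      Finset.sum_eq_single a (fun k _ hk => by simp [hk]) (by simp), if_pos rfl, s.ip_apply]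
    congr 1
    simp [Matrix.mul_apply, Matrix.trace, Matrix.single_apply, ite_and]
  rw [e1, e2, map_neg, neg_sq] at h
  refine h.trans ?_
  have hT := s.Tr_nonneg x
  have hb := fun i => s.abs_H_le x i i
  have h3 : ev x (s.H a a * (s.H i i * s.H j j)) ≤ ev x (s.Tr ^ 3) := by
    refine (le_abs_self _).trans ?_
    rw [map_mul, map_mul, abs_mul, abs_mul, map_pow, pow_succ', sq]
    exact mul_le_mul (hb a) (mul_le_mul (hb i) (hb j) (abs_nonneg _) hT) (by positivity) hT
  rw [map_mul]
  exact mul_le_mul_of_nonneg_left h3 (s.S_nonneg x)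

end Sol

end Abreu

namespace Abreu
open Set Filter Topology
open scoped ContDiff

variable {n : ℕ} {ι : Type*}

/-- Componentwise partial derivative. -/
noncomputable def dv (i : Fin n) : (ι → T ℝ n) →ₗ[ℝ] (ι → T ℝ n) := (dx i : T ℝ n →ₗ[ℝ] T ℝ n).compLeft ι

lemma dv_apply (i : Fin n) (f : ι → T ℝ n) (c) : dv i f c = dx i (f c) := rfl

lemma dv_comm (i j : Fin n) (f : ι → T ℝ n) : dv i (dv j f) = dv j (dv i f) :=
  funext fun c => dx_comm i j (f c)

/-- Iterated partial derivative along a list of indices. -/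
noncomputable def dw : List (Fin n) → T ℝ n →ₗ[ℝ] T ℝ n
  | [] => LinearMap.id
  | i :: w => (dw w).comp (dx i : T ℝ n →ₗ[ℝ] T ℝ n)

@[simp] lemma dw_nil (f : T ℝ n) : dw [] f = f := rfl
lemma dw_cons (i : Fin n) (w) (f : T ℝ n) : dw (i :: w) f = dw w (dx i f) := rfl
lemma dw_dx (i : Fin n) (w) (f : T ℝ n) : dw w (dx i f) = dx i (dw w f) := by
  induction w generalizing f with
  | nil => rfl
  | cons j w ih => rw [dw_cons, dw_cons, dx_comm, ih]
lemma dw_append (u w : List (Fin n)) (f : T ℝ n) : dw (u ++ w) f = dw w (dw u f) := by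
  induction u generalizing f with
  | nil => rfl
  | cons j u ih => rw [List.cons_append, dw_cons, dw_cons, ih]

lemma I_dw_mul (w : List (Fin n)) (f g : T ℝ n) : I (dw w f * g) = (-1) ^ w.length * I (f * dw w g) := by
  induction w generalizing f g with
  | nil => simp
  | cons i w ih =>
    rw [dw_cons, ih, dw_cons, dw_dx, List.length_cons, pow_succ, I_parts]
    ring

variable [Fintype ι]

/-- Pointwise inner product of the tensors of `j`-th order partial derivatives. -/
noncomputable def bl : ℕ → (ι → T ℝ n) →ₗ[ℝ] (ι → T ℝ n) →ₗ[ℝ] T ℝ n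
  | 0 => ∑ c, (LinearMap.mul ℝ (T ℝ n)).compl₁₂ (LinearMap.proj c) (LinearMap.proj c)
  | j + 1 => ∑ i, (bl j).compl₁₂ (dv i) (dv i)

lemma bl_zero (f g : ι → T ℝ n) : bl 0 f g = ∑ c, f c * g c := by simp [bl]
lemma bl_succ (j) (f g : ι → T ℝ n) : bl (j + 1) f g = ∑ i, bl j (dv i f) (dv i g) := by simp [bl]

lemma bl_psd (j) : IsPSD (bl j : (ι → T ℝ n) →ₗ[ℝ] (ι → T ℝ n) →ₗ[ℝ] T ℝ n) := by
  induction j with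
  | zero =>
    refine ⟨fun X Y => ?_, fun x X => ?_⟩
    · simp only [bl_zero, mul_comm]
    · simp only [bl_zero, map_sum, map_mul]
      exact Finset.sum_nonneg fun c _ => mul_self_nonneg _
  | succ j ih =>
    refine ⟨fun X Y => ?_, fun x X => ?_⟩
    · simp only [bl_succ, ih.symm]
    · simp only [bl_succ, map_sum]
      exact Finset.sum_nonneg fun c _ => ih.nonneg _ _

lemma dx_bl (j i) (f g : ι → T ℝ n) : dx i (bl j f g) = bl j (dv i f) g + bl j f (dv i g) := by
  induction j generalizing f g with
  | zero => simp only [bl_zero, map_sum, dx_mul, ← Finset.sum_add_distrib, dv_apply]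
  | succ j ih => simp only [bl_succ, map_sum, ih, ← Finset.sum_add_distrib, dv_comm i]

lemma bl_dv_le (j i x) (f : ι → T ℝ n) : ev x (bl j (dv i f) (dv i f)) ≤ ev x (bl (j + 1) f f) := by
  rw [bl_succ, map_sum]
  exact Finset.single_le_sum (f := fun i => ev x (bl j (dv i f) (dv i f)))
    (fun i _ => (bl_psd j).nonneg x _) (Finset.mem_univ i)

lemma sq_dw_le (w : List (Fin n)) (x) (f : ι → T ℝ n) (c) :
    ev x (dw w (f c)) ^ 2 ≤ ev x (bl w.length f f) := by
  induction w generalizing f with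
  | nil =>
    rw [List.length_nil, bl_zero, map_sum, dw_nil, sq, ← map_mul]
    exact Finset.single_le_sum (f := fun i => ev x (f i * f i))
      (fun i _ => by rw [map_mul]; exact mul_self_nonneg _) (Finset.mem_univ c)
  | cons i w ih => exact (ih (dv i f)).trans (bl_dv_le _ i x f)

lemma bl_eq_sum (j) (f : ι → T ℝ n) :
    bl j f f = ∑ w : Fin j → Fin n, ∑ c, dw (List.ofFn w) (f c) ^ 2 := by
  induction j generalizing f with
  | zero => simp [bl_zero, sq]
  | succ j ih =>
    rw [bl_succ, ← (Fin.consEquiv fun _ => Fin n).sum_comp, Fintype.sum_prod_type]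
    refine Finset.sum_congr rfl fun i _ => (ih _).trans (Finset.sum_congr rfl fun w _ => ?_)
    simp [Fin.consEquiv, List.ofFn_succ, dw_cons, dv_apply]

lemma one_add_bl_pos (j) (f : ι → T ℝ n) (x) : 0 < ev x (1 + bl j f f) := by
  rw [map_add, map_one]; linarith [(bl_psd j).nonneg x f]

/-- Logarithm of the (regularised) size of the `j`-th derivatives. -/
noncomputable def lb (j : ℕ) (f : ι → T ℝ n) : T ℝ n := (1 / 2 : ℝ) • logT (1 + bl j f f) (one_add_bl_pos j f)

lemma lb_nonneg (j) (f : ι → T ℝ n) (x) : 0 ≤ ev x (lb j f) := by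
  rw [lb, ev_smul, ev_logT, map_add, map_one]
  exact mul_nonneg (by norm_num) (Real.log_nonneg (by linarith [(bl_psd j).nonneg x f]))

lemma exp_lb_sq (j) (f : ι → T ℝ n) (x) : Real.exp (ev x (lb j f)) ^ 2 = 1 + ev x (bl j f f) := by
  rw [lb, ev_smul, ev_logT, ← Real.exp_nat_mul, Nat.cast_ofNat, ← mul_assoc, mul_one_div_cancel two_ne_zero,
    one_mul, Real.exp_log (one_add_bl_pos j f x), map_add, map_one]

lemma bl_le (j) (f : ι → T ℝ n) (x) : ev x (bl j f f) ≤ Real.exp (ev x (lb j f)) ^ 2 := by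
  rw [exp_lb_sq]; linarith

lemma abs_bl_le {j x} {f g : ι → T ℝ n} {a b : ℝ} (ha : 0 ≤ a) (hb : 0 ≤ b) (h1 : ev x (bl j f f) ≤ a ^ 2)
    (h2 : ev x (bl j g g) ≤ b ^ 2) : |ev x (bl j f g)| ≤ a * b := by
  refine abs_le_of_sq_le_sq ?_ (by positivity)
  refine ((bl_psd j).cs x f g).trans ?_
  rw [mul_pow]
  exact mul_le_mul h1 h2 ((bl_psd j).nonneg x g) (by positivity)

lemma abs_bl_dv_le (j i x) (f : ι → T ℝ n) :
    |ev x (bl j f (dv i f))| ≤ Real.exp (ev x (lb j f)) * Real.exp (ev x (lb (j + 1) f)) :=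
  abs_bl_le (Real.exp_pos _).le (Real.exp_pos _).le (bl_le j f x) ((bl_dv_le j i x f).trans (bl_le _ f x))

lemma abs_bl_dv_dv_le (j i x) (f : ι → T ℝ n) :
    |ev x (bl j f (dv i (dv i f)))| ≤ Real.exp (ev x (lb j f)) * Real.exp (ev x (lb (j + 2) f)) :=
  abs_bl_le (Real.exp_pos _).le (Real.exp_pos _).le (bl_le j f x)
    ((bl_dv_le j i x _).trans ((bl_dv_le _ i x f).trans (bl_le _ f x)))

lemma abs_dx_lb_mul_le (j i x) (f : ι → T ℝ n) :
    |ev x (dx i (lb j f))| * Real.exp (ev x (lb j f)) ≤ Real.exp (ev x (lb (j + 1) f)) := by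
  have h := dx_logT i (1 + bl j f f) (one_add_bl_pos j f)
  have h1 : (1 + bl j f f) * dx i (lb j f) = bl j f (dv i f) := by
    rw [lb, Derivation.map_smul, mul_smul_comm, h, map_add, dx_bl, (bl_psd j).symm, Derivation.map_one_eq_zero, zero_add,
      ← two_smul ℝ, smul_smul]
    norm_num
  have h2 := congrArg (ev x) h1
  rw [map_mul, map_add, map_one, ← exp_lb_sq] at h2
  have h3 := abs_bl_dv_le j i x f
  rw [← h2, abs_mul, abs_of_pos (by positivity : 0 < Real.exp (ev x (lb j f)) ^ 2)] at h3
  refine le_of_mul_le_mul_left ?_ (Real.exp_pos (ev x (lb j f)))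
  refine le_trans (le_of_eq ?_) h3
  ring

lemma interpolation (j : ℕ) (f : ι → T ℝ n) {p : ℝ} (hp : 2 ≤ p) :
    I (expT (p • lb (j + 1) f)) ≤ (1 + n * (p - 1)) *
      I (expT (lb j f + (p - 2) • lb (j + 1) f + lb (j + 2) f)) := by
  set φ := expT ((p - 2) • lb (j + 1) f) with hφ
  have e : expT (p • lb (j + 1) f) = φ + ∑ i, φ * bl j (dv i f) (dv i f) := T.ext fun x => by
    rw [← Finset.mul_sum, ← bl_succ, map_add, map_mul, ← mul_one_add, ← exp_lb_sq, hφ, ev_expT, ev_expT,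
      ← Real.exp_nat_mul, ← Real.exp_add, ev_smul, ev_smul]
    congr 1; push_cast; ring
  have h0 : ∀ x, Real.exp (ev x (lb j f)) * ev x φ * Real.exp (ev x (lb (j + 2) f)) =
      ev x (expT (lb j f + (p - 2) • lb (j + 1) f + lb (j + 2) f)) := fun x => by
    rw [hφ, ev_expT, ev_expT, ← Real.exp_add, ← Real.exp_add, map_add, map_add]
  have h1 : I φ ≤ I (expT (lb j f + (p - 2) • lb (j + 1) f + lb (j + 2) f)) := I_mono fun x => by
    rw [hφ, ev_expT, ev_expT, map_add, map_add]
    exact Real.exp_le_exp.mpr (by linarith [lb_nonneg j f x, lb_nonneg (j + 2) f x])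
  have h2 : ∀ i, I (φ * bl j (dv i f) (dv i f)) ≤
      (p - 1) * I (expT (lb j f + (p - 2) • lb (j + 1) f + lb (j + 2) f)) := fun i => by
    have e2 : φ * bl j (dv i f) (dv i f) = dx i (φ * bl j f (dv i f))
        + -(dx i φ * bl j f (dv i f) + φ * bl j f (dv i (dv i f))) := by
      rw [dx_mul, dx_bl]; ring
    rw [e2, map_add, I_dx, zero_add, ← I_smul]
    refine I_mono fun x => ?_
    rw [ev_smul, ← h0, map_neg, map_add]
    have hφ0 : 0 < ev x φ := Real.exp_pos _
    have a1 := abs_bl_dv_dv_le j i x f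
    have a2 := abs_bl_dv_le j i x f
    have a3 := abs_dx_lb_mul_le (j + 1) i x f
    have b1 : |ev x (φ * bl j f (dv i (dv i f)))| ≤
        Real.exp (ev x (lb j f)) * ev x φ * Real.exp (ev x (lb (j + 2) f)) := by
      rw [map_mul, abs_mul, abs_of_pos hφ0]
      linarith [mul_le_mul_of_nonneg_left a1 hφ0.le]
    have b2 : |ev x (dx i φ * bl j f (dv i f))| ≤ (p - 2) *
        (Real.exp (ev x (lb j f)) * ev x φ * Real.exp (ev x (lb (j + 2) f))) := by
      rw [hφ, dx_expT, ← hφ, Derivation.map_smul, map_mul, map_mul, ev_smul, abs_mul, abs_mul, abs_mul, abs_of_pos hφ0,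
        abs_of_nonneg (by linarith : 0 ≤ p - 2)]
      calc _ ≤ ev x φ * ((p - 2) * |ev x (dx i (lb (j + 1) f))|) *
            (Real.exp (ev x (lb j f)) * Real.exp (ev x (lb (j + 1) f))) :=
              mul_le_mul_of_nonneg_left a2 (mul_nonneg hφ0.le (mul_nonneg (by linarith) (abs_nonneg _)))
        _ = ((p - 2) * ev x φ * Real.exp (ev x (lb j f))) *
            (|ev x (dx i (lb (j + 1) f))| * Real.exp (ev x (lb (j + 1) f))) := by ring
        _ ≤ ((p - 2) * ev x φ * Real.exp (ev x (lb j f))) * Real.exp (ev x (lb (j + 2) f)) :=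
              mul_le_mul_of_nonneg_left a3 (mul_nonneg (mul_nonneg (by linarith) hφ0.le) (Real.exp_pos _).le)
        _ = _ := by ring
    have := neg_le_of_abs_le b1
    have := neg_le_of_abs_le b2
    linarith
  rw [e, map_add, map_sum]
  have h3 := Finset.sum_le_sum fun i (_ : i ∈ Finset.univ) => h2 i
  rw [Finset.sum_const, Finset.card_univ, Fintype.card_fin, nsmul_eq_mul] at h3
  linarith

/-- Weighted arithmetic-geometric mean inequality with prescribed small constants. -/
lemma exists_exp_le₃ {a b c C δ ε : ℝ} (ha : 0 < a) (hb : 0 ≤ b) (hc : 0 ≤ c) (h : a + b + c = 1) (hC : 0 < C)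
    (hδ : 0 < δ) (hε : 0 < ε) : ∃ K : ℝ, 0 < K ∧ ∀ x y z : ℝ,
    C * Real.exp (a * x + b * y + c * z) ≤ K * Real.exp x + δ * Real.exp y + ε * Real.exp z := by
  set κ := (Real.log C - b * Real.log δ - c * Real.log ε) / a
  have hκ : a * κ = Real.log C - b * Real.log δ - c * Real.log ε := mul_div_cancel₀ _ ha.ne'
  refine ⟨Real.exp κ, Real.exp_pos _, fun x y z => ?_⟩
  have h1 := Real.geom_mean_le_arith_mean3_weighted ha.le hb hc (Real.exp_pos (κ + x)).le
    (Real.exp_pos (Real.log δ + y)).le (Real.exp_pos (Real.log ε + z)).le h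
  rw [← Real.exp_mul, ← Real.exp_mul, ← Real.exp_mul, ← Real.exp_add, ← Real.exp_add] at h1
  have e : C * Real.exp (a * x + b * y + c * z) =
      Real.exp ((κ + x) * a + (Real.log δ + y) * b + (Real.log ε + z) * c) := by
    conv_lhs => rw [← Real.exp_log hC, ← Real.exp_add]
    congr 1; linarith
  rw [e]
  refine h1.trans ?_
  rw [Real.exp_add κ, Real.exp_add (Real.log δ), Real.exp_add (Real.log ε), Real.exp_log hδ, Real.exp_log hε]
  have f1 : a * (Real.exp κ * Real.exp x) ≤ 1 * (Real.exp κ * Real.exp x) :=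
    mul_le_mul_of_nonneg_right (by linarith) (by positivity)
  have f2 : b * (δ * Real.exp y) ≤ 1 * (δ * Real.exp y) :=
    mul_le_mul_of_nonneg_right (by linarith) (by positivity)
  have f3 : c * (ε * Real.exp z) ≤ 1 * (ε * Real.exp z) :=
    mul_le_mul_of_nonneg_right (by linarith) (by positivity)
  linarith

end Abreu

namespace Abreu
open Set Filter Topology
open scoped ContDiff

variable {n : ℕ}

lemma exists_mul_rpow_le {θ η : ℝ} {k : ℕ} (hθ : 0 ≤ θ) (hk : (1 - θ) * k = 1) (hη : 0 < η) :
    ∃ K : ℝ, 0 < K ∧ ∀ a b : ℝ, 0 < a → 0 < b → a * b ^ θ ≤ η * b + K * a ^ k := by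
  have hk0 : (0 : ℝ) ≤ k := Nat.cast_nonneg k
  have h1 : 0 < 1 - θ := by
    by_contra h
    nlinarith
  obtain ⟨K, hK, h⟩ := exists_exp_le₃ h1 hθ le_rfl (by ring) one_pos hη one_pos
  refine ⟨K + 1, by linarith, fun a b ha hb => ?_⟩
  have h2 := h (k * Real.log a) (Real.log b) (k * Real.log a)
  have e : a ^ k = Real.exp (k * Real.log a) := by rw [Real.exp_nat_mul, Real.exp_log ha]
  rw [Real.exp_log hb, ← e, ← mul_assoc, hk, Real.exp_add, Real.exp_add, one_mul a.log, Real.exp_log ha,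
    zero_mul, Real.exp_zero, mul_comm θ, ← Real.rpow_def_of_pos hb] at h2
  linarith

/-- Interpolation exponents, chosen so that their inverses form an arithmetic progression. -/
noncomputable def ex (N j : ℕ) : ℝ := 8 * (N + 1) / (4 * j + 1)

lemma ex_pos (N j : ℕ) : 0 < ex N j := by rw [ex]; positivity

namespace Pot
variable (s : Pot n)

/-- The entries of the Hessian as a family of functions. -/
noncomputable def hs (c : Fin n × Fin n) : T ℝ n := s.H c.1 c.2

/-- Powers of the size of the derivatives of order `j + 1` of the Hessian. -/
noncomputable def Y (N j : ℕ) : T ℝ n := expT (ex N j • lb (j + 1) s.hs)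

noncomputable def Ψ (N : ℕ) : T ℝ n := ∑ j ∈ Finset.range (N + 1), s.Y N j

lemma Y_pos (N j x) : 0 < ev x (s.Y N j) := Real.exp_pos _

lemma one_le_Y (N j x) : 1 ≤ ev x (s.Y N j) := by
  rw [Y, ev_expT, ev_smul]
  exact Real.one_le_exp (mul_nonneg (ex_pos N j).le (lb_nonneg _ _ x))

lemma Y_le_Ψ {N j : ℕ} (h : j < N + 1) (x) : ev x (s.Y N j) ≤ ev x (s.Ψ N) := by
  rw [Ψ, map_sum]
  exact Finset.single_le_sum (f := fun j => ev x (s.Y N j)) (fun j _ => (s.Y_pos N j x).le) (Finset.mem_range.mpr h)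

lemma one_le_Ψ (N x) : 1 ≤ ev x (s.Ψ N) := (s.one_le_Y N 0 x).trans (s.Y_le_Ψ (Nat.succ_pos N) x)

lemma I_Y_nonneg (N j) : 0 ≤ I (s.Y N j) := I_nonneg fun x => (s.Y_pos N j x).le

lemma exp_lb_le_Ψ {N j : ℕ} (h : j < N + 1) (x) :
    Real.exp (ev x (lb (j + 1) s.hs)) ≤ ev x (s.Ψ N) ^ (ex N j)⁻¹ := by
  have h1 := Real.rpow_le_rpow (s.Y_pos N j x).le (s.Y_le_Ψ h x) (inv_nonneg.mpr (ex_pos N j).le)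
  refine le_trans (le_of_eq ?_) h1
  rw [Y, ev_expT, ← Real.exp_mul, ev_smul, mul_comm (ex N j), mul_assoc, mul_inv_cancel₀ (ex_pos N j).ne', mul_one]

end Pot

/-- Improved interpolation between consecutive orders of differentiation. -/
lemma exists_I_Y_le {N j : ℕ} (h : j + 1 ≤ N) {δ : ℝ} (hδ : 0 < δ) : ∃ K : ℝ, 0 < K ∧ ∀ s : Pot n,
    I (s.Y N (j + 1)) ≤ δ * I (s.Y N (j + 2)) + K * I (s.Y N j) := by
  have hp : 2 ≤ ex N (j + 1) := by
    rw [ex, le_div_iff₀ (by positivity)]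
    have : (j : ℝ) + 1 ≤ N := by exact_mod_cast h
    push_cast; linarith
  have e0 : (ex N j)⁻¹ = (4 * j + 1) / (8 * (N + 1)) := by rw [ex, inv_div]
  have e1 : (ex N (j + 1))⁻¹ = (4 * j + 5) / (8 * (N + 1)) := by rw [ex, inv_div]; push_cast; ring
  have e2 : (ex N (j + 2))⁻¹ = (4 * j + 9) / (8 * (N + 1)) := by rw [ex, inv_div]; push_cast; ring
  have hw : 0 ≤ 1 - 2 * (ex N (j + 1))⁻¹ := by
    have := inv_anti₀ two_pos hp
    linarith
  have hC : 0 < 1 + n * (ex N (j + 1) - 1) := by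
    have : (0 : ℝ) ≤ n * (ex N (j + 1) - 1) := mul_nonneg (Nat.cast_nonneg n) (by linarith)
    linarith
  obtain ⟨K, hK, hx⟩ := exists_exp_le₃ (inv_pos.mpr (ex_pos N j)) hw (inv_pos.mpr (ex_pos N (j + 2))).le
    (by rw [e0, e1, e2]; field_simp; ring) hC one_half_pos (half_pos hδ)
  refine ⟨2 * K, by positivity, fun s => ?_⟩
  have h1 := interpolation j.succ s.hs hp
  rw [← I_smul] at h1
  have h2 : I ((1 + n * (ex N (j + 1) - 1)) • expT (lb (j + 1) s.hs + (ex N (j + 1) - 2) • lb (j + 2) s.hs + lb (j + 3) s.hs))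
      ≤ I (K • s.Y N j + (1 / 2 : ℝ) • s.Y N (j + 1) + (δ / 2) • s.Y N (j + 2)) := I_mono fun x => by
    have := hx (ex N j * ev x (lb (j + 1) s.hs)) (ex N (j + 1) * ev x (lb (j + 2) s.hs))
      (ex N (j + 2) * ev x (lb (j + 3) s.hs))
    rw [inv_mul_cancel_left₀ (ex_pos N j).ne', inv_mul_cancel_left₀ (ex_pos N (j + 2)).ne', sub_mul,
      mul_assoc 2, inv_mul_cancel_left₀ (ex_pos N (j + 1)).ne', one_mul, ← sub_mul] at this
    simpa only [map_add, ev_smul, ev_expT, Pot.Y] using this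
  have h3 := h1.trans h2
  rw [map_add, map_add, I_smul, I_smul, I_smul] at h3
  change I (s.Y N (j + 1)) ≤ _ at h3
  linarith

namespace Sol
variable [NeZero n]

lemma exists_I_Y_zero_le (A0 : T ℝ n) (N : ℕ) : ∃ K : ℝ, ∀ s : Sol A0, I (s.Y N 0) ≤ K := by
  have h : LQ fun s : Sol A0 => 1 + bl 1 s.hs s.hs := by
    refine (LQ.const 1).add ?_
    simp only [bl_succ, bl_zero, dv_apply]
    exact LQ.sum _ fun i => LQ.sum _ fun c => (lq_dx_H A0 i c.1 c.2).mul (lq_dx_H A0 i c.1 c.2)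
  obtain ⟨K, hK⟩ := h.moment (4 * (N + 1))
  refine ⟨K, fun s => (le_of_eq ?_).trans (abs_le.mp (hK s)).2⟩
  congr 1
  refine T.ext fun x => ?_
  rw [Pot.Y, ev_expT, ev_smul, map_pow, map_add, map_one, ← exp_lb_sq, ← pow_mul, ← Real.exp_nat_mul, ex]
  congr 1; push_cast; ring

lemma exists_I_Y_le_succ (A0 : T ℝ n) {N j : ℕ} (h : j ≤ N) : ∀ {δ : ℝ}, 0 < δ → ∃ K : ℝ, ∀ s : Sol A0,
    I (s.Y N j) ≤ δ * I (s.Y N (j + 1)) + K := by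
  induction j with
  | zero =>
    intro δ hδ
    obtain ⟨K, hK⟩ := exists_I_Y_zero_le A0 N
    exact ⟨K, fun s => (hK s).trans (by linarith [mul_nonneg hδ.le (s.I_Y_nonneg N 1)])⟩
  | succ j ih =>
    intro δ hδ
    obtain ⟨K, hK, h1⟩ := exists_I_Y_le (n := n) h (half_pos hδ)
    obtain ⟨K', h2⟩ := ih (by omega) (by positivity : 0 < 1 / (2 * K))
    refine ⟨2 * K * K', fun s => ?_⟩
    have h3 := h1 s.toPot
    have h4 := mul_le_mul_of_nonneg_left (h2 s) hK.le
    have e : K * (1 / (2 * K) * I (s.Y N (j + 1)) + K') = 1 / 2 * I (s.Y N (j + 1)) + K * K' := by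
      field_simp
    rw [e] at h4
    linarith

lemma exists_I_Y_le_top (A0 : T ℝ n) {N j : ℕ} (h : j ≤ N + 1) : ∃ K : ℝ, ∀ s : Sol A0,
    I (s.Y N j) ≤ I (s.Y N (N + 1)) + K := by
  induction h using Nat.decreasingInduction with
  | self => exact ⟨0, fun s => by simp⟩
  | of_succ k hk ih =>
    obtain ⟨K, hK⟩ := ih
    obtain ⟨K', hK'⟩ := exists_I_Y_le_succ A0 (Nat.lt_succ_iff.mp hk) one_pos
    exact ⟨K + K', fun s => by linarith [hK s, hK' s]⟩

lemma exists_I_Ψ_le (A0 : T ℝ n) (N : ℕ) : ∃ K : ℝ, ∀ s : Sol A0,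
    I (s.Ψ N) ≤ (N + 1) * I (s.Y N (N + 1)) + K := by
  have h : ∀ j, ∃ K : ℝ, j < N + 1 → ∀ s : Sol A0, I (s.Y N j) ≤ I (s.Y N (N + 1)) + K := fun j => by
    by_cases hj : j < N + 1
    · exact (exists_I_Y_le_top A0 hj.le).imp fun K hK _ => hK
    · exact ⟨0, fun h => absurd h hj⟩
  choose K hK using h
  refine ⟨∑ j ∈ Finset.range (N + 1), K j, fun s => ?_⟩
  rw [Pot.Ψ, map_sum]
  refine (Finset.sum_le_sum fun j hj => hK j (Finset.mem_range.mp hj) s).trans (le_of_eq ?_)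
  rw [Finset.sum_add_distrib, Finset.sum_const, Finset.card_range, nsmul_eq_mul]
  push_cast; ring

end Sol

end Abreu

namespace Abreu
open Set Filter Topology
open scoped ContDiff

variable {n : ℕ}

namespace Pot
variable (s : Pot n)

/-- Commutator terms in the derivatives of the inverse Hessian. -/
noncomputable def ρ (w : List (Fin n)) : Matrix (Fin n) (Fin n) (T ℝ n) :=
  s.G.map (dw w) + s.G * s.H.map (dw w) * s.G

lemma map_dw_cons (X : Matrix (Fin n) (Fin n) (T ℝ n)) (i w) :
    X.map (dw (i :: w)) = (X.map (dw w)).map (dx i) := by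
  ext1 a b; exact dw_dx i w _

lemma ρ_cons (i w) : s.ρ (i :: w) = (s.ρ w).map (dx i) -
    (s.G.map (dx i) * s.H.map (dw w) * s.G + s.G * s.H.map (dw w) * s.G.map (dx i)) := by
  rw [ρ, map_dw_cons, map_dw_cons, ρ]
  have e : ∀ X Y : Matrix (Fin n) (Fin n) (T ℝ n), (X + Y).map (dx i) = X.map (dx i) + Y.map (dx i) :=
    fun X Y => by ext1 a b; exact map_add (dx i) _ _
  rw [e, map_derivation_mul, map_derivation_mul]
  noncomm_ring

end Pot

/-- Differential polynomials in the entries of the Hessian and its inverse: `Mon m r f` says that every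
monomial of `f` has total order `m` and contains at least `r` differentiated factors. -/
inductive Mon {σ : Type*} (u : σ → Pot n) : ℕ → ℕ → (σ → T ℝ n) → Prop
  | G (a b) : Mon u 0 0 fun s => (u s).G a b
  | dH (w : List (Fin n)) (hw : w ≠ []) (c) : Mon u w.length 1 fun s => dw w ((u s).hs c)
  | sum {m r} {f : Fin n → σ → T ℝ n} (t : Finset (Fin n)) (h : ∀ i, Mon u m r (f i)) : r ≤ m → Mon u m r fun s => ∑ i ∈ t, f i s
  | add {m r f g} : Mon u m r f → Mon u m r g → Mon u m r fun s => f s + g s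
  | neg {m r f} : Mon u m r f → Mon u m r fun s => -f s
  | mul {m r m' r' f g} : Mon u m r f → Mon u m' r' g → Mon u (m + m') (r + r') fun s => f s * g s
  | weaken {m r f} : Mon u m (r + 1) f → Mon u m r f

namespace Mon
variable {σ : Type*} {u : σ → Pot n} {m r : ℕ} {f : σ → T ℝ n}

lemma le (h : Mon u m r f) : r ≤ m := by
  induction h with
  | G a b => exact le_rfl
  | dH w hw c => exact List.length_pos_iff.mpr hw
  | sum t h hr ih => exact hr
  | add hf hg ihf ihg => exact ihf
  | neg hf ih => exact ih
  | mul hf hg ihf ihg => exact add_le_add ihf ihg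
  | weaken hf ih => omega

lemma dx_G (i a b) : Mon u 1 1 fun s => dx i ((u s).G a b) := by
  have h : (fun s => dx i ((u s).G a b)) = fun s => -∑ c, ∑ d, (u s).G a c * dw [i] ((u s).hs (c, d)) * (u s).G d b := by
    funext s
    have := congrFun (congrFun ((u s).dG (dx i)) a) b
    rw [Matrix.map_apply, Matrix.neg_apply, mul_apply] at this
    simp only [mul_apply, Finset.sum_mul] at this
    rw [this, Finset.sum_comm]
    rfl
  rw [h]
  exact (Mon.sum _ (fun c => Mon.sum _ (fun d => ((Mon.G a c).mul (.dH [i] (by simp) (c, d))).mul (.G d b)) le_rfl) le_rfl).neg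

lemma dx (i) (h : Mon u m r f) : Mon u (m + 1) r fun s => dx i (f s) := by
  induction h with
  | G a b => exact (dx_G i a b).weaken
  | dH w hw c =>
    have := Mon.dH (u := u) (i :: w) (by simp) c
    simp only [dw_cons, dw_dx, List.length_cons] at this
    exact this
  | sum t h hr ih => simpa only [map_sum] using Mon.sum t ih (by omega)
  | add hf hg ihf ihg => simpa only [map_add] using ihf.add ihg
  | neg hf ih => simpa only [map_neg] using ih.neg
  | @mul m r m' r' f g hf hg ihf ihg =>
    simp only [dx_mul]
    have h1 := ihf.mul hg
    have h2 := hf.mul ihg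
    rw [show m + 1 + m' = m + m' + 1 by omega] at h1
    simpa only [add_comm] using h1.add h2
  | weaken hf ih => exact ih.weaken

lemma mul_entries {w : List (Fin n)} (hw : w ≠ []) (i a b) :
    Mon u (w.length + 1) 2 fun s => ((u s).G.map (Abreu.dx i) * (u s).H.map (dw w) * (u s).G) a b +
      ((u s).G * (u s).H.map (dw w) * (u s).G.map (Abreu.dx i)) a b := by
  have hl := List.length_pos_iff.mpr hw
  simp only [mul_apply, Finset.sum_mul]
  have e1 : 1 + w.length + 0 = w.length + 1 := by omega
  have e2 : 0 + w.length + 1 = w.length + 1 := by omega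
  refine .add ?_ ?_
  · refine .sum _ (fun c => .sum _ (fun d => ?_) (by omega)) (by omega)
    exact e1 ▸ ((dx_G i a d).mul (.dH w hw (d, c))).mul (.G c b)
  · refine .sum _ (fun c => .sum _ (fun d => ?_) (by omega)) (by omega)
    exact e2 ▸ ((Mon.G a d).mul (.dH w hw (d, c))).mul (dx_G i c b)

lemma ρ (w : List (Fin n)) : w ≠ [] → ∀ a b, (∀ s, (u s).ρ w a b = 0) ∨ Mon u w.length 2 fun s => (u s).ρ w a b := by
  induction w with
  | nil => exact fun h => absurd rfl h
  | cons i w ih =>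
    intro _ a b
    by_cases hw : w = []
    · subst hw
      refine .inl fun s => ?_
      have := congrFun (congrFun ((u s).dG (Abreu.dx i)) a) b
      rw [Pot.ρ, Matrix.add_apply]
      exact (eq_neg_iff_add_eq_zero.mp this)
    · refine .inr ?_
      have h1 := (mul_entries (u := u) hw i a b).neg
      simp only [List.length_cons, Pot.ρ_cons, Matrix.sub_apply, Matrix.map_apply, Matrix.add_apply (_ * _ * _)]
      rcases ih hw a b with h | h
      · simpa only [h, map_zero, zero_sub] using h1
      · simpa only [sub_eq_add_neg] using (h.dx i).add h1

end Mon

namespace Sol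
variable [NeZero n]

/-- Differential polynomials are controlled by the size of the lower order derivatives. -/
lemma exists_mon_bound (A0 : T ℝ n) (N : ℕ) {m r : ℕ} {f : Sol A0 → T ℝ n} (h : Mon Sol.toPot m r f)
    (hm : m < N + 2 ∨ m = N + 2 ∧ 2 ≤ r) : ∃ c : Sol A0 → T ℝ n, LQ c ∧ (∀ s x, 0 ≤ ev x (c s)) ∧
      ∀ s x, |ev x (f s)| ≤ ev x (c s) * ev x (s.Ψ N) ^ ((4 * m - 3 * r) / (8 * (N + 1)) : ℝ) := by
  have hN : (0 : ℝ) < 8 * (N + 1) := by positivity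
  have h0 : ∀ (s : Sol A0) x, 0 < ev x (s.Ψ N) := fun s x => one_pos.trans_le (s.one_le_Ψ N x)
  induction h with
  | G a b =>
    exact ⟨fun s => s.P, lq_P A0, fun s => s.P_nonneg, fun s x => by simpa using s.abs_G_le x a b⟩
  | dH w hw c =>
    refine ⟨fun _ => 1, LQ.const 1, fun s x => by simp, fun s x => ?_⟩
    obtain ⟨j, hj⟩ := Nat.exists_eq_succ_of_ne_zero (List.length_pos_iff.mpr hw).ne'
    rw [map_one, one_mul]
    have h1 : |ev x (dw w (s.hs c))| ≤ Real.exp (ev x (lb (j + 1) s.hs)) := by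
      refine abs_le_of_sq_le_sq ((sq_dw_le w x s.hs c).trans ?_) (Real.exp_pos _).le
      rw [hj]; exact bl_le _ _ _
    refine h1.trans ((s.exp_lb_le_Ψ (N := N) (by omega) x).trans (le_of_eq ?_))
    rw [ex, inv_div, hj]
    congr 2; push_cast; ring
  | sum t h hr ih =>
    choose c hc h1 h2 using fun i => ih i hm
    refine ⟨fun s => ∑ i ∈ t, c i s, LQ.sum t hc, fun s x => ?_, fun s x => ?_⟩
    · rw [map_sum]; exact Finset.sum_nonneg fun i _ => h1 i s x
    · rw [map_sum, map_sum, Finset.sum_mul]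
      exact (Finset.abs_sum_le_sum_abs _ _).trans (Finset.sum_le_sum fun i _ => h2 i s x)
  | add hf hg ihf ihg =>
    obtain ⟨c, hc, h1, h2⟩ := ihf hm
    obtain ⟨c', hc', h1', h2'⟩ := ihg hm
    refine ⟨fun s => c s + c' s, hc.add hc', fun s x => ?_, fun s x => ?_⟩
    · rw [map_add]; exact add_nonneg (h1 s x) (h1' s x)
    · rw [map_add, map_add, add_mul]
      exact (abs_add_le _ _).trans (add_le_add (h2 s x) (h2' s x))
  | neg hf ih =>
    obtain ⟨c, hc, h1, h2⟩ := ih hm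
    exact ⟨c, hc, h1, fun s x => by rw [map_neg, abs_neg]; exact h2 s x⟩
  | @mul m r m' r' f g hf hg ihf ihg =>
    have hl := hf.le
    have hl' := hg.le
    obtain ⟨c, hc, h1, h2⟩ := ihf (by omega)
    obtain ⟨c', hc', h1', h2'⟩ := ihg (by omega)
    refine ⟨fun s => c s * c' s, hc.mul hc', fun s x => ?_, fun s x => ?_⟩
    · rw [map_mul]; exact mul_nonneg (h1 s x) (h1' s x)
    · rw [map_mul, map_mul, abs_mul]
      refine (mul_le_mul (h2 s x) (h2' s x) (abs_nonneg _)
        (mul_nonneg (h1 s x) (Real.rpow_nonneg (h0 s x).le _))).trans (le_of_eq ?_)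
      rw [mul_mul_mul_comm, ← Real.rpow_add (h0 s x)]
      congr 2; push_cast; ring
  | @weaken m r f hf ih =>
    obtain ⟨c, hc, h1, h2⟩ := ih (by omega)
    refine ⟨c, hc, h1, fun s x => (h2 s x).trans (mul_le_mul_of_nonneg_left ?_ (h1 s x))⟩
    refine Real.rpow_le_rpow_of_exponent_le (s.one_le_Ψ N x) ?_
    gcongr; linarith

end Sol

end Abreu

namespace Abreu
open Set Filter Topology
open scoped ContDiff

variable {n : ℕ}

namespace Pot
variable (s : Pot n)

/-- Energy density of the derivative of the Hessian along `w`. -/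
noncomputable def q (w : List (Fin n)) : T ℝ n :=
  s.ip (s.G * s.H.map (dw w) * s.G) (s.G * s.H.map (dw w) * s.G)

lemma q_nonneg (w x) : 0 ≤ ev x (s.q w) := s.ip_psd.nonneg x _

lemma q_eq (w) : s.q w = (s.G * s.H.map (dw w) * s.G * (s.H.map (dw w))ᵀ).trace := by
  rw [q, ip_apply, transpose_mul, transpose_mul, s.Gt]
  have e : s.H * (s.G * s.H.map (dw w) * s.G) * s.H * (s.G * ((s.H.map (dw w))ᵀ * s.G)) =
    s.H * s.G * s.H.map (dw w) * s.G * (s.H * s.G) * (s.H.map (dw w))ᵀ * s.G := by noncomm_ring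
  rw [e, s.HG, Matrix.trace_mul_comm]
  simp only [one_mul, mul_one, Matrix.mul_assoc]

lemma sq_dw_H_le (w x a b) : ev x (dw w (s.H a b)) ^ 2 ≤ ev x s.Tr ^ 2 * ev x (s.q w) := by
  have h := s.ip_psd.cs x (s.G * s.H.map (dw w) * s.G) (Matrix.single a b 1)
  have e1 : s.ip (s.G * s.H.map (dw w) * s.G) (Matrix.single a b 1) = dw w (s.H a b) := by
    have e : s.H * (s.G * s.H.map (dw w) * s.G) * s.H = s.H * s.G * s.H.map (dw w) * (s.G * s.H) := by noncomm_ring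
    rw [ip_apply, e, s.HG, s.GH, one_mul, mul_one]
    simp [Matrix.mul_apply, Matrix.trace, Matrix.single_apply, ite_and]
  have e2 : s.ip (Matrix.single a b 1) (Matrix.single a b 1) = s.H a a * s.H b b := by
    rw [ip_apply]
    simp [Matrix.mul_apply, Matrix.trace, Matrix.single_apply, ite_and]
  rw [e1, e2] at h
  refine h.trans ?_
  rw [mul_comm]
  refine mul_le_mul_of_nonneg_right ?_ (s.q_nonneg w x)
  refine (le_abs_self _).trans ?_
  rw [map_mul, abs_mul, sq]
  exact mul_le_mul (s.abs_H_le x a a) (s.abs_H_le x b b) (abs_nonneg _) (s.Tr_nonneg x)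

lemma sum_dw_mul (w) : ∑ a, ∑ b, dw w (s.G a b) * dw w (s.H a b) =
    ∑ a, ∑ b, s.ρ w a b * dw w (s.H a b) - s.q w := by
  rw [q_eq, ← sum_mul_eq_trace, ← Finset.sum_sub_distrib]
  refine Finset.sum_congr rfl fun a _ => ?_
  rw [← Finset.sum_sub_distrib]
  refine Finset.sum_congr rfl fun b _ => ?_
  rw [ρ, Matrix.add_apply, Matrix.map_apply, Matrix.map_apply]
  ring

lemma I_sum_dw_mul {w : List (Fin n)} (hw : w ≠ []) : I (∑ a, ∑ b, dw w (s.G a b) * dw w (s.H a b)) =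
    (-1) ^ w.length * I (s.φ * dw (w ++ w) s.A) := by
  have h1 : ∀ a b, dw w (s.H a b) = dx a (dx b (dw w s.φ)) := fun a b => by
    rw [H_apply, map_add, dw_dx, dw_dx]
    obtain ⟨i, w, rfl⟩ := List.exists_cons_of_ne_nil hw
    rw [dw_cons, one_apply]
    split_ifs <;> simp
  have h2 : ∀ a b, I (dw w (s.G a b) * dw w (s.H a b)) = I (dw w (dx a (dx b (s.G a b))) * dw w s.φ) := fun a b => by
    rw [h1, I_parts, ← dw_dx, I_parts, neg_neg, ← dw_dx, dx_comm]
  simp only [map_sum, h2]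
  simp only [← map_sum, ← Finset.sum_mul]
  have hA : s.A = ∑ a, dx a (∑ b, dx b (s.G a b)) := by simp only [A, map_sum]
  rw [← hA, mul_comm, I_dw_mul, dw_append]

lemma I_q_le (w) (hn : 0 < n) : I (s.q w) ≤ n ^ 2 * ∑ a, ∑ b, I ((s.ρ w a b * s.Tr) ^ 2)
    - 2 * I (∑ a, ∑ b, dw w (s.G a b) * dw w (s.H a b)) := by
  have hn' : (0 : ℝ) < n := by exact_mod_cast hn
  have h : ∀ a b, I (s.ρ w a b * dw w (s.H a b)) ≤ (n : ℝ) ^ 2 / 2 * I ((s.ρ w a b * s.Tr) ^ 2)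
      + 1 / (2 * n ^ 2) * I (s.q w) := fun a b => by
    rw [← I_smul, ← I_smul, ← map_add]
    refine I_mono fun x => ?_
    have h1 : ev x (s.ρ w a b * dw w (s.H a b)) ^ 2 ≤ ev x ((s.ρ w a b * s.Tr) ^ 2) * ev x (s.q w) := by
      rw [map_pow, map_mul, map_mul, mul_pow, mul_pow, mul_assoc]
      exact mul_le_mul_of_nonneg_left (s.sq_dw_H_le w x a b) (sq_nonneg _)
    have h2 := (abs_le.mp (abs_two_mul_le h1 (by rw [map_pow]; exact sq_nonneg _) (s.q_nonneg w x) (n ^ 2))).2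
    rw [map_add, ev_smul, ev_smul]
    refine le_of_mul_le_mul_left (h2.trans (le_of_eq ?_)) (by positivity : 0 < 2 * (n : ℝ) ^ 2)
    field_simp
  have h3 := Finset.sum_le_sum fun a (_ : a ∈ Finset.univ) => Finset.sum_le_sum fun b (_ : b ∈ Finset.univ) => h a b
  simp only [Finset.sum_add_distrib, ← Finset.mul_sum, Finset.sum_const, Finset.card_univ, Fintype.card_fin,
    nsmul_eq_mul] at h3
  rw [s.sum_dw_mul, map_sub]
  simp only [map_sum]
  have e : 1 / (2 * (n : ℝ) ^ 2) * (n * (n * I (s.q w))) = 1 / 2 * I (s.q w) := by field_simp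
  rw [e] at h3
  linarith

end Pot

namespace Sol
lemma exists_I_sum_dw_mul (A0 : T ℝ n) {w : List (Fin n)} (hw : w ≠ []) : ∃ B : ℝ, ∀ s : Sol A0,
    -I (∑ a, ∑ b, dw w (s.G a b) * dw w (s.H a b)) ≤ B := by
  obtain ⟨C, hC⟩ := bdd_dx_A A0 (dw (w ++ w))
  refine ⟨n * C, fun s => ?_⟩
  rw [s.I_sum_dw_mul hw]
  have h : ‖I (s.φ * dw (w ++ w) s.A)‖ ≤ n * C := norm_I_le fun x => by
    rw [map_mul, norm_mul]
    exact mul_le_mul (s.abs_φ_le x) (hC s x) (abs_nonneg _) (Nat.cast_nonneg n)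
  refine (neg_le_abs _).trans ?_
  rwa [abs_mul, abs_pow, abs_neg, abs_one, one_pow, one_mul, ← Real.norm_eq_abs]

variable [NeZero n]

lemma exists_I_ρ_le (A0 : T ℝ n) {N : ℕ} {w : List (Fin n)} (hw : w.length = N + 2) (a b) {η : ℝ} (hη : 0 < η) :
    ∃ B : ℝ, ∀ s : Sol A0, I ((s.ρ w a b * s.Tr) ^ 2) ≤ η * I (s.Ψ N) + B := by
  have hΨ : ∀ s : Sol A0, 0 ≤ I (s.Ψ N) := fun s => I_nonneg fun x => zero_le_one.trans (s.one_le_Ψ N x)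
  rcases Mon.ρ (u := Sol.toPot (A0 := A0)) w (fun h => by simp [h] at hw) a b with h | h
  · exact ⟨0, fun s => by simp [h s, mul_nonneg hη.le (hΨ s)]⟩
  obtain ⟨c, hc, hc0, hb⟩ := exists_mon_bound A0 N h (.inr ⟨hw, le_rfl⟩)
  have hN : (0 : ℝ) < N + 1 := by positivity
  obtain ⟨K, hK, hy⟩ := exists_mul_rpow_le (θ := (2 * N + 1) / (2 * N + 2)) (k := 2 * N + 2) (η := η) (by positivity)
    (by push_cast; field_simp; ring) hη
  obtain ⟨B, hB⟩ := ((LQ.const 1).add ((hc.mul (lq_Tr A0)).pow 2)).moment (2 * N + 2)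
  refine ⟨K * B, fun s => ?_⟩
  have h1 : I ((s.ρ w a b * s.Tr) ^ 2) ≤ I (η • s.Ψ N + K • (1 + (c s * s.Tr) ^ 2) ^ (2 * N + 2)) := I_mono fun x => by
    have hp := one_pos.trans_le (s.one_le_Ψ N x)
    have h2 := hb s x
    rw [hw] at h2
    have h3 : ev x (s.ρ w a b) ^ 2 ≤ ev x (c s) ^ 2 * ev x (s.Ψ N) ^ ((2 * N + 1) / (2 * N + 2) : ℝ) := by
      rw [← sq_abs]
      refine (pow_le_pow_left₀ (abs_nonneg _) h2 2).trans (le_of_eq ?_)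
      rw [mul_pow, ← Real.rpow_natCast (_ ^ _) 2, ← Real.rpow_mul hp.le]
      congr 2
      push_cast; field_simp; ring
    have h4 := hy (1 + (ev x (c s) * ev x s.Tr) ^ 2) (ev x (s.Ψ N)) (by positivity) hp
    simp only [map_add, ev_smul, map_pow, map_mul, map_one]
    refine le_trans ?_ h4
    rw [mul_pow, mul_pow]
    have h5 := mul_le_mul_of_nonneg_right h3 (sq_nonneg (ev x s.Tr))
    have h6 : 0 ≤ ev x (s.Ψ N) ^ ((2 * N + 1) / (2 * N + 2) : ℝ) := by positivity
    linarith
  rw [map_add, I_smul, I_smul] at h1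
  have h2 := mul_le_mul_of_nonneg_left (abs_le.mp (hB s)).2 hK.le
  linarith

lemma exists_I_q_le (A0 : T ℝ n) {N : ℕ} {w : List (Fin n)} (hw : w.length = N + 2) {η : ℝ} (hη : 0 < η) :
    ∃ B : ℝ, ∀ s : Sol A0, I (s.q w) ≤ η * I (s.Ψ N) + B := by
  have hn : (0 : ℝ) < n := by exact_mod_cast Nat.pos_of_ne_zero (NeZero.ne n)
  choose B hB using fun a b => exists_I_ρ_le A0 hw a b (by positivity : 0 < η / (n ^ 2 * (n * n)))
  obtain ⟨B', hB'⟩ := exists_I_sum_dw_mul A0 (w := w) (fun h => by simp [h] at hw)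
  refine ⟨n ^ 2 * (∑ a, ∑ b, B a b) + 2 * B', fun s => ?_⟩
  have h3 := Finset.sum_le_sum fun a (_ : a ∈ Finset.univ) =>
    Finset.sum_le_sum fun b (_ : b ∈ Finset.univ) => hB a b s
  simp only [Finset.sum_add_distrib, Finset.sum_const, Finset.card_univ, Fintype.card_fin,
    nsmul_eq_mul] at h3
  have h4 := mul_le_mul_of_nonneg_left h3 (by positivity : 0 ≤ (n : ℝ) ^ 2)
  have e : (n : ℝ) ^ 2 * (n * (n * (η / (n ^ 2 * (n * n)) * I (s.Ψ N))) + ∑ a, ∑ b, B a b) =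
    η * I (s.Ψ N) + n ^ 2 * ∑ a, ∑ b, B a b := by field_simp
  rw [e] at h4
  have := s.I_q_le w (Nat.pos_of_ne_zero (NeZero.ne n))
  linarith [hB' s]

lemma exists_Y_top_le (A0 : T ℝ n) (N : ℕ) : ∃ B : ℝ, ∀ s : Sol A0, I (s.Y N (N + 1)) ≤
    n ^ 2 * ∑ w : Fin (N + 2) → Fin n, I (s.q (List.ofFn w)) + B := by
  obtain ⟨K, hK, hy⟩ := exists_mul_rpow_le (θ := (4 * N + 4) / (4 * N + 5)) (k := 4 * N + 5) (η := 1) (by positivity)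
    (by push_cast; field_simp; ring) one_pos
  obtain ⟨B, hB⟩ := ((LQ.const 1).add (lq_Tr A0)).moment (8 * (N + 1))
  refine ⟨1 + K * B, fun s => ?_⟩
  have h1 : I (s.Y N (N + 1)) ≤ I ((1 + (n ^ 2 : ℝ) • ∑ w : Fin (N + 2) → Fin n, s.q (List.ofFn w))
      + K • (1 + s.Tr) ^ (8 * (N + 1))) := I_mono fun x => by
    have hT := s.Tr_nonneg x
    have hq : 0 ≤ ∑ w : Fin (N + 2) → Fin n, ev x (s.q (List.ofFn w)) := Finset.sum_nonneg fun w _ => s.q_nonneg _ x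
    set Z := 1 + (n : ℝ) ^ 2 * ∑ w : Fin (N + 2) → Fin n, ev x (s.q (List.ofFn w)) with hZ
    have hZ0 : 0 < Z := by positivity
    have h2 : ev x (bl (N + 2) s.hs s.hs) ≤ n ^ 2 * (ev x s.Tr ^ 2 * ∑ w : Fin (N + 2) → Fin n, ev x (s.q (List.ofFn w))) := by
      rw [bl_eq_sum, map_sum, Finset.mul_sum, Finset.mul_sum]
      refine Finset.sum_le_sum fun w _ => ?_
      rw [map_sum]
      refine (Finset.sum_le_sum fun c _ => (le_of_eq (map_pow _ _ _)).trans (s.sq_dw_H_le (List.ofFn w) x c.1 c.2)).trans (le_of_eq ?_)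
      rw [Finset.sum_const, Finset.card_univ, Fintype.card_prod, Fintype.card_fin, nsmul_eq_mul]
      push_cast; ring
    have h3 : Real.exp (ev x (lb (N + 2) s.hs)) ^ 2 ≤ (1 + ev x s.Tr) ^ 2 * Z := by
      rw [exp_lb_sq, hZ]
      have h5 : 0 ≤ (n : ℝ) ^ 2 * ∑ w : Fin (N + 2) → Fin n, ev x (s.q (List.ofFn w)) := by positivity
      nlinarith [mul_nonneg h5 hT]
    have h4 := hy ((1 + ev x s.Tr) ^ ex N (N + 1)) Z (by positivity) hZ0
    have h5 : ev x (s.Y N (N + 1)) ≤ (1 + ev x s.Tr) ^ ex N (N + 1) * Z ^ ((4 * N + 4) / (4 * N + 5) : ℝ) := by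
      have h6 := Real.rpow_le_rpow (by positivity) h3 (half_pos (ex_pos N (N + 1))).le
      rw [Real.mul_rpow (by positivity) hZ0.le, ← Real.rpow_natCast, ← Real.rpow_natCast, ← Real.rpow_mul (by positivity),
        ← Real.rpow_mul (by positivity), Nat.cast_ofNat, mul_div_cancel₀ _ (two_ne_zero' ℝ), ← Real.exp_mul] at h6
      rw [Pot.Y, ev_expT, ev_smul, mul_comm (ex N (N + 1))]
      refine h6.trans (le_of_eq ?_)
      congr 2
      rw [ex]; push_cast; field_simp; ring
    have h7 : ((1 + ev x s.Tr) ^ ex N (N + 1)) ^ (4 * N + 5) = (1 + ev x s.Tr) ^ (8 * (N + 1)) := by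
      rw [← Real.rpow_natCast, ← Real.rpow_natCast, ← Real.rpow_mul (by positivity), ex]
      congr 1; push_cast; field_simp; ring
    rw [h7, one_mul] at h4
    simp only [map_add, ev_smul, map_pow, map_one, map_sum]
    exact h5.trans h4
  simp only [map_add, I_smul, I_one, map_sum] at h1
  have h2 := mul_le_mul_of_nonneg_left (abs_le.mp (hB s)).2 hK.le
  linarith

/-- The derivatives of the Hessian of order at least two are bounded in mean. -/
lemma exists_I_exp_lb_le (A0 : T ℝ n) (N : ℕ) : ∃ B : ℝ, ∀ s : Sol A0, I (expT (lb (N + 2) s.hs)) ≤ B := by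
  have hn : (0 : ℝ) < n := by exact_mod_cast Nat.pos_of_ne_zero (NeZero.ne n)
  set k : ℝ := (Fintype.card (Fin (N + 2) → Fin n) : ℝ) with hk
  have hk0 : 0 < k := by
    rw [hk]
    exact Nat.cast_pos.mpr (Fintype.card_pos (α := Fin (N + 2) → Fin n))
  obtain ⟨B1, h1⟩ := exists_Y_top_le A0 N
  choose B2 h2 using fun w : Fin (N + 2) → Fin n => exists_I_q_le A0 (N := N) (w := List.ofFn w) (by simp)
    (by positivity : 0 < 1 / (2 * (N + 1) * (n ^ 2 * k)))
  obtain ⟨B3, h3⟩ := exists_I_Ψ_le A0 N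
  refine ⟨2 * (1 / (2 * (N + 1)) * B3 + n ^ 2 * ∑ w, B2 w + B1), fun s => ?_⟩
  have h4 := Finset.sum_le_sum fun w (_ : w ∈ Finset.univ) => h2 w s
  rw [Finset.sum_add_distrib, Finset.sum_const, Finset.card_univ, nsmul_eq_mul, ← hk] at h4
  have h5 := mul_le_mul_of_nonneg_left h4 (by positivity : 0 ≤ (n : ℝ) ^ 2)
  have e1 : (n : ℝ) ^ 2 * (k * (1 / (2 * (N + 1) * (n ^ 2 * k)) * I (s.Ψ N)) + ∑ w, B2 w) =
    1 / (2 * (N + 1)) * I (s.Ψ N) + n ^ 2 * ∑ w, B2 w := by field_simp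
  rw [e1] at h5
  have h6 := mul_le_mul_of_nonneg_left (h3 s) (by positivity : 0 ≤ 1 / (2 * ((N : ℝ) + 1)))
  have e2 : 1 / (2 * ((N : ℝ) + 1)) * ((N + 1) * I (s.Y N (N + 1)) + B3) = 1 / 2 * I (s.Y N (N + 1)) +
    1 / (2 * (N + 1)) * B3 := by field_simp
  rw [e2] at h6
  have h7 : I (expT (lb (N + 2) s.hs)) ≤ I (s.Y N (N + 1)) := I_mono fun x => by
    rw [Pot.Y, ev_expT, ev_expT, ev_smul]
    refine Real.exp_le_exp.mpr (le_mul_of_one_le_left (lb_nonneg _ _ x) ?_)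
    rw [ex, one_le_div (by positivity)]
    push_cast; linarith [(Nat.cast_nonneg N : (0 : ℝ) ≤ N)]
  linarith [h1 s]

end Sol

end Abreu

namespace Abreu
open Set Filter Topology
open scoped ContDiff

variable {n : ℕ}

/-- The projection of `ℝⁿ` onto the torus. -/
def toTorus (x : Fin n → ℝ) : UnitAddTorus (Fin n) := fun i => (x i : UnitAddCircle)

lemma isQuotientMap_toTorus : IsQuotientMap (toTorus (n := n)) :=
  (IsOpenQuotientMap.piMap fun _ : Fin n => QuotientAddGroup.isOpenQuotientMap_mk).isQuotientMap

lemma Per.eq_of_toTorus_eq {α : Type*} {f : (Fin n → ℝ) → α} (hp : Per f) {a b : Fin n → ℝ}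
    (h : toTorus a = toTorus b) : f a = f b := by
  have h1 : ∀ i, ∃ k : ℤ, a i = b i + k := fun i => by
    have h2 := congrFun h i
    obtain ⟨k, hk⟩ := AddSubgroup.mem_zmultiples_iff.mp (QuotientAddGroup.eq.mp h2)
    exact ⟨-k, by push_cast; simp at hk; linarith⟩
  choose k hk using h1
  rw [← hp b k]
  exact congrArg f (funext hk)

lemma Per.exists_factor {f : (Fin n → ℝ) → ℂ} (hc : Continuous f) (hp : Per f) :
    ∃ F : C(UnitAddTorus (Fin n), ℂ), ∀ x, F (toTorus x) = f x :=
  ⟨isQuotientMap_toTorus.lift (f := ⟨toTorus, isQuotientMap_toTorus.continuous⟩) ⟨f, hc⟩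
    fun _ _ h => hp.eq_of_toTorus_eq h,
    fun x => DFunLike.congr_fun (isQuotientMap_toTorus.lift_comp (f := ⟨toTorus, isQuotientMap_toTorus.continuous⟩)
      ⟨f, hc⟩ fun _ _ h => hp.eq_of_toTorus_eq h) x⟩

/-- The characters of the torus. -/
noncomputable def ek (k : Fin n → ℤ) : T ℂ n :=
  mkT (fun x => Complex.exp (2 * Real.pi * Complex.I * ((∑ i, k i * x i : ℝ) : ℂ)))
    (by
      have h : ContDiff ℝ ∞ fun x : Fin n → ℝ => ∑ i, (k i : ℝ) * x i := ContDiff.sum fun i _ => contDiff_const.mul (contDiff_apply (ι := Fin n) ℝ ℝ i)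
      exact ContDiff.cexp (contDiff_const.mul (Complex.ofRealCLM.contDiff.comp h)))
    (fun x m => by
      refine Complex.exp_eq_exp_iff_exists_int.mpr ⟨∑ i, k i * m i, ?_⟩
      push_cast
      simp only [Pi.add_apply, Complex.ofReal_add, Complex.ofReal_intCast, mul_add, Finset.sum_add_distrib]
      ring)

lemma ev_ek (k : Fin n → ℤ) (x) :
    ev x (ek k) = Complex.exp (2 * Real.pi * Complex.I * ((∑ i, k i * x i : ℝ) : ℂ)) := rfl

lemma mFourier_toTorus (k : Fin n → ℤ) (x) : UnitAddTorus.mFourier k (toTorus x) = ev x (ek k) := by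
  rw [ev_ek]
  simp only [UnitAddTorus.mFourier, ContinuousMap.coe_mk, toTorus, fourier_coe_apply]
  rw [← Complex.exp_sum]
  congr 1
  push_cast
  rw [Finset.mul_sum]
  exact Finset.sum_congr rfl fun i _ => by simp; ring

lemma norm_ev_ek (k : Fin n → ℤ) (x) : ‖ev x (ek k)‖ = 1 := by
  rw [ev_ek, mul_comm, ← mul_assoc, Complex.norm_exp]
  simp

lemma dk_ek (i : Fin n) (k : Fin n → ℤ) : dk ℂ i (ek k) = (2 * Real.pi * Complex.I * k i) • ek k := by
  refine T.ext fun x => ?_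
  have h := hasDerivAt_ev (ek k) x (Pi.single i 1) 0
  simp only [zero_smul, add_zero] at h
  have h1 : ∑ j, (((Pi.single i 1 : Fin n → ℝ) j : ℝ) : ℂ) * ev x (dk ℂ j (ek k)) = ev x (dk ℂ i (ek k)) := by
    rw [Finset.sum_eq_single i] <;> simp +contextual
  have h2 : HasDerivAt (fun t : ℝ => ev (x + t • (Pi.single i 1 : Fin n → ℝ)) (ek k))
      (2 * Real.pi * Complex.I * k i * ev x (ek k)) 0 := by
    have e : (fun t : ℝ => ev (x + t • (Pi.single i 1 : Fin n → ℝ)) (ek k)) = fun t : ℝ =>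
        Complex.exp (2 * Real.pi * Complex.I * k i * (t : ℂ)) * ev x (ek k) := by
      funext t
      rw [ev_ek, ev_ek, ← Complex.exp_add]
      congr 1
      have : ∑ j, (k j : ℝ) * (x + t • (Pi.single i 1 : Fin n → ℝ)) j = k i * t + ∑ j, k j * x j := by
        simp only [Pi.add_apply, Pi.smul_apply, smul_eq_mul, mul_add, Finset.sum_add_distrib]
        rw [add_comm]
        congr 1
        rw [Finset.sum_eq_single i] <;> simp +contextual
      rw [this]
      push_cast
      ring
    rw [e]
    have h3 : HasDerivAt (fun t : ℝ => 2 * Real.pi * Complex.I * k i * (t : ℂ)) (2 * Real.pi * Complex.I * k i) 0 := by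
      simpa using (Complex.ofRealCLM.hasDerivAt (x := (0 : ℝ))).const_mul (2 * Real.pi * Complex.I * k i)
    have h4 := h3.cexp.mul_const (ev x (ek k))
    simpa using h4
  rw [ev_smul, ← h1]
  exact h.unique h2

/-- Fourier coefficients. -/
noncomputable def fc (k : Fin n → ℤ) : T ℂ n →ₗ[ℂ] ℂ := I.comp (LinearMap.mulLeft ℂ (ek (-k)))

lemma fc_apply (k : Fin n → ℤ) (f : T ℂ n) : fc k f = I (ek (-k) * f) := rfl

lemma fc_dk (k : Fin n → ℤ) (i) (f : T ℂ n) : fc k (dk ℂ i f) = 2 * Real.pi * Complex.I * k i * fc k f := by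
  rw [fc_apply, fc_apply, I_parts', dk_ek, smul_mul_assoc, map_smul, smul_eq_mul]
  push_cast [Pi.neg_apply]
  ring

lemma ek_zero : ek (0 : Fin n → ℤ) = 1 := T.ext fun x => by simp [ev_ek]

lemma fc_zero (f : T ℂ n) : fc 0 f = I f := by rw [fc_apply, neg_zero, ek_zero, one_mul]

lemma norm_fc_le {f : T ℂ n} {g : T ℝ n} (h : ∀ x, ‖ev x f‖ ≤ ev x g) (k) : ‖fc k f‖ ≤ I g := by
  rw [fc_apply, I_def, I_def]
  refine (norm_integral_le_integral_norm _).trans (setIntegral_mono ?_ (ev_cont g).integrableOn_Icc fun x => ?_)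
  · exact (ev_cont _).norm.integrableOn_Icc
  · dsimp only
    rw [map_mul, norm_mul, norm_ev_ek, one_mul]
    exact h x

lemma hasSum_fc {f : T ℂ n} (h : Summable fun k => fc k f) (x) : HasSum (fun k => fc k f * ev x (ek k)) (ev x f) := by
  obtain ⟨F, hF⟩ := Per.exists_factor (ev_cont f) (ev_per f)
  have hc : UnitAddTorus.mFourierCoeff F = fun k => fc k f := by
    funext k
    rw [UnitAddTorus.mFourierCoeff_eq_integral _ _ 0, fc_apply, I_def]
    have hs : {x : Fin n → ℝ | ∀ i, x i ∈ Ioc ((0 : Fin n → ℝ) i) ((0 : Fin n → ℝ) i + 1)} =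
        Set.pi univ fun i => Ioc ((0 : Fin n → ℝ) i) ((1 : Fin n → ℝ) i) := by
      ext x; simp
    have hae := Measure.univ_pi_Ioc_ae_eq_Icc (μ := fun _ : Fin n => (volume : Measure ℝ)) (f := (0 : Fin n → ℝ)) (g := 1)
    rw [← volume_pi] at hae
    rw [hs, setIntegral_congr_set hae]
    refine setIntegral_congr_fun measurableSet_Icc fun x _ => ?_
    rw [map_mul, ← hF x, smul_eq_mul]
    exact congrArg₂ _ (mFourier_toTorus (-k) x) rfl
  have h1 := UnitAddTorus.hasSum_mFourier_series_apply_of_summable (f := F) (by rw [hc]; exact h) (toTorus x)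
  rw [hF, hc] at h1
  simpa only [mFourier_toTorus, smul_eq_mul] using h1

/-- Weights for which the Fourier multiplier `∏ᵢ (1 - ∂ᵢ²)` is given by multiplication. -/
noncomputable def wt (k : Fin n → ℤ) : ℝ := ∏ i, (1 + (2 * Real.pi * k i) ^ 2)

lemma one_le_wt (k : Fin n → ℤ) : 1 ≤ wt k :=
  Finset.prod_const_one.symm.le.trans (Finset.prod_le_prod (fun _ _ => zero_le_one) fun i _ => by
    nlinarith [sq_nonneg (2 * Real.pi * k i)])

lemma summable_inv_wt : Summable fun k : Fin n → ℤ => (wt k)⁻¹ := by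
  have h0 : Summable fun j : ℤ => (1 + (2 * Real.pi * (j : ℝ)) ^ 2)⁻¹ := by
    have h1 : Summable fun j : ℤ => 1 / (j : ℝ) ^ 2 := by
      exact_mod_cast (Real.summable_one_div_int_pow (p := 2)).mpr (by norm_num)
    refine Summable.of_norm_bounded_eventually h1 ?_
    rw [Filter.eventually_cofinite]
    refine (Set.finite_singleton (0 : ℤ)).subset fun j hj => ?_
    by_contra hj0
    refine hj ?_
    have hj1 : (0 : ℝ) < (j : ℝ) ^ 2 := by
      have : (j : ℝ) ≠ 0 := by exact_mod_cast hj0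
      positivity
    rw [Real.norm_of_nonneg (by positivity), ← one_div]
    refine one_div_le_one_div_of_le hj1 ?_
    rw [mul_pow]
    have h2 : (1 : ℝ) ≤ (2 * Real.pi) ^ 2 := by nlinarith [Real.pi_gt_three]
    nlinarith
  refine summable_of_sum_le (c := ∏ _i : Fin n, ∑' j : ℤ, (1 + (2 * Real.pi * (j : ℝ)) ^ 2)⁻¹)
    (fun k => by have := one_le_wt k; positivity) fun u => ?_
  classical
  have hsub : u ⊆ Fintype.piFinset fun i => u.image fun k => k i := fun k hk => by
    rw [Fintype.mem_piFinset]
    exact fun i => Finset.mem_image_of_mem _ hk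
  refine (Finset.sum_le_sum_of_subset_of_nonneg hsub fun k _ _ => by have := one_le_wt k; positivity).trans ?_
  simp only [wt, ← Finset.prod_inv_distrib]
  rw [← Finset.prod_univ_sum (t := fun i => u.image fun k : Fin n → ℤ => k i)
    (f := fun _ (j : ℤ) => (1 + (2 * Real.pi * (j : ℝ)) ^ 2)⁻¹)]
  exact Finset.prod_le_prod (fun i _ => Finset.sum_nonneg fun j _ => by positivity)
    fun i _ => h0.sum_le_tsum _ fun j _ => by positivity

/-- Complexification of real functions. -/
noncomputable def toC (f : T ℝ n) : T ℂ n :=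
  mkT (fun x => ((ev x f : ℝ) : ℂ)) (Complex.ofRealCLM.contDiff.comp (ev_smooth f))
    (fun x k => congrArg _ (ev_per f x k))

@[simp] lemma ev_toC (f : T ℝ n) (x) : ev x (toC f) = ((ev x f : ℝ) : ℂ) := rfl

lemma toC_sub (f g : T ℝ n) : toC (f - g) = toC f - toC g := T.ext fun x => by simp

lemma dk_toC (i) (f : T ℝ n) : dk ℂ i (toC f) = toC (dx i f) := T.ext fun x => by
  rw [ev_dk, ev_toC, ev_dx]
  have h := Complex.ofRealCLM.hasFDerivAt.comp x (hasFDerivAt_ev f x)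
  have h2 : fderiv ℝ (fun y => ev y (toC f)) x = _ := h.fderiv
  rw [h2]
  rfl

lemma I_toC (f : T ℝ n) : I (toC f) = ((I f : ℝ) : ℂ) := by
  rw [I_def, I_def]
  exact integral_ofReal

/-- The operator `∏ (1 - ∂ᵢ²)` over the indices in a list. -/
noncomputable def jl : List (Fin n) → T ℝ n →ₗ[ℝ] T ℝ n
  | [] => LinearMap.id
  | i :: l => (jl l).comp (LinearMap.id - (dx i : T ℝ n →ₗ[ℝ] T ℝ n).comp (dx i : T ℝ n →ₗ[ℝ] T ℝ n))

lemma jl_nil (f : T ℝ n) : jl [] f = f := rfl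
lemma jl_cons (i : Fin n) (l) (f : T ℝ n) : jl (i :: l) f = jl l (f - dx i (dx i f)) := rfl

lemma fc_jl (k : Fin n → ℤ) (l : List (Fin n)) (f : T ℝ n) :
    fc k (toC (jl l f)) = ((l.map fun i => 1 + (2 * Real.pi * (k i : ℝ)) ^ 2).prod : ℝ) * fc k (toC f) := by
  induction l generalizing f with
  | nil => simp [jl_nil]
  | cons i l ih =>
    rw [jl_cons, ih, toC_sub, ← dk_toC, ← dk_toC, map_sub, fc_dk, fc_dk, List.map_cons, List.prod_cons]
    generalize (l.map fun i => 1 + (2 * Real.pi * (k i : ℝ)) ^ 2).prod = p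
    push_cast
    linear_combination (-(p : ℂ) * (2 * Real.pi * k i) ^ 2 * fc k (toC f)) * Complex.I_sq

/-- The operator `∏ᵢ (1 - ∂ᵢ²)`. -/
noncomputable def jT : T ℝ n →ₗ[ℝ] T ℝ n := jl (List.finRange n)

lemma fc_jT (k : Fin n → ℤ) (f : T ℝ n) : fc k (toC (jT f)) = wt k * fc k (toC f) := by
  rw [jT, fc_jl, wt, ← List.ofFn_eq_map, List.prod_ofFn]

/-- The norm of the Sobolev embedding. -/
noncomputable def sob (n : ℕ) : ℝ := ∑' k : Fin n → ℤ, (wt k)⁻¹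

lemma norm_fc_le_wt {f g : T ℝ n} (h : ∀ x, |ev x (jT f)| ≤ ev x g) (k) :
    ‖fc k (toC f)‖ ≤ (wt k)⁻¹ * I g := by
  have h0 : 0 < wt k := zero_lt_one.trans_le (one_le_wt k)
  have h1 : ‖fc k (toC (jT f))‖ ≤ I g := norm_fc_le (fun x => by simpa using h x) k
  rw [fc_jT, norm_mul, Complex.norm_real, Real.norm_of_nonneg h0.le] at h1
  rw [inv_mul_eq_div, le_div_iff₀ h0]
  linarith

lemma summable_fc (f : T ℝ n) : Summable fun k => ‖fc k (toC f)‖ := by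
  obtain ⟨C, hC⟩ := exists_bound (jT f)
  refine Summable.of_nonneg_of_le (fun k => norm_nonneg _)
    (fun k => norm_fc_le_wt (g := algebraMap ℝ _ C) (fun x => by simpa using hC x) k) (summable_inv_wt.mul_right _)

lemma hasSum_fc_toC (f : T ℝ n) (x) : HasSum (fun k => fc k (toC f) * ev x (ek k)) ((ev x f : ℝ) : ℂ) := by
  rw [← ev_toC]
  exact hasSum_fc (summable_fc f).of_norm x

/-- A Sobolev inequality. -/
lemma abs_ev_le {f g : T ℝ n} (h : ∀ x, |ev x (jT f)| ≤ ev x g) (x) : |ev x f| ≤ sob n * I g := by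
  have h1 := hasSum_fc_toC f x
  have h2 : ∀ k, ‖fc k (toC f) * ev x (ek k)‖ = ‖fc k (toC f)‖ := fun k => by
    rw [norm_mul, norm_ev_ek, mul_one]
  have h3 : Summable fun k => ‖fc k (toC f) * ev x (ek k)‖ := by simpa only [h2] using summable_fc f
  have h4 : ‖((ev x f : ℝ) : ℂ)‖ ≤ ∑' k, ‖fc k (toC f) * ev x (ek k)‖ := by
    rw [← h1.tsum_eq]; exact norm_tsum_le_tsum_norm h3
  rw [Complex.norm_real, Real.norm_eq_abs] at h4
  refine h4.trans ?_
  rw [sob, ← tsum_mul_right]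
  simp only [h2]
  exact (summable_fc f).tsum_le_tsum (norm_fc_le_wt h) (summable_inv_wt.mul_right _)

end Abreu

namespace Abreu
open Set Filter Topology
open scoped ContDiff

variable {n : ℕ}

/-- A family of maps containing all partial derivatives of its members consists of smooth maps. -/
lemma contDiff_of_family {E : Type*} [NormedAddCommGroup E] [NormedSpace ℝ E] {F : List (Fin n) → (Fin n → ℝ) → E}
    (h : ∀ w x, HasFDerivAt (F w) (∑ i, (ContinuousLinearMap.proj (R := ℝ) (φ := fun _ : Fin n => ℝ) i).smulRight
      (F (i :: w) x)) x) (w) : ContDiff ℝ ∞ (F w) := by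
  refine contDiff_infty.mpr fun m => ?_
  induction m generalizing w with
  | zero => exact contDiff_zero.mpr (continuous_iff_continuousAt.mpr fun x => (h w x).continuousAt)
  | succ m ih =>
    push_cast
    refine contDiff_succ_iff_hasFDerivAt.mpr ⟨_, ?_, h w⟩
    exact ContDiff.sum fun i _ => contDiff_const.smulRight (ih (i :: w))

lemma hasFDerivAt_of_quadratic {E F : Type*} [NormedAddCommGroup E] [NormedSpace ℝ E] [NormedAddCommGroup F]
    [NormedSpace ℝ F] {f : E → F} {f' : E →L[ℝ] F} {x : E} {C : ℝ}
    (h : ∀ v, ‖f (x + v) - f x - f' v‖ ≤ C * ‖v‖ ^ 2) : HasFDerivAt f f' x := by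
  rw [hasFDerivAt_iff_isLittleO_nhds_zero]
  refine (Asymptotics.IsBigO.of_bound C (g := fun v : E => ‖v‖ ^ 2) (Eventually.of_forall fun v => ?_)).trans_isLittleO
    (Asymptotics.isLittleO_norm_pow_id one_lt_two)
  simpa using h v

lemma abs_ev_add_sub_le {f : T ℝ n} {C : ℝ} (hC : ∀ i x, |ev x (dx i f)| ≤ C) (x v : Fin n → ℝ) :
    |ev (x + v) f - ev x f| ≤ n * (C * ‖v‖) := by
  have h := (convex_Icc (0 : ℝ) 1).norm_image_sub_le_of_norm_hasDerivWithin_le (C := n * (C * ‖v‖))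
    (fun t _ => (hasDerivAt_ev f x v t).hasDerivWithinAt) (fun t _ => by
      refine (norm_sum_le _ _).trans ((Finset.sum_le_card_nsmul _ _ (C * ‖v‖) fun i _ => ?_).trans (by simp))
      rw [norm_mul, mul_comm]
      exact mul_le_mul (hC i _) (norm_le_pi_norm v i) (norm_nonneg _) ((abs_nonneg _).trans (hC i x)))
    (left_mem_Icc.mpr zero_le_one) (right_mem_Icc.mpr zero_le_one)
  simpa using h

lemma taylor_le {f : T ℝ n} {C : ℝ} (hC : ∀ i j x, |ev x (dx i (dx j f))| ≤ C) (x v : Fin n → ℝ) :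
    |ev (x + v) f - ev x f - ∑ i, v i * ev x (dx i f)| ≤ n * (n * C) * ‖v‖ ^ 2 := by
  have hd : ∀ t : ℝ, HasDerivAt (fun t : ℝ => ev (x + t • v) f - t * ∑ i, v i * ev x (dx i f))
      (∑ i, v i * (ev (x + t • v) (dx i f) - ev x (dx i f))) t := fun t => by
    refine ((hasDerivAt_ev f x v t).sub ((hasDerivAt_id t).mul_const _)).congr_deriv ?_
    simp only [mul_sub, Finset.sum_sub_distrib, one_mul]
    rfl
  have h := (convex_Icc (0 : ℝ) 1).norm_image_sub_le_of_norm_hasDerivWithin_le (C := n * (‖v‖ * (n * (C * ‖v‖))))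
    (fun t _ => (hd t).hasDerivWithinAt) (fun t ht => by
      refine (norm_sum_le _ _).trans ((Finset.sum_le_card_nsmul _ _ (‖v‖ * (n * (C * ‖v‖))) fun i _ => ?_).trans (by simp))
      rw [norm_mul]
      refine mul_le_mul (norm_le_pi_norm v i) ((abs_ev_add_sub_le (fun j => hC j i) x (t • v)).trans ?_)
        (norm_nonneg _) (norm_nonneg _)
      refine mul_le_mul_of_nonneg_left (mul_le_mul_of_nonneg_left ?_ ((abs_nonneg _).trans (hC i i x)))
        (Nat.cast_nonneg n)
      rw [norm_smul, Real.norm_of_nonneg ht.1]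
      exact mul_le_of_le_one_left (norm_nonneg _) ht.2)
    (left_mem_Icc.mpr zero_le_one) (right_mem_Icc.mpr zero_le_one)
  have e : n * (n * C) * ‖v‖ ^ 2 = n * (‖v‖ * (n * (C * ‖v‖))) * ‖(1 : ℝ) - 0‖ := by simp; ring
  rw [e]
  refine (le_of_eq ?_).trans h
  rw [Real.norm_eq_abs]
  congr 1
  simp
  ring

section Family
variable {σ : Type*} {f g : σ → T ℝ n}

/-- Uniform bounds on the derivatives up to a given order of a family of functions. -/
def UB : ℕ → (σ → T ℝ n) → Prop
  | 0, f => Bdd f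
  | N + 1, f => Bdd f ∧ ∀ i, UB N fun s => dx i (f s)

lemma UB.bdd {N} (h : UB N f) : Bdd f := by
  cases N with
  | zero => exact h
  | succ N => exact h.1

lemma UB.of_succ {N} (h : UB (N + 1) f) : UB N f := by
  induction N generalizing f with
  | zero => exact h.bdd
  | succ N ih => exact ⟨h.1, fun i => ih (h.2 i)⟩

lemma UB.bdd_dw (h : ∀ N, UB N f) (w) : Bdd fun s => dw w (f s) := by
  induction w generalizing f with
  | nil => exact h 0
  | cons i w ih => exact ih fun N => (h (N + 1)).2 i

lemma UB.of_dw (h : ∀ w, Bdd fun s => dw w (f s)) (N) : UB N f := by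
  induction N generalizing f with
  | zero => exact h []
  | succ N ih => exact ⟨h [], fun i => ih fun w => h (i :: w)⟩

lemma Bdd.add (hf : Bdd f) (hg : Bdd g) : Bdd fun s => f s + g s := by
  obtain ⟨C, hC⟩ := hf
  obtain ⟨D, hD⟩ := hg
  refine ⟨C + D, fun s x => ?_⟩
  rw [map_add]
  exact (abs_add_le _ _).trans (add_le_add (hC s x) (hD s x))

lemma Bdd.mul (hf : Bdd f) (hg : Bdd g) : Bdd fun s => f s * g s := by
  obtain ⟨C, hC⟩ := hf
  obtain ⟨D, hD⟩ := hg
  refine ⟨C * D, fun s x => ?_⟩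
  rw [map_mul, abs_mul]
  exact mul_le_mul (hC s x) (hD s x) (abs_nonneg _) ((abs_nonneg _).trans (hC s x))

lemma Bdd.neg (hf : Bdd f) : Bdd fun s => - f s := by
  obtain ⟨C, hC⟩ := hf
  exact ⟨C, fun s x => by rw [map_neg, abs_neg]; exact hC s x⟩

lemma Bdd.const (c : T ℝ n) : Bdd fun _ : σ => c := by
  obtain ⟨C, hC⟩ := exists_bound c
  exact ⟨C, fun _ x => hC x⟩

lemma UB.add {N} (hf : UB N f) (hg : UB N g) : UB N fun s => f s + g s := by
  induction N generalizing f g with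
  | zero => exact Bdd.add hf hg
  | succ N ih => exact ⟨hf.1.add hg.1, fun i => by simpa only [map_add] using ih (hf.2 i) (hg.2 i)⟩

lemma UB.neg {N} (hf : UB N f) : UB N fun s => - f s := by
  induction N generalizing f with
  | zero => exact Bdd.neg hf
  | succ N ih => exact ⟨hf.1.neg, fun i => by simpa only [map_neg] using ih (hf.2 i)⟩

lemma UB.mul {N} (hf : UB N f) (hg : UB N g) : UB N fun s => f s * g s := by
  induction N generalizing f g with
  | zero => exact Bdd.mul hf hg
  | succ N ih =>
    exact ⟨hf.1.mul hg.1, fun i => by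
      simpa only [dx_mul] using (ih (hf.2 i) hg.of_succ).add (ih hf.of_succ (hg.2 i))⟩

lemma UB.const (N) (c : T ℝ n) : UB N fun _ : σ => c := UB.of_dw (fun w => Bdd.const (dw w c)) N

lemma UB.sum {ι : Type*} {N} (t : Finset ι) {f : ι → σ → T ℝ n} (h : ∀ i, UB N (f i)) :
    UB N fun s => ∑ i ∈ t, f i s := by
  classical
  induction t using Finset.induction_on with
  | empty => simpa using UB.const N 0
  | insert i t hi ih => simpa only [Finset.sum_insert hi] using (h i).add ih

/-- Families dominated by functions with bounded integrals. -/
def LB (f : σ → T ℝ n) : Prop := ∃ B : ℝ, ∀ s, ∃ g : T ℝ n, (∀ x, |ev x (f s)| ≤ ev x g) ∧ I g ≤ B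

lemma LB.sub (hf : LB f) (hg : LB g) : LB fun s => f s - g s := by
  obtain ⟨B, hB⟩ := hf
  obtain ⟨D, hD⟩ := hg
  refine ⟨B + D, fun s => ?_⟩
  obtain ⟨u, hu, hu'⟩ := hB s
  obtain ⟨v, hv, hv'⟩ := hD s
  refine ⟨u + v, fun x => ?_, I_add_le hu' hv'⟩
  rw [map_sub, map_add]
  exact (abs_sub _ _).trans (add_le_add (hu x) (hv x))

lemma LQ.lb (hf : LQ f) : LB f := by
  obtain ⟨C, hC⟩ := hf.moment 2
  refine ⟨1 + C, fun s => ⟨1 + f s ^ 2, fun x => ?_, I_add_le I_one.le ((le_abs_self _).trans (hC s))⟩⟩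
  rw [map_add, map_one, map_pow]
  exact abs_le.mpr ⟨by nlinarith [sq_nonneg (ev x (f s) + 1)], by nlinarith [sq_nonneg (ev x (f s) - 1)]⟩

lemma LB.of_jl {l : List (Fin n)} (h : ∀ w : List (Fin n), w.length ≤ 2 * l.length → LB fun s => dw w (f s)) :
    LB fun s => jl l (f s) := by
  induction l generalizing f with
  | nil => exact h [] (Nat.zero_le _)
  | cons i l ih =>
    refine ih fun w hw => ?_
    have h1 : ∀ s, dw w (f s - dx i (dx i (f s))) = dw w (f s) - dw (i :: i :: w) (f s) := fun s => map_sub _ _ _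
    change LB fun s => dw w (f s - dx i (dx i (f s)))
    simpa only [h1] using (h w (by simp; omega)).sub (h (i :: i :: w) (by simp; omega))

/-- Sobolev embedding for families. -/
lemma LB.bdd (h : ∀ w : List (Fin n), w.length ≤ 2 * n → LB fun s => dw w (f s)) : Bdd f := by
  obtain ⟨B, hB⟩ := LB.of_jl (l := List.finRange n) (by simpa using h)
  refine ⟨sob n * B, fun s x => ?_⟩
  obtain ⟨g, hg, hg'⟩ := hB s
  exact (abs_ev_le hg x).trans (mul_le_mul_of_nonneg_left hg'
    (tsum_nonneg fun k => inv_nonneg.mpr (zero_le_one.trans (one_le_wt k))))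

lemma LB.ub (h : ∀ w, LB fun s => dw w (f s)) (N) : UB N f :=
  UB.of_dw (fun w => LB.bdd (f := fun s => dw w (f s)) fun u _ => by simpa only [dw_append] using h (w ++ u)) N

/-- Compactness of families with uniformly bounded derivatives. -/
lemma UB.exists_lim (h : ∀ N, UB N f) (U : Ultrafilter σ) : ∃ g : T ℝ n, ∀ w x,
    Tendsto (fun s => ev x (dw w (f s))) U (𝓝 (ev x (dw w g))) := by
  choose C hC using UB.bdd_dw h
  have h1 : ∀ w x, ∃ y, Tendsto (fun s => ev x (dw w (f s))) U (𝓝 y) := fun w x => by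
    obtain ⟨y, -, hy⟩ := (isCompact_Icc (a := -C w) (b := C w)).ultrafilter_le_nhds'
      (U.map fun s => ev x (dw w (f s))) (Ultrafilter.mem_map.mpr (Filter.Eventually.of_forall fun s => abs_le.mp (hC w s x)))
    exact ⟨y, hy⟩
  choose F hF using h1
  have h2 : ∀ w x, HasFDerivAt (F w) (∑ i, (ContinuousLinearMap.proj (R := ℝ) (φ := fun _ : Fin n => ℝ) i).smulRight
      (F (i :: w) x)) x := fun w x => by
    obtain ⟨D, hD⟩ : ∃ D, ∀ i j, C (i :: j :: w) ≤ D := by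
      refine ⟨∑ i, ∑ j, |C (i :: j :: w)|, fun i j => (le_abs_self _).trans ?_⟩
      exact (Finset.single_le_sum (f := fun j => |C (i :: j :: w)|) (fun _ _ => abs_nonneg _) (Finset.mem_univ j)).trans
        (Finset.single_le_sum (f := fun i => ∑ j, |C (i :: j :: w)|)
          (fun _ _ => Finset.sum_nonneg fun _ _ => abs_nonneg _) (Finset.mem_univ i))
    refine hasFDerivAt_of_quadratic (C := n * (n * D)) fun v => ?_
    have h3 : Tendsto (fun s => |ev (x + v) (dw w (f s)) - ev x (dw w (f s)) - ∑ i, v i * ev x (dw (i :: w) (f s))|) U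
        (𝓝 |F w (x + v) - F w x - ∑ i, v i * F (i :: w) x|) :=
      (((hF w (x + v)).sub (hF w x)).sub (tendsto_finsetSum _ fun i _ => (hF (i :: w) x).const_mul _)).abs
    have h4 := le_of_tendsto h3 (Eventually.of_forall fun s => by
      simp only [dw_cons, dw_dx]
      exact taylor_le (C := D) (fun i j y => by
        have := hC (i :: j :: w) s y
        dsimp only at this
        rw [dw_cons, dw_cons, dw_dx, dw_dx, dx_comm] at this
        exact this.trans (hD i j)) x v)
    simpa using h4
  have h3 : Per (F []) := fun x k => by
    refine tendsto_nhds_unique (hF [] _) ((hF [] x).congr fun s => ?_)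
    exact (ev_per (f s) x k).symm
  refine ⟨mkT (F []) (contDiff_of_family h2 []) h3, fun w x => ?_⟩
  have h4 : ∀ w x, ev x (dw w (mkT (F []) (contDiff_of_family h2 []) h3)) = F w x := fun w => by
    induction w with
    | nil => exact fun x => rfl
    | cons i w ih =>
      intro x
      rw [dw_cons, dw_dx, ev_dx, funext ih, (h2 w x).fderiv]
      simp [Pi.single_apply]
  rw [h4]
  exact hF w x

end Family

namespace Pot
variable {σ : Type*} {q : σ → Pot n}

lemma dx_G_eq (s : Pot n) (i a b) : dx i (s.G a b) = -∑ c, ∑ d, s.G a d * dx i (s.H d c) * s.G c b := by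
  have := congrFun (congrFun (s.dG (dx i)) a) b
  simpa only [map_apply, Matrix.neg_apply, mul_apply, Finset.sum_mul] using this

lemma ub_G {N} (hH : ∀ a b, UB N fun s => (q s).H a b) (hG : ∀ a b, Bdd fun s => (q s).G a b) (a b) :
    UB N fun s => (q s).G a b := by
  induction N generalizing a b with
  | zero => exact hG a b
  | succ N ih =>
    refine ⟨hG a b, fun i => ?_⟩
    have h2 := ih fun a b => (hH a b).of_succ
    simp only [dx_G_eq]
    exact (UB.sum _ fun c => UB.sum _ fun d => ((h2 a d).mul ((hH d c).2 i)).mul (h2 c b)).neg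

lemma ub_φ (hm : ∀ s, I (q s).φ = 0) (hH : ∀ a b N, UB N fun s => (q s).H a b) (N) : UB N fun s => (q s).φ := by
  have h0 : Bdd fun s => (q s).φ := ⟨n, fun s => abs_le_of_mean (abs_sub_le_of_grad (q s).abs_grad_le) (hm s)⟩
  have h1 : ∀ i, Bdd fun s => dx i (q s).φ := fun i => ⟨1, fun s x => (q s).abs_grad_le x i⟩
  have h2 : ∀ i j N, UB N fun s => dx i (dx j (q s).φ) := fun i j N => by
    have h : ∀ s, dx i (dx j (q s).φ) = (q s).H i j + -(1 : Matrix (Fin n) (Fin n) (T ℝ n)) i j := fun s => by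
      rw [H_apply]; ring
    simp only [h]
    exact (hH i j N).add (UB.const N _)
  match N with
  | 0 => exact h0
  | 1 => exact ⟨h0, h1⟩
  | N + 2 => exact ⟨h0, fun i => ⟨h1 i, fun j => h2 j i N⟩⟩

/-- Compactness of families of potentials with bounded derivatives. -/
lemma exists_lim (hm : ∀ s, I (q s).φ = 0) (hH : ∀ a b N, UB N fun s => (q s).H a b)
    (hG : ∀ a b, Bdd fun s => (q s).G a b) (U : Ultrafilter σ) :
    ∃ p : Pot n, I p.φ = 0 ∧ ∀ a b w x, Tendsto (fun s => ev x (dw w ((q s).G a b))) U (𝓝 (ev x (dw w (p.G a b)))) := by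
  obtain ⟨φ, hφ⟩ := UB.exists_lim (ub_φ hm hH) U
  choose G hG using fun a b => UB.exists_lim (fun N => ub_G (fun a b => hH a b N) hG a b) U
  have hH' : ∀ x i j, Tendsto (fun s => ev x ((q s).H i j)) U (𝓝 (ev x (hM φ i j))) := fun x i j => by
    have h1 : ∀ ψ : T ℝ n, ev x (hM ψ i j) = ev x ((1 : Matrix (Fin n) (Fin n) (T ℝ n)) i j) + ev x (dw [j, i] ψ) :=
      fun ψ => map_add _ _ _
    rw [h1]
    exact ((hφ [j, i] x).const_add _).congr fun s => (h1 (q s).φ).symm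
  have hGH : (Matrix.of G) * hM φ = 1 := by
    ext1 i j
    refine T.ext fun x => ?_
    rw [mul_apply, map_sum]
    have h1 : Tendsto (fun s => ∑ k, ev x ((q s).G i k) * ev x ((q s).H k j)) U
        (𝓝 (∑ k, ev x (G i k) * ev x (hM φ k j))) := tendsto_finsetSum _ fun k _ => (hG i k [] x).mul (hH' x k j)
    have h2 : Tendsto (fun s => ∑ k, ev x ((q s).G i k) * ev x ((q s).H k j)) U
        (𝓝 (ev x ((1 : Matrix (Fin n) (Fin n) (T ℝ n)) i j))) := by
      refine tendsto_const_nhds.congr fun s => ?_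
      rw [← (q s).GH, mul_apply, map_sum]
      simp only [map_mul]
    simpa only [map_mul, of_apply] using tendsto_nhds_unique h1 h2
  have hpos : ∀ x, ((hM φ).map (ev x)).PosDef := fun x => by
    have h1 : ((hM φ).map (ev x)).PosSemidef := by
      refine PosSemidef.of_dotProduct_mulVec_nonneg ?_ fun v => ?_
      · ext1 i j
        rw [conjTranspose_apply, star_trivial, map_apply, map_apply]
        exact tendsto_nhds_unique (hH' x j i) ((hH' x i j).congr fun s => by rw [(q s).Hsymm])
      · have h2 : Tendsto (fun s => star v ⬝ᵥ ((q s).H.map (ev x)) *ᵥ v) U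
            (𝓝 (star v ⬝ᵥ ((hM φ).map (ev x)) *ᵥ v)) := by
          simp only [dotProduct, mulVec, map_apply]
          exact tendsto_finsetSum _ fun i _ => (tendsto_finsetSum _ fun j _ => (hH' x i j).mul_const _).const_mul _
        exact ge_of_tendsto h2 (Eventually.of_forall fun s => ((q s).pos x).posSemidef.dotProduct_mulVec_nonneg v)
    refine h1.posDef_iff_isUnit.mpr ?_
    refine (Matrix.isUnit_iff_isUnit_det _).mpr (isUnit_iff_ne_zero.mpr fun h2 => ?_)
    have h3 := congrArg (fun M => ev x (Matrix.det M)) hGH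
    simp only [det_mul, map_mul, det_one, map_one, ev_det, h2, mul_zero, zero_ne_one] at h3
  have hM' : hM (φ - algebraMap ℝ _ (I φ)) = hM φ := by
    ext1 i j
    simp [hM, map_sub]
  let p : Pot n := ⟨φ - algebraMap ℝ _ (I φ), fun x => by rw [hM']; exact hpos x⟩
  have hp : p.G = Matrix.of G := by
    have : p.H = hM φ := hM'
    calc p.G = Matrix.of G * p.H * p.G := by rw [this, hGH, one_mul]
      _ = Matrix.of G := by rw [mul_assoc, p.HG, mul_one]
  exact ⟨p, by rw [map_sub, I_const, sub_self], fun a b => by rw [hp]; exact hG a b⟩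

lemma tendsto_A {U : Filter σ} {p : Pot n} {x}
    (h : ∀ a b w, Tendsto (fun s => ev x (dw w ((q s).G a b))) U (𝓝 (ev x (dw w (p.G a b))))) :
    Tendsto (fun s => ev x (q s).A) U (𝓝 (ev x p.A)) := by
  have h2 : ∀ q : Pot n, ev x q.A = ∑ a, ∑ b, ev x (dw [b, a] (q.G a b)) := fun q => by
    simp only [Pot.A, map_sum, dw_cons, dw_nil]
  rw [h2 p]
  refine Tendsto.congr (fun s => (h2 (q s)).symm) ?_
  exact tendsto_finsetSum _ fun a _ => tendsto_finsetSum _ fun b _ => h a b [b, a]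

end Pot

namespace Sol
variable [NeZero n]

lemma ub_H (A0 : T ℝ n) (a b) (N) : UB N fun s : Sol A0 => s.H a b := by
  refine LB.ub (fun w => ?_) N
  match w with
  | [] => exact (lq_H A0 a b).lb
  | [i] => exact (lq_dx_H A0 i a b).lb
  | i :: j :: w =>
    obtain ⟨B, hB⟩ := exists_I_exp_lb_le A0 w.length
    refine ⟨B, fun s => ⟨_, fun x => ?_, hB s⟩⟩
    rw [ev_expT]
    exact abs_le_of_sq_le_sq ((sq_dw_le (i :: j :: w) x s.hs (a, b)).trans (bl_le _ _ x)) (Real.exp_pos _).le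

lemma bdd_G (A0 : T ℝ n) (a b) : Bdd fun s : Sol A0 => s.G a b := by
  obtain ⟨C, hC⟩ := (UB.sum (σ := Sol A0) (N := 0) Finset.univ fun a => ub_H A0 a a 0).bdd
  obtain ⟨D, hD⟩ := bdd_F A0
  refine ⟨n * (n.factorial * (1 + C) ^ n) * Real.exp D, fun s x => (s.abs_G_le x a b).trans ((s.P_le x).trans ?_)⟩
  have h1 : ev x s.Tr ≤ C := (le_abs_self _).trans (hC s x)
  have h2 := s.Tr_nonneg x
  have h3 : ev x s.F ≤ D := (le_abs_self _).trans (hD s x)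
  have h4 : 0 ≤ C := h2.trans h1
  gcongr

/-- The set of parameters for which the equation can be solved is closed. -/
lemma isClosed_range (A0 : T ℝ n) : IsClosed (range (Sol.t (A0 := A0))) := by
  refine isClosed_of_closure_subset fun t ht => ?_
  have hne : (comap (Sol.t (A0 := A0)) (𝓝 t)).NeBot := by
    refine comap_neBot_iff.mpr fun V hV => ?_
    obtain ⟨y, hy, s, rfl⟩ := mem_closure_iff_nhds.mp ht V hV
    exact ⟨s, hy⟩
  set U := Ultrafilter.of (comap (Sol.t (A0 := A0)) (𝓝 t))
  have hU : Tendsto (Sol.t (A0 := A0)) U (𝓝 t) := tendsto_comap.mono_left (Ultrafilter.of_le _)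
  obtain ⟨p, hp, hG⟩ := Pot.exists_lim (q := fun s : Sol A0 => s.toPot) (fun s => s.mean) (ub_H A0) (bdd_G A0) U
  have ht0 : 0 ≤ t := ge_of_tendsto hU (Eventually.of_forall fun s => s.t0)
  have ht1 : t ≤ 1 := le_of_tendsto hU (Eventually.of_forall fun s => s.t1)
  refine ⟨⟨p, t, ht0, ht1, hp, T.ext fun x => ?_⟩, rfl⟩
  refine tendsto_nhds_unique (Pot.tendsto_A fun a b w => hG a b w x) ?_
  rw [ev_smul]
  refine (hU.mul_const (ev x A0)).congr fun s => ?_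
  rw [s.eqn, ev_smul]

end Sol

end Abreu

namespace Abreu
open Set Filter Topology
open scoped ContDiff

variable {n : ℕ} {σ : Type*} {r : σ → ℝ} {f g : σ → T ℝ n}

/-- Families of functions with square integrals bounded by multiples of given weights. -/
def L2 (r : σ → ℝ) (f : σ → T ℝ n) : Prop := ∃ C : ℝ, ∀ s, I (f s ^ 2) ≤ C * r s

lemma L2.of_le (hf : L2 r f) (h : ∃ C, 0 ≤ C ∧ ∀ s x, ev x (g s) ^ 2 ≤ C * ev x (f s) ^ 2) : L2 r g := by
  obtain ⟨C, hC⟩ := hf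
  obtain ⟨D, hD, h⟩ := h
  refine ⟨D * C, fun s => ?_⟩
  have h1 : I (g s ^ 2) ≤ I (D • f s ^ 2) := I_mono fun x => by
    rw [map_pow, ev_smul, map_pow]; exact h s x
  rw [I_smul] at h1
  exact h1.trans ((mul_le_mul_of_nonneg_left (hC s) hD).trans_eq (mul_assoc _ _ _).symm)

lemma L2.add (hf : L2 r f) (hg : L2 r g) : L2 r fun s => f s + g s := by
  obtain ⟨C, hC⟩ := hf
  obtain ⟨D, hD⟩ := hg
  refine ⟨2 * C + 2 * D, fun s => ?_⟩
  have h1 : I ((f s + g s) ^ 2) ≤ I ((2 : ℝ) • f s ^ 2 + (2 : ℝ) • g s ^ 2) := I_mono fun x => by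
    simp only [map_pow, map_add, ev_smul]
    nlinarith [sq_nonneg (ev x (f s) - ev x (g s))]
  rw [map_add, I_smul, I_smul] at h1
  linarith [hC s, hD s]

lemma L2.neg (hf : L2 r f) : L2 r fun s => - f s := by
  simpa only [L2, neg_sq] using hf

lemma L2.bdd_mul (hf : Bdd f) (hg : L2 r g) : L2 r fun s => f s * g s := by
  obtain ⟨C, hC⟩ := hf
  refine hg.of_le ⟨C ^ 2, sq_nonneg _, fun s x => ?_⟩
  rw [map_mul, mul_pow]
  exact mul_le_mul_of_nonneg_right (sq_le_sq.mpr ((hC s x).trans (le_abs_self C))) (sq_nonneg _)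

lemma L2.mul_bdd (hf : L2 r f) (hg : Bdd g) : L2 r fun s => f s * g s := by
  simpa only [mul_comm] using L2.bdd_mul hg hf

lemma L2.mono (hf : L2 1 f) (hr : ∀ s, 1 ≤ r s) : L2 r f := by
  obtain ⟨C, hC⟩ := hf
  refine ⟨|C|, fun s => (hC s).trans ?_⟩
  rw [Pi.one_apply, mul_one]
  exact (le_abs_self C).trans (le_mul_of_one_le_right (abs_nonneg C) (hr s))

lemma Bdd.l2 (hf : Bdd f) : L2 1 f := by
  obtain ⟨C, hC⟩ := hf
  refine ⟨C ^ 2, fun s => ?_⟩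
  have h1 : I (f s ^ 2) ≤ I (algebraMap ℝ (T ℝ n) (C ^ 2)) := I_mono fun x => by
    rw [map_pow, ev_algebraMap]
    exact sq_le_sq.mpr ((hC s x).trans (le_abs_self C))
  simpa only [I_const, Pi.one_apply, mul_one] using h1

lemma L2.zero : L2 1 fun _ : σ => (0 : T ℝ n) := (Bdd.const 0).l2

lemma L2.sum {ι : Type*} (t : Finset ι) {f : ι → σ → T ℝ n} (hr : ∀ s, 1 ≤ r s) (h : ∀ i, L2 r (f i)) :
    L2 r fun s => ∑ i ∈ t, f i s := by
  classical
  induction t using Finset.induction_on with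
  | empty => simpa using L2.zero.mono hr
  | insert i t hi ih => simpa only [Finset.sum_insert hi] using (h i).add ih

lemma L2.lb (hf : L2 1 f) : LB f := by
  obtain ⟨C, hC⟩ := hf
  refine ⟨1 + C, fun s => ⟨1 + f s ^ 2, fun x => ?_, I_add_le I_one.le (by simpa using hC s)⟩⟩
  rw [map_add, map_one, map_pow]
  exact abs_le.mpr ⟨by nlinarith [sq_nonneg (ev x (f s) + 1)], by nlinarith [sq_nonneg (ev x (f s) - 1)]⟩

/-- Families with square integrable derivatives of orders less than `N`, uniformly. -/
def HB (N : ℕ) (f : σ → T ℝ n) : Prop := ∀ w : List (Fin n), w.length < N → L2 1 fun s => dw w (f s)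

/-- Families with uniformly square integrable derivatives of orders less than `N` for which the square integrals of
the derivatives of order `N` are bounded by the weights `r`. -/
def HW (N : ℕ) (r : σ → ℝ) (f : σ → T ℝ n) : Prop :=
  HB N f ∧ ∀ w : List (Fin n), w.length = N → L2 r fun s => dw w (f s)

lemma HB.mono {M N} (hf : HB N f) (h : M ≤ N) : HB M f := fun w hw => hf w (hw.trans_le h)

lemma HW.hb {N} (hf : HW N 1 f) : HB (N + 1) f := fun w hw =>
  (Nat.lt_succ_iff_lt_or_eq.mp hw).elim (hf.1 w) (hf.2 w)

lemma HB.hw {N} (hf : HB (N + 1) f) (hr : ∀ s, 1 ≤ r s) : HW N r f :=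
  ⟨hf.mono (Nat.le_succ N), fun w hw => (hf w (hw.trans_lt (Nat.lt_succ_self N))).mono hr⟩

lemma HB.succ {N} (h0 : L2 1 f) (h1 : ∀ i, HB N fun s => dx i (f s)) : HB (N + 1) f := fun w hw => by
  match w with
  | [] => exact h0
  | i :: w => exact h1 i w (Nat.lt_of_succ_lt_succ hw)

lemma HB.dx {N} (hf : HB (N + 1) f) (i) : HB N fun s => dx i (f s) := fun w hw => hf (i :: w) (Nat.succ_lt_succ hw)

lemma HW.succ {N} (h0 : L2 1 f) (h1 : ∀ i, HW N r fun s => Abreu.dx i (f s)) : HW (N + 1) r f :=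
  ⟨HB.succ h0 fun i => (h1 i).1, fun w hw => by
    match w with
    | i :: w => exact (h1 i).2 w (Nat.succ_injective hw)⟩

lemma HW.dx {N} (hf : HW (N + 1) r f) (i) : HW N r fun s => Abreu.dx i (f s) :=
  ⟨hf.1.dx i, fun w hw => hf.2 (i :: w) (congrArg Nat.succ hw)⟩

lemma HB.add {N} (hf : HB N f) (hg : HB N g) : HB N fun s => f s + g s := fun w hw => by
  simpa only [map_add] using (hf w hw).add (hg w hw)
lemma HB.neg {N} (hf : HB N f) : HB N fun s => - f s := fun w hw => by
  simpa only [map_neg] using (hf w hw).neg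
lemma HW.neg {N} (hf : HW N r f) : HW N r fun s => - f s :=
  ⟨hf.1.neg, fun w hw => by simpa only [map_neg] using (hf.2 w hw).neg⟩

lemma HW.sum {ι : Type*} {N} (t : Finset ι) {f : ι → σ → T ℝ n} (hr : ∀ s, 1 ≤ r s) (h : ∀ i, HW N r (f i)) :
    HW N r fun s => ∑ i ∈ t, f i s := by
  refine ⟨fun w hw => ?_, fun w hw => ?_⟩
  · have := L2.sum t (r := 1) (fun _ => le_rfl) fun i => (h i).1 w hw
    simpa only [map_sum] using this
  · simpa only [map_sum] using L2.sum t hr fun i => (h i).2 w hw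

lemma HB.bdd_dw {N} (hf : HB N f) {w : List (Fin n)} (hw : w.length + 2 * n < N) : Bdd fun s => dw w (f s) :=
  LB.bdd fun u hu => by
    simpa only [dw_append] using (hf (w ++ u) (by rw [List.length_append]; omega)).lb

lemma HB.ub {N M} (hf : HB N f) (h : M + 2 * n < N) : UB M f := by
  induction M generalizing f N with
  | zero => exact hf.bdd_dw (w := []) (by simpa using h)
  | succ M ih =>
    obtain ⟨N, rfl⟩ : ∃ k, N = k + 1 := ⟨N - 1, by omega⟩
    exact ⟨hf.bdd_dw (w := []) (by simp; omega), fun i => ih (hf.dx i) (by omega)⟩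

lemma UB.hb {M} (hf : UB M f) : HB (M + 1) f := by
  induction M generalizing f with
  | zero => exact HB.succ (Bdd.l2 hf) fun i w hw => absurd hw (Nat.not_lt_zero _)
  | succ M ih => exact HB.succ hf.1.l2 fun i => ih (hf.2 i)

lemma HB.mul_l2 {N} (hN : 4 * n < N) (hf : HB N f) (hg : HB N g) {u v : List (Fin n)} (hu : u.length < N)
    (hv : v.length < N) (h : u.length + v.length ≤ N) : L2 1 fun s => dw u (f s) * dw v (g s) := by
  by_cases h1 : u.length + 2 * n < N
  · exact L2.bdd_mul (hf.bdd_dw h1) (hg v hv)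
  · exact (hf u hu).mul_bdd (hg.bdd_dw (by omega))

/-- The terms of intermediate order in the Leibniz formula. -/
lemma HB.rem {N} (hN : 4 * n < N) (hf : HB N f) (hg : HB N g) {u v w : List (Fin n)} (hw : w ≠ [])
    (h : u.length + v.length + w.length ≤ N) : L2 1 fun s => dw w (dw u (f s) * dw v (g s))
      - dw u (f s) * dw w (dw v (g s)) - dw w (dw u (f s)) * dw v (g s) := by
  match w with
  | [i] =>
    have e : ∀ s, dw [i] (dw u (f s) * dw v (g s)) - dw u (f s) * dw [i] (dw v (g s))
        - dw [i] (dw u (f s)) * dw v (g s) = 0 := fun s => by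
      simp only [dw_cons, dw_nil, dx_mul]; ring
    simpa only [e] using L2.zero
  | i :: j :: w =>
    have h1 := HB.rem hN hf hg (u := i :: u) (v := v) (w := j :: w) (by simp) (by simp at h ⊢; omega)
    have h2 := HB.rem hN hf hg (u := u) (v := i :: v) (w := j :: w) (by simp) (by simp at h ⊢; omega)
    have h3 := HB.mul_l2 hN hf hg (u := i :: u) (v := v ++ j :: w) (by simp at h ⊢; omega) (by simp at h ⊢; omega)
      (by simp at h ⊢; omega)
    have h4 := HB.mul_l2 hN hf hg (u := u ++ j :: w) (v := i :: v) (by simp at h ⊢; omega) (by simp at h ⊢; omega)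
      (by simp at h ⊢; omega)
    refine ((h1.add h2).add (h3.add h4)).of_le ⟨1, zero_le_one, fun s x => le_of_eq ?_⟩
    rw [one_mul]
    congr 2
    rw [dw_cons i (j :: w), dx_mul, map_add, dw_cons i (j :: w), dw_cons i (j :: w), dw_append, dw_append, dw_cons i u,
      dw_cons i v, dw_dx i u, dw_dx i v]
    ring

lemma HW.mul {N} (hN : 4 * n < N) (hr : ∀ s, 1 ≤ r s) (hf : HW N r f) (hg : HW N r g) :
    HW N r fun s => f s * g s := by
  have h1 : ∀ w : List (Fin n), w ≠ [] → ∀ s, dw w (f s * g s) = f s * dw w (g s) + dw w (f s) * g s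
      + (dw w (f s * g s) - f s * dw w (g s) - dw w (f s) * g s) := fun w _ s => by ring
  have h2 : ∀ ρ : σ → ℝ, (∀ s, 1 ≤ ρ s) → ∀ w : List (Fin n), w.length ≤ N → (L2 ρ fun s => dw w (f s)) →
      (L2 ρ fun s => dw w (g s)) → L2 ρ fun s => dw w (f s * g s) := fun ρ hρ w hw hf' hg' => by
    by_cases h0 : w = []
    · subst h0
      exact L2.bdd_mul (hf.1.bdd_dw (w := []) (by simp; omega)) hg'
    · refine Eq.mp (congrArg (L2 ρ) (funext fun s => (h1 w h0 s).symm)) ?_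
      exact ((L2.bdd_mul (hf.1.bdd_dw (w := []) (by simp; omega)) hg').add
        (hf'.mul_bdd (hg.1.bdd_dw (w := []) (by simp; omega)))).add
        ((HB.rem hN hf.1 hg.1 (u := []) (v := []) h0 (by simpa using hw)).mono hρ)
  exact ⟨fun w hw => h2 1 (fun _ => le_rfl) w hw.le (hf.1 w hw) (hg.1 w hw),
    fun w hw => h2 r hr w hw.le (hf.2 w hw) (hg.2 w hw)⟩

lemma HB.mul {N} (hN : 4 * n + 1 < N) (hf : HB N f) (hg : HB N g) : HB N fun s => f s * g s := by
  obtain ⟨N, rfl⟩ : ∃ k, N = k + 1 := ⟨N - 1, by omega⟩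
  exact (HW.mul (by omega) (fun _ => le_rfl) (hf.hw fun _ => le_rfl) (hg.hw fun _ => le_rfl)).hb

lemma UB.mul_hb {N} (hf : UB N f) (hg : HB (N + 1) g) : HB (N + 1) fun s => f s * g s := by
  induction N generalizing f g with
  | zero => exact HB.succ (L2.bdd_mul hf (hg [] (by simp))) fun i w hw => absurd hw (Nat.not_lt_zero _)
  | succ N ih =>
    refine HB.succ (L2.bdd_mul hf.1 (hg [] (by simp))) fun i => ?_
    simp only [dx_mul]
    exact (ih (hf.2 i) (hg.mono (by omega))).add (ih hf.of_succ (hg.dx i))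

lemma UB.comm {w : List (Fin n)} (hf : UB w.length f) (hg : HB w.length g) :
    L2 1 fun s => dw w (f s * g s) - f s * dw w (g s) := by
  induction w generalizing f g with
  | nil => simpa using L2.zero
  | cons i w ih =>
    have e : ∀ s, dw (i :: w) (f s * g s) - f s * dw (i :: w) (g s)
        = dw w (dx i (f s) * g s) + (dw w (f s * dx i (g s)) - f s * dw w (dx i (g s))) := fun s => by
      rw [dw_cons, dw_cons, dx_mul, map_add]; ring
    simp only [e]
    exact ((hf.2 i).mul_hb hg w (Nat.lt_succ_self _)).add (ih hf.of_succ (hg.dx i))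

namespace Pot
variable {q : σ → Pot n}

lemma hb_G {N} (hN : 6 * n + 2 ≤ N) (hG : ∀ a b, Bdd fun s => (q s).G a b) (hH : ∀ a b, HB N fun s => (q s).H a b)
    (a b) : HB N fun s => (q s).G a b := by
  have h : ∀ k, k ≤ 2 * n → ∀ a b, HB (N - 2 * n + k) fun s => (q s).G a b := fun k => by
    induction k with
    | zero =>
      intro _ a b
      obtain ⟨M, hM⟩ : ∃ M, N - 2 * n = M + 1 := ⟨N - 2 * n - 1, by omega⟩
      rw [hM]
      exact (ub_G (fun a b => (hH a b).ub (by omega)) hG a b).hb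
    | succ k ih =>
      intro hk a b
      have ih := ih (by omega)
      obtain ⟨M, hM⟩ : ∃ M, N - 2 * n + k = M + 1 := ⟨N - 2 * n + k - 1, by omega⟩
      rw [← add_assoc, hM]
      rw [hM] at ih
      refine HB.succ (hG a b).l2 fun i => ?_
      simp only [dx_G_eq]
      exact (HW.sum _ (fun _ => le_rfl) fun c => HW.sum _ (fun _ => le_rfl) fun d => (HB.mul (by omega) (HB.mul (by omega)
        (ih a d) (((hH d c).mono (by omega)).dx i)) (ih c b)).hw fun _ => le_rfl).hb.neg
  simpa only [show N - 2 * n + 2 * n = N by omega] using h (2 * n) le_rfl a b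

lemma hw_G {N} (hN : 6 * n + 2 ≤ N) (hr : ∀ s, 1 ≤ r s) (hG : ∀ a b, Bdd fun s => (q s).G a b)
    (hH : ∀ a b, HW N r fun s => (q s).H a b) (a b) : HW N r fun s => (q s).G a b := by
  have hGN := hb_G hN hG fun a b => (hH a b).1
  obtain ⟨N, rfl⟩ : ∃ k, N = k + 1 := ⟨N - 1, by omega⟩
  refine HW.succ (hG a b).l2 fun i => ?_
  simp only [dx_G_eq]
  exact (HW.sum _ hr fun c => HW.sum _ hr fun d => HW.mul (by omega) hr (HW.mul (by omega) hr
    ((hGN a d).hw hr) ((hH d c).dx i)) ((hGN c b).hw hr)).neg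

end Pot

end Abreu

namespace Abreu
open Set Filter Topology
open scoped ContDiff

variable {n : ℕ}

lemma toC_mul (f g : T ℝ n) : toC (f * g) = toC f * toC g := T.ext fun x => by simp

lemma hasSum_I_mul (B f : T ℝ n) : HasSum (fun k => fc k (toC B) * fc (-k) (toC f)) ((I (B * f) : ℝ) : ℂ) := by
  have h1 : ∀ k, fc k (toC B) * fc (-k) (toC f)
      = ∫ x in Icc (0 : Fin n → ℝ) 1, ev x (fc k (toC B) • (ek k * toC f)) := fun k => by
    rw [← I_def, map_smul, smul_eq_mul, fc_apply (-k), neg_neg]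
  have h2 : ((I (B * f) : ℝ) : ℂ)
      = ∫ x in Icc (0 : Fin n → ℝ) 1, ∑' k, ev x (fc k (toC B) • (ek k * toC f)) := by
    rw [← I_toC, I_def]
    congr 1; ext x
    have := (hasSum_fc_toC B x).mul_right (ev x (toC f))
    rw [toC_mul, map_mul, ev_toC B, ← this.tsum_eq]
    exact tsum_congr fun k => by rw [map_smul, map_mul, smul_eq_mul, mul_assoc]
  rw [h2]; simp_rw [h1]
  obtain ⟨C, hC⟩ := exists_bound (toC f)
  refine hasSum_integral_of_summable_integral_norm (fun k => (ev_cont _).integrableOn_Icc) ?_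
  refine Summable.of_nonneg_of_le (fun k => integral_nonneg fun x => norm_nonneg _) (fun k => ?_)
    ((summable_fc B).mul_right C)
  have hb : ∀ x, ‖ev x (fc k (toC B) • (ek k * toC f))‖ ≤ ‖fc k (toC B)‖ * C := fun x => by
    rw [map_smul, map_mul, norm_smul, norm_mul, norm_ev_ek, one_mul]
    exact mul_le_mul_of_nonneg_left (hC x) (norm_nonneg _)
  refine (setIntegral_mono (g := fun _ => ‖fc k (toC B)‖ * C) (ev_cont _).norm.integrableOn_Icc
    (continuous_const.continuousOn.integrableOn_compact isCompact_Icc) hb).trans_eq ?_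
  rw [setIntegral_const, smul_eq_mul, volume_cube, one_mul]

/-- A mean zero function pairs with `f` through the pure second derivatives of `f` alone. -/
lemma exists_abs_I_mul_le {B : T ℝ n} (hB : I B = 0) : ∃ S : ℝ, 0 ≤ S ∧ ∀ (f : T ℝ n) (g : Fin n → T ℝ n),
    (∀ i x, |ev x (dx i (dx i f))| ≤ ev x (g i)) → |I (B * f)| ≤ S * ∑ i, I (g i) := by
  refine ⟨∑' k, ‖fc k (toC B)‖, tsum_nonneg fun k => norm_nonneg _, fun f g h => ?_⟩
  have hg : ∀ i, 0 ≤ I (g i) := fun i => I_nonneg fun x => (abs_nonneg _).trans (h i x)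
  have hs := (summable_fc B).mul_right (∑ i, I (g i))
  rw [← tsum_mul_right]
  have key : ∀ k, ‖fc k (toC B) * fc (-k) (toC f)‖ ≤ ‖fc k (toC B)‖ * ∑ i, I (g i) := fun k => by
    by_cases hk : k = 0
    · subst hk; rw [fc_zero, I_toC, hB]; simp
    obtain ⟨i, hi⟩ := Function.ne_iff.1 hk
    rw [norm_mul]
    refine mul_le_mul_of_nonneg_left ?_ (norm_nonneg _)
    have h1 := norm_fc_le (f := toC (dx i (dx i f))) (g := g i)
      (fun x => by rw [ev_toC, Complex.norm_real]; exact h i x) (-k)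
    rw [← dk_toC, ← dk_toC, fc_dk, fc_dk, ← mul_assoc, norm_mul] at h1
    have h2 : (1 : ℝ) ≤ ‖2 * (Real.pi : ℂ) * Complex.I * ((-k) i : ℤ)‖ := by
      have e : (1 : ℝ) ≤ |((k i : ℤ) : ℝ)| := by exact_mod_cast Int.one_le_abs hi
      simp only [norm_mul, Complex.norm_I, Complex.norm_real, Pi.neg_apply, Int.cast_neg,
        norm_neg, Complex.norm_intCast, mul_one, Complex.norm_ofNat, Real.norm_eq_abs, abs_of_pos Real.pi_pos]
      nlinarith [Real.two_le_pi]
    have h3 : (1 : ℝ) ≤ ‖2 * (Real.pi : ℂ) * Complex.I * ((-k) i : ℤ) * (2 * (Real.pi : ℂ) * Complex.I * ((-k) i : ℤ))‖ := by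
      rw [norm_mul]; nlinarith
    calc ‖fc (-k) (toC f)‖ ≤ _ * ‖fc (-k) (toC f)‖ := le_mul_of_one_le_left (norm_nonneg _) h3
      _ ≤ I (g i) := h1
      _ ≤ _ := Finset.single_le_sum (f := fun i => I (g i)) (fun j _ => hg j) (Finset.mem_univ i)
  have h4 : Summable fun k => ‖fc k (toC B) * fc (-k) (toC f)‖ :=
    Summable.of_nonneg_of_le (fun _ => norm_nonneg _) key hs
  have h5 := norm_tsum_le_tsum_norm h4
  rw [(hasSum_I_mul B f).tsum_eq, Complex.norm_real, Real.norm_eq_abs] at h5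
  exact h5.trans (h4.tsum_le_tsum key hs)

end Abreu

namespace Abreu
open Set Filter Topology
open scoped ContDiff

variable {n : ℕ}

/-- The matrix of second derivatives. -/
noncomputable def D2 (f : T ℝ n) : Matrix (Fin n) (Fin n) (T ℝ n) := Matrix.of fun a b => dx a (dx b f)

lemma D2_apply (f : T ℝ n) (a b) : D2 f a b = dx a (dx b f) := rfl

lemma dw_D2 (w) (f : T ℝ n) (a b) : dw w (D2 f a b) = D2 (dw w f) a b := by
  rw [D2_apply, D2_apply, dw_dx, dw_dx]

lemma abs_le_sq_add {δ : ℝ} (hδ : 0 < δ) (t : ℝ) : |t| ≤ δ * t ^ 2 + 1 / (4 * δ) := by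
  rw [← sq_abs]
  have h : δ * |t| ^ 2 + 1 / (4 * δ) - |t| = (2 * δ * |t| - 1) ^ 2 / (4 * δ) := by field_simp; ring
  have : 0 ≤ (2 * δ * |t| - 1) ^ 2 / (4 * δ) := by positivity
  linarith

lemma abs_I_mul_le_add {ε : ℝ} (hε : 0 < ε) (f g : T ℝ n) :
    |I (f * g)| ≤ 1 / (4 * ε) * I (f ^ 2) + ε * I (g ^ 2) := by
  have key : ∀ f : T ℝ n, I (f * g) ≤ 1 / (4 * ε) * I (f ^ 2) + ε * I (g ^ 2) := fun f => by
    rw [← I_smul, ← I_smul, ← map_add]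
    refine I_mono fun x => ?_
    simp only [map_mul, map_add, ev_smul, map_pow]
    have h : 1 / (4 * ε) * ev x f ^ 2 + ε * ev x g ^ 2 - ev x f * ev x g = (2 * ε * ev x g - ev x f) ^ 2 / (4 * ε) := by
      field_simp; ring
    have : 0 ≤ (2 * ε * ev x g - ev x f) ^ 2 / (4 * ε) := by positivity
    linarith
  refine abs_le'.mpr ⟨key f, ?_⟩
  simpa only [neg_mul, map_neg, neg_sq] using key (-f)

namespace Pot
variable (s : Pot n)

/-- The quadratic form of the linearised operator. -/
noncomputable def en (X Y : Matrix (Fin n) (Fin n) (T ℝ n)) : T ℝ n := s.ip (s.G * X * s.G) (s.G * Y * s.G)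

lemma HGXGH (X : Matrix (Fin n) (Fin n) (T ℝ n)) : s.H * (s.G * X * s.G) * s.H = X := by
  rw [mul_assoc s.G X, ← mul_assoc s.H, s.HG, one_mul, mul_assoc, s.GH, mul_one]

lemma en_eq (X Y) : s.en X Y = ∑ a, ∑ b, (s.G * X * s.G) a b * Y a b := by
  rw [en, s.ip_psd.symm, ip_apply, HGXGH, Matrix.trace_mul_comm]
  simp only [Matrix.trace, diag_apply, mul_apply, transpose_apply]
  rw [Finset.sum_comm]

lemma en_nonneg (x X) : 0 ≤ ev x (s.en X X) := s.ip_psd.nonneg x _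

lemma sq_le_en (x X) (a b : Fin n) : ev x (X a b) ^ 2 ≤ ev x (s.en X X) * (ev x (s.H a a) * ev x (s.H b b)) := by
  have h := s.ip_psd.cs x (s.G * X * s.G) (Matrix.single a b 1)
  have e1 : s.ip (s.G * X * s.G) (Matrix.single a b 1) = X a b := by
    rw [ip_apply, HGXGH, Matrix.transpose_single, Matrix.trace_mul_single]; simp
  have e2 : s.ip (Matrix.single a b 1) (Matrix.single a b 1) = s.H a a * s.H b b := by
    rw [ip_apply, Matrix.transpose_single, Matrix.trace_mul_single, mul₃_apply]
    rw [Finset.sum_eq_single_of_mem a (Finset.mem_univ a), Finset.sum_eq_single_of_mem b (Finset.mem_univ b)]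
    · simp
    · intro c _ hc; simp [hc.symm]
    · intro c _ hc; simp [hc.symm]
  rw [e1, e2, map_mul (ev x) (s.H a a)] at h
  exact h

end Pot

/-- Solutions `V` of the linearised equation with source `-B`, tested against a space of functions. -/
structure Lin (B : T ℝ n) where
  p : Pot n
  W : Submodule ℝ (T ℝ n)
  stable : ∀ i, ∀ f ∈ W, dx i f ∈ W
  V : T ℝ n
  mem : V ∈ W
  eqn : ∀ χ ∈ W, I (∑ a, ∑ b, (p.G * D2 V * p.G) a b * D2 χ a b) = - I (B * χ)

namespace Lin
variable {B : T ℝ n}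

lemma dw_mem (l : Lin B) (w) {f} (hf : f ∈ l.W) : dw w f ∈ l.W := by
  induction w generalizing f with
  | nil => exact hf
  | cons i w ih => exact ih (l.stable i f hf)

/-- The error in commuting derivatives with the linearised operator. -/
noncomputable def R (l : Lin B) (w : List (Fin n)) (a b : Fin n) : T ℝ n :=
  dw w ((l.p.G * D2 l.V * l.p.G) a b) - (l.p.G * D2 (dw w l.V) * l.p.G) a b

lemma I_en (l : Lin B) (w) : I (l.p.en (D2 (dw w l.V)) (D2 (dw w l.V)))
    = - ((-1) ^ w.length * I (B * dw w (dw w l.V))) - ∑ a, ∑ b, I (l.R w a b * D2 (dw w l.V) a b) := by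
  have h := l.eqn _ (l.dw_mem w (l.dw_mem w l.mem))
  have e : ∀ a b, I ((l.p.G * D2 l.V * l.p.G) a b * D2 (dw w (dw w l.V)) a b) = (-1) ^ w.length *
      I (dw w ((l.p.G * D2 l.V * l.p.G) a b) * D2 (dw w l.V) a b) := fun a b => by
    rw [I_dw_mul, ← mul_assoc, ← mul_pow, dw_D2]; simp
  simp only [map_sum, e, ← Finset.mul_sum] at h
  have h2 : (-1 : ℝ) ^ w.length * (-1) ^ w.length = 1 := by rw [← mul_pow]; simp
  rw [Pot.en_eq]
  simp only [map_sum, R, sub_mul, map_sub, Finset.sum_sub_distrib]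
  linear_combination (-1 : ℝ) ^ w.length * h - h2 * ∑ a, ∑ b, I (dw w ((l.p.G * D2 l.V * l.p.G) a b) * D2 (dw w l.V) a b)

variable {σ : Type*} {q : σ → Lin B} {r : σ → ℝ}

/-- The square norm of a derivative of the Hessian of the solution. -/
noncomputable def sq (l : Lin B) (w : List (Fin n)) : ℝ := ∑ a, ∑ b, I (dw w (D2 l.V a b) ^ 2)

lemma sq_nonneg (l : Lin B) (w) : 0 ≤ l.sq w :=
  Finset.sum_nonneg fun a _ => Finset.sum_nonneg fun b _ => I_nonneg fun x => by rw [map_pow]; positivity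

lemma I_le_sq (l : Lin B) (w a b) : I (dw w (D2 l.V a b) ^ 2) ≤ l.sq w := by
  have h : ∀ a b, 0 ≤ I (dw w (D2 l.V a b) ^ 2) := fun a b => I_nonneg fun x => by
    rw [map_pow]; positivity
  exact (Finset.single_le_sum (f := fun b => I (dw w (D2 l.V a b) ^ 2)) (fun b _ => h a b) (Finset.mem_univ b)).trans
    (Finset.single_le_sum (f := fun a => ∑ b, I (dw w (D2 l.V a b) ^ 2))
      (fun a _ => Finset.sum_nonneg fun b _ => h a b) (Finset.mem_univ a))

lemma source_le (hB : I B = 0) (w : List (Fin n)) (hX : ∀ a b, HB w.length fun s => D2 (q s).V a b) {ε : ℝ} (hε : 0 < ε) :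
    ∃ C : ℝ, ∀ s, |I (B * dw w (dw w (q s).V))| ≤ C + ε * (q s).sq w := by
  cases w with
  | nil =>
    obtain ⟨S, hS, h⟩ := exists_abs_I_mul_le hB
    have hδ : 0 < ε / (S * n + 1) := by positivity
    set δ := ε / (S * n + 1) with hd
    refine ⟨S * ∑ _i : Fin n, 1 / (4 * δ), fun s => ?_⟩
    refine (h (q s).V (fun i => δ • D2 (q s).V i i ^ 2 + algebraMap ℝ _ (1 / (4 * δ))) fun i x => ?_).trans ?_
    · rw [map_add, ev_smul, map_pow, ev_algebraMap]
      exact abs_le_sq_add hδ _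
    have h1 : ∀ i, I (δ • D2 (q s).V i i ^ 2 + algebraMap ℝ (T ℝ n) (1 / (4 * δ))) ≤ δ * (q s).sq [] + 1 / (4 * δ) :=
      fun i => by
        rw [map_add, I_smul, I_const]
        exact add_le_add_left (mul_le_mul_of_nonneg_left ((q s).I_le_sq [] i i) hδ.le) _
    refine (mul_le_mul_of_nonneg_left (Finset.sum_le_sum fun i _ => h1 i) hS).trans ?_
    rw [Finset.sum_add_distrib, mul_add, add_comm]
    refine add_le_add_right ?_ _
    have h2 : S * n * δ ≤ ε := by
      rw [hd, mul_div_assoc', div_le_iff₀ (by positivity)]; nlinarith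
    rw [Finset.sum_const, Finset.card_univ, Fintype.card_fin, nsmul_eq_mul]
    nlinarith [mul_le_mul_of_nonneg_right h2 ((q s).sq_nonneg [])]
  | cons i w =>
    obtain ⟨C, hC⟩ := hX i i w (Nat.lt_succ_self _)
    refine ⟨I (dw w B ^ 2) + C, fun s => ?_⟩
    have e : |I (B * dw (i :: w) (dw (i :: w) (q s).V))| = |I (dw w B * dw w (D2 (q s).V i i))| := by
      rw [dw_cons, dw_cons, ← dw_dx, ← D2_apply, I_dw_mul, abs_mul, abs_pow]
      simp
    rw [e]
    have h1 := abs_I_mul_le_add (ε := 1) one_pos (dw w B) (dw w (D2 (q s).V i i))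
    have h2 := hC s
    have h3 : 0 ≤ I (dw w B ^ 2) := I_nonneg fun x => by rw [map_pow]; positivity
    have h4 := mul_nonneg hε.le ((q s).sq_nonneg (i :: w))
    rw [Pi.one_apply] at h2
    linarith

lemma l2_of_R (hB : I B = 0) (hr : ∀ s, 1 ≤ r s) (hH : ∀ a b, Bdd fun s => (q s).p.H a b) (w : List (Fin n))
    (hX : ∀ a b, HB w.length fun s => D2 (q s).V a b) (hR : ∀ a b, L2 r fun s => (q s).R w a b) (a b) :
    L2 r fun s => dw w (D2 (q s).V a b) := by
  choose K hK using hH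
  choose D hD using hR
  set k : ℝ := ∑ a, |K a a|
  set M : ℝ := n * (n * (k * k))
  have hk : 0 ≤ k := Finset.sum_nonneg fun a _ => abs_nonneg _
  have hM : 0 ≤ M := by positivity
  have hHk : ∀ s x a, ev x ((q s).p.H a a) ≤ k := fun s x a => (le_abs_self _).trans ((hK a a s x).trans
    ((le_abs_self _).trans (Finset.single_le_sum (f := fun a => |K a a|) (fun a _ => abs_nonneg _) (Finset.mem_univ a))))
  have hε : 0 < 1 / (4 * M + 4) := by positivity
  set ε := 1 / (4 * M + 4) with he
  obtain ⟨C, hC⟩ := source_le hB w hX hε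
  set d : ℝ := ∑ a, ∑ b, D a b
  have h1 : ∀ s, I ((q s).p.en (D2 (dw w (q s).V)) (D2 (dw w (q s).V)))
      ≤ C + 1 / (4 * ε) * (d * r s) + 2 * ε * (q s).sq w := fun s => by
    have h2 : -∑ a, ∑ b, I ((q s).R w a b * D2 (dw w (q s).V) a b) ≤ 1 / (4 * ε) * (d * r s) + ε * (q s).sq w := by
      have e : 1 / (4 * ε) * (d * r s) + ε * (q s).sq w
          = ∑ a, ∑ b, (1 / (4 * ε) * (D a b * r s) + ε * I (dw w (D2 (q s).V a b) ^ 2)) := by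
        simp only [Finset.sum_add_distrib, ← Finset.mul_sum, ← Finset.sum_mul]; rfl
      rw [e]
      simp only [← Finset.sum_neg_distrib]
      refine Finset.sum_le_sum fun a _ => Finset.sum_le_sum fun b _ => ?_
      have h3 := (neg_le_abs _).trans (abs_I_mul_le_add hε ((q s).R w a b) (D2 (dw w (q s).V) a b))
      rw [dw_D2]
      exact h3.trans (add_le_add_left (mul_le_mul_of_nonneg_left (hD a b s) (by positivity)) _)
    have h3 : -((-1) ^ w.length * I (B * dw w (dw w (q s).V))) ≤ C + ε * (q s).sq w := by
      refine (neg_le_abs _).trans ((hC s).trans' (le_of_eq ?_))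
      rw [abs_mul, abs_pow]; simp
    rw [I_en]
    linarith
  have h4 : ∀ s, (q s).sq w ≤ M * I ((q s).p.en (D2 (dw w (q s).V)) (D2 (dw w (q s).V))) := fun s => by
    have h5 : ∀ a b, I (dw w (D2 (q s).V a b) ^ 2) ≤ k * k * I ((q s).p.en (D2 (dw w (q s).V)) (D2 (dw w (q s).V))) :=
      fun a b => by
        rw [← I_smul, dw_D2]
        refine I_mono fun x => ?_
        rw [map_pow, ev_smul, mul_comm]
        refine ((q s).p.sq_le_en x _ a b).trans (mul_le_mul_of_nonneg_left ?_ ((q s).p.en_nonneg x _))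
        exact mul_le_mul (hHk s x a) (hHk s x b) ((q s).p.posH x).diag_pos.le hk
    refine (Finset.sum_le_sum fun a _ => Finset.sum_le_sum fun b _ => h5 a b).trans_eq ?_
    simp only [Finset.sum_const, Finset.card_univ, Fintype.card_fin, nsmul_eq_mul]
    ring
  refine ⟨2 * M * (|C| + |1 / (4 * ε) * d|), fun s => ((q s).I_le_sq w a b).trans ?_⟩
  have h6 := (h4 s).trans (mul_le_mul_of_nonneg_left (h1 s) hM)
  have h7 : M * (2 * ε) ≤ 1 / 2 := by
    rw [he, mul_one_div, mul_div_assoc', div_le_iff₀ (by positivity)]; linarith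
  have h8 := mul_le_mul_of_nonneg_right h7 ((q s).sq_nonneg w)
  have h9 : C ≤ |C| * r s := (le_abs_self C).trans (le_mul_of_one_le_right (abs_nonneg C) (hr s))
  have h10 : 1 / (4 * ε) * d * r s ≤ |1 / (4 * ε) * d| * r s :=
    mul_le_mul_of_nonneg_right (le_abs_self _) (zero_le_one.trans (hr s))
  have h11 := mul_le_mul_of_nonneg_left (add_le_add h9 h10) hM
  linarith

end Lin

end Abreu

namespace Abreu
open Set Filter Topology
open scoped ContDiff

namespace Lin
variable {n : ℕ} {B : T ℝ n} {σ : Type*} {q : σ → Lin B} {r : σ → ℝ}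

lemma R_eq (l : Lin B) (w : List (Fin n)) (a b) : l.R w a b = ∑ c, ∑ d,
    (dw w (l.p.G a c * l.p.G d b * D2 l.V c d) - l.p.G a c * l.p.G d b * dw w (D2 l.V c d)) := by
  simp only [R, Pot.mul₃_apply, map_sum, Finset.sum_sub_distrib, dw_D2]
  congr 1 <;> exact Finset.sum_congr rfl fun c _ => Finset.sum_congr rfl fun d _ => by
    first | (congr 1; ring) | ring

lemma l2_R_low {w : List (Fin n)} (hG : ∀ a b, UB w.length fun s => (q s).p.G a b)
    (hX : ∀ a b, HB w.length fun s => D2 (q s).V a b) (a b) : L2 1 fun s => (q s).R w a b := by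
  simp only [R_eq]
  exact L2.sum (r := 1) _ (fun _ => le_rfl) fun c => L2.sum (r := 1) _ (fun _ => le_rfl) fun d =>
    UB.comm ((hG a c).mul (hG d b)) (hX c d)

lemma l2_R_high {w : List (Fin n)} (hw : 4 * n < w.length) (hr : ∀ s, 1 ≤ r s)
    (hG : ∀ a b, HW w.length r fun s => (q s).p.G a b)
    (hX : ∀ a b, HB w.length fun s => D2 (q s).V a b) (a b) : L2 r fun s => (q s).R w a b := by
  simp only [R_eq]
  refine L2.sum _ hr fun c => L2.sum _ hr fun d => ?_
  have hc := HW.mul hw hr (hG a c) (hG d b)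
  have h1 := (HB.rem hw hc.1 (hX c d) (u := []) (v := []) (w := w) (by rintro rfl; simp at hw) (by simp)).mono hr
  have h2 := (hc.2 w rfl).mul_bdd ((hX c d).bdd_dw (w := []) (by simp; omega))
  refine Eq.mp (congrArg (L2 r) (funext fun s => ?_)) (h1.add h2)
  simp only [dw_nil]
  ring

lemma hb_X (hB : I B = 0) {N : ℕ} (hN : 6 * n + 2 ≤ N) (hG : ∀ a b, Bdd fun s => (q s).p.G a b)
    (hH : ∀ a b, HB N fun s => (q s).p.H a b) (a b) : HB N fun s => D2 (q s).V a b := by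
  have hHb : ∀ a b, Bdd fun s => (q s).p.H a b := fun a b => ((hH a b).ub (M := 0) (by omega)).bdd
  have hGN := Pot.hb_G (q := fun s => (q s).p) hN hG hH
  suffices h : ∀ j, j ≤ N → ∀ a b, HB j fun s => D2 (q s).V a b from h N le_rfl a b
  intro j
  induction j with
  | zero => exact fun _ a b w hw => absurd hw (Nat.not_lt_zero _)
  | succ j ih =>
    intro hj a b
    have ih := ih (by omega)
    refine HW.hb ⟨ih a b, fun w hw => ?_⟩
    subst hw
    refine l2_of_R hB (fun _ => le_rfl) hHb w ih (fun a b => ?_) a b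
    by_cases h : w.length + 2 * n < N
    · exact l2_R_low (fun a b => (hGN a b).ub h) ih a b
    · exact l2_R_high (by omega) (fun _ => le_rfl) (fun a b => ((hGN a b).mono hj).hw fun _ => le_rfl) ih a b

lemma hw_X (hB : I B = 0) {N : ℕ} (hN : 6 * n + 2 ≤ N) (hG : ∀ a b, Bdd fun s => (q s).p.G a b)
    (hr : ∀ s, 1 ≤ r s) (hH : ∀ a b, HW N r fun s => (q s).p.H a b) (a b) :
    HW N r fun s => D2 (q s).V a b := by
  have hX := hb_X hB hN hG fun a b => (hH a b).1
  refine ⟨hX a b, fun w hw => ?_⟩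
  have hGN := Pot.hw_G (q := fun s => (q s).p) hN hr hG hH
  subst hw
  exact l2_of_R hB hr (fun a b => ((hH a b).1.ub (M := 0) (by omega)).bdd) w hX
    (l2_R_high (by omega) hr hGN hX) a b

end Lin

end Abreu

namespace Abreu
open Set Filter Topology
open scoped ContDiff

variable {n : ℕ}

lemma D2_add (f g : T ℝ n) : D2 (f + g) = D2 f + D2 g := by
  ext1 a b; rw [Matrix.add_apply]; simp only [D2_apply, map_add]

lemma D2_smul (c : ℝ) (f : T ℝ n) : D2 (c • f) = c • D2 f := by
  ext1 a b; rw [Matrix.smul_apply]; simp only [D2_apply, Derivation.map_smul]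

lemma eq_zero_of_dx {f : T ℝ n} (h : ∀ i, dx i f = 0) (h0 : I f = 0) : f = 0 := T.ext fun x => by
  have h1 : ∀ x y, |ev y f - ev x f| ≤ 0 := fun x y => by
    have := abs_ev_add_sub_le (f := f) (C := 0) (fun i x => by simp [h i]) x (y - x)
    simpa using this
  simpa using abs_le_of_mean h1 h0 x

lemma eq_zero_of_D2 {f : T ℝ n} (h : D2 f = 0) (h0 : I f = 0) : f = 0 := by
  refine eq_zero_of_dx (fun i => eq_zero_of_dx (fun a => ?_) (I_dx i f)) h0
  exact congrFun (congrFun h a) i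

lemma exists_lin {B : T ℝ n} (p : Pot n) (W : Submodule ℝ (T ℝ n)) [FiniteDimensional ℝ W]
    (hW : ∀ i, ∀ f ∈ W, dx i f ∈ W) (hI : ∀ f ∈ W, I f = 0) : ∃ l : Lin B, l.p = p ∧ l.W = W := by
  let Φ : W →ₗ[ℝ] Module.Dual ℝ W := LinearMap.mk₂ ℝ (fun V χ : W => I (p.en (D2 (V : T ℝ n)) (D2 (χ : T ℝ n))))
    (fun V V' χ => by simp [Pot.en, D2_add, mul_add, add_mul]) (fun c V χ => by simp [Pot.en, D2_smul])
    (fun V χ χ' => by simp [Pot.en, D2_add, mul_add, add_mul]) (fun c V χ => by simp [Pot.en, D2_smul])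
  have hΦ : Function.Injective Φ := by
    refine (injective_iff_map_eq_zero Φ).mpr fun V hV => Subtype.ext (eq_zero_of_D2 ?_ (hI _ V.2))
    have h1 : I (p.en (D2 (V : T ℝ n)) (D2 (V : T ℝ n))) = 0 := LinearMap.congr_fun hV V
    have h2 := I_eq_zero (fun x => p.en_nonneg x _) h1
    ext1 a b
    refine T.ext fun x => ?_
    have h3 := p.sq_le_en x (D2 (V : T ℝ n)) a b
    rw [h2, map_zero, zero_mul] at h3
    rw [Matrix.zero_apply, map_zero]
    exact pow_eq_zero_iff two_ne_zero |>.mp (le_antisymm h3 (sq_nonneg _))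
  have hs := (LinearMap.injective_iff_surjective_of_finrank_eq_finrank Subspace.dual_finrank_eq.symm).mp hΦ
  obtain ⟨V, hV⟩ := hs ((-(I.comp (LinearMap.mulLeft ℝ B))).comp W.subtype)
  exact ⟨⟨p, W, hW, V, V.2, fun χ hχ => by
    rw [← Pot.en_eq]; exact LinearMap.congr_fun hV ⟨χ, hχ⟩⟩, rfl, rfl⟩

end Abreu

namespace Abreu
open Set Filter Topology
open scoped ContDiff

variable {n : ℕ}

noncomputable def reT (f : T ℂ n) : T ℝ n :=
  mkT (fun x => (ev x f).re) (Complex.reCLM.contDiff.comp (ev_smooth f)) (fun x k => congrArg _ (ev_per f x k))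

noncomputable def imT (f : T ℂ n) : T ℝ n :=
  mkT (fun x => (ev x f).im) (Complex.imCLM.contDiff.comp (ev_smooth f)) (fun x k => congrArg _ (ev_per f x k))

lemma ev_reT (f : T ℂ n) (x) : ev x (reT f) = (ev x f).re := rfl
lemma ev_imT (f : T ℂ n) (x) : ev x (imT f) = (ev x f).im := rfl

lemma dx_reT (i) (f : T ℂ n) : dx i (reT f) = reT (dk ℂ i f) := T.ext fun x => by
  rw [ev_dx]
  have h : fderiv ℝ (fun y => ev y (reT f)) x = _ := (Complex.reCLM.hasFDerivAt.comp x (hasFDerivAt_ev f x)).fderiv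
  rw [h]
  rfl

lemma dx_imT (i) (f : T ℂ n) : dx i (imT f) = imT (dk ℂ i f) := T.ext fun x => by
  rw [ev_dx]
  have h : fderiv ℝ (fun y => ev y (imT f)) x = _ := (Complex.imCLM.hasFDerivAt.comp x (hasFDerivAt_ev f x)).fderiv
  rw [h]
  rfl

lemma dx_reT_ek (i) (k : Fin n → ℤ) : dx i (reT (ek k)) = (-(2 * Real.pi * k i)) • imT (ek k) := by
  rw [dx_reT, dk_ek]
  refine T.ext fun x => ?_
  rw [ev_smul, ev_reT, ev_imT, ev_smul]
  simp

lemma dx_imT_ek (i) (k : Fin n → ℤ) : dx i (imT (ek k)) = (2 * Real.pi * k i) • reT (ek k) := by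
  rw [dx_imT, dk_ek]
  refine T.ext fun x => ?_
  rw [ev_smul, ev_reT, ev_imT, ev_smul]
  simp

/-- Real trigonometric polynomials with frequencies in a given set. -/
noncomputable def trig (S : Set (Fin n → ℤ)) : Submodule ℝ (T ℝ n) :=
  Submodule.span ℝ ((fun k => reT (ek k)) '' S ∪ (fun k => imT (ek k)) '' S)

lemma reT_mem {S : Set (Fin n → ℤ)} {k} (hk : k ∈ S) : reT (ek k) ∈ trig S :=
  Submodule.subset_span (Or.inl ⟨k, hk, rfl⟩)

lemma imT_mem {S : Set (Fin n → ℤ)} {k} (hk : k ∈ S) : imT (ek k) ∈ trig S :=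
  Submodule.subset_span (Or.inr ⟨k, hk, rfl⟩)

lemma finiteDimensional_trig {S : Set (Fin n → ℤ)} (hS : S.Finite) : FiniteDimensional ℝ (trig S) :=
  FiniteDimensional.span_of_finite ℝ ((hS.image _).union (hS.image _))

lemma dx_mem_trig {S : Set (Fin n → ℤ)} (i) {f : T ℝ n} (hf : f ∈ trig S) : dx i f ∈ trig S := by
  induction hf using Submodule.span_induction with
  | mem f hf =>
    rcases hf with ⟨k, hk, rfl⟩ | ⟨k, hk, rfl⟩
    · dsimp only
      rw [dx_reT_ek]; exact Submodule.smul_mem _ _ (imT_mem hk)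
    · dsimp only
      rw [dx_imT_ek]; exact Submodule.smul_mem _ _ (reT_mem hk)
  | zero => rw [map_zero]; exact Submodule.zero_mem _
  | add f g _ _ hf hg => rw [map_add]; exact Submodule.add_mem _ hf hg
  | smul c f _ hf => rw [Derivation.map_smul]; exact Submodule.smul_mem _ _ hf

lemma I_trig {S : Set (Fin n → ℤ)} (h0 : 0 ∉ S) {f : T ℝ n} (hf : f ∈ trig S) : I f = 0 := by
  induction hf using Submodule.span_induction with
  | mem f hf =>
    rcases hf with ⟨k, hk, rfl⟩ | ⟨k, hk, rfl⟩ <;> dsimp only <;>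
    obtain ⟨i, hi⟩ := Function.ne_iff.1 (show k ≠ 0 from fun h => h0 (h ▸ hk)) <;>
    have hi : (2 * Real.pi * k i : ℝ) ≠ 0 := mul_ne_zero (by positivity) (Int.cast_ne_zero.mpr hi)
    · have h := I_dx i (imT (ek k))
      rw [dx_imT_ek, I_smul] at h
      exact (mul_eq_zero.mp h).resolve_left hi
    · have h := I_dx i (reT (ek k))
      rw [dx_reT_ek, I_smul] at h
      exact (mul_eq_zero.mp h).resolve_left (neg_ne_zero.mpr hi)
  | zero => rw [map_zero]
  | add f g _ _ hf hg => rw [map_add, hf, hg, add_zero]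
  | smul c f _ hf => rw [I_smul, hf, mul_zero]

lemma eq_zero_of_trig {f : T ℝ n} (h0 : I f = 0) (h : ∀ χ ∈ trig {k : Fin n → ℤ | k ≠ 0}, I (χ * f) = 0) : f = 0 := by
  refine T.ext fun x => ?_
  have h1 : ∀ k, fc k (toC f) = 0 := fun k => by
    by_cases hk : k = 0
    · rw [hk, fc_zero, I_toC, h0, Complex.ofReal_zero]
    have hk' : -k ∈ {k : Fin n → ℤ | k ≠ 0} := neg_ne_zero.mpr hk
    have e : ek (-k) * toC f = toC (reT (ek (-k)) * f) + Complex.I • toC (imT (ek (-k)) * f) := T.ext fun x => by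
      rw [map_mul, map_add, ev_smul, ev_toC, ev_toC, ev_toC, map_mul, map_mul, ev_reT, ev_imT]
      conv_lhs => rw [← Complex.re_add_im (ev x (ek (-k)))]
      push_cast; ring
    rw [fc_apply, e, map_add, map_smul, I_toC, I_toC, h _ (reT_mem hk'), h _ (imT_mem hk')]
    simp
  have h2 := hasSum_fc_toC f x
  simp only [h1, zero_mul] at h2
  rw [map_zero]
  exact_mod_cast h2.unique hasSum_zero

end Abreu

namespace Abreu
open Set Filter Topology
open scoped ContDiff

variable {n : ℕ}

/-- Sums of square norms of the entries of a matrix, differentiated along a set of words. -/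
noncomputable def sm (L : Finset (List (Fin n))) (M : Matrix (Fin n) (Fin n) (T ℝ n)) : ℝ :=
  ∑ a, ∑ b, ∑ w ∈ L, I (dw w (M a b) ^ 2)

lemma I_sq_nonneg (f : T ℝ n) : 0 ≤ I (f ^ 2) := I_nonneg fun x => by rw [map_pow]; positivity

lemma sm_nonneg (L : Finset (List (Fin n))) (M) : 0 ≤ sm L M :=
  Finset.sum_nonneg fun _ _ => Finset.sum_nonneg fun _ _ => Finset.sum_nonneg fun _ _ => I_sq_nonneg _

lemma le_sm {L : Finset (List (Fin n))} {w} (hw : w ∈ L) (M) (a b) : I (dw w (M a b) ^ 2) ≤ sm L M :=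
  (Finset.single_le_sum (f := fun w => I (dw w (M a b) ^ 2)) (fun _ _ => I_sq_nonneg _) hw).trans <|
  (Finset.single_le_sum (f := fun b => ∑ w ∈ L, I (dw w (M a b) ^ 2))
    (fun _ _ => Finset.sum_nonneg fun _ _ => I_sq_nonneg _) (Finset.mem_univ b)).trans
    (Finset.single_le_sum (f := fun a => ∑ b, ∑ w ∈ L, I (dw w (M a b) ^ 2))
      (fun _ _ => Finset.sum_nonneg fun _ _ => Finset.sum_nonneg fun _ _ => I_sq_nonneg _) (Finset.mem_univ a))

lemma sm_add_smul_le (L : Finset (List (Fin n))) (M X) {δ : ℝ} (hδ : 0 ≤ δ) :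
    sm L (M + δ • X) ≤ (1 + δ) * sm L M + (δ + δ ^ 2) * sm L X := by
  simp only [sm, Finset.mul_sum, ← Finset.sum_add_distrib]
  refine Finset.sum_le_sum fun a _ => Finset.sum_le_sum fun b _ => Finset.sum_le_sum fun w _ => ?_
  rw [← I_smul, ← I_smul, ← map_add, Matrix.add_apply, Matrix.smul_apply]
  refine I_mono fun x => ?_
  simp only [map_add, map_smul, map_pow, smul_eq_mul]
  nlinarith [mul_nonneg hδ (sq_nonneg (ev x (dw w (M a b)) - ev x (dw w (X a b))))]

variable {σ : Type*} {r : σ → ℝ} {M : σ → Matrix (Fin n) (Fin n) (T ℝ n)}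

lemma exists_sm_le {L : Finset (List (Fin n))} (h : ∀ w ∈ L, ∀ a b, L2 r fun s => dw w (M s a b)) :
    ∃ C : ℝ, ∀ s, sm L (M s) ≤ C * r s := by
  have h' : ∀ a b w, ∃ C : ℝ, w ∈ L → ∀ s, I (dw w (M s a b) ^ 2) ≤ C * r s := fun a b w => by
    by_cases hw : w ∈ L
    · obtain ⟨C, hC⟩ := h w hw a b
      exact ⟨C, fun _ => hC⟩
    · exact ⟨0, fun h => absurd h hw⟩
  choose C hC using h'
  refine ⟨∑ a, ∑ b, ∑ w ∈ L, C a b w, fun s => ?_⟩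
  simp only [sm, Finset.sum_mul]
  exact Finset.sum_le_sum fun a _ => Finset.sum_le_sum fun b _ => Finset.sum_le_sum fun w hw => hC a b w hw s

lemma l2_of_sm {L : Finset (List (Fin n))} (h : ∃ C : ℝ, ∀ s, sm L (M s) ≤ C * r s) {w} (hw : w ∈ L) (a b) :
    L2 r fun s => dw w (M s a b) := by
  obtain ⟨C, hC⟩ := h
  exact ⟨C, fun s => (le_sm hw _ a b).trans (hC s)⟩

/-- The words of a given length. -/
noncomputable def words (n N : ℕ) : Finset (List (Fin n)) := (List.finite_length_eq (Fin n) N).toFinset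

/-- The words of length less than a given bound. -/
noncomputable def wordsLT (n N : ℕ) : Finset (List (Fin n)) := (List.finite_length_lt (Fin n) N).toFinset

lemma mem_words {N} {w : List (Fin n)} : w ∈ words n N ↔ w.length = N := by simp [words]
lemma mem_wordsLT {N} {w : List (Fin n)} : w ∈ wordsLT n N ↔ w.length < N := by simp [wordsLT]

/-- Coercivity of a matrix. -/
def Coer (c : ℝ) (m : Fin n → Fin n → ℝ) : Prop := ∀ v : Fin n → ℝ, c * ∑ a, v a ^ 2 ≤ ∑ a, ∑ b, m a b * (v a * v b)

lemma Coer.of_close {c ε : ℝ} {m m' : Fin n → Fin n → ℝ} (h : Coer c m) (hε : ∀ a b, |m' a b - m a b| ≤ ε) :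
    Coer (c - n * ε) m' := fun v => by
  have h1 : ∑ a, ∑ b, m a b * (v a * v b) - ∑ a, ∑ b, ε * ((v a ^ 2 + v b ^ 2) / 2) ≤ ∑ a, ∑ b, m' a b * (v a * v b) := by
    simp only [← Finset.sum_sub_distrib]
    refine Finset.sum_le_sum fun a _ => Finset.sum_le_sum fun b _ => ?_
    have h2 := mul_le_mul (hε a b) (show |v a * v b| ≤ (v a ^ 2 + v b ^ 2) / 2 by
      rw [abs_mul, ← sq_abs (v a), ← sq_abs (v b)]; nlinarith [sq_nonneg (|v a| - |v b|)]) (abs_nonneg _)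
      ((abs_nonneg _).trans (hε a b))
    rw [← abs_mul] at h2
    linarith [(abs_le.mp h2).1, sub_mul (m' a b) (m a b) (v a * v b)]
  have h3 : ∑ a : Fin n, ∑ b : Fin n, ε * ((v a ^ 2 + v b ^ 2) / 2) = n * ε * ∑ a, v a ^ 2 := by
    simp only [← Finset.mul_sum, ← Finset.sum_div, Finset.sum_add_distrib, Finset.sum_const, Finset.card_univ,
      Fintype.card_fin, nsmul_eq_mul]
    ring
  have := h v
  rw [h3] at h1
  linarith

lemma Coer.mono {c c' : ℝ} {m : Fin n → Fin n → ℝ} (h : Coer c m) (hc : c' ≤ c) : Coer c' m := fun v =>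
  (mul_le_mul_of_nonneg_right hc (Finset.sum_nonneg fun _ _ => sq_nonneg _)).trans (h v)

namespace Pot

lemma sum_sq_le (p : Pot n) (x) (v : Fin n → ℝ) :
    ∑ a, v a ^ 2 ≤ (∑ a, ev x (p.G a a)) * ∑ a, ∑ b, ev x (p.H a b) * (v a * v b) := by
  rw [Finset.sum_mul]
  refine Finset.sum_le_sum fun a _ => ?_
  have h := p.ip1_psd.cs x (fun i => p.G i a) (fun i => algebraMap ℝ _ (v i))
  have e1 : p.ip1 (fun i => p.G i a) (fun i => algebraMap ℝ _ (v i)) = algebraMap ℝ _ (v a) := by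
    rw [ip1_apply, Finset.sum_comm]
    have : ∀ k, ∑ i, p.H i k * (p.G i a * algebraMap ℝ _ (v k)) = (if k = a then 1 else 0) * algebraMap ℝ _ (v k) :=
      fun k => by
        rw [← p.HG_sum k a, Finset.sum_mul]
        exact Finset.sum_congr rfl fun i _ => by rw [p.Hsymm i k]; ring
    simp [this]
  have e2 : p.ip1 (fun i => p.G i a) (fun i => p.G i a) = p.G a a := by
    rw [ip1_apply]
    have : ∀ i, ∑ k, p.H i k * (p.G i a * p.G k a) = p.G i a * (if i = a then 1 else 0) :=
      fun i => by
        rw [← p.HG_sum i a, Finset.mul_sum]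
        exact Finset.sum_congr rfl fun k _ => by ring
    simp [this]
  rw [e1, e2, ev_algebraMap, ip1_apply] at h
  simpa only [map_sum, map_mul, ev_algebraMap] using h

lemma exists_coer (p : Pot n) : ∃ c : ℝ, 0 < c ∧ ∀ x, Coer c fun a b => ev x (p.H a b) := by
  obtain ⟨C, hC⟩ := exists_bound (∑ a, p.G a a)
  refine ⟨1 / (|C| + 1), by positivity, fun x v => ?_⟩
  have h1 := p.sum_sq_le x v
  have h2 : 0 ≤ ∑ a, ∑ b, ev x (p.H a b) * (v a * v b) := by
    have := p.ip1_psd.nonneg x (fun i => algebraMap ℝ _ (v i))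
    rw [ip1_apply] at this
    simpa only [map_sum, map_mul, ev_algebraMap] using this
  have h3 := hC x
  rw [map_sum, Real.norm_eq_abs] at h3
  rw [one_div, inv_mul_le_iff₀ (by positivity)]
  exact h1.trans (mul_le_mul_of_nonneg_right (by linarith [le_abs_self (∑ a, ev x (p.G a a)), le_abs_self C]) h2)

lemma abs_G_le_of_coer (p : Pot n) {c : ℝ} (hc : 0 < c) {x} (h : Coer c fun a b => ev x (p.H a b)) (a b) :
    |ev x (p.G a b)| ≤ 1 / c := by
  have h1 := h fun i => ev x (p.G i b)
  have e : ∑ i, ∑ k, ev x (p.H i k) * (ev x (p.G i b) * ev x (p.G k b)) = ev x (p.G b b) := by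
    have : ∀ i, ∑ k, p.H i k * (p.G i b * p.G k b) = p.G i b * (if i = b then 1 else 0) :=
      fun i => by
        rw [← p.HG_sum i b, Finset.mul_sum]
        exact Finset.sum_congr rfl fun k _ => by ring
    simp only [← map_mul, ← map_sum, this]
    simp
  dsimp only at h1
  rw [e] at h1
  have h2 : ∀ i, c * ev x (p.G i b) ^ 2 ≤ ev x (p.G b b) := fun i =>
    (mul_le_mul_of_nonneg_left (Finset.single_le_sum (f := fun i => ev x (p.G i b) ^ 2)
      (fun _ _ => sq_nonneg _) (Finset.mem_univ i)) hc.le).trans h1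
  have h3 : ev x (p.G b b) ≤ 1 / c := by
    rw [le_div_iff₀ hc]; nlinarith [h2 b]
  refine abs_le_of_sq_le_sq ?_ (by positivity)
  have h4 := (h2 a).trans h3
  rw [mul_comm, ← le_div_iff₀ hc] at h4
  rw [sq (1 / c)]
  simpa [div_eq_mul_inv] using h4

lemma exists_of_coer {φ : T ℝ n} {c : ℝ} (hc : 0 < c) (h : ∀ x, Coer c fun a b => ev x (hM φ a b)) :
    ∃ p : Pot n, p.φ = φ := by
  refine ⟨⟨φ, fun x => PosDef.of_dotProduct_mulVec_pos ?_ fun v hv => ?_⟩, rfl⟩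
  · ext1 a b
    simp only [conjTranspose_apply, map_apply, star_trivial, hM, Matrix.of_apply]
    rw [dx_comm, Matrix.one_apply, Matrix.one_apply]
    simp only [eq_comm]
  · obtain ⟨i, hi⟩ := Function.ne_iff.1 hv
    have h1 : 0 < ∑ a, v a ^ 2 := Finset.sum_pos' (fun _ _ => sq_nonneg _) ⟨i, Finset.mem_univ i, by
      have : v i ≠ 0 := hi
      positivity⟩
    refine (mul_pos hc h1).trans_le ((h x v).trans_eq ?_)
    simp only [dotProduct, mulVec, Finset.mul_sum, star_trivial, map_apply]
    exact Finset.sum_congr rfl fun a _ => Finset.sum_congr rfl fun b _ => by ring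

end Pot

end Abreu

namespace Abreu
open Set Filter Topology
open scoped ContDiff

variable {n : ℕ}

/-- Euler steps of length `δ` for the continuity path `A = A(p₀) + τ B`. -/
inductive Path (p0 : Pot n) (B : T ℝ n) (δ : ℝ) (W : Submodule ℝ (T ℝ n)) : ℕ → Pot n → Prop
  | zero : Path p0 B δ W 0 p0
  | succ {j : ℕ} {p : Pot n} (l : Lin B) (hW : l.W = W) (h : Path p0 B δ W j l.p) (hφ : p.φ = l.p.φ + δ • l.V) :
      Path p0 B δ W (j + 1) p

lemma hM_add_smul (φ V : T ℝ n) (δ : ℝ) : hM (φ + δ • V) = hM φ + δ • D2 V := by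
  ext1 a b
  rw [Matrix.add_apply, Matrix.smul_apply]
  simp only [hM, Matrix.of_apply, D2_apply, map_add, Derivation.map_smul, add_assoc]

lemma gronwall_step {L : Finset (List (Fin n))} {δ C : ℝ} (h0 : 0 ≤ δ) (h1 : δ ≤ 1)
    {M X : Matrix (Fin n) (Fin n) (T ℝ n)} (h : sm L X ≤ C * (1 + sm L M)) :
    1 + sm L (M + δ • X) ≤ (1 + (1 + 2 * C) * δ) * (1 + sm L M) := by
  have h2 := sm_add_smul_le L M X h0
  have h3 := sm_nonneg L M
  have h4 : δ + δ ^ 2 ≤ 2 * δ := by nlinarith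
  have h5 := mul_le_mul h4 h (sm_nonneg L X) (by positivity)
  linarith

lemma pow_le_exp {C δ : ℝ} (hC : 0 ≤ C) (hδ : 0 ≤ δ) {j : ℕ} {η : ℝ} (h : j * δ ≤ η) :
    (1 + C * δ) ^ j ≤ Real.exp (C * η) := by
  calc (1 + C * δ) ^ j ≤ Real.exp (C * δ) ^ j :=
        pow_le_pow_left₀ (by positivity) (by linarith [Real.add_one_le_exp (C * δ)]) j
    _ = Real.exp (C * (j * δ)) := by rw [← Real.exp_nat_mul]; ring_nf
    _ ≤ _ := Real.exp_le_exp.mpr (mul_le_mul_of_nonneg_left h hC)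

/-- Potentials with uniform bounds on finitely many derivatives. -/
def Good (N : ℕ) (c K : ℝ) (p : Pot n) : Prop :=
  (∀ x, Coer c fun a b => ev x (p.H a b)) ∧ sm (wordsLT n N) p.H ≤ K

section
variable {σ : Type*} {q : σ → Pot n} {N : ℕ} {c K : ℝ}

lemma Good.bdd_G (hc : 0 < c) (h : ∀ s, Good N c K (q s)) (a b) : Bdd fun s => (q s).G a b :=
  ⟨1 / c, fun s x => (q s).abs_G_le_of_coer hc ((h s).1 x) a b⟩

lemma Good.hb_H (h : ∀ s, Good N c K (q s)) (a b) : HB N fun s => (q s).H a b := fun w hw =>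
  l2_of_sm (M := fun s => (q s).H) (L := wordsLT n N) ⟨K, fun s => by simpa using (h s).2⟩ (mem_wordsLT.mpr hw) a b

end

/-- Short Euler paths exist and satisfy uniform bounds. -/
theorem exists_path (p0 : Pot n) {B : T ℝ n} (hB : I B = 0) : ∃ η > 0, ∃ c > 0, ∃ K,
    ∀ δ, 0 < δ → δ ≤ 1 → ∀ W, (∀ j p, Path p0 B δ W j p → j * δ ≤ η → Good (6 * n + 2) c K p) ∧
      (FiniteDimensional ℝ W → (∀ i, ∀ f ∈ W, dx i f ∈ W) → (∀ f ∈ W, I f = 0) →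
        ∀ j : ℕ, j * δ ≤ η → ∃ p, Path p0 B δ W j p) := by
  obtain ⟨c0, hc0, hp0⟩ := p0.exists_coer
  set c := c0 / 2
  have hc : 0 < c := half_pos hc0
  set L := wordsLT n (6 * n + 2)
  set K := 2 + 3 * sm L p0.H with hK
  let q : {l : Lin B // Good (6 * n + 2) c K l.p} → Lin B := Subtype.val
  have hG := Good.bdd_G (q := fun s => (q s).p) hc fun s => s.2
  have hX := Lin.hb_X hB le_rfl hG (Good.hb_H fun s => s.2)
  obtain ⟨C1, hC1⟩ := exists_sm_le (M := fun s => D2 (q s).V) (L := L) (r := 1) fun w hw a b => hX a b w (mem_wordsLT.mp hw)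
  have hXb : ∀ a b, Bdd fun s => D2 (q s).V a b := fun a b => ((hX a b).ub (M := 0) (by omega)).bdd
  choose D hD using hXb
  have hC1' : 0 ≤ |C1| := abs_nonneg _
  set k : ℝ := ∑ a, ∑ b, |D a b|
  have hk : 0 ≤ k := Finset.sum_nonneg fun _ _ => Finset.sum_nonneg fun _ _ => abs_nonneg _
  have hDk : ∀ s a b x, |ev x (D2 (q s).V a b)| ≤ k := fun s a b x => (hD a b s x).trans <| (le_abs_self _).trans <|
    (Finset.single_le_sum (f := fun b => |D a b|) (fun _ _ => abs_nonneg _) (Finset.mem_univ b)).trans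
    (Finset.single_le_sum (f := fun a => ∑ b, |D a b|)
      (fun _ _ => Finset.sum_nonneg fun _ _ => abs_nonneg _) (Finset.mem_univ a))
  set η := min (1 / (1 + 2 * |C1|)) (c / (n * k + 1)) with hη
  have hη1 : (1 + 2 * |C1|) * η ≤ 1 := by
    have := min_le_left (1 / (1 + 2 * |C1|)) (c / (n * k + 1))
    rw [← hη, le_div_iff₀ (by positivity)] at this
    linarith
  have hη2 : n * (η * k) ≤ c := by
    have := min_le_right (1 / (1 + 2 * |C1|)) (c / (n * k + 1))
    rw [← hη, le_div_iff₀ (by positivity)] at this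
    have h0 : 0 ≤ η := by positivity
    linarith
  have hη0 : 0 < η := by positivity
  have coer : ∀ {m : Matrix (Fin n) (Fin n) (T ℝ n)} {t : ℝ}, t ≤ η →
      (∀ a b x, |ev x (m a b) - ev x (p0.H a b)| ≤ t * k) → ∀ x, Coer c fun a b => ev x (m a b) := fun ht hm x =>
    ((hp0 x).of_close fun a b => hm a b x).mono (by
      have := mul_le_mul_of_nonneg_left (mul_le_mul_of_nonneg_right ht hk) (Nat.cast_nonneg (α := ℝ) n)
      have : c0 = c + c := (add_halves c0).symm
      linarith)
  refine ⟨η, hη0, c, hc, K, fun δ hδ hδ1 W => ?_⟩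
  have step : ∀ {j : ℕ} {l : Lin B}, Good (6 * n + 2) c K l.p →
      (∀ a b x, |ev x (l.p.H a b) - ev x (p0.H a b)| ≤ j * δ * k) →
      ∀ a b x, |ev x ((l.p.H + δ • D2 l.V) a b) - ev x (p0.H a b)| ≤ (j + 1 : ℕ) * δ * k := fun {j l} hg h a b x => by
    have h1 := mul_le_mul_of_nonneg_left (hDk ⟨l, hg⟩ a b x) hδ.le
    rw [Matrix.add_apply, Matrix.smul_apply, map_add, ev_smul, add_sub_right_comm]
    have h2 : |δ * ev x (D2 l.V a b)| ≤ δ * k := by rw [abs_mul, abs_of_pos hδ]; exact h1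
    exact (abs_add_le _ _).trans ((add_le_add (h a b x) h2).trans_eq (by push_cast; ring))
  have main : ∀ j p, Path p0 B δ W j p → j * δ ≤ η → ((∀ a b x, |ev x (p.H a b) - ev x (p0.H a b)| ≤ j * δ * k) ∧
      1 + sm L p.H ≤ (1 + (1 + 2 * |C1|) * δ) ^ j * (1 + sm L p0.H)) ∧ Good (6 * n + 2) c K p := fun j p h => by
    induction h with
    | zero =>
      intro _
      refine ⟨⟨by simp, by simp⟩, fun x => (hp0 x).mono (half_le_self hc0.le), ?_⟩
      linarith [sm_nonneg L p0.H]
    | @succ j p l hW h hφ ih =>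
      intro hj
      obtain ⟨⟨h1, h2⟩, hg⟩ := ih (le_trans (by push_cast; linarith) hj)
      have e : p.H = l.p.H + δ • D2 l.V := by rw [Pot.H, hφ, hM_add_smul]; rfl
      have h3 := step hg h1
      have h4 : 1 + sm L p.H ≤ (1 + (1 + 2 * |C1|) * δ) ^ (j + 1) * (1 + sm L p0.H) := by
        rw [e]
        have hs : sm L (D2 l.V) ≤ |C1| * (1 + sm L l.p.H) := by
          have h5 : sm L (D2 l.V) ≤ C1 * 1 := hC1 ⟨l, hg⟩
          nlinarith [le_abs_self C1, mul_nonneg hC1' (sm_nonneg L l.p.H)]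
        refine (gronwall_step hδ.le hδ1 hs).trans ?_
        rw [pow_succ', mul_assoc]
        exact mul_le_mul_of_nonneg_left h2 (by positivity)
      rw [← e] at h3
      refine ⟨⟨h3, h4⟩, coer hj h3, ?_⟩
      have h5 := pow_le_exp (C := 1 + 2 * |C1|) (by positivity) hδ.le hj
      have h6 : Real.exp ((1 + 2 * |C1|) * η) ≤ 3 :=
        (Real.exp_le_exp.mpr hη1).trans (by linarith [Real.exp_one_lt_d9])
      have h7 := h4.trans (mul_le_mul_of_nonneg_right (h5.trans h6) (by linarith [sm_nonneg L p0.H]))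
      linarith
  refine ⟨fun j p h hj => (main j p h hj).2, fun hW hd hI j => ?_⟩
  induction j with
  | zero => exact fun _ => ⟨p0, Path.zero⟩
  | succ j ih =>
    intro hj
    have hj' : j * δ ≤ η := le_trans (by push_cast; linarith) hj
    obtain ⟨p, hp⟩ := ih hj'
    obtain ⟨l, rfl, hl⟩ := exists_lin (B := B) p W hd hI
    obtain ⟨⟨h1, -⟩, hg⟩ := main j _ hp hj'
    obtain ⟨p', hp'⟩ := Pot.exists_of_coer (φ := l.p.φ + δ • l.V) hc (by
      rw [hM_add_smul]; exact coer hj (step hg h1))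
    exact ⟨p', Path.succ l hl hp hp'⟩

end Abreu

namespace Abreu
open Set Filter Topology
open scoped ContDiff

variable {n : ℕ}

/-- Potentials reached by Euler steps up to time `η`. -/
def Reach (p0 : Pot n) (B : T ℝ n) (η : ℝ) (p : Pot n) : Prop :=
  ∃ δ : ℝ, 0 < δ ∧ δ ≤ 1 ∧ ∃ W, ∃ j : ℕ, Path p0 B δ W j p ∧ j * δ ≤ η

section
variable {p0 : Pot n} {B : T ℝ n} {η c K : ℝ}

lemma hb_reach (hB : I B = 0) (hc : 0 < c) (hg : ∀ p, Reach p0 B η p → Good (6 * n + 2) c K p) {N : ℕ}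
    (hN : 6 * n + 2 ≤ N) : ∀ a b, HB N fun s : {p // Reach p0 B η p} => s.1.H a b := by
  induction N, hN using Nat.le_induction with
  | base => exact Good.hb_H (q := fun s : {p // Reach p0 B η p} => s.1) fun s => hg s.1 s.2
  | succ N hN ih =>
    set L := words n N
    let q : {l : Lin B // Reach p0 B η l.p} → Lin B := Subtype.val
    let r : {l : Lin B // Reach p0 B η l.p} → ℝ := fun s => 1 + sm L (q s).p.H
    have hr : ∀ s, 1 ≤ r s := fun s => le_add_of_nonneg_right (sm_nonneg L _)
    have hH : ∀ a b, HW N r fun s => (q s).p.H a b := fun a b => by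
      refine ⟨fun w hw => ?_, fun w hw => l2_of_sm (M := fun s => (q s).p.H)
        ⟨1, fun s => by simp [r, L]⟩ (mem_words.mpr hw) a b⟩
      obtain ⟨C, hC⟩ := ih a b w hw
      exact ⟨C, fun s => hC ⟨s.1.p, s.2⟩⟩
    have hG := Good.bdd_G (q := fun s => (q s).p) hc fun s => hg _ s.2
    have hX := Lin.hw_X hB hN hG hr hH
    obtain ⟨C, hC⟩ := exists_sm_le (M := fun s => D2 (q s).V) (L := L) (r := r) fun w hw a b =>
      (hX a b).2 w (mem_words.mp hw)
    have bound : ∀ s : {p // Reach p0 B η p}, sm L s.1.H ≤ Real.exp ((1 + 2 * |C|) * η) * (1 + sm L p0.H) := by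
      rintro ⟨p, δ, hδ, hδ1, W, j, h, hj⟩
      have main : ∀ j p, Path p0 B δ W j p → j * δ ≤ η →
          1 + sm L p.H ≤ (1 + (1 + 2 * |C|) * δ) ^ j * (1 + sm L p0.H) := fun j p h => by
        induction h with
        | zero => intro _; simp
        | @succ j p l hW h hφ ih =>
          intro hj
          have hj' : j * δ ≤ η := le_trans (by push_cast; linarith) hj
          have e : p.H = l.p.H + δ • D2 l.V := by rw [Pot.H, hφ, hM_add_smul]; rfl
          have hs : sm L (D2 l.V) ≤ |C| * (1 + sm L l.p.H) :=
            (hC ⟨l, δ, hδ, hδ1, W, j, h, hj'⟩).trans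
              (mul_le_mul_of_nonneg_right (le_abs_self C) (by linarith [sm_nonneg L l.p.H]))
          rw [e]
          refine (gronwall_step hδ.le hδ1 hs).trans ?_
          rw [pow_succ', mul_assoc]
          exact mul_le_mul_of_nonneg_left (ih hj') (by positivity)
      have h1 := (main j p h hj).trans (mul_le_mul_of_nonneg_right
        (pow_le_exp (C := 1 + 2 * |C|) (by positivity) hδ.le hj) (by linarith [sm_nonneg L p0.H]))
      exact (le_add_of_nonneg_left zero_le_one).trans h1
    exact fun a b => HW.hb ⟨ih a b, fun w hw => l2_of_sm (M := fun s : {p // Reach p0 B η p} => s.1.H)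
      ⟨_, fun s => (bound s).trans_eq (mul_one _).symm⟩ (mem_words.mpr hw) a b⟩

lemma ub_reach (hB : I B = 0) (hc : 0 < c) (hg : ∀ p, Reach p0 B η p → Good (6 * n + 2) c K p) (a b) (N : ℕ) :
    UB N fun s : {p // Reach p0 B η p} => s.1.H a b :=
  (hb_reach hB hc hg (N := N + 6 * n + 2) (by omega) a b).ub (by omega)

end

section
variable {σ : Type*}

lemma Bdd.matrix_mul {M N : σ → Matrix (Fin n) (Fin n) (T ℝ n)} (hM : ∀ a b, Bdd fun s => M s a b)
    (hN : ∀ a b, Bdd fun s => N s a b) (a b) : Bdd fun s => (M s * N s) a b := by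
  simp only [mul_apply]
  exact UB.sum (N := 0) _ fun i => (hM a i).mul (hN i b)

lemma Bdd.exists_abs_I_le {f : σ → T ℝ n} (h : Bdd f) : ∃ C, ∀ s, |I (f s)| ≤ C := by
  obtain ⟨C, hC⟩ := h
  exact ⟨C, fun s => norm_I_le (𝕜 := ℝ) (hC s)⟩

end

namespace Pot

lemma I_mul_A (p : Pot n) (χ : T ℝ n) : I (χ * p.A) = I (∑ a, ∑ b, p.G a b * D2 χ a b) := by
  simp only [Pot.A, Finset.mul_sum, map_sum]
  refine Finset.sum_congr rfl fun a _ => Finset.sum_congr rfl fun b _ => ?_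
  rw [I_parts, I_parts, neg_neg, D2_apply, dx_comm, mul_comm]

lemma G_of_H_add {p p' : Pot n} {δ : ℝ} {X : Matrix (Fin n) (Fin n) (T ℝ n)} (h : p'.H = p.H + δ • X) :
    p'.G = p.G - δ • (p.G * X * p.G) + δ ^ 2 • (p'.G * X * p.G * X * p.G) := by
  have h1 : p'.G = p.G - δ • (p'.G * X * p.G) := by
    have e1 := congrArg (· * p.G) p'.GH
    have e2 : p'.G * p'.H * p.G = p'.G * (p.H * p.G) + δ • (p'.G * X * p.G) := by
      rw [h, Matrix.mul_add, Matrix.add_mul, Matrix.mul_smul, Matrix.smul_mul, Matrix.mul_assoc]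
    rw [e2, p.HG, Matrix.mul_one, Matrix.one_mul] at e1
    exact eq_sub_of_add_eq e1
  have h2 : p'.G * X * p.G = p.G * X * p.G - δ • (p'.G * X * p.G * X * p.G) := by
    have := congrArg (fun Y => Y * X * p.G) h1
    simpa only [Matrix.sub_mul, Matrix.smul_mul] using this
  refine h1.trans ((congrArg (fun Y => p.G - δ • Y) h2).trans ?_)
  simp only [smul_sub, smul_smul, pow_two]
  abel

end Pot

lemma Lin.I_mul_A_step {B : T ℝ n} (l : Lin B) {p : Pot n} {δ : ℝ} (h : p.φ = l.p.φ + δ • l.V) {χ : T ℝ n} (hχ : χ ∈ l.W) :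
    I (χ * p.A) = I (χ * l.p.A) + δ * I (B * χ) +
      δ ^ 2 * I (∑ a, ∑ b, (p.G * D2 l.V * l.p.G * D2 l.V * l.p.G) a b * D2 χ a b) := by
  have e : p.H = l.p.H + δ • D2 l.V := by rw [Pot.H, h, hM_add_smul]; rfl
  have h1 : ∑ a, ∑ b, p.G a b * D2 χ a b = ∑ a, ∑ b, l.p.G a b * D2 χ a b
      - δ • (∑ a, ∑ b, (l.p.G * D2 l.V * l.p.G) a b * D2 χ a b)
      + δ ^ 2 • ∑ a, ∑ b, (p.G * D2 l.V * l.p.G * D2 l.V * l.p.G) a b * D2 χ a b := by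
    simp only [Finset.smul_sum, ← Finset.sum_sub_distrib, ← Finset.sum_add_distrib]
    refine Finset.sum_congr rfl fun a _ => Finset.sum_congr rfl fun b _ => ?_
    have h2 := congrArg (fun M => M a b * D2 χ a b) (Pot.G_of_H_add e)
    rw [h2, Matrix.add_apply, Matrix.sub_apply, Matrix.smul_apply, Matrix.smul_apply, add_mul, sub_mul,
      smul_mul_assoc, smul_mul_assoc]
  rw [Pot.I_mul_A, Pot.I_mul_A, h1, map_add, map_sub, I_smul, I_smul, l.eqn χ hχ]
  ring

lemma exists_weak_error {p0 : Pot n} {B : T ℝ n} {η c K : ℝ} (hB : I B = 0) (hc : 0 < c)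
    (hg : ∀ p, Reach p0 B η p → Good (6 * n + 2) c K p) (χ : T ℝ n) : ∃ C : ℝ, ∀ δ : ℝ, 0 < δ → δ ≤ 1 → ∀ W, χ ∈ W →
      ∀ j p, Path p0 B δ W j p → j * δ ≤ η →
        |I (χ * p.A) - I (χ * p0.A) - j * δ * I (B * χ)| ≤ j * δ ^ 2 * C := by
  let σ := {s : Lin B × Pot n // Reach p0 B η s.1.p ∧ Reach p0 B η s.2}
  have hG : ∀ a b, Bdd fun s : σ => s.1.1.p.G a b := Good.bdd_G hc fun s => hg _ s.2.1
  have hG' : ∀ a b, Bdd fun s : σ => s.1.2.G a b := Good.bdd_G hc fun s => hg _ s.2.2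
  have hX : ∀ a b, Bdd fun s : σ => D2 s.1.1.V a b := fun a b =>
    ((Lin.hb_X (q := fun s : σ => s.1.1) hB le_rfl hG (Good.hb_H fun s => hg _ s.2.1) a b).ub (M := 0) (by omega)).bdd
  obtain ⟨C, hC⟩ := Bdd.exists_abs_I_le (UB.sum (N := 0) Finset.univ fun a => UB.sum (N := 0) Finset.univ fun b =>
    Bdd.mul (Bdd.matrix_mul (Bdd.matrix_mul (Bdd.matrix_mul (Bdd.matrix_mul hG' hX) hG) hX) hG a b) (Bdd.const (D2 χ a b)))
  refine ⟨C, fun δ hδ hδ1 W hχ j p h => ?_⟩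
  induction h with
  | zero => intro _; simp
  | @succ j p l hW h hφ ih =>
    intro hj
    have hj' : j * δ ≤ η := le_trans (by push_cast; linarith) hj
    have h1 := ih hj'
    have h2 := mul_le_mul_of_nonneg_left (hC ⟨(l, p), ⟨δ, hδ, hδ1, W, j, h, hj'⟩,
      ⟨δ, hδ, hδ1, W, j + 1, Path.succ l hW h hφ, hj⟩⟩) (sq_nonneg δ)
    rw [← abs_of_nonneg (sq_nonneg δ), ← abs_mul, abs_of_nonneg (sq_nonneg δ)] at h2
    rw [l.I_mul_A_step hφ (hW ▸ hχ)]
    have h3 := abs_add_le _ _ |>.trans (add_le_add h1 h2)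
    rw [show (j + 1 : ℕ) * δ ^ 2 * C = j * δ ^ 2 * C + δ ^ 2 * C by push_cast; ring]
    refine le_trans (le_of_eq (congrArg _ ?_)) h3
    push_cast; ring

end Abreu

namespace Abreu
open Set Filter Topology
open scoped ContDiff

variable {n : ℕ}

section
variable {σ : Type*} {f : σ → T ℝ n} {U : Filter σ}

lemma UB.eventually_abs_le (h : UB 1 f) (h0 : ∀ x, Tendsto (fun s => ev x (f s)) U (𝓝 0)) {ε : ℝ} (hε : 0 < ε) :
    ∀ᶠ s in U, ∀ x, |ev x (f s)| ≤ ε := by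
  choose D hD using h.2
  set C := ∑ i, |D i|
  have hC : 0 ≤ C := Finset.sum_nonneg fun _ _ => abs_nonneg _
  have hDC : ∀ s i x, |ev x (dx i (f s))| ≤ C := fun s i x => (hD i s x).trans <| (le_abs_self _).trans <|
    Finset.single_le_sum (f := fun i => |D i|) (fun _ _ => abs_nonneg _) (Finset.mem_univ i)
  have hr : 0 < ε / (2 * (n * C + 1)) := by positivity
  obtain ⟨t, -, ht, hcov⟩ := (isCompact_Icc : IsCompact (Icc (0 : Fin n → ℝ) 1)).finite_cover_balls hr
  have hev : ∀ᶠ s in U, ∀ y ∈ t, |ev y (f s)| < ε / 2 := (eventually_all_finite ht).mpr fun y _ =>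
    (h0 y).abs.eventually_lt_const (by rw [abs_zero]; exact half_pos hε)
  filter_upwards [hev] with s hs x
  obtain ⟨y, hy, k, rfl⟩ := exists_cube x
  have hk : ev (y + fun i => (k i : ℝ)) (f s) = ev y (f s) := ev_per (f s) y k
  rw [hk]
  obtain ⟨z, hz, hyz⟩ := mem_iUnion₂.mp (hcov hy)
  have h1 := abs_ev_add_sub_le (hDC s) z (y - z)
  rw [add_sub_cancel] at h1
  have h2 : ‖y - z‖ ≤ ε / (2 * (n * C + 1)) := (mem_ball_iff_norm.mp hyz).le
  have h3 : n * (C * ‖y - z‖) ≤ ε / 2 := by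
    have h4 := mul_le_mul_of_nonneg_left h2 (show 0 ≤ n * C by positivity)
    have h5 : n * C * (ε / (2 * (n * C + 1))) ≤ ε / 2 := by
      rw [mul_div_assoc', div_le_div_iff₀ (by positivity) two_pos]
      nlinarith
    linarith
  have h6 := abs_add_le (ev y (f s) - ev z (f s)) (ev z (f s))
  rw [sub_add_cancel] at h6
  linarith [hs z hz]

lemma UB.tendsto_I_mul (h : UB 1 f) {g : T ℝ n} (h0 : ∀ x, Tendsto (fun s => ev x (f s)) U (𝓝 (ev x g))) (χ : T ℝ n) :
    Tendsto (fun s => I (f s * χ)) U (𝓝 (I (g * χ))) := by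
  obtain ⟨C, hC⟩ := exists_bound χ
  have h1 : UB 1 fun s => f s + -g := UB.add h (UB.const 1 (-g))
  have h2 : ∀ x, Tendsto (fun s => ev x (f s + -g)) U (𝓝 0) := fun x => by
    have := (h0 x).add_const (-ev x g)
    rw [add_neg_cancel] at this
    exact this.congr fun s => by rw [map_add, map_neg]
  refine tendsto_iff_norm_sub_tendsto_zero.mpr (Metric.tendsto_nhds.mpr fun ε hε => ?_)
  filter_upwards [h1.eventually_abs_le h2 (ε := ε / (2 * (|C| + 1))) (by positivity)] with s hs
  rw [dist_zero_right, norm_norm, ← map_sub, ← sub_mul]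
  refine (norm_I_le (𝕜 := ℝ) (c := ε / 2) fun x => ?_).trans_lt (half_lt_self hε)
  rw [map_mul, norm_mul, sub_eq_add_neg]
  calc _ ≤ ε / (2 * (|C| + 1)) * (|C| + 1) :=
        mul_le_mul (hs x) ((hC x).trans (by linarith [le_abs_self C])) (norm_nonneg _) (by positivity)
    _ = ε / 2 := by field_simp

end

lemma Path.mean {p0 : Pot n} {B : T ℝ n} {δ : ℝ} {W} (hW : ∀ f ∈ W, I f = 0) {j p} (h : Path p0 B δ W j p) :
    I p.φ = I p0.φ := by
  induction h with
  | zero => rfl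
  | succ l hl h hφ ih => rw [hφ, map_add, I_smul, hW l.V (hl ▸ l.mem), ih, mul_zero, add_zero]

lemma Pot.I_A (p : Pot n) : I p.A = 0 := by simp only [Pot.A, map_sum, I_dx, Finset.sum_const_zero]

/-- Short-time solvability of the continuity path. -/
theorem exists_local (p0 : Pot n) (h0 : I p0.φ = 0) {B : T ℝ n} (hB : I B = 0) :
    ∃ η : ℝ, 0 < η ∧ ∀ τ, 0 < τ → τ ≤ η → ∃ p : Pot n, I p.φ = 0 ∧ p.A = p0.A + τ • B := by
  obtain ⟨η, hη, c, hc, K, hpath⟩ := exists_path p0 hB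
  refine ⟨min η 1, lt_min hη one_pos, fun τ hτ hτη => ?_⟩
  have hg : ∀ p, Reach p0 B η p → Good (6 * n + 2) c K p := fun p ⟨δ, hδ, hδ1, W, j, h, hj⟩ =>
    (hpath δ hδ hδ1 W).1 j p h hj
  let S : ℕ → Set (Fin n → ℤ) := fun s => {k | k ≠ 0 ∧ ∀ i, |k i| ≤ s}
  have hS : ∀ s, (S s).Finite := fun s => (Set.finite_Icc (fun _ => -(s : ℤ)) (fun _ => (s : ℤ))).subset
    fun k hk => ⟨fun i => (abs_le.mp (hk.2 i)).1, fun i => (abs_le.mp (hk.2 i)).2⟩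
  let δ : ℕ → ℝ := fun s => τ / (s + 1 : ℕ)
  have hδ : ∀ s, 0 < δ s := fun s => by positivity
  have hδ1 : ∀ s, δ s ≤ 1 := fun s => (div_le_self hτ.le (by simp)).trans (hτη.trans (min_le_right _ _))
  have hδτ : ∀ s, (s + 1 : ℕ) * δ s = τ := fun s => mul_div_cancel₀ _ (by positivity)
  have hδη : ∀ s, (s + 1 : ℕ) * δ s ≤ η := fun s => (hδτ s).trans_le (hτη.trans (min_le_left _ _))
  have hI : ∀ s, ∀ f ∈ trig (S s), I f = 0 := fun s f hf => I_trig (fun h => h.1 rfl) hf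
  choose q hq using fun s => (hpath (δ s) (hδ s) (hδ1 s) (trig (S s))).2 (finiteDimensional_trig (hS s))
    (fun i f hf => dx_mem_trig i hf) (hI s) (s + 1) (hδη s)
  have hr : ∀ s, Reach p0 B η (q s) := fun s => ⟨δ s, hδ s, hδ1 s, _, s + 1, hq s, hδη s⟩
  have hH : ∀ a b N, UB N fun s => (q s).H a b := fun a b N => UB.of_dw (fun w => by
    obtain ⟨C, hC⟩ := UB.bdd_dw (ub_reach hB hc hg a b) w
    exact ⟨C, fun s => hC ⟨q s, hr s⟩⟩) N
  have hG := Good.bdd_G hc fun s => hg _ (hr s)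
  obtain ⟨p, hp, hlim⟩ := Pot.exists_lim (fun s => ((hq s).mean (hI s)).trans h0) hH hG (hyperfilter ℕ)
  refine ⟨p, hp, ?_⟩
  have hA : ∀ χ : T ℝ n, Tendsto (fun s => I (χ * (q s).A)) (hyperfilter ℕ) (𝓝 (I (χ * p.A))) := fun χ => by
    simp only [Pot.I_mul_A, map_sum]
    exact tendsto_finsetSum _ fun a _ => tendsto_finsetSum _ fun b _ =>
      UB.tendsto_I_mul (Pot.ub_G (fun a b => hH a b 1) hG a b) (fun x => hlim a b [] x) _
  have key : ∀ χ : T ℝ n, (∃ s0 : ℕ, ∀ s ≥ s0, χ ∈ trig (S s)) → I (χ * (p.A - (p0.A + τ • B))) = 0 := by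
    rintro χ ⟨s0, hs0⟩
    obtain ⟨C, hC⟩ := exists_weak_error hB hc hg χ
    have h1 : Tendsto (fun s => I (χ * (q s).A) - I (χ * p0.A) - τ * I (B * χ)) (hyperfilter ℕ)
        (𝓝 (I (χ * p.A) - I (χ * p0.A) - τ * I (B * χ))) := ((hA χ).sub_const _).sub_const _
    have h2 : Tendsto (fun s => I (χ * (q s).A) - I (χ * p0.A) - τ * I (B * χ)) (hyperfilter ℕ) (𝓝 0) := by
      refine Tendsto.mono_left ?_ Nat.hyperfilter_le_atTop
      have h3 : Tendsto (fun s : ℕ => τ ^ 2 * C * (1 / ((s : ℝ) + 1))) atTop (𝓝 0) := by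
        simpa using tendsto_one_div_add_atTop_nhds_zero_nat.const_mul (τ ^ 2 * C)
      refine squeeze_zero_norm' ?_ h3
      filter_upwards [eventually_ge_atTop s0] with s hs
      have h4 := hC (δ s) (hδ s) (hδ1 s) _ (hs0 s hs) _ _ (hq s) (hδη s)
      rw [hδτ, pow_two, ← mul_assoc, hδτ] at h4
      refine h4.trans_eq ?_
      simp only [δ]
      push_cast
      ring
    have h5 := tendsto_nhds_unique h1 h2
    rw [mul_sub, mul_add, map_sub, map_add, mul_smul_comm, I_smul, mul_comm χ B]
    linarith
  have ev_mem : ∀ k : Fin n → ℤ, k ≠ 0 → ∃ s0 : ℕ, ∀ s ≥ s0, k ∈ S s := fun k hk =>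
    ⟨∑ i, (k i).natAbs, fun s hs => ⟨hk, fun i => by
      have := Finset.single_le_sum (f := fun i => (k i).natAbs) (fun _ _ => Nat.zero_le _) (Finset.mem_univ i)
      rw [Int.abs_eq_natAbs]
      exact_mod_cast this.trans hs⟩⟩
  refine sub_eq_zero.mp (eq_zero_of_trig ?_ fun χ hχ => ?_)
  · rw [map_sub, map_add, I_smul, Pot.I_A, Pot.I_A, hB, mul_zero, add_zero, sub_zero]
  · induction hχ using Submodule.span_induction with
    | mem χ hχ =>
      rcases hχ with ⟨k, hk, rfl⟩ | ⟨k, hk, rfl⟩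
      all_goals
        obtain ⟨s0, hs0⟩ := ev_mem k hk
      · exact key _ ⟨s0, fun s hs => reT_mem (hs0 s hs)⟩
      · exact key _ ⟨s0, fun s hs => imT_mem (hs0 s hs)⟩
    | zero => rw [zero_mul, map_zero]
    | add f g _ _ hf hg => rw [add_mul, map_add, hf, hg, add_zero]
    | smul c f _ hf => rw [smul_mul_assoc, I_smul, hf, mul_zero]

end Abreu

namespace Abreu
open Set Filter Topology
open scoped ContDiff

variable {n : ℕ}

/-- The flat potential. -/
noncomputable def flat (n : ℕ) : Pot n where
  φ := 0
  pos x := by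
    have : (hM (0 : T ℝ n)).map (ev x) = 1 := by
      ext i j
      rw [map_apply, hM, of_apply, map_zero, map_zero, add_zero, one_apply, one_apply]
      split_ifs <;> simp
    rw [this]
    exact PosDef.one

lemma A_flat : (flat n).A = 0 := by
  have h1 : (flat n).H = 1 := by
    ext1 i j
    rw [Pot.H_apply, flat, map_zero, map_zero, add_zero]
  have h2 : (flat n).G = 1 := by
    have := (flat n).HG
    rwa [h1, Matrix.one_mul] at this
  have h3 : ∀ a b c : Fin n, dx c ((1 : Matrix (Fin n) (Fin n) (T ℝ n)) a b) = 0 := fun a b c => by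
    rw [one_apply]
    split_ifs <;> simp
  simp only [Pot.A, h2, h3, map_zero, Finset.sum_const_zero]

/-- Solvability of Abreu's equation on the torus. -/
theorem exists_pot (A0 : T ℝ n) (h : I A0 = 0) : ∃ p : Pot n, p.A = A0 := by
  rcases Nat.eq_zero_or_pos n with rfl | hn
  · refine ⟨flat 0, A_flat.trans (T.ext fun x => ?_)⟩
    have : A0 = algebraMap ℝ _ (ev 0 A0) := T.ext fun y => by rw [ev_algebraMap, Subsingleton.elim y 0]
    rw [this, I_const] at h
    rw [Subsingleton.elim x 0, map_zero, h]
  · have : NeZero n := ⟨hn.ne'⟩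
    have key : Icc 0 1 ⊆ range (Sol.t (A0 := A0)) := by
      refine ((Sol.isClosed_range A0).inter isClosed_Icc).Icc_subset_of_forall_exists_gt ?_ ?_
      · exact ⟨⟨flat n, 0, le_rfl, zero_le_one, map_zero I, by rw [A_flat, zero_smul]⟩, rfl⟩
      · rintro _ ⟨⟨s, rfl⟩, -, ht⟩ y hy
        obtain ⟨η, hη, hloc⟩ := exists_local s.toPot s.mean h
        have hτ : 0 < min η (min (y - s.t) (1 - s.t)) :=
          lt_min hη (lt_min (sub_pos.mpr hy) (sub_pos.mpr ht))
        obtain ⟨p, hp, hA⟩ := hloc _ hτ (min_le_left _ _)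
        have h1 := (min_le_right η (min (y - s.t) (1 - s.t))).trans (min_le_left _ _)
        have h2 := (min_le_right η (min (y - s.t) (1 - s.t))).trans (min_le_right _ _)
        refine ⟨s.t + min η (min (y - s.t) (1 - s.t)), ⟨⟨p, _, ?_, ?_, hp, ?_⟩, rfl⟩, ?_, ?_⟩
        · linarith [s.t0]
        · linarith
        · rw [hA, s.eqn, add_smul]
        · linarith
        · linarith
    obtain ⟨s, hs⟩ := key (right_mem_Icc.mpr zero_le_one)
    exact ⟨s.toPot, by rw [s.eqn, hs, one_smul]⟩

namespace Pot
variable (p : Pot n)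

/-- The convex function of a potential. -/
noncomputable def u (x : Fin n → ℝ) : ℝ := (1 / 2 : ℝ) * ∑ i, x i ^ 2 + ev x p.φ

lemma pd_ev (i) (f : T ℝ n) (x) : pd i (fun y => ev y f) x = ev x (dx i f) := rfl

lemma pd_u (j x) : pd j p.u x = x j + ev x (dx j p.φ) := by
  have h1 : ∀ i : Fin n, HasFDerivAt (fun y : Fin n → ℝ => y i ^ 2) ((2 * x i) • ContinuousLinearMap.proj (R := ℝ) (φ := fun _ : Fin n => ℝ) i) x :=
    fun i => by
      have := (ContinuousLinearMap.proj (R := ℝ) (φ := fun _ : Fin n => ℝ) i).hasFDerivAt (x := x) |>.pow 2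
      simpa using this
  have h2 : HasFDerivAt p.u _ x := ((HasFDerivAt.fun_sum fun i (_ : i ∈ Finset.univ) => h1 i).const_mul (1 / 2 : ℝ)).add
    (ev_diff p.φ x).hasFDerivAt
  rw [pd, h2.fderiv, _root_.add_apply, ev_dx]
  congr 1
  simp [Pi.single_apply]

lemma hess_u (x) : hess p.u x = p.H.map (ev x) := by
  ext i j
  rw [hess, of_apply, map_apply, H_apply, map_add, funext (p.pd_u j), pd,
    ((hasFDerivAt_apply (𝕜 := ℝ) (F' := fun _ : Fin n => ℝ) j x).fun_add (ev_diff (dx j p.φ) x).hasFDerivAt).fderiv, _root_.add_apply, ev_dx i]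
  congr 1
  rw [one_apply]
  by_cases h : i = j <;> simp [h, eq_comm]

lemma abreu_u (x) : abreuOp p.u x = ev x p.A := by
  simp only [abreuOp, hess_u, ← ev_inv, map_apply, Pot.A, map_sum]
  refine Finset.sum_congr rfl fun i _ => Finset.sum_congr rfl fun j _ => ?_
  rw [show pd j (fun z => ev z (p.G i j)) = fun z => ev z (dx j (p.G i j)) from rfl, pd_ev]

lemma hasDerivAt_u (x v : Fin n → ℝ) (t : ℝ) : HasDerivAt (fun t : ℝ => p.u (x + t • v))
    (∑ j, v j * ((x + t • v) j + ev (x + t • v) (dx j p.φ))) t := by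
  have h1 : ∀ i : Fin n, HasDerivAt (fun t : ℝ => (x + t • v) i ^ 2) (2 * (x + t • v) i * v i) t := fun i => by
    have := ((((hasDerivAt_id t).mul_const (v i)).const_add (x i)).fun_pow 2)
    simpa using this
  refine (((HasDerivAt.fun_sum fun i (_ : i ∈ Finset.univ) => h1 i).const_mul (1 / 2 : ℝ)).add
    (hasDerivAt_ev p.φ x v t)).congr_deriv ?_
  rw [Finset.mul_sum, ← Finset.sum_add_distrib]
  refine Finset.sum_congr rfl fun i _ => ?_
  dsimp only [RCLike.ofReal_real_eq_id, id]
  ring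

lemma convexOn_line (x v : Fin n → ℝ) : ConvexOn ℝ univ fun t : ℝ => p.u (x + t • v) := by
  have h2 : ∀ t : ℝ, HasDerivAt (fun t : ℝ => ∑ j, v j * ((x + t • v) j + ev (x + t • v) (dx j p.φ)))
      (∑ j, v j * (v j + ∑ i, v i * ev (x + t • v) (dx i (dx j p.φ)))) t := fun t => by
    refine HasDerivAt.fun_sum fun j _ => HasDerivAt.const_mul _ (HasDerivAt.add ?_ (hasDerivAt_ev _ x v t))
    have := (((hasDerivAt_id t).mul_const (v j)).const_add (x j))
    simpa using this
  have e1 : deriv (fun t : ℝ => p.u (x + t • v)) = _ := funext fun t => (p.hasDerivAt_u x v t).deriv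
  refine convexOn_univ_of_deriv2_nonneg (fun t => (p.hasDerivAt_u x v t).differentiableAt) ?_ fun t => ?_
  · rw [e1]; exact fun t => (h2 t).differentiableAt
  · rw [Function.iterate_succ, Function.iterate_one, Function.comp_apply, e1, (h2 t).deriv]
    have h3 := (p.posH (x + t • v)).posSemidef.dotProduct_mulVec_nonneg v
    have h4 : star v ⬝ᵥ (p.H.map (ev (x + t • v))) *ᵥ v
        = ∑ j, v j * (v j + ∑ i, v i * ev (x + t • v) (dx i (dx j p.φ))) := by
      refine Finset.sum_congr rfl fun j _ => ?_
      rw [star_trivial]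
      congr 1
      simp only [mulVec, dotProduct, map_apply]
      have : ∀ i, ev (x + t • v) (p.H j i) * v i = (if i = j then v i else 0) + v i * ev (x + t • v) (dx i (dx j p.φ)) := fun i => by
        rw [p.Hsymm, H_apply, map_add, one_apply]
        split_ifs <;> simp <;> ring
      rw [Finset.sum_congr rfl fun i _ => this i, Finset.sum_add_distrib]
      simp
    rwa [h4] at h3

lemma convexOn_u : ConvexOn ℝ univ p.u := by
  refine ⟨convex_univ, fun x _ y _ a b ha hb hab => ?_⟩
  have h := (p.convexOn_line x (y - x)).2 (mem_univ 0) (mem_univ 1) ha hb hab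
  have e : x + (a • (0 : ℝ) + b • (1 : ℝ)) • (y - x) = a • x + b • y := by
    obtain rfl : a = 1 - b := by linarith
    simp only [smul_eq_mul, mul_zero, mul_one, zero_add]
    module
  dsimp only at h
  rw [e] at h
  simpa using h

end Pot

end Abreu

theorem abreu_periodic_existence {n : ℕ} (A : (Fin n → ℝ) → ℝ)
    (hA : ContDiff ℝ (⊤ : ℕ∞) A) (hAper : ZPer A)
    (hAmean : ∫ x in Set.Icc (0 : Fin n → ℝ) 1, A x = 0) :
    ∃ φ : (Fin n → ℝ) → ℝ, ContDiff ℝ (⊤ : ℕ∞) φ ∧ ZPer φ ∧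
      ConvexOn ℝ Set.univ (fun x => (1 / 2 : ℝ) * ∑ i, x i ^ 2 + φ x) ∧
      (∀ x, (hess (fun y => (1 / 2 : ℝ) * ∑ i, y i ^ 2 + φ y) x).PosDef) ∧
      (∀ x, abreuOp (fun y => (1 / 2 : ℝ) * ∑ i, y i ^ 2 + φ y) x = A x) := by
  obtain ⟨p, hp⟩ := Abreu.exists_pot (Abreu.mkT A hA hAper) hAmean
  refine ⟨fun x => Abreu.ev x p.φ, Abreu.ev_smooth p.φ, Abreu.ev_per p.φ, p.convexOn_u, fun x => ?_, fun x => ?_⟩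
  · exact (p.hess_u x).symm ▸ p.posH x
  · exact (p.abreu_u x).trans (congrArg (Abreu.ev x) hp)
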